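/- Let Ω ⊂ ℝ² be a bounded domain with smooth boundary and let q ∈ (2,∞). If the source term of the stationary Stokes system −Δu + ∇p = f, ∇·u = 0 in Ω, u = 0 on ∂Ω, has the divergence form f = ∇·F with F ∈ W^{1,q}(Ω), then the solution u satisfies the logarithmic estimate ‖∇u‖_{L^∞(Ω)} ≤ C (1 + ‖F‖_{L^∞(Ω)}) ln(e + ‖∇F‖_{L^q(Ω)}), where C depends only on Ω. -/

import Mathlib

open MeasureTheory Set
open scoped ENNReal NNReal

noncomputable section

/-- The Euclidean plane `ℝ²`. -/
abbrev Vec2 : Type := EuclideanSpace ℝ (Fin 2)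

/-- A (nonempty) bounded domain in `ℝⁿ` with smooth boundary: a bounded open set which is
the sublevel set of a globally smooth defining function whose gradient does not vanish
on the boundary. -/
def IsBoundedSmoothDomain {n : ℕ} (Ω : Set (EuclideanSpace ℝ (Fin n))) : Prop :=
  IsOpen Ω ∧ Ω.Nonempty ∧ Bornology.IsBounded Ω ∧
    ∃ ρ : EuclideanSpace ℝ (Fin n) → ℝ, ContDiff ℝ (⊤ : ℕ∞) ρ ∧
      Ω = {x | ρ x < 0} ∧ ∀ x ∈ frontier Ω, fderiv ℝ ρ x ≠ 0

/-- The `L^p(Ω)` norm (valued in `ℝ≥0∞`). -/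
def lpnorm {n : ℕ} {F : Type*} [NormedAddCommGroup F]
    (Ω : Set (EuclideanSpace ℝ (Fin n))) (p : ℝ≥0∞)
    (f : EuclideanSpace ℝ (Fin n) → F) : ℝ≥0∞ :=
  eLpNorm f p (volume.restrict Ω)

/-- The `W^{m,p}(Ω)` norm: sum of the `L^p(Ω)` norms of all derivatives up to order `m`. -/
def sobNorm {n : ℕ} {F : Type*} [NormedAddCommGroup F] [NormedSpace ℝ F]
    (Ω : Set (EuclideanSpace ℝ (Fin n))) (m : ℕ) (p : ℝ≥0∞)
    (f : EuclideanSpace ℝ (Fin n) → F) : ℝ≥0∞ :=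
  ∑ j ∈ Finset.range (m + 1), lpnorm Ω p (fun x => iteratedFDeriv ℝ j f x)

/-- The `i`-th standard basis vector of `ℝ²`. -/
def e2 (i : Fin 2) : Vec2 := EuclideanSpace.single i 1

/-- The partial derivative `∂ᵢ f`. -/
def pd {F : Type*} [NormedAddCommGroup F] [NormedSpace ℝ F]
    (i : Fin 2) (f : Vec2 → F) (x : Vec2) : F :=
  fderiv ℝ f x (e2 i)

/-- The gradient `∇f = (∂₁ f, ∂₂ f)` of a scalar function on `ℝ²`. -/
def grad2 (f : Vec2 → ℝ) (x : Vec2) : Vec2 :=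
  (EuclideanSpace.equiv (Fin 2) ℝ).symm ![pd 0 f x, pd 1 f x]

/-- The perpendicular gradient `∇^⊥ f = (-∂₂ f, ∂₁ f)`. -/
def perpGrad (f : Vec2 → ℝ) (x : Vec2) : Vec2 :=
  (EuclideanSpace.equiv (Fin 2) ℝ).symm ![-(pd 1 f x), pd 0 f x]

/-- The divergence `∇·u = ∂₁ u₁ + ∂₂ u₂` of a vector field on `ℝ²`. -/
def div2 (u : Vec2 → Vec2) (x : Vec2) : ℝ := ∑ i, pd i u x i

/-- The scalar curl `∇^⊥·u = ∂₁ u₂ − ∂₂ u₁` of a vector field on `ℝ²`. -/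
def curl2 (u : Vec2 → Vec2) (x : Vec2) : ℝ := pd 0 u x 1 - pd 1 u x 0

/-- The Laplacian `Δf = ∂₁₁ f + ∂₂₂ f` (componentwise for vector valued `f`). -/
def lapl {F : Type*} [NormedAddCommGroup F] [NormedSpace ℝ F]
    (f : Vec2 → F) (x : Vec2) : F :=
  ∑ i : Fin 2, iteratedFDeriv ℝ 2 f x ![e2 i, e2 i]

/-- The `L^p(0,T;·)` norm in time of a nonnegative quantity `φ t`. -/
def tLp (p : ℝ) (T : ℝ) (φ : ℝ → ℝ≥0∞) : ℝ≥0∞ :=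
  (∫⁻ t in Set.Ioc (0 : ℝ) T, φ t ^ p) ^ (1 / p)

/-- The `L^∞(0,T;·)` norm in time (for time-continuous quantities) of `φ t`. -/
def tLinf (T : ℝ) (φ : ℝ → ℝ≥0∞) : ℝ≥0∞ :=
  ⨆ t ∈ Set.Icc (0 : ℝ) T, φ t

/-- `(v, π)` is a classical solution of the stationary Stokes system in `Ω` with source `f`
and no-slip boundary condition. -/
def IsStokesSol (Ω : Set Vec2) (f : Vec2 → Vec2) (v : Vec2 → Vec2) (π : Vec2 → ℝ) : Prop :=
  (∀ x ∈ Ω, -lapl v x + grad2 π x = f x) ∧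
  (∀ x ∈ Ω, div2 v x = 0) ∧
  (∀ x ∈ frontier Ω, v x = 0)

/-- `(u, w, π)` is a (global-in-time) smooth solution of the 2D micropolar system without
angular viscosity on `Ω`, with no-slip boundary condition for `u` and initial data `(u₀, w₀)`. -/
structure IsMicropolarSol (Ω : Set Vec2) (ν κ : ℝ)
    (u : ℝ → Vec2 → Vec2) (w : ℝ → Vec2 → ℝ) (π : ℝ → Vec2 → ℝ)
    (u0 : Vec2 → Vec2) (w0 : Vec2 → ℝ) : Prop where
  smooth_u : ContDiffOn ℝ (⊤ : ℕ∞) (Function.uncurry u) (Set.Ici (0 : ℝ) ×ˢ closure Ω)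
  smooth_w : ContDiffOn ℝ (⊤ : ℕ∞) (Function.uncurry w) (Set.Ici (0 : ℝ) ×ˢ closure Ω)
  smooth_π : ContDiffOn ℝ (⊤ : ℕ∞) (Function.uncurry π) (Set.Ici (0 : ℝ) ×ˢ closure Ω)
  momentum : ∀ t > (0 : ℝ), ∀ x ∈ Ω,
    deriv (fun s => u s x) t - (ν + κ) • lapl (u t) x + fderiv ℝ (u t) x (u t x)
      + grad2 (π t) x = -(2 * κ) • perpGrad (w t) x
  micro : ∀ t > (0 : ℝ), ∀ x ∈ Ω,
    deriv (fun s => w s x) t + 4 * κ * w t x + fderiv ℝ (w t) x (u t x)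
      = 2 * κ * curl2 (u t) x
  incomp : ∀ t ≥ (0 : ℝ), ∀ x ∈ Ω, div2 (u t) x = 0
  noslip : ∀ t ≥ (0 : ℝ), ∀ x ∈ frontier Ω, u t x = 0
  init_u : ∀ x ∈ closure Ω, u 0 x = u0 x
  init_w : ∀ x ∈ closure Ω, w 0 x = w0 x

end

noncomputable section

/-- The row-wise divergence `(∇·F)ᵢ = ∑ⱼ ∂ⱼ Fᵢⱼ` of a matrix-valued field on `ℝ²`. -/
def matDiv (F : Vec2 → Fin 2 → Fin 2 → ℝ) (x : Vec2) : Vec2 :=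
  (EuclideanSpace.equiv (Fin 2) ℝ).symm (fun i => ∑ j, pd j (fun y => F y i j) x)

end

open scoped ContDiff Topology

/-! ### Directional derivatives and symbol classes -/

section Symbols

variable {E ι : Type*} [NormedAddCommGroup E] [NormedSpace ℝ E]

/-- The derivative of the scalar function `f` in the direction `v`. -/
noncomputable def dd (v : E) (f : E → ℝ) (x : E) : ℝ := fderiv ℝ f x v

theorem dd_congr_of_isOpen {V : Set E} (hV : IsOpen V) {f g : E → ℝ} (h : EqOn f g V) (v : E) :
    EqOn (dd v f) (dd v g) V := fun x hx => by
  have : f =ᶠ[nhds x] g := Filter.eventuallyEq_of_mem (hV.mem_nhds hx) h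
  simp only [dd, this.fderiv_eq]

theorem ContDiffOn.dd {V : Set E} (hV : IsOpen V) {f : E → ℝ} (hf : ContDiffOn ℝ ∞ f V) (v : E) :
    ContDiffOn ℝ ∞ (dd v f) V := by
  have h := hf.fderiv_of_isOpen hV (m := ∞) (by simp)
  exact h.clm_apply contDiffOn_const

theorem ContDiff.dd {f : E → ℝ} (hf : ContDiff ℝ ∞ f) (v : E) : ContDiff ℝ ∞ (dd v f) := by
  have h := hf.fderiv_right (m := ∞) (by simp)
  exact h.clm_apply contDiff_const

theorem ContDiffOn.diffAt {V : Set E} (hV : IsOpen V) {f : E → ℝ} (hf : ContDiffOn ℝ ∞ f V)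
    {x : E} (hx : x ∈ V) : DifferentiableAt ℝ f x :=
  (hf.contDiffAt (hV.mem_nhds hx)).differentiableAt (by simp)

theorem dd_add {f g : E → ℝ} {x : E} (hf : DifferentiableAt ℝ f x) (hg : DifferentiableAt ℝ g x)
    (v : E) : dd v (fun y => f y + g y) x = dd v f x + dd v g x := by
  simp only [dd]
  rw [fderiv_fun_add hf hg]; rfl

theorem dd_sub {f g : E → ℝ} {x : E} (hf : DifferentiableAt ℝ f x) (hg : DifferentiableAt ℝ g x)
    (v : E) : dd v (fun y => f y - g y) x = dd v f x - dd v g x := by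
  simp only [dd]
  rw [fderiv_fun_sub hf hg]; rfl

theorem dd_neg (f : E → ℝ) (x : E) (v : E) : dd v (fun y => - f y) x = - dd v f x := by
  simp only [dd]
  rw [fderiv_fun_neg]; rfl

theorem dd_mul {f g : E → ℝ} {x : E} (hf : DifferentiableAt ℝ f x) (hg : DifferentiableAt ℝ g x)
    (v : E) : dd v (fun y => f y * g y) x = dd v f x * g x + f x * dd v g x := by
  simp only [dd]
  rw [fderiv_fun_mul hf hg]
  simp [mul_comm, add_comm]

theorem dd_const (c : ℝ) (x v : E) : dd v (fun _ : E => c) x = 0 := by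
  simp [dd]

theorem dd_const_mul {f : E → ℝ} {x : E} (c : ℝ) (v : E) :
    dd v (fun y => c * f y) x = c * dd v f x := by
  simp only [dd]
  by_cases hc : c = 0
  · subst hc; simp
  · rw [show (fun y => c * f y) = c • f from rfl, fderiv_const_smul_field]; rfl

theorem dd_inv {f : E → ℝ} {x : E} (hf : DifferentiableAt ℝ f x) (h0 : f x ≠ 0) (v : E) :
    dd v (fun y => (f y)⁻¹) x = - dd v f x * ((f x)⁻¹ * (f x)⁻¹) := by
  have := (hasDerivAt_inv h0).comp_hasFDerivAt x hf.hasFDerivAt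
  simp only [dd]
  rw [show (fun y => (f y)⁻¹) = Inv.inv ∘ f from rfl, this.fderiv]
  simp [pow_two]
  ring

theorem dd_log {f : E → ℝ} {x : E} (hf : DifferentiableAt ℝ f x) (h0 : f x ≠ 0) (v : E) :
    dd v (fun y => Real.log (f y)) x = dd v f x * (f x)⁻¹ := by
  have := hf.hasFDerivAt.log h0
  simp only [dd]
  rw [this.fderiv]
  simp [mul_comm]

theorem dd_comp {g : ℝ → ℝ} {f : E → ℝ} {x : E} (hg : DifferentiableAt ℝ g (f x))
    (hf : DifferentiableAt ℝ f x) (v : E) :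
    dd v (fun y => g (f y)) x = deriv g (f x) * dd v f x := by
  have := hg.hasDerivAt.comp_hasFDerivAt x hf.hasFDerivAt
  simp only [dd]
  rw [show (fun y => g (f y)) = g ∘ f from rfl, this.fderiv]
  simp

theorem dd_comm {V : Set E} (hV : IsOpen V) {f : E → ℝ} (hf : ContDiffOn ℝ ∞ f V) (v w : E) :
    EqOn (dd v (dd w f)) (dd w (dd v f)) V := fun x hx => by
  have h1 : ContDiffAt ℝ 2 f x := (contDiffAt_infty.1 (hf.contDiffAt (hV.mem_nhds hx))) 2
  have h2 : DifferentiableAt ℝ (fderiv ℝ f) x :=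
    (h1.fderiv_right (m := 1) (by norm_num)).differentiableAt (by simp)
  have h3 : IsSymmSndFDerivAt ℝ f x := h1.isSymmSndFDerivAt (by simp)
  have key : ∀ a b : E, dd a (dd b f) x = fderiv ℝ (fderiv ℝ f) x a b := fun a b => by
    simp only [dd]
    rw [show dd b f = fun y => fderiv ℝ f y b from rfl]
    rw [fderiv_clm_apply h2 (by fun_prop)]
    simp
  rw [key, key]
  exact h3 v w

theorem dd_eq_zero_of_notMem_tsupport {f : E → ℝ} {x : E} (hx : x ∉ tsupport f) (v : E) :
    dd v f x = 0 := by
  simp only [dd]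
  have : f =ᶠ[nhds x] fun _ => 0 := notMem_tsupport_iff_eventuallyEq.1 hx
  rw [this.fderiv_eq]; simp

theorem tsupport_dd_subset (f : E → ℝ) (v : E) : tsupport (dd v f) ⊆ tsupport f := by
  apply closure_minimal _ isClosed_closure
  intro x hx
  by_contra h
  exact hx (dd_eq_zero_of_notMem_tsupport h v)

theorem HasCompactSupport.dd {f : E → ℝ} (hf : HasCompactSupport f) (v : E) :
    HasCompactSupport (dd v f) := hf.mono' (subset_tsupport _ |>.trans (tsupport_dd_subset f v))

/-- The family `f` and its derivatives up to order `J` are bounded by powers of the weight `w`,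
each derivative lowering the exponent by one. -/
def SymbN (V : Set E) (w : ι → E → ℝ) : ℕ → ℤ → (ι → E → ℝ) → Prop
  | 0, k, f => ∃ C, ∀ i, ∀ x ∈ V, |f i x| ≤ C * w i x ^ k
  | J + 1, k, f => (∃ C, ∀ i, ∀ x ∈ V, |f i x| ≤ C * w i x ^ k) ∧
      ∀ v : E, SymbN V w J (k - 1) (fun i => dd v (f i))

/-- A bounded positive weight on an open set. -/
structure IsWeight (V : Set E) (w : ι → E → ℝ) : Prop where
  isOpen : IsOpen V
  pos : ∀ i, ∀ x ∈ V, 0 < w i x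
  bdd : ∃ M, ∀ i, ∀ x ∈ V, w i x ≤ M

/-- Smooth families whose derivatives of order `j` are `O(w ^ (k - j))`. -/
structure Symb (V : Set E) (w : ι → E → ℝ) (k : ℤ) (f : ι → E → ℝ) : Prop where
  smooth : ∀ i, ContDiffOn ℝ ∞ (f i) V
  symbN : ∀ J, SymbN V w J k f

variable {V : Set E} {w : ι → E → ℝ}

theorem SymbN.bound {J : ℕ} {k : ℤ} {f : ι → E → ℝ} (h : SymbN V w J k f) :
    ∃ C, 0 ≤ C ∧ ∀ i, ∀ x ∈ V, |f i x| ≤ C * |w i x ^ k| := by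
  have : ∃ C, ∀ i, ∀ x ∈ V, |f i x| ≤ C * w i x ^ k := by
    cases J with
    | zero => exact h
    | succ J => exact h.1
  obtain ⟨C, hC⟩ := this
  refine ⟨|C|, abs_nonneg _, fun i x hx => (hC i x hx).trans ?_⟩
  rw [← abs_mul]; exact le_abs_self _

theorem SymbN.congr (hV : IsOpen V) {J : ℕ} {k : ℤ} {f g : ι → E → ℝ}
    (h : SymbN V w J k f) (hfg : ∀ i, EqOn (f i) (g i) V) : SymbN V w J k g := by
  induction J generalizing k f g with
  | zero =>
    obtain ⟨C, hC⟩ := h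
    exact ⟨C, fun i x hx => by rw [← hfg i hx]; exact hC i x hx⟩
  | succ J ih =>
    obtain ⟨⟨C, hC⟩, h2⟩ := h
    exact ⟨⟨C, fun i x hx => by rw [← hfg i hx]; exact hC i x hx⟩,
      fun v => ih (h2 v) (fun i => dd_congr_of_isOpen hV (hfg i) v)⟩

theorem SymbN.of_succ {J : ℕ} {k : ℤ} {f : ι → E → ℝ}
    (h : SymbN V w (J + 1) k f) : SymbN V w J k f := by
  induction J generalizing k f with
  | zero => exact h.1
  | succ J ih => exact ⟨h.1, fun v => ih (h.2 v)⟩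

theorem SymbN.zero (J : ℕ) (k : ℤ) : SymbN V w J k (fun _ _ => 0) := by
  induction J generalizing k with
  | zero => exact ⟨0, by simp⟩
  | succ J ih =>
    refine ⟨⟨0, by simp⟩, fun v => ?_⟩
    have : (fun (_ : ι) => dd v (fun _ : E => (0 : ℝ))) = fun _ _ => 0 := by
      funext i x; exact dd_const 0 x v
    rw [this]; exact ih _

theorem SymbN.add (hw : IsWeight V w) {J : ℕ} {k : ℤ} {f g : ι → E → ℝ}
    (sf : ∀ i, ContDiffOn ℝ ∞ (f i) V) (sg : ∀ i, ContDiffOn ℝ ∞ (g i) V)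
    (hf : SymbN V w J k f) (hg : SymbN V w J k g) :
    SymbN V w J k (fun i x => f i x + g i x) := by
  have key : (∃ C, ∀ i, ∀ x ∈ V, |f i x + g i x| ≤ C * w i x ^ k) := by
    obtain ⟨C, hC0, hC⟩ := hf.bound
    obtain ⟨D, hD0, hD⟩ := hg.bound
    refine ⟨C + D, fun i x hx => ?_⟩
    have h0 : 0 < w i x ^ k := zpow_pos (hw.pos i x hx) k
    have h1 := hC i x hx
    have h2 := hD i x hx
    rw [abs_of_pos h0] at h1 h2
    calc _ ≤ |f i x| + |g i x| := abs_add_le _ _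
      _ ≤ _ := by linarith
  induction J generalizing k f g with
  | zero => exact key
  | succ J ih =>
    refine ⟨key, fun v => ?_⟩
    have h := ih (fun i => (sf i).dd hw.isOpen v) (fun i => (sg i).dd hw.isOpen v)
      (hf.2 v) (hg.2 v)
    have key' : (∃ C, ∀ i, ∀ x ∈ V, |dd v (f i) x + dd v (g i) x| ≤ C * w i x ^ (k-1)) := by
      obtain ⟨C, hC0, hC⟩ := (hf.2 v).bound
      obtain ⟨D, hD0, hD⟩ := (hg.2 v).bound
      refine ⟨C + D, fun i x hx => ?_⟩
      have h0 : 0 < w i x ^ (k-1) := zpow_pos (hw.pos i x hx) _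
      have h1 := hC i x hx
      have h2 := hD i x hx
      rw [abs_of_pos h0] at h1 h2
      calc _ ≤ |dd v (f i) x| + |dd v (g i) x| := abs_add_le _ _
        _ ≤ _ := by linarith
    exact (h key').congr hw.isOpen fun i x hx =>
      (dd_add ((sf i).diffAt hw.isOpen hx) ((sg i).diffAt hw.isOpen hx) v).symm

theorem SymbN.mono (hw : IsWeight V w) {J : ℕ} {k : ℤ} {f : ι → E → ℝ}
    (hf : SymbN V w J k f) : SymbN V w J (k - 1) f := by
  obtain ⟨M, hM⟩ := hw.bdd
  have key : ∃ C, ∀ i, ∀ x ∈ V, |f i x| ≤ C * w i x ^ (k - 1) := by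
    obtain ⟨C, hC0, hC⟩ := hf.bound
    refine ⟨C * M, fun i x hx => (hC i x hx).trans ?_⟩
    have hp := hw.pos i x hx
    rw [abs_of_pos (zpow_pos hp k), mul_assoc]
    gcongr
    calc w i x ^ k = w i x * w i x ^ (k - 1) := by
          rw [← zpow_one_add₀ hp.ne']; congr 1; ring
      _ ≤ _ := by
          have := (zpow_pos hp (k-1)).le
          gcongr; exact hM i x hx
  induction J generalizing k f with
  | zero => exact key
  | succ J ih =>
    refine ⟨key, fun v => ih (hf.2 v) ?_⟩
    obtain ⟨C, hC0, hC⟩ := (hf.2 v).bound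
    refine ⟨C * M, fun i x hx => (hC i x hx).trans ?_⟩
    have hp := hw.pos i x hx
    rw [abs_of_pos (zpow_pos hp _), mul_assoc]
    gcongr
    calc w i x ^ (k - 1) = w i x * w i x ^ (k - 1 - 1) := by
          rw [← zpow_one_add₀ hp.ne']; congr 1; ring
      _ ≤ _ := by
          have := (zpow_pos hp (k-1-1)).le
          gcongr; exact hM i x hx

theorem SymbN.mul (hw : IsWeight V w) {J : ℕ} {k l : ℤ} {f g : ι → E → ℝ}
    (sf : ∀ i, ContDiffOn ℝ ∞ (f i) V) (sg : ∀ i, ContDiffOn ℝ ∞ (g i) V)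
    (hf : SymbN V w J k f) (hg : SymbN V w J l g) :
    SymbN V w J (k + l) (fun i x => f i x * g i x) := by
  have key : ∀ (J : ℕ) (k l : ℤ) (f g : ι → E → ℝ), SymbN V w J k f → SymbN V w J l g →
      (∃ C, ∀ i, ∀ x ∈ V, |f i x * g i x| ≤ C * w i x ^ (k + l)) := by
    intro J k l f g hf hg
    obtain ⟨C, hC0, hC⟩ := hf.bound
    obtain ⟨D, hD0, hD⟩ := hg.bound
    refine ⟨C * D, fun i x hx => ?_⟩
    have hp := hw.pos i x hx
    have h1 := hC i x hx
    have h2 := hD i x hx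
    rw [abs_of_pos (zpow_pos hp _)] at h1 h2
    rw [abs_mul, zpow_add₀ hp.ne']
    calc _ ≤ (C * w i x ^ k) * (D * w i x ^ l) := by gcongr
      _ = _ := by ring
  induction J generalizing k l f g with
  | zero => exact key _ _ _ _ _ hf hg
  | succ J ih =>
    refine ⟨key _ _ _ _ _ hf hg, fun v => ?_⟩
    have h1 := ih (fun i => (sf i).dd hw.isOpen v) sg (hf.2 v) hg.of_succ
    have h2 := ih sf (fun i => (sg i).dd hw.isOpen v) hf.of_succ (hg.2 v)
    rw [show k - 1 + l = k + l - 1 by ring] at h1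
    rw [show k + (l - 1) = k + l - 1 by ring] at h2
    have h3 := h1.add hw (fun i => ((sf i).dd hw.isOpen v).mul (sg i))
      (fun i => (sf i).mul ((sg i).dd hw.isOpen v)) h2
    exact h3.congr hw.isOpen fun i x hx =>
      (dd_mul ((sf i).diffAt hw.isOpen hx) ((sg i).diffAt hw.isOpen hx) v).symm

namespace Symb

variable {k l : ℤ} {f g : ι → E → ℝ}

theorem bound (hw : IsWeight V w) (h : Symb V w k f) :
    ∃ C, 0 ≤ C ∧ ∀ i, ∀ x ∈ V, |f i x| ≤ C * w i x ^ k := by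
  obtain ⟨C, hC0, hC⟩ := (h.symbN 0).bound
  exact ⟨C, hC0, fun i x hx => by
    have := hC i x hx
    rwa [abs_of_pos (zpow_pos (hw.pos i x hx) _)] at this⟩

theorem congr (hw : IsWeight V w) (h : Symb V w k f) (hfg : ∀ i, EqOn (g i) (f i) V) :
    Symb V w k g :=
  ⟨fun i => (h.smooth i).congr (hfg i), fun J => (h.symbN J).congr hw.isOpen
    fun i => (hfg i).symm⟩

theorem dd (hw : IsWeight V w) (h : Symb V w k f) (v : E) :
    Symb V w (k - 1) (fun i => dd v (f i)) :=
  ⟨fun i => (h.smooth i).dd hw.isOpen v, fun J => (h.symbN (J + 1)).2 v⟩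

theorem of_dd (hs : ∀ i, ContDiffOn ℝ ∞ (f i) V)
    (hb : ∃ C, ∀ i, ∀ x ∈ V, |f i x| ≤ C * w i x ^ k)
    (hd : ∀ v, Symb V w (k - 1) (fun i => _root_.dd v (f i))) : Symb V w k f :=
  ⟨hs, fun J => match J with
    | 0 => hb
    | J + 1 => ⟨hb, fun v => (hd v).symbN J⟩⟩

theorem zero : Symb V w k (fun _ _ => 0) := ⟨fun _ => contDiffOn_const, fun J => SymbN.zero J k⟩

theorem add (hw : IsWeight V w) (hf : Symb V w k f) (hg : Symb V w k g) :
    Symb V w k (fun i x => f i x + g i x) :=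
  ⟨fun i => (hf.smooth i).add (hg.smooth i), fun J =>
    (hf.symbN J).add hw hf.smooth hg.smooth (hg.symbN J)⟩

theorem mul (hw : IsWeight V w) (hf : Symb V w k f) (hg : Symb V w l g) :
    Symb V w (k + l) (fun i x => f i x * g i x) :=
  ⟨fun i => (hf.smooth i).mul (hg.smooth i), fun J =>
    (hf.symbN J).mul hw hf.smooth hg.smooth (hg.symbN J)⟩

theorem mul' (hw : IsWeight V w) (hf : Symb V w k f) (hg : Symb V w l g) {m : ℤ}
    (hm : k + l = m) : Symb V w m (fun i x => f i x * g i x) := hm ▸ hf.mul hw hg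

theorem mono (hw : IsWeight V w) (hf : Symb V w k f) (hlk : l ≤ k) : Symb V w l f := by
  obtain ⟨n, rfl⟩ : ∃ n : ℕ, l = k - n := ⟨(k - l).toNat, by
    rw [Int.toNat_of_nonneg (by linarith)]; ring⟩
  clear hlk
  induction n with
  | zero => simpa using hf
  | succ n ih =>
    refine ⟨hf.smooth, fun J => ?_⟩
    have := (ih.symbN J).mono hw
    rwa [show k - (n : ℤ) - 1 = k - ((n + 1 : ℕ) : ℤ) by push_cast; ring] at this

theorem of_param (hw : IsWeight V w) {c : ι → ℝ} (h : ∃ C, ∀ i, ∀ x ∈ V, |c i| ≤ C * w i x ^ k) :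
    Symb V w k (fun i _ => c i) := by
  refine of_dd (fun i => contDiffOn_const) h fun v => ?_
  refine zero.congr hw fun i x _ => dd_const _ x v

theorem const (hw : IsWeight V w) (c : ℝ) : Symb V w 0 (fun _ _ => c) :=
  of_param hw ⟨|c|, fun i x _ => by simp⟩

theorem const_mul (hw : IsWeight V w) (hf : Symb V w k f) (c : ℝ) :
    Symb V w k (fun i x => c * f i x) := (const hw c).mul' hw hf (by ring)

theorem neg (hw : IsWeight V w) (hf : Symb V w k f) : Symb V w k (fun i x => - f i x) :=
  (hf.const_mul hw (-1)).congr hw fun i x _ => by simp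

theorem sub (hw : IsWeight V w) (hf : Symb V w k f) (hg : Symb V w k g) :
    Symb V w k (fun i x => f i x - g i x) :=
  (hf.add hw (hg.neg hw)).congr hw fun i x _ => by simp [sub_eq_add_neg]

theorem inv (hw : IsWeight V w) (hf : Symb V w k f) {c : ℝ} (hc : 0 < c)
    (hlow : ∀ i, ∀ x ∈ V, c * w i x ^ k ≤ f i x) : Symb V w (-k) (fun i x => (f i x)⁻¹) := by
  have hpos : ∀ i, ∀ x ∈ V, 0 < f i x := fun i x hx =>
    lt_of_lt_of_le (mul_pos hc (zpow_pos (hw.pos i x hx) _)) (hlow i x hx)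
  have hs : ∀ i, ContDiffOn ℝ ∞ (fun x => (f i x)⁻¹) V := fun i =>
    (hf.smooth i).inv fun x hx => (hpos i x hx).ne'
  have hb : ∃ C, ∀ i, ∀ x ∈ V, |(f i x)⁻¹| ≤ C * w i x ^ (-k) := by
    refine ⟨c⁻¹, fun i x hx => ?_⟩
    rw [abs_of_pos (inv_pos.2 (hpos i x hx)), zpow_neg, ← mul_inv]
    exact inv_anti₀ (mul_pos hc (zpow_pos (hw.pos i x hx) _)) (hlow i x hx)
  refine ⟨hs, fun J => ?_⟩
  induction J with
  | zero => exact hb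
  | succ J ih =>
    refine ⟨hb, fun v => ?_⟩
    have h1 := ((ih.mul hw hs hs ih).mul hw (fun i => (hs i).mul (hs i))
      ((hf.dd hw v).neg hw).smooth (((hf.dd hw v).neg hw).symbN J))
    rw [show -k + -k + (k - 1) = -k - 1 by ring] at h1
    refine h1.congr hw.isOpen fun i x hx => ?_
    rw [dd_inv ((hf.smooth i).diffAt hw.isOpen hx) (hpos i x hx).ne']
    ring

/-- A smooth function with compact support is a symbol of order `0`. -/
theorem of_compactSupport (hw : IsWeight V w) {g : E → ℝ} (hg : ContDiff ℝ ∞ g)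
    (hc : HasCompactSupport g) : Symb V w 0 (fun _ => g) := by
  obtain ⟨M, hM⟩ := hw.bdd
  have key : ∀ (J : ℕ) (g : E → ℝ), ContDiff ℝ ∞ g → HasCompactSupport g →
      SymbN V w J 0 (fun _ => g) := by
    intro J
    induction J with
    | zero =>
      intro g hg hc
      obtain ⟨C, hC⟩ := hg.continuous.bounded_above_of_compact_support hc
      exact ⟨C, fun i x hx => by simpa using hC x⟩
    | succ J ih =>
      intro g hg hc
      have h0 : SymbN V w 0 0 (fun (_ : ι) => g) := by
        obtain ⟨C, hC⟩ := hg.continuous.bounded_above_of_compact_support hc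
        exact ⟨C, fun i x hx => by simpa using hC x⟩
      exact ⟨h0, fun v => (ih _ (hg.dd v) (hc.dd v)).mono hw⟩
  exact ⟨fun _ => hg.contDiffOn, fun J => key J g hg hc⟩

theorem log (hw : IsWeight V w) (hf : Symb V w k f) {c : ℝ} (hc : 0 < c)
    (hlow : ∀ i, ∀ x ∈ V, c * w i x ^ k ≤ f i x)
    (hb : ∃ C, ∀ i, ∀ x ∈ V, |Real.log (f i x)| ≤ C * w i x ^ (-1 : ℤ)) :
    Symb V w (-1) (fun i x => Real.log (f i x)) ∧
    ∀ v, Symb V w (-1) (fun i => _root_.dd v (fun x => Real.log (f i x))) := by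
  have hpos : ∀ i, ∀ x ∈ V, 0 < f i x := fun i x hx =>
    lt_of_lt_of_le (mul_pos hc (zpow_pos (hw.pos i x hx) _)) (hlow i x hx)
  have hd : ∀ v, Symb V w (-1) (fun i => _root_.dd v (fun x => Real.log (f i x))) := fun v =>
    ((hf.dd hw v).mul' hw (hf.inv hw hc hlow) (m := -1) (by ring)).congr hw fun i x hx =>
      dd_log ((hf.smooth i).diffAt hw.isOpen hx) (hpos i x hx).ne' v
  exact ⟨of_dd (fun i => (hf.smooth i).log fun x hx => (hpos i x hx).ne') hb
    fun v => (hd v).mono hw (by norm_num), hd⟩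

end Symb

end Symbols

/-! ### The defining function -/

section Plane

theorem vec2_eq (v : Vec2) : v = v 0 • e2 0 + v 1 • e2 1 := by
  ext i; fin_cases i <;> simp [e2]

theorem norm_e2 (i : Fin 2) : ‖e2 i‖ = 1 := by simp [e2]

theorem abs_coord_le (v : Vec2) (i : Fin 2) : |v i| ≤ ‖v‖ := by
  have := PiLp.norm_apply_le v i
  simpa using this

theorem fderiv_apply_eq (f : Vec2 → ℝ) (x v : Vec2) :
    fderiv ℝ f x v = v 0 * dd (e2 0) f x + v 1 * dd (e2 1) f x := by
  conv_lhs => rw [vec2_eq v]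
  simp [dd]

theorem abs_dd_le (f : Vec2 → ℝ) (x : Vec2) (i : Fin 2) : |dd (e2 i) f x| ≤ ‖fderiv ℝ f x‖ := by
  have := (fderiv ℝ f x).le_opNorm (e2 i)
  rwa [norm_e2, mul_one] at this

theorem norm_fderiv_le (f : Vec2 → ℝ) (x : Vec2) :
    ‖fderiv ℝ f x‖ ≤ |dd (e2 0) f x| + |dd (e2 1) f x| := by
  refine ContinuousLinearMap.opNorm_le_bound _ (by positivity) fun v => ?_
  rw [fderiv_apply_eq]
  have h0 := abs_coord_le v 0
  have h1 := abs_coord_le v 1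
  calc ‖v 0 * dd (e2 0) f x + v 1 * dd (e2 1) f x‖
      ≤ |v 0| * |dd (e2 0) f x| + |v 1| * |dd (e2 1) f x| := by
        rw [← abs_mul, ← abs_mul]; exact abs_add_le _ _
    _ ≤ ‖v‖ * |dd (e2 0) f x| + ‖v‖ * |dd (e2 1) f x| := by gcongr
    _ = _ := by ring

/-- The squared length of the gradient. -/
noncomputable def gradSq (f : Vec2 → ℝ) (x : Vec2) : ℝ := dd (e2 0) f x ^ 2 + dd (e2 1) f x ^ 2

/-- `d` is a compactly supported smooth function that is positive exactly on `Ω` and whose gradient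
has unit length on the boundary. -/
structure IsDefFun (Ω : Set Vec2) (d : Vec2 → ℝ) : Prop where
  smooth : ContDiff ℝ ∞ d
  supp : HasCompactSupport d
  mem_iff : ∀ x, x ∈ Ω ↔ 0 < d x
  unit : ∀ x ∈ frontier Ω, gradSq d x = 1
  bdd : Bornology.IsBounded Ω
  nonempty : Ω.Nonempty

theorem exists_isDefFun {Ω : Set Vec2} (hΩ : IsBoundedSmoothDomain Ω) : ∃ d, IsDefFun Ω d := by
  obtain ⟨ho, hne, hb, ρ, hρ, hΩρ, hgrad⟩ := hΩ
  set s2 : Vec2 → ℝ := fun x => gradSq ρ x + ρ x ^ 2 with hs2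
  have hs2s : ContDiff ℝ ∞ s2 :=
    (((hρ.dd _).pow 2).add ((hρ.dd _).pow 2)).add (hρ.pow 2)
  have hfr : ∀ x ∈ frontier Ω, ρ x = 0 := fun x hx => by
    have h1 : ρ x ≤ 0 := by
      have : closure Ω ⊆ {x | ρ x ≤ 0} :=
        closure_minimal (by rw [hΩρ]; intro y hy; exact le_of_lt (show ρ y < 0 from hy))
          (isClosed_le hρ.continuous continuous_const)
      exact this (frontier_subset_closure hx)
    have h2 : x ∉ Ω := by
      rw [ho.frontier_eq] at hx; exact hx.2
    rw [hΩρ] at h2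
    simp only [mem_ofPred_eq, not_lt] at h2
    exact le_antisymm h1 h2
  have hpos : ∀ x ∈ closure Ω, 0 < s2 x := fun x hx => by
    have hnn : 0 ≤ gradSq ρ x := by unfold gradSq; positivity
    by_cases hxo : x ∈ Ω
    · have : ρ x < 0 := by rw [hΩρ] at hxo; exact hxo
      have : 0 < ρ x ^ 2 := by nlinarith
      simp only [hs2]; linarith
    · have hxf : x ∈ frontier Ω := by rw [ho.frontier_eq]; exact ⟨hx, hxo⟩
      have hn := hgrad x hxf
      rcases hnn.lt_or_eq with h | h
      · have := sq_nonneg (ρ x); simp only [hs2]; linarith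
      · exfalso; apply hn
        unfold gradSq at h
        have h0 : dd (e2 0) ρ x = 0 := by nlinarith [sq_nonneg (dd (e2 0) ρ x), sq_nonneg (dd (e2 1) ρ x)]
        have h1 : dd (e2 1) ρ x = 0 := by nlinarith [sq_nonneg (dd (e2 0) ρ x), sq_nonneg (dd (e2 1) ρ x)]
        ext v; rw [fderiv_apply_eq, h0, h1]; simp
  have hcomp : IsCompact (closure Ω) := hb.isCompact_closure
  have hUo : IsOpen {x | 0 < s2 x} := isOpen_lt continuous_const hs2s.continuous
  obtain ⟨θ, hθU, hθc, hθs, hθr, hθ1⟩ : ∃ θ : Vec2 → ℝ, tsupport θ ⊆ {x | 0 < s2 x} ∧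
      HasCompactSupport θ ∧ ContDiff ℝ ∞ θ ∧ range θ ⊆ Icc 0 1 ∧ ∀ x ∈ closure Ω, θ x = 1 := by
    obtain ⟨K, hK, hK1, hK2⟩ := exists_compact_between hcomp hUo hpos
    obtain ⟨f, hf1, hf2, hf3⟩ := exists_contMDiffMap_one_nhds_of_subset_interior
      (modelWithCornersSelf ℝ Vec2) (n := (⊤ : ℕ∞)) hcomp.isClosed hK1
    have hsub : tsupport (f : Vec2 → ℝ) ⊆ K := by
      refine closure_minimal ?_ hK.isClosed
      intro x hx; by_contra h; exact hx (hf2 x h)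
    refine ⟨f, hsub.trans hK2, hK.of_isClosed_subset isClosed_closure hsub, f.contMDiff.contDiff,
      ?_, fun x hx => hf1.self_of_nhdsSet x hx⟩
    rintro _ ⟨x, rfl⟩; exact hf3 x
  set d : Vec2 → ℝ := fun x => - ρ x * (θ x * (Real.sqrt (s2 x))⁻¹) with hd
  have hσ : ContDiff ℝ ∞ (fun x => θ x * (Real.sqrt (s2 x))⁻¹) := by
    rw [contDiff_iff_contDiffAt]
    intro x
    by_cases hx : x ∈ tsupport θ
    · have h0 : 0 < s2 x := hθU hx
      exact hθs.contDiffAt.mul ((hs2s.contDiffAt.sqrt h0.ne').inv (Real.sqrt_pos.2 h0).ne')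
    · have : (fun x => θ x * (Real.sqrt (s2 x))⁻¹) =ᶠ[nhds x] fun _ => 0 := by
        filter_upwards [notMem_tsupport_iff_eventuallyEq.1 hx] with y hy
        rw [hy]; simp
      exact contDiffAt_const.congr_of_eventuallyEq this
  have hds : ContDiff ℝ ∞ d := hρ.neg.mul hσ
  refine ⟨d, hds, ?_, ?_, ?_, hb, hne⟩
  · exact (hθc.mul_right (f' := fun x => (Real.sqrt (s2 x))⁻¹)).mul_left (f := fun x => - ρ x)
  · intro x
    constructor
    · intro hx
      have h1 : ρ x < 0 := by rw [hΩρ] at hx; exact hx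
      have h2 := hpos x (subset_closure hx)
      simp only [hd, hθ1 x (subset_closure hx)]
      have := Real.sqrt_pos.2 h2
      have := inv_pos.2 this
      nlinarith
    · intro hx
      rw [hΩρ]
      by_contra h
      simp only [mem_ofPred_eq, not_lt] at h
      have h2 : 0 ≤ θ x := (hθr ⟨x, rfl⟩).1
      have : 0 ≤ θ x * (Real.sqrt (s2 x))⁻¹ := by positivity
      simp only [hd] at hx
      nlinarith
  · intro x hx
    have hr := hfr x hx
    have hcl := frontier_subset_closure hx
    have hp := hpos x hcl
    have key : ∀ v, dd v d x = - dd v ρ x * (Real.sqrt (s2 x))⁻¹ := fun v => by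
      have := dd_mul (f := fun x => - ρ x) (g := fun x => θ x * (Real.sqrt (s2 x))⁻¹) (x := x)
        (hρ.neg.differentiable (by simp) x) (hσ.differentiable (by simp) x) v
      rw [hd, this, dd_neg, hr, hθ1 x hcl]; simp
    have hs : s2 x = gradSq ρ x := by simp [hs2, hr]
    unfold gradSq
    rw [key, key]
    have h3 : Real.sqrt (s2 x) ^ 2 = s2 x := Real.sq_sqrt hp.le
    have h4 : (Real.sqrt (s2 x)) ≠ 0 := (Real.sqrt_pos.2 hp).ne'
    rw [mul_pow, mul_pow, ← add_mul, inv_pow, h3, hs, neg_sq, neg_sq]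
    rw [hs] at hp
    exact mul_inv_cancel₀ hp.ne'

namespace IsDefFun

variable {Ω : Set Vec2} {d : Vec2 → ℝ}

theorem isOpen (h : IsDefFun Ω d) : IsOpen Ω := by
  have : Ω = {x | 0 < d x} := Set.ext h.mem_iff
  rw [this]; exact isOpen_lt continuous_const h.smooth.continuous

theorem pos (h : IsDefFun Ω d) {x : Vec2} (hx : x ∈ Ω) : 0 < d x := (h.mem_iff x).1 hx

theorem isCompact_closure (h : IsDefFun Ω d) : IsCompact (closure Ω) := h.bdd.isCompact_closure

theorem frontier_eq (h : IsDefFun Ω d) : frontier Ω = closure Ω \ Ω := h.isOpen.frontier_eq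

theorem nonneg_of_closure (h : IsDefFun Ω d) {x : Vec2} (hx : x ∈ closure Ω) : 0 ≤ d x :=
  closure_minimal (fun _ hy => (h.pos hy).le)
    (isClosed_le continuous_const h.smooth.continuous) hx

theorem frontier_zero (h : IsDefFun Ω d) {x : Vec2} (hx : x ∈ frontier Ω) : d x = 0 := by
  rw [h.frontier_eq] at hx
  refine le_antisymm ?_ (h.nonneg_of_closure hx.1)
  by_contra hc
  exact hx.2 ((h.mem_iff x).2 (not_le.1 hc))

theorem exists_bound (h : IsDefFun Ω d) : ∃ M, 0 < M ∧ ∀ x, |d x| ≤ M := by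
  obtain ⟨C, hC⟩ := h.smooth.continuous.bounded_above_of_compact_support h.supp
  exact ⟨|C| + 1, by positivity, fun x => (hC x).trans (by linarith [le_abs_self C])⟩

theorem exists_lipschitz (h : IsDefFun Ω d) : ∃ Λ, 0 < Λ ∧ ∀ x y, |d x - d y| ≤ Λ * ‖x - y‖ := by
  obtain ⟨C, hC⟩ := h.smooth.lipschitzWith_of_hasCompactSupport h.supp (by simp)
  refine ⟨C + 1, by positivity, fun x y => ?_⟩
  have := hC.dist_le_mul x y
  rw [Real.dist_eq, dist_eq_norm] at this
  exact this.trans (by gcongr; linarith)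

/-- Every interior point has a nearest boundary point. -/
theorem exists_nearest (h : IsDefFun Ω d) {y : Vec2} (hy : y ∈ Ω) :
    ∃ z ∈ frontier Ω, 0 < ‖y - z‖ ∧ Metric.infDist y Ωᶜ = ‖y - z‖ ∧
      ∀ t ∈ Ioc (0 : ℝ) 1, z + t • (y - z) ∈ Ω ∧
        t * ‖y - z‖ = Metric.infDist (z + t • (y - z)) Ωᶜ := by
  have hne : (Ωᶜ).Nonempty := by
    by_contra hc
    rw [not_nonempty_iff_eq_empty, compl_empty_iff] at hc
    exact NormedSpace.unbounded_univ ℝ Vec2 (hc ▸ h.bdd)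
  obtain ⟨z, hz, hdist⟩ := h.isOpen.isClosed_compl.exists_infDist_eq_dist hne y
  have hr : 0 < ‖y - z‖ := by
    rw [norm_pos_iff, sub_ne_zero]; rintro rfl; exact hz hy
  have hlow : ∀ w ∈ Ωᶜ, ‖y - z‖ ≤ ‖y - w‖ := fun w hw => by
    rw [← dist_eq_norm, ← hdist, ← dist_eq_norm]; exact Metric.infDist_le_dist_of_mem hw
  have key : ∀ t ∈ Ioc (0 : ℝ) 1, ∀ w ∈ Ωᶜ, t * ‖y - z‖ ≤ ‖z + t • (y - z) - w‖ := by
    intro t ht w hw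
    have h1 : y - w = (1 - t) • (y - z) + (z + t • (y - z) - w) := by
      rw [sub_smul, one_smul]; abel
    have h2 := hlow w hw
    rw [h1] at h2
    have h3 := norm_add_le ((1 - t) • (y - z)) (z + t • (y - z) - w)
    rw [norm_smul, Real.norm_of_nonneg (by linarith [ht.2])] at h3
    linarith
  have hmem : ∀ t ∈ Ioc (0 : ℝ) 1, z + t • (y - z) ∈ Ω := fun t ht => by
    by_contra hc
    have := key t ht _ hc
    rw [sub_self, norm_zero] at this
    have := mul_pos ht.1 hr
    linarith
  refine ⟨z, ?_, hr, by rw [hdist, dist_eq_norm], fun t ht => ⟨hmem t ht, ?_⟩⟩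
  · rw [h.frontier_eq]
    refine ⟨?_, hz⟩
    have ht : Filter.Tendsto (fun t : ℝ => z + t • (y - z)) (nhdsWithin 0 (Ioi 0)) (nhds z) := by
      have : Continuous fun t : ℝ => z + t • (y - z) := by fun_prop
      have h0 := this.tendsto 0
      simp only [zero_smul, add_zero] at h0
      exact h0.mono_left nhdsWithin_le_nhds
    refine mem_closure_of_tendsto ht ?_
    filter_upwards [Ioc_mem_nhdsGT (show (0 : ℝ) < 1 by norm_num)] with t ht' using hmem t ht'
  · refine le_antisymm ?_ ?_
    · refine (Metric.le_infDist hne).2 fun w hw => ?_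
      rw [dist_eq_norm]; exact key t ht w hw
    · refine (Metric.infDist_le_dist_of_mem hz).trans ?_
      rw [dist_eq_norm, add_sub_cancel_left, norm_smul, Real.norm_of_nonneg ht.1.le]

theorem exists_gradSq_lower (h : IsDefFun Ω d) :
    ∃ ε > 0, ∀ x ∈ Ω, d x ≤ ε → 1 / 2 ≤ gradSq d x := by
  have hcont : Continuous (gradSq d) := by
    unfold gradSq
    exact ((h.smooth.dd _).continuous.pow 2).add ((h.smooth.dd _).continuous.pow 2)
  set A := closure Ω ∩ {x | gradSq d x ≤ 1 / 2}
  have hA : IsCompact A := h.isCompact_closure.inter_right (isClosed_le hcont continuous_const)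
  have hpos : ∀ x ∈ A, 0 < d x := fun x hx => by
    by_contra hc
    have hx' : x ∈ frontier Ω := by
      rw [h.frontier_eq]; exact ⟨hx.1, fun hm => hc (h.pos hm)⟩
    have h1 := h.unit x hx'
    have h2 : gradSq d x ≤ 1 / 2 := hx.2
    linarith
  rcases A.eq_empty_or_nonempty with he | hne
  · refine ⟨1, one_pos, fun x hx _ => ?_⟩
    by_contra hc
    have : x ∈ A := ⟨subset_closure hx, le_of_lt (not_le.1 hc)⟩
    rw [he] at this; exact this
  · obtain ⟨x0, hx0, hmin⟩ := hA.exists_isMinOn hne h.smooth.continuous.continuousOn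
    refine ⟨d x0 / 2, half_pos (hpos x0 hx0), fun x hx hdx => ?_⟩
    by_contra hc
    have : x ∈ A := ⟨subset_closure hx, le_of_lt (not_le.1 hc)⟩
    have h1 : d x0 ≤ d x := hmin this
    have := hpos x0 hx0
    linarith

/-- The gradient, as a vector. -/
theorem exists_normal (f : Vec2 → ℝ) (x : Vec2) :
    ∃ n : Vec2, n 0 = dd (e2 0) f x ∧ n 1 = dd (e2 1) f x ∧ ‖n‖ ^ 2 = gradSq f x := by
  refine ⟨dd (e2 0) f x • e2 0 + dd (e2 1) f x • e2 1, by simp [e2], by simp [e2], ?_⟩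
  rw [EuclideanSpace.norm_sq_eq]
  simp [e2, gradSq]

theorem exists_grad_lipschitz (h : IsDefFun Ω d) : ∃ Λ, 0 < Λ ∧ ∀ x y v,
    |fderiv ℝ d x v - fderiv ℝ d y v| ≤ Λ * ‖x - y‖ * ‖v‖ := by
  obtain ⟨C, hC⟩ := (h.smooth.fderiv_right (m := ∞) (by simp)).lipschitzWith_of_hasCompactSupport
    (h.supp.fderiv (𝕜 := ℝ)) (by simp)
  refine ⟨C + 1, by positivity, fun x y v => ?_⟩
  have := hC.dist_le_mul x y
  rw [dist_eq_norm, dist_eq_norm] at this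
  have h2 := (fderiv ℝ d x - fderiv ℝ d y).le_opNorm v
  rw [sub_apply] at h2
  refine h2.trans ?_
  gcongr
  exact this.trans (by gcongr; linarith)

/-- Mean value estimate along a direction. -/
theorem le_along (h : IsDefFun Ω d) {p v : Vec2} {m s : ℝ} (hs : 0 ≤ s)
    (hm : ∀ t ∈ Icc 0 s, fderiv ℝ d (p + t • v) v ≤ m) : d (p + s • v) ≤ d p + m * s := by
  have hder : ∀ t, HasDerivAt (fun t : ℝ => d (p + t • v)) (fderiv ℝ d (p + t • v) v) t := by
    intro t
    have h1 : HasDerivAt (fun t : ℝ => p + t • v) v t := by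
      simpa using ((hasDerivAt_id t).smul_const v).const_add p
    exact ((h.smooth.differentiable (by simp)) _).hasFDerivAt.comp_hasDerivAt t h1
  have := image_le_of_deriv_right_le_deriv_boundary (f := fun t : ℝ => d (p + t • v))
    (f' := fun t => fderiv ℝ d (p + t • v) v) (a := 0) (b := s) (B := fun t => d p + m * t)
    (B' := fun _ => m) (fun t _ => (hder t).continuousAt.continuousWithinAt)
    (fun t _ => (hder t).hasDerivWithinAt) (by simp) (by fun_prop)
    (fun t _ => by simpa using (((hasDerivAt_id t).const_mul m).const_add (d p)).hasDerivWithinAt)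
    (fun t ht => hm t ⟨ht.1, ht.2.le⟩) 
  exact this ⟨hs, le_refl _⟩

theorem exists_infDist_le (h : IsDefFun Ω d) :
    ∃ C, 0 < C ∧ ∀ y ∈ Ω, Metric.infDist y Ωᶜ ≤ C * d y := by
  obtain ⟨ε, hε, hlow⟩ := h.exists_gradSq_lower
  obtain ⟨Λ, hΛ, hlip⟩ := h.exists_lipschitz
  obtain ⟨Λ', hΛ', hlip'⟩ := h.exists_grad_lipschitz
  obtain ⟨G, hG0, hG⟩ : ∃ G, 0 < G ∧ ∀ x, gradSq d x ≤ G := by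
    refine ⟨2 * Λ ^ 2, by positivity, fun x => ?_⟩
    have hb : ‖fderiv ℝ d x‖ ≤ Λ := by
      have : LipschitzWith ⟨Λ, hΛ.le⟩ d := LipschitzWith.of_dist_le_mul fun x y => by
        rw [Real.dist_eq, dist_eq_norm]; exact hlip x y
      exact norm_fderiv_le_of_lipschitz ℝ this
    have h0 := (abs_dd_le d x 0).trans hb
    have h1 := (abs_dd_le d x 1).trans hb
    unfold gradSq
    have h0' := sq_le_sq' (by linarith [neg_abs_le (dd (e2 0) d x)]) ((le_abs_self _).trans h0)
    have h1' := sq_le_sq' (by linarith [neg_abs_le (dd (e2 1) d x)]) ((le_abs_self _).trans h1)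
    linarith
  obtain ⟨R, hR0, hR⟩ : ∃ R, 0 < R ∧ ∀ y ∈ Ω, Metric.infDist y Ωᶜ ≤ R := by
    obtain ⟨R, hR⟩ := h.bdd.subset_closedBall 0
    refine ⟨2 * |R| + 1, by positivity, fun y hy => ?_⟩
    obtain ⟨z, hz, -, h2, -⟩ := h.exists_nearest hy
    have hcl : closure Ω ⊆ Metric.closedBall 0 R := closure_minimal hR Metric.isClosed_closedBall
    have h3 := hcl (frontier_subset_closure hz)
    have h4 := hR hy
    rw [mem_closedBall_zero_iff] at h3 h4
    rw [h2]
    have := norm_sub_le y z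
    linarith [le_abs_self R]
  set ε1 := min ε (1 / (32 * Λ' * G)) with hε1
  have hε1p : 0 < ε1 := lt_min hε (by positivity)
  refine ⟨8 * (G + 1) + R / ε1, by positivity, fun y hy => ?_⟩
  have hdy := h.pos hy
  by_cases hc : d y ≤ ε1
  · obtain ⟨n, hn0, hn1, hn2⟩ := exists_normal d y
    have hgl := hlow y hy (hc.trans (min_le_left _ _))
    have hn3 : ‖n‖ ^ 2 ≤ G := hn2 ▸ hG y
    have hfy : fderiv ℝ d y n = ‖n‖ ^ 2 := by
      rw [fderiv_apply_eq, hn0, hn1, hn2, gradSq]; ring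
    have hnot : y + (8 * d y) • (-n) ∉ Ω := by
      rw [h.mem_iff, not_lt]
      have := h.le_along (p := y) (v := -n) (m := -1/4) (s := 8 * d y) (by positivity) ?_
      · linarith
      · intro t ht
        have h1 := hlip' (y + t • (-n)) y (-n)
        rw [add_sub_cancel_left, norm_smul, norm_neg, Real.norm_of_nonneg ht.1] at h1
        have h2 : d y ≤ 1 / (32 * Λ' * G) := hc.trans (min_le_right _ _)
        rw [le_div_iff₀ (by positivity)] at h2
        have h3 : Λ' * (t * ‖n‖) * ‖n‖ ≤ ‖n‖ ^ 2 / 2 := by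
          have h5 : t ≤ 8 * d y := ht.2
          have : Λ' * t * ‖n‖^2 ≤ 1/4 := by
            have hnn := sq_nonneg ‖n‖
            have h9 : Λ' * t * ‖n‖^2 ≤ Λ' * (8 * d y) * G := by
              gcongr
            nlinarith
          nlinarith
        have h4 : fderiv ℝ d y (-n) = - ‖n‖^2 := by rw [map_neg, hfy]
        rw [h4] at h1
        have := abs_le.1 h1
        rw [hn2] at this h3
        linarith [this.2]
    have h1 := Metric.infDist_le_dist_of_mem (x := y) (s := Ωᶜ) hnot
    rw [dist_eq_norm, sub_add_cancel_left, norm_neg, norm_smul, norm_neg, Real.norm_of_nonneg (by positivity)] at h1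
    have h2 : ‖n‖ ≤ G + 1 := by nlinarith [sq_nonneg (‖n‖ - 1), norm_nonneg n]
    calc _ ≤ 8 * d y * ‖n‖ := h1
      _ ≤ 8 * d y * (G + 1) := by gcongr
      _ ≤ _ := by
        have : 0 ≤ R / ε1 * d y := by positivity
        nlinarith
  · have h1 := hR y hy
    have h2 : R ≤ R / ε1 * d y := by
      rw [div_mul_eq_mul_div, le_div_iff₀ hε1p]
      exact mul_le_mul_of_nonneg_left (not_le.1 hc).le hR0.le
    nlinarith

end IsDefFun

end Plane

/-! ### Boundary growth and connectivity near the boundary -/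

section Growth

/-- `z` is a boundary point nearest to `y`. -/
structure IsNearest (Ω : Set Vec2) (y z : Vec2) : Prop where
  mem : z ∈ frontier Ω
  pos : 0 < ‖y - z‖
  eq : Metric.infDist y Ωᶜ = ‖y - z‖
  seg : ∀ t ∈ Ioc (0 : ℝ) 1, z + t • (y - z) ∈ Ω ∧
        t * ‖y - z‖ = Metric.infDist (z + t • (y - z)) Ωᶜ

theorem hasDerivAt_comp_line {f : Vec2 → ℝ} {p q : Vec2} {t : ℝ}
    (hf : DifferentiableAt ℝ f (p + t • q)) :
    HasDerivAt (fun t : ℝ => f (p + t • q)) (fderiv ℝ f (p + t • q) q) t := by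
  have h1 : HasDerivAt (fun t : ℝ => p + t • q) q t := by
    simpa using ((hasDerivAt_id t).smul_const q).const_add p
  exact hf.hasFDerivAt.comp_hasDerivAt t h1

theorem eq_of_fderiv_eq_zero_segment {ψ : Vec2 → ℝ} (hψ : Differentiable ℝ ψ) {p q : Vec2}
    (h : ∀ t ∈ Icc (0 : ℝ) 1, fderiv ℝ ψ (p + t • q) = 0) : ψ (p + q) = ψ p := by
  have := constant_of_has_deriv_right_zero (f := fun t : ℝ => ψ (p + t • q)) (a := 0) (b := 1)
    (fun t _ => (hasDerivAt_comp_line (hψ _)).continuousAt.continuousWithinAt)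
    (fun t ht => by
      have := (hasDerivAt_comp_line (t := t) (p := p) (q := q) (hψ _)).hasDerivWithinAt (s := Ici t)
      rwa [h t ⟨ht.1, ht.2.le⟩] at this) 1 ⟨zero_le_one, le_refl _⟩
  simpa using this

theorem abs_sub_le_of_abs_deriv_le {f f' g g' : ℝ → ℝ}
    (hf : ContinuousOn f (Icc 0 1)) (hg : ContinuousOn g (Icc 0 1))
    (hf' : ∀ t ∈ Ioo (0 : ℝ) 1, HasDerivAt f (f' t) t)
    (hg' : ∀ t ∈ Ioo (0 : ℝ) 1, HasDerivAt g (g' t) t)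
    (h : ∀ t ∈ Ioo (0 : ℝ) 1, |f' t| ≤ g' t) : |f 1 - f 0| ≤ g 1 - g 0 := by
  have h0 : (0 : ℝ) ∈ Icc (0 : ℝ) 1 := ⟨le_refl _, zero_le_one⟩
  have h1 : (1 : ℝ) ∈ Icc (0 : ℝ) 1 := ⟨zero_le_one, le_refl _⟩
  have hm1 : MonotoneOn (fun t => g t - f t) (Icc 0 1) := by
    refine monotoneOn_of_deriv_nonneg (convex_Icc 0 1) (hg.sub hf) ?_ ?_
    · rw [interior_Icc]
      exact fun t ht => ((hg' t ht).sub (hf' t ht)).differentiableAt.differentiableWithinAt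
    · rw [interior_Icc]
      intro t ht
      have := ((hg' t ht).sub (hf' t ht)).deriv
      rw [show (fun t => g t - f t) = g - f from rfl, this]
      have := (abs_le.1 (h t ht)).2; linarith
  have hm2 : MonotoneOn (fun t => g t + f t) (Icc 0 1) := by
    refine monotoneOn_of_deriv_nonneg (convex_Icc 0 1) (hg.add hf) ?_ ?_
    · rw [interior_Icc]
      exact fun t ht => ((hg' t ht).add (hf' t ht)).differentiableAt.differentiableWithinAt
    · rw [interior_Icc]
      intro t ht
      have := ((hg' t ht).add (hf' t ht)).deriv
      rw [show (fun t => g t + f t) = g + f from rfl, this]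
      have := (abs_le.1 (h t ht)).1; linarith
  have e1 := hm1 h0 h1 zero_le_one
  have e2 := hm2 h0 h1 zero_le_one
  simp only at e1 e2
  exact abs_le.2 ⟨by linarith, by linarith⟩

namespace IsDefFun

variable {Ω : Set Vec2} {d : Vec2 → ℝ}

theorem exists_isNearest (h : IsDefFun Ω d) {y : Vec2} (hy : y ∈ Ω) : ∃ z, IsNearest Ω y z := by
  obtain ⟨z, h1, h2, h3, h4⟩ := h.exists_nearest hy
  exact ⟨z, h1, h2, h3, h4⟩

theorem abs_sub_nearest_le {f : Vec2 → ℝ} (hd : ∀ y ∈ Ω, DifferentiableAt ℝ f y)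
    (hc : ContinuousOn f (closure Ω)) {A s : ℝ} (hs : 0 < s)
    (hb : ∀ y ∈ Ω, ‖fderiv ℝ f y‖ ≤ A * Metric.infDist y Ωᶜ ^ (s - 1)) {y z : Vec2}
    (hz : IsNearest Ω y z) : |f y - f z| ≤ A / s * ‖y - z‖ ^ s := by
  set r := ‖y - z‖ with hr
  have hr0 : 0 < r := hz.pos
  have key := abs_sub_le_of_abs_deriv_le (f := fun t : ℝ => f (z + t • (y - z)))
    (f' := fun t => fderiv ℝ f (z + t • (y - z)) (y - z))
    (g := fun t => A / s * r ^ s * t ^ s) (g' := fun t => A / s * r ^ s * (s * t ^ (s - 1))) ?_ ?_ ?_ ?_ ?_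
  · simpa [Real.zero_rpow hs.ne'] using key
  · refine hc.comp (by fun_prop) fun t ht => ?_
    rcases ht.1.eq_or_lt with h0 | h0
    · rw [← h0]; simpa using frontier_subset_closure hz.mem
    · exact subset_closure (hz.seg t ⟨h0, ht.2⟩).1
  · exact continuousOn_const.mul (continuousOn_id.rpow_const fun _ _ => Or.inr hs.le)
  · exact fun t ht => hasDerivAt_comp_line (hd _ (hz.seg t ⟨ht.1, ht.2.le⟩).1)
  · exact fun t ht => (Real.hasDerivAt_rpow_const (Or.inl ht.1.ne')).const_mul _
  · intro t ht
    obtain ⟨hm, he⟩ := hz.seg t ⟨ht.1, ht.2.le⟩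
    have h1 := (fderiv ℝ f (z + t • (y - z))).le_opNorm (y - z)
    have h2 := hb _ hm
    rw [← he, Real.mul_rpow ht.1.le hr0.le] at h2
    calc _ ≤ A * (t ^ (s - 1) * r ^ (s - 1)) * r := h1.trans (by gcongr)
      _ = A * t ^ (s - 1) * (r ^ (s - 1) * r) := by ring
      _ = A * t ^ (s - 1) * r ^ s := by
        rw [← Real.rpow_add_one hr0.ne', sub_add_cancel]
      _ = _ := by field_simp

theorem exists_abs_gradSq_sub_one_le (h : IsDefFun Ω d) :
    ∃ C, 0 < C ∧ ∀ x ∈ Ω, |gradSq d x - 1| ≤ C * d x := by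
  obtain ⟨C, hC, hinf⟩ := h.exists_infDist_le
  have hsm : ContDiff ℝ ∞ (gradSq d) := ((h.smooth.dd _).pow 2).add ((h.smooth.dd _).pow 2)
  obtain ⟨M, hM⟩ := h.isCompact_closure.exists_bound_of_continuousOn
    (hsm.continuous_fderiv (by simp)).continuousOn
  have hM' : ∀ y ∈ Ω, ‖fderiv ℝ (gradSq d) y‖ ≤ |M| := fun y hy =>
    (hM y (subset_closure hy)).trans (le_abs_self M)
  refine ⟨(|M| + 1) * C, by positivity, fun x hx => ?_⟩
  obtain ⟨z, hz⟩ := h.exists_isNearest hx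
  have := abs_sub_nearest_le (Ω := Ω) (f := gradSq d) (A := |M| + 1) (s := 1)
    (fun y _ => hsm.differentiable (by simp) y) hsm.continuous.continuousOn one_pos
    (fun y hy => by simpa using (hM' y hy).trans (by linarith)) hz
  rw [h.unit z hz.mem] at this
  refine this.trans ?_
  rw [Real.rpow_one, div_one, ← hz.eq, mul_assoc]
  gcongr
  exact hinf x hx

theorem exists_radius (h : IsDefFun Ω d) : ∃ r > 0, ∀ ψ : Vec2 → ℝ, Differentiable ℝ ψ →
    (∀ x ∉ Ω, fderiv ℝ ψ x = 0) → ∀ z ∈ frontier Ω, ∀ w ∈ frontier Ω, ‖z - w‖ < r → ψ z = ψ w := by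
  obtain ⟨Λ, hΛ, hlip⟩ := h.exists_lipschitz
  obtain ⟨Λ', hΛ', hlip'⟩ := h.exists_grad_lipschitz
  refine ⟨1 / (2 * Λ') / (1 + 2 * Λ), by positivity, fun ψ hψ h0 z hz w hw hzw => ?_⟩
  rw [lt_div_iff₀ (by positivity)] at hzw
  obtain ⟨n, hn0, hn1, hn2⟩ := exists_normal d z
  rw [h.unit z hz] at hn2
  have hn : ‖n‖ = 1 := by nlinarith [norm_nonneg n, sq_nonneg (‖n‖ - 1)]
  set s := 2 * Λ * ‖z - w‖ with hs
  have hs0 : 0 ≤ s := by positivity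
  have hder : ∀ ξ, ‖ξ - z‖ ≤ 1 / (2 * Λ') → fderiv ℝ d ξ (-n) ≤ -1 / 2 := fun ξ hξ => by
    have h1 := hlip' ξ z (-n)
    rw [norm_neg, hn, mul_one] at h1
    have h2 : fderiv ℝ d z (-n) = -1 := by
      rw [map_neg, fderiv_apply_eq, hn0, hn1]
      have := h.unit z hz
      rw [gradSq] at this; linarith
    rw [h2] at h1
    have h3 : Λ' * ‖ξ - z‖ ≤ 1 / 2 := by
      calc Λ' * ‖ξ - z‖ ≤ Λ' * (1 / (2 * Λ')) := by gcongr
        _ = 1 / 2 := by field_simp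
    have := (abs_le.1 h1).2
    linarith
  have hdesc : ∀ p, ‖p - z‖ ≤ ‖z - w‖ → ∀ t ∈ Icc 0 s, d (p + t • (-n)) ≤ d p - t / 2 := by
    intro p hp t ht
    have := h.le_along (p := p) (v := -n) (m := -1/2) ht.1 fun τ hτ => hder _ ?_
    · linarith
    · have h1 : p + τ • (-n) - z = (p - z) + τ • (-n) := by abel
      rw [h1]
      have h2 := norm_add_le (p - z) (τ • (-n))
      rw [norm_smul, norm_neg, hn, Real.norm_of_nonneg hτ.1, mul_one] at h2
      have := hτ.2.trans ht.2
      have : ‖z - w‖ + s ≤ 1 / (2 * Λ') := by rw [hs]; linarith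
      linarith
  have hnm : ∀ p, d p ≤ 0 → fderiv ℝ ψ p = 0 := fun p hp =>
    h0 p fun hm => absurd (h.pos hm) (not_lt.2 hp)
  have e1 : ψ (z + s • (-n)) = ψ z := eq_of_fderiv_eq_zero_segment hψ fun t ht => hnm _ (by
    rw [smul_smul]
    have := hdesc z (by simp) (t * s) ⟨mul_nonneg ht.1 hs0, by nlinarith [ht.2]⟩
    rw [h.frontier_zero hz] at this
    have := mul_nonneg ht.1 hs0
    linarith)
  have e3 : ψ (w + s • (-n)) = ψ w := eq_of_fderiv_eq_zero_segment hψ fun t ht => hnm _ (by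
    rw [smul_smul]
    have := hdesc w (by rw [norm_sub_rev]) (t * s) ⟨mul_nonneg ht.1 hs0, by nlinarith [ht.2]⟩
    rw [h.frontier_zero hw] at this
    have := mul_nonneg ht.1 hs0
    linarith)
  have e2 : ψ (z + s • (-n) + (w - z)) = ψ (z + s • (-n)) :=
    eq_of_fderiv_eq_zero_segment hψ fun t ht => hnm _ (by
      have hnt : ‖t • (w - z)‖ ≤ ‖z - w‖ := by
        rw [norm_smul, Real.norm_of_nonneg ht.1, norm_sub_rev]
        nlinarith [ht.2, norm_nonneg (z - w)]
      have h1 := hdesc (z + t • (w - z)) (by rwa [add_sub_cancel_left]) s ⟨hs0, le_refl _⟩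
      have h2 := hlip (z + t • (w - z)) z
      rw [add_sub_cancel_left, h.frontier_zero hz, sub_zero] at h2
      have h3 := (le_abs_self _).trans h2
      have h4 : Λ * ‖t • (w - z)‖ ≤ Λ * ‖z - w‖ := by gcongr
      have h5 : z + s • (-n) + t • (w - z) = z + t • (w - z) + s • (-n) := by abel
      rw [h5]; linarith)
  rw [← e1, ← e2, ← e3]
  congr 1; abel

end IsDefFun

end Growth

/-! ### Integration by parts, boundary strips and cutoffs -/

section Strip

theorem contDiff_of_tsupport_subset {Ω : Set Vec2} (hΩ : IsOpen Ω) {n : ℕ∞} {g : Vec2 → ℝ}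
    (hg : ContDiffOn ℝ n g Ω) (hs : tsupport g ⊆ Ω) : ContDiff ℝ n g := by
  rw [contDiff_iff_contDiffAt]
  intro x
  by_cases hx : x ∈ tsupport g
  · exact hg.contDiffAt (hΩ.mem_nhds (hs hx))
  · exact contDiffAt_const.congr_of_eventuallyEq (notMem_tsupport_iff_eventuallyEq.1 hx)

theorem ContDiff.continuous_dd {g : Vec2 → ℝ} (hg : ContDiff ℝ 1 g) (v : Vec2) :
    Continuous (_root_.dd v g) := (hg.continuous_fderiv (by simp)).clm_apply continuous_const

theorem integral_dd_eq_zero {g : Vec2 → ℝ} (hg : ContDiff ℝ 1 g) (hc : HasCompactSupport g)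
    (v : Vec2) : ∫ x, dd v g x = 0 := by
  have h1 : Integrable (dd v g) :=
    (hg.continuous_dd v).integrable_of_hasCompactSupport (hc.dd v)
  have := integral_mul_fderiv_eq_neg_fderiv_mul_of_integrable (𝕜 := ℝ) (μ := (volume : Measure Vec2))
    (f := fun _ => (1 : ℝ)) (g := g) (v := v)
    (by simp) (by
      have h2 : Integrable (fun x => fderiv ℝ g x v) := h1
      simpa using h2)
    (by simpa using hg.continuous.integrable_of_hasCompactSupport hc)
    (fun x _ => differentiableAt_const _) (fun x _ => hg.differentiable (by simp) x)
  simpa [dd] using this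

/-- A cutoff function on the line. -/
noncomputable def stepFun (t : ℝ) : ℝ := Real.smoothTransition (2 * t - 1)

theorem stepFun_contDiff : ContDiff ℝ ∞ stepFun :=
  Real.smoothTransition.contDiff.comp (by fun_prop)

theorem stepFun_eq_zero {t : ℝ} (h : t ≤ 1 / 2) : stepFun t = 0 :=
  Real.smoothTransition.zero_of_nonpos (by linarith)

theorem stepFun_eq_one {t : ℝ} (h : 1 ≤ t) : stepFun t = 1 :=
  Real.smoothTransition.one_of_one_le (by linarith)

theorem stepFun_nonneg (t : ℝ) : 0 ≤ stepFun t := Real.smoothTransition.nonneg _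

theorem stepFun_le_one (t : ℝ) : stepFun t ≤ 1 := Real.smoothTransition.le_one _

theorem hasCompactSupport_deriv_stepFun : HasCompactSupport (deriv stepFun) := by
  refine HasCompactSupport.of_support_subset_isCompact (isCompact_Icc (a := (1/2 : ℝ)) (b := 1)) ?_
  intro t ht
  by_contra hc
  apply ht
  rcases not_and_or.1 (show ¬ (1 / 2 ≤ t ∧ t ≤ 1) from hc) with h | h
  · have : stepFun =ᶠ[nhds t] fun _ => 0 := by
      filter_upwards [Iio_mem_nhds (not_le.1 h)] with s hs using stepFun_eq_zero (le_of_lt hs)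
    rw [this.deriv_eq]; simp
  · have : stepFun =ᶠ[nhds t] fun _ => 1 := by
      filter_upwards [Ioi_mem_nhds (not_le.1 h)] with s hs using stepFun_eq_one (le_of_lt hs)
    rw [this.deriv_eq]; simp

theorem Symb.scaled {E ι : Type*} [NormedAddCommGroup E] [NormedSpace ℝ E] {V : Set E}
    {w : ι → E → ℝ} (hw : IsWeight V w) {k : ℤ} {f : ι → E → ℝ} (hf : Symb V w k f) {c : ℝ}
    (hc : 0 < c) (hlow : ∀ i, ∀ x ∈ V, c * w i x ^ k ≤ f i x) (s : ι → ℝ) {θ : ℝ → ℝ}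
    (hθ : ContDiff ℝ ∞ θ) (hb : ∃ M, ∀ t, |θ t| ≤ M) (hθc : HasCompactSupport (deriv θ)) :
    Symb V w 0 (fun i x => θ (s i * f i x)) := by
  have hpos : ∀ i, ∀ x ∈ V, 0 < f i x := fun i x hx =>
    lt_of_lt_of_le (mul_pos hc (zpow_pos (hw.pos i x hx) _)) (hlow i x hx)
  have hs : ∀ θ : ℝ → ℝ, ContDiff ℝ ∞ θ → ∀ i, ContDiffOn ℝ ∞ (fun x => θ (s i * f i x)) V :=
    fun θ hθ i => hθ.comp_contDiffOn (contDiffOn_const.mul (hf.smooth i))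
  refine ⟨hs θ hθ, fun J => ?_⟩
  induction J generalizing θ with
  | zero =>
    obtain ⟨M, hM⟩ := hb
    exact ⟨M, fun i x _ => by simpa using hM _⟩
  | succ J ih =>
    refine ⟨?_, fun v => ?_⟩
    · obtain ⟨M, hM⟩ := hb
      exact ⟨M, fun i x _ => by simpa using hM _⟩
    set η : ℝ → ℝ := fun t => t * deriv θ t with hη
    have hθ' : ContDiff ℝ ∞ (deriv θ) := ((contDiff_succ_iff_deriv (n := ∞)).1 (by simpa using hθ)).2.2
    have hηs : ContDiff ℝ ∞ η := contDiff_id.mul hθ'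
    have hηc : HasCompactSupport η := hθc.mul_left (f := fun t : ℝ => t)
    obtain ⟨M, hM⟩ := hηs.continuous.bounded_above_of_compact_support hηc
    have h1 := ih hηs ⟨M, hM⟩ hηc.deriv
    have h2 := (hf.inv hw hc hlow).mul' hw (hf.dd hw v) (m := -1) (by ring)
    have h3 := h1.mul hw (hs η hηs) h2.smooth (h2.symbN J)
    rw [zero_add] at h3
    rw [zero_sub]
    refine h3.congr hw.isOpen fun i x hx => ?_
    have hfd := (hf.smooth i).diffAt hw.isOpen hx
    rw [dd_comp (f := fun x => s i * f i x) (hθ.differentiable (by simp) _)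
      (hfd.const_mul (s i)), dd_const_mul]
    have := (hpos i x hx).ne'
    simp only [hη]
    field_simp

namespace IsDefFun

variable {Ω : Set Vec2} {d : Vec2 → ℝ}

theorem volume_lt_top (h : IsDefFun Ω d) : volume Ω < ⊤ := h.bdd.measure_lt_top

theorem exists_strip (h : IsDefFun Ω d) :
    ∃ C, 0 < C ∧ ∀ ε > 0, volume.real {x | x ∈ Ω ∧ d x ≤ ε} ≤ C * ε := by
  obtain ⟨ε0, hε0, hlow⟩ := h.exists_gradSq_lower
  set L : Vec2 → ℝ := fun x => |dd (e2 0) (dd (e2 0) d) x + dd (e2 1) (dd (e2 1) d) x| with hL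
  have hdc : Continuous d := h.smooth.continuous
  have hLc : Continuous L :=
    ((((h.smooth.dd _).dd _).continuous).add (((h.smooth.dd _).dd _).continuous)).abs
  have hLi : Integrable L := by
    refine hLc.integrable_of_hasCompactSupport ?_
    refine HasCompactSupport.abs ?_
    exact ((h.supp.dd _).dd _).add ((h.supp.dd _).dd _)
  set V := volume.real Ω
  have hmeas : ∀ ε, MeasurableSet {x | x ∈ Ω ∧ d x ≤ ε} := fun ε =>
    h.isOpen.measurableSet.inter (isClosed_le hdc continuous_const).measurableSet
  refine ⟨4 * (2 * ∫ x, L x) + V / ε0 + 1, ?_, fun ε hε => ?_⟩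
  · have : 0 ≤ ∫ x, L x := integral_nonneg fun x => abs_nonneg _
    positivity
  have hLnn : 0 ≤ ∫ x, L x := integral_nonneg fun x => abs_nonneg _
  by_cases hc : ε ≤ ε0
  · set a : Vec2 → ℝ := fun x => Real.arctan (ε⁻¹ * d x) with ha
    have has : ContDiff ℝ ∞ a := (contDiff_const.mul h.smooth).arctan
    have hdd : ∀ x v, dd v a x = (1 / (1 + (ε⁻¹ * d x) ^ 2)) * (ε⁻¹ * dd v d x) := fun x v => by
      rw [ha, dd_comp (g := Real.arctan) (f := fun x => ε⁻¹ * d x)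
        (Real.differentiable_arctan _) ((h.smooth.differentiable (by simp) x).const_mul _),
        dd_const_mul, Real.deriv_arctan]
    have hz : ∀ i, ∫ x, dd (e2 i) (fun x => a x * dd (e2 i) d x) x = 0 := fun i =>
      integral_dd_eq_zero ((has.mul (h.smooth.dd _)).of_le (by simp)) ((h.supp.dd _).mul_left) _
    have hInt : ∀ i, Integrable (dd (e2 i) (fun x => a x * dd (e2 i) d x)) := fun i =>
      ((has.mul (h.smooth.dd _)).dd _).continuous.integrable_of_hasCompactSupport
        (((h.supp.dd _).mul_left).dd _)
    have hsum : ∀ x, dd (e2 0) (fun x => a x * dd (e2 0) d x) x +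
        dd (e2 1) (fun x => a x * dd (e2 1) d x) x = ε⁻¹ / (1 + (ε⁻¹ * d x) ^ 2) * gradSq d x
          + a x * (dd (e2 0) (dd (e2 0) d) x + dd (e2 1) (dd (e2 1) d) x) := fun x => by
      rw [dd_mul (has.differentiable (by simp) x) ((h.smooth.dd _).differentiable (by simp) x),
        dd_mul (has.differentiable (by simp) x) ((h.smooth.dd _).differentiable (by simp) x),
        hdd, hdd, gradSq]
      ring
    set P : Vec2 → ℝ := fun x => ε⁻¹ / (1 + (ε⁻¹ * d x) ^ 2) * gradSq d x with hP
    have hPnn : ∀ x, 0 ≤ P x := fun x => by simp only [hP, gradSq]; positivity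
    have hle : ∀ x, P x ≤ (dd (e2 0) (fun x => a x * dd (e2 0) d x) x +
        dd (e2 1) (fun x => a x * dd (e2 1) d x) x) + 2 * L x := fun x => by
      rw [hsum]
      have h1 : |a x| ≤ 2 := by
        have := Real.arctan_lt_pi_div_two (ε⁻¹ * d x)
        have := Real.neg_pi_div_two_lt_arctan (ε⁻¹ * d x)
        have := Real.pi_lt_four
        exact abs_le.2 ⟨by simp only [ha]; linarith, by simp only [ha]; linarith⟩
      have h2 : |a x * (dd (e2 0) (dd (e2 0) d) x + dd (e2 1) (dd (e2 1) d) x)| ≤ 2 * L x := by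
        rw [abs_mul]; exact mul_le_mul_of_nonneg_right h1 (abs_nonneg _)
      have := (abs_le.1 h2).1
      linarith
    have hbi : Integrable fun x => (dd (e2 0) (fun x => a x * dd (e2 0) d x) x +
        dd (e2 1) (fun x => a x * dd (e2 1) d x) x) + 2 * L x :=
      ((hInt 0).add (hInt 1)).add (hLi.const_mul 2)
    have hPc : Continuous P := by
      have hg : Continuous (gradSq d) :=
        ((h.smooth.dd _).continuous.pow 2).add ((h.smooth.dd _).continuous.pow 2)
      refine Continuous.mul (Continuous.div continuous_const (by fun_prop) fun x => ?_) hg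
      positivity
    have hPi : Integrable P := hbi.mono' hPc.aestronglyMeasurable
      (Filter.Eventually.of_forall fun x => by rw [Real.norm_of_nonneg (hPnn x)]; exact hle x)
    have h1 : ∫ x, P x ≤ 2 * ∫ x, L x := by
      refine (integral_mono hPi hbi hle).trans (le_of_eq ?_)
      have h01 : Integrable (fun x => dd (e2 0) (fun x => a x * dd (e2 0) d x) x +
        dd (e2 1) (fun x => a x * dd (e2 1) d x) x) := (hInt 0).add (hInt 1)
      rw [integral_add h01 (hLi.const_mul 2),
        integral_add (hInt 0) (hInt 1), hz, hz, integral_const_mul]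
      ring
    have hfin : volume {x | x ∈ Ω ∧ d x ≤ ε} ≠ ⊤ :=
      ((measure_mono (fun x hx => hx.1)).trans_lt h.volume_lt_top).ne
    have h2 : (4 * ε)⁻¹ * volume.real {x | x ∈ Ω ∧ d x ≤ ε} ≤ ∫ x, P x := by
      refine (setIntegral_ge_of_const_le_real (hmeas ε) hfin (fun x hx => ?_)
        hPi.integrableOn).trans (setIntegral_le_integral hPi (Filter.Eventually.of_forall hPnn))
      have hd0 := h.pos hx.1
      have hg := hlow x hx.1 (hx.2.trans hc)
      have h3 : ε⁻¹ * d x ≤ 1 := by rw [inv_mul_le_iff₀ hε]; linarith [hx.2]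
      have h4 : 0 ≤ ε⁻¹ * d x := by positivity
      have h5 : (ε⁻¹ * d x) ^ 2 ≤ 1 := by nlinarith
      calc (4 * ε)⁻¹ = ε⁻¹ / (1 + 1) * (1 / 2) := by field_simp; norm_num
        _ ≤ P x := by simp only [hP]; gcongr
    have h3 := h2.trans h1
    rw [inv_mul_le_iff₀ (by positivity)] at h3
    have : 0 ≤ V / ε0 * ε := by positivity
    nlinarith
  · have h1 : volume.real {x | x ∈ Ω ∧ d x ≤ ε} ≤ V :=
      measureReal_mono (fun x hx => hx.1) h.volume_lt_top.ne
    have h2 : V ≤ V / ε0 * ε := by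
      rw [div_mul_eq_mul_div, le_div_iff₀ hε0]
      exact mul_le_mul_of_nonneg_left (not_le.1 hc).le measureReal_nonneg
    have := mul_nonneg hLnn hε.le
    nlinarith

theorem isWeight (h : IsDefFun Ω d) (ι : Type*) : IsWeight Ω (fun _ : ι => d) :=
  ⟨h.isOpen, fun _ _ hx => h.pos hx, by
    obtain ⟨M, -, hM⟩ := h.exists_bound
    exact ⟨M, fun _ x _ => (le_abs_self _).trans (hM x)⟩⟩

theorem symb_self (h : IsDefFun Ω d) (ι : Type*) : Symb Ω (fun _ : ι => d) 1 (fun _ => d) :=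
  Symb.of_dd (fun _ => h.smooth.contDiffOn) ⟨1, fun _ x hx => by simp [abs_of_pos (h.pos hx)]⟩
    fun v => Symb.of_compactSupport (h.isWeight ι) (h.smooth.dd v) (h.supp.dd v)

/-- The cutoff vanishing in the boundary strip of width `ε / 2`. -/
noncomputable def cut (d : Vec2 → ℝ) (ε : ℝ) (x : Vec2) : ℝ := stepFun (ε⁻¹ * d x)

theorem symb_cut (h : IsDefFun Ω d) : Symb Ω (fun _ : ℝ => d) 0 (fun ε => cut d ε) :=
  Symb.scaled (h.isWeight ℝ) (h.symb_self ℝ) one_pos (fun _ x _ => by simp) (fun ε => ε⁻¹)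
    stepFun_contDiff ⟨1, fun t => abs_le.2 ⟨by linarith [stepFun_nonneg t], stepFun_le_one t⟩⟩
    hasCompactSupport_deriv_stepFun

theorem cut_contDiff (h : IsDefFun Ω d) (ε : ℝ) : ContDiff ℝ ∞ (cut d ε) :=
  stepFun_contDiff.comp (contDiff_const.mul h.smooth)

theorem cut_eq_zero {ε : ℝ} (hε : 0 < ε) {x : Vec2} (hx : d x ≤ ε / 2) : cut d ε x = 0 :=
  stepFun_eq_zero (by rw [inv_mul_le_iff₀ hε]; linarith)

theorem cut_eq_one {ε : ℝ} (hε : 0 < ε) {x : Vec2} (hx : ε ≤ d x) : cut d ε x = 1 :=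
  stepFun_eq_one (by rw [le_inv_mul_iff₀ hε]; linarith)

theorem tsupport_cut_subset (h : IsDefFun Ω d) {ε : ℝ} (hε : 0 < ε) :
    tsupport (cut d ε) ⊆ Ω := by
  have : tsupport (cut d ε) ⊆ {x | ε / 2 ≤ d x} := by
    refine closure_minimal (fun x hx => ?_) (isClosed_le continuous_const h.smooth.continuous)
    by_contra hc
    exact hx (cut_eq_zero hε (le_of_lt (not_le.1 hc)))
  exact this.trans fun x hx => (h.mem_iff x).2 (lt_of_lt_of_le (half_pos hε) hx)

theorem hasCompactSupport_cut (h : IsDefFun Ω d) {ε : ℝ} (hε : 0 < ε) :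
    HasCompactSupport (cut d ε) :=
  h.isCompact_closure.of_isClosed_subset isClosed_closure
    ((h.tsupport_cut_subset hε).trans subset_closure)

theorem symb_of_nhds (h : IsDefFun Ω d) (ι : Type*) {U : Set Vec2} (hU : IsOpen U) (hcl : closure Ω ⊆ U)
    {g : Vec2 → ℝ} (hg : ContDiffOn ℝ ∞ g U) : Symb Ω (fun _ : ι => d) 0 (fun _ => g) := by
  have hw := h.isWeight ι
  refine ⟨fun _ => hg.mono (subset_closure.trans hcl), fun J => ?_⟩
  have hb : ∀ g : Vec2 → ℝ, ContDiffOn ℝ ∞ g U → ∃ C, ∀ _ : ι, ∀ x ∈ Ω, |g x| ≤ C * d x ^ (0 : ℤ) :=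
    fun g hg => by
      obtain ⟨C, hC⟩ := h.isCompact_closure.exists_bound_of_continuousOn (hg.continuousOn.mono hcl)
      exact ⟨C, fun _ x hx => by simpa using hC x (subset_closure hx)⟩
  induction J generalizing g with
  | zero => exact hb g hg
  | succ J ih => exact ⟨hb g hg, fun v => (ih (hg.dd hU v)).mono hw⟩

theorem symb_one_of_nhds (h : IsDefFun Ω d) (ι : Type*) {U : Set Vec2} (hU : IsOpen U)
    (hcl : closure Ω ⊆ U) {g : Vec2 → ℝ} (hg : ContDiffOn ℝ ∞ g U) (h0 : ∀ x ∈ frontier Ω, g x = 0) :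
    Symb Ω (fun _ : ι => d) 1 (fun _ => g) := by
  have hg0 := h.symb_of_nhds ι hU hcl hg
  have hw := h.isWeight ι
  refine Symb.of_dd (hg0.smooth) ?_ fun v => by simpa using h.symb_of_nhds ι hU hcl (hg.dd hU v)
  obtain ⟨C, hC0, hC⟩ := h.exists_infDist_le
  obtain ⟨M, hM⟩ := h.isCompact_closure.exists_bound_of_continuousOn
    ((hg.continuousOn_fderiv_of_isOpen hU (by simp)).mono hcl)
  have hM' : ∀ y ∈ Ω, ‖fderiv ℝ g y‖ ≤ |M| := fun y hy =>
    (hM y (subset_closure hy)).trans (le_abs_self M)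
  refine ⟨|M| * C, fun _ x hx => ?_⟩
  obtain ⟨z, hz⟩ := h.exists_isNearest hx
  have := abs_sub_nearest_le (Ω := Ω) (f := g) (A := |M|) (s := 1)
    (fun y hy => hg.diffAt hU (hcl (subset_closure hy))) (hg.continuousOn.mono hcl) one_pos
    (fun y hy => by simpa using hM' y hy) hz
  rw [h0 z hz.mem, sub_zero, Real.rpow_one, div_one, ← hz.eq] at this
  rw [zpow_one, mul_assoc]
  exact this.trans (by gcongr; exact hC x hx)

theorem symb_two_of_nhds (h : IsDefFun Ω d) (ι : Type*) {U : Set Vec2} (hU : IsOpen U)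
    (hcl : closure Ω ⊆ U) {g : Vec2 → ℝ} (hg : ContDiffOn ℝ ∞ g U) (h0 : ∀ x ∈ frontier Ω, g x = 0)
    (h1 : ∀ x ∈ frontier Ω, ∀ v, dd v g x = 0) :
    Symb Ω (fun _ : ι => d) 2 (fun _ => g) := by
  have hg0 := h.symb_of_nhds ι hU hcl hg
  have hw := h.isWeight ι
  have hd1 : ∀ v, Symb Ω (fun _ : ι => d) 1 (fun _ => dd v g) := fun v =>
    h.symb_one_of_nhds ι hU hcl (hg.dd hU v) fun x hx => h1 x hx v
  refine Symb.of_dd (hg0.smooth) ?_ hd1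
  obtain ⟨C, hC0, hC⟩ := h.exists_infDist_le
  obtain ⟨Λ, hΛ, hlip⟩ := h.exists_lipschitz
  have hdi : ∀ y ∈ Ω, d y ≤ Λ * Metric.infDist y Ωᶜ := fun y hy => by
    obtain ⟨z, hz⟩ := h.exists_isNearest hy
    have := hlip y z
    rw [h.frontier_zero hz.mem, sub_zero, ← hz.eq] at this
    exact (le_abs_self _).trans this
  by_cases hι : Nonempty ι
  swap
  · exact ⟨0, fun i => (hι ⟨i⟩).elim⟩
  obtain ⟨i⟩ := hι
  obtain ⟨A, hA0, hA⟩ := (hd1 (e2 0)).bound hw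
  obtain ⟨B, hB0, hB⟩ := (hd1 (e2 1)).bound hw
  have hM' : ∀ y ∈ Ω, ‖fderiv ℝ g y‖ ≤ (A + B) * Λ * Metric.infDist y Ωᶜ ^ ((2 : ℝ) - 1) :=
    fun y hy => by
      have hA' := hA i y hy
      have hB' := hB i y hy
      rw [zpow_one] at hA' hB'
      norm_num
      calc _ ≤ _ := norm_fderiv_le g y
        _ ≤ (A + B) * d y := by linarith
        _ ≤ _ := by rw [mul_assoc]; gcongr; exact hdi y hy
  refine ⟨(A + B) * Λ / 2 * C ^ 2, fun _ x hx => ?_⟩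
  obtain ⟨z, hz⟩ := h.exists_isNearest hx
  have := abs_sub_nearest_le (Ω := Ω) (f := g) (A := (A + B) * Λ) (s := 2)
    (fun y hy => hg.diffAt hU (hcl (subset_closure hy))) (hg.continuousOn.mono hcl) two_pos
    hM' hz
  rw [h0 z hz.mem, sub_zero, ← hz.eq] at this
  refine this.trans ?_
  rw [mul_assoc, show C ^ 2 * d x ^ (2 : ℤ) = (C * d x) ^ (2 : ℝ) by
    rw [Real.rpow_two, zpow_ofNat]; ring]
  have hnn := Metric.infDist_nonneg (x := x) (s := Ωᶜ)
  gcongr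
  exact hC x hx

end IsDefFun

end Strip

/-! ### The weak form of the Stokes system -/

section Weak

variable {Ω : Set Vec2}

theorem ContDiffOn.dd_succ {V : Set Vec2} (hV : IsOpen V) {n : ℕ} {f : Vec2 → ℝ}
    (hf : ContDiffOn ℝ (n + 1 : ℕ) f V) (v : Vec2) : ContDiffOn ℝ n (_root_.dd v f) V :=
  (hf.fderiv_of_isOpen hV (m := n) (by norm_cast)).clm_apply contDiffOn_const

theorem ContDiff.dd_succ {n : ℕ} {f : Vec2 → ℝ} (hf : ContDiff ℝ (n + 1 : ℕ) f) (v : Vec2) :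
    ContDiff ℝ n (_root_.dd v f) :=
  (hf.fderiv_right (m := n) (by norm_cast)).clm_apply contDiff_const

theorem dd_comm_of_two {f : Vec2 → ℝ} {x : Vec2} (hf : ContDiffAt ℝ 2 f x) (v w : Vec2) :
    dd v (dd w f) x = dd w (dd v f) x := by
  have h2 : DifferentiableAt ℝ (fderiv ℝ f) x :=
    (hf.fderiv_right (m := 1) (by norm_num)).differentiableAt (by simp)
  have h3 : IsSymmSndFDerivAt ℝ f x := hf.isSymmSndFDerivAt (by simp)
  have h4 : ∀ a b : Vec2, dd a (dd b f) x = fderiv ℝ (fderiv ℝ f) x a b := fun a b => by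
    change fderiv ℝ (fun y => fderiv ℝ f y b) x a = _
    rw [fderiv_clm_apply h2 (differentiableAt_const _)]
    simp
  rw [h4, h4, h3.eq]

theorem ContDiffOn.mul_of_tsupport (hΩ : IsOpen Ω) {n : ℕ} {f g : Vec2 → ℝ}
    (hf : ContDiffOn ℝ n f Ω) (hg : ContDiff ℝ n g) (hs : tsupport g ⊆ Ω) :
    ContDiff ℝ n (fun x => f x * g x) :=
  contDiff_of_tsupport_subset hΩ (n := (n : ℕ∞)) (hf.mul hg.contDiffOn)
    ((tsupport_mul_subset_right (f := f) (g := g)).trans hs)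

theorem ContinuousOn.mul_of_tsupport (hΩ : IsOpen Ω) {f g : Vec2 → ℝ}
    (hf : ContinuousOn f Ω) (hg : Continuous g) (hs : tsupport g ⊆ Ω) :
    Continuous (fun x => f x * g x) := by
  have := ContDiffOn.mul_of_tsupport hΩ (n := 0) (contDiffOn_zero.2 hf) (contDiff_zero.2 hg) hs
  exact contDiff_zero.1 this

theorem ContinuousOn.integrable_mul (hΩ : IsOpen Ω) {f g : Vec2 → ℝ}
    (hf : ContinuousOn f Ω) (hg : Continuous g) (hs : tsupport g ⊆ Ω) (hc : HasCompactSupport g) :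
    Integrable (fun x => f x * g x) :=
  (hf.mul_of_tsupport hΩ hg hs).integrable_of_hasCompactSupport hc.mul_left

theorem integral_mul_dd (hΩ : IsOpen Ω) {f g : Vec2 → ℝ} (hf : ContDiffOn ℝ 1 f Ω)
    (hg : ContDiff ℝ 1 g) (hs : tsupport g ⊆ Ω) (hc : HasCompactSupport g) (v : Vec2) :
    ∫ x, f x * dd v g x = -∫ x, dd v f x * g x := by
  have h0 := integral_dd_eq_zero (hf.mul_of_tsupport hΩ hg hs) (hc.mul_left (f := f)) v
  have hs' := (tsupport_dd_subset g v).trans hs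
  have h1 : ∀ x, dd v (fun y => f y * g y) x = dd v f x * g x + f x * dd v g x := fun x => by
    by_cases hx : x ∈ Ω
    · exact dd_mul ((hf.contDiffAt (hΩ.mem_nhds hx)).differentiableAt (by simp))
        (hg.differentiable (by simp) x) v
    · have h2 : x ∉ tsupport g := fun h => hx (hs h)
      have h3 : x ∉ tsupport (fun y => f y * g y) := fun h =>
        h2 (tsupport_mul_subset_right (f := f) (g := g) h)
      rw [dd_eq_zero_of_notMem_tsupport h3, dd_eq_zero_of_notMem_tsupport h2,
        image_eq_zero_of_notMem_tsupport h2]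
      ring
  have hdf : ContinuousOn (dd v f) Ω := (hf.dd_succ hΩ (n := 0) v).continuousOn
  have hi1 : Integrable (fun x => dd v f x * g x) := hdf.integrable_mul hΩ hg.continuous hs hc
  have hi2 : Integrable (fun x => f x * dd v g x) :=
    hf.continuousOn.integrable_mul hΩ (hg.continuous_dd v) hs' (hc.dd v)
  simp only [h1] at h0
  rw [integral_add hi1 hi2] at h0
  linarith

/-- The rotated gradient, componentwise. -/
noncomputable def perp (φ : Vec2 → ℝ) : Fin 2 → Vec2 → ℝ :=
  ![fun x => -dd (e2 1) φ x, fun x => dd (e2 0) φ x]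

theorem perp_contDiff {n : ℕ} {φ : Vec2 → ℝ} (hφ : ContDiff ℝ (n + 1 : ℕ) φ) (i : Fin 2) :
    ContDiff ℝ n (perp φ i) := by
  fin_cases i
  · exact (hφ.dd_succ _).neg
  · exact hφ.dd_succ _

theorem tsupport_perp (φ : Vec2 → ℝ) (i : Fin 2) : tsupport (perp φ i) ⊆ tsupport φ := by
  fin_cases i
  · refine subset_trans ?_ (tsupport_dd_subset φ (e2 1))
    exact (tsupport_neg (dd (e2 1) φ)).subset
  · exact tsupport_dd_subset φ (e2 0)

theorem HasCompactSupport.perp {φ : Vec2 → ℝ} (h : HasCompactSupport φ) (i : Fin 2) :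
    HasCompactSupport (perp φ i) := h.mono' ((subset_tsupport _).trans (tsupport_perp φ i))

/-- The density of the pairing of the source with `∇∇^⊥φ`. -/
noncomputable def load (G : Fin 2 → Fin 2 → Vec2 → ℝ) (φ : Vec2 → ℝ) (x : Vec2) : ℝ :=
  ∑ i, ∑ j, G i j x * dd (e2 j) (perp φ i) x

/-- Scalar form of the Stokes system, with the velocity extended by zero. -/
structure ScalarStokes (Ω : Set Vec2) (G : Fin 2 → Fin 2 → Vec2 → ℝ) (U : Fin 2 → Vec2 → ℝ)
    (p : Vec2 → ℝ) : Prop where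
  smooth : ∀ i, ContDiffOn ℝ 2 (U i) Ω
  smooth_p : ContDiffOn ℝ 1 p Ω
  smooth_G : ∀ i j, ContDiffOn ℝ 1 (G i j) Ω
  eqn : ∀ i, ∀ x ∈ Ω, -(∑ j, dd (e2 j) (dd (e2 j) (U i)) x) + dd (e2 i) p x =
    ∑ j, dd (e2 j) (G i j) x
  div : ∀ x ∈ Ω, dd (e2 0) (U 0) x + dd (e2 1) (U 1) x = 0
  cont : ∀ i, Continuous (U i)
  zero : ∀ i, ∀ x ∉ Ω, U i x = 0

theorem ScalarStokes.weak {G : Fin 2 → Fin 2 → Vec2 → ℝ} {U : Fin 2 → Vec2 → ℝ} {p : Vec2 → ℝ}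
    (h : ScalarStokes Ω G U p) (hΩ : IsOpen Ω) {v : Fin 2 → Vec2 → ℝ}
    (hv : ∀ i, ContDiff ℝ 1 (v i)) (hs : ∀ i, tsupport (v i) ⊆ Ω)
    (hc : ∀ i, HasCompactSupport (v i))
    (hdiv : ∀ x, dd (e2 0) (v 0) x + dd (e2 1) (v 1) x = 0) :
    ∫ x, ∑ i, ∑ j, dd (e2 j) (U i) x * dd (e2 j) (v i) x =
      -∫ x, ∑ i, ∑ j, G i j x * dd (e2 j) (v i) x := by
  have hU1 : ∀ i j, ContDiffOn ℝ 1 (dd (e2 j) (U i)) Ω := fun i j =>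
    (h.smooth i).dd_succ hΩ (n := 1) _
  have hsd : ∀ i j, tsupport (dd (e2 j) (v i)) ⊆ Ω := fun i j => (tsupport_dd_subset _ _).trans (hs i)
  have iU : ∀ i j, Integrable (fun x => dd (e2 j) (U i) x * dd (e2 j) (v i) x) := fun i j =>
    (hU1 i j).continuousOn.integrable_mul hΩ ((hv i).continuous_dd _) (hsd i j) ((hc i).dd _)
  have iG : ∀ i j, Integrable (fun x => G i j x * dd (e2 j) (v i) x) := fun i j =>
    (h.smooth_G i j).continuousOn.integrable_mul hΩ ((hv i).continuous_dd _) (hsd i j) ((hc i).dd _)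
  have iP : ∀ i, Integrable (fun x => p x * dd (e2 i) (v i) x) := fun i =>
    h.smooth_p.continuousOn.integrable_mul hΩ ((hv i).continuous_dd _) (hsd i i) ((hc i).dd _)
  have iUU : ∀ i j, Integrable (fun x => dd (e2 j) (dd (e2 j) (U i)) x * v i x) := fun i j =>
    ((hU1 i j).dd_succ hΩ (n := 0) _).continuousOn.integrable_mul hΩ (hv i).continuous (hs i) (hc i)
  have iGG : ∀ i j, Integrable (fun x => dd (e2 j) (G i j) x * v i x) := fun i j =>
    ((h.smooth_G i j).dd_succ hΩ (n := 0) _).continuousOn.integrable_mul hΩ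
      (hv i).continuous (hs i) (hc i)
  have iPP : ∀ i, Integrable (fun x => dd (e2 i) p x * v i x) := fun i =>
    (h.smooth_p.dd_succ hΩ (n := 0) _).continuousOn.integrable_mul hΩ (hv i).continuous (hs i) (hc i)
  have e1 : ∀ i j, ∫ x, dd (e2 j) (U i) x * dd (e2 j) (v i) x
      = -∫ x, dd (e2 j) (dd (e2 j) (U i)) x * v i x := fun i j =>
    integral_mul_dd hΩ (hU1 i j) (hv i) (hs i) (hc i) _
  have e2' : ∀ i j, ∫ x, G i j x * dd (e2 j) (v i) x = -∫ x, dd (e2 j) (G i j) x * v i x :=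
    fun i j => integral_mul_dd hΩ (h.smooth_G i j) (hv i) (hs i) (hc i) _
  have e3 : ∀ i, ∫ x, p x * dd (e2 i) (v i) x = -∫ x, dd (e2 i) p x * v i x :=
    fun i => integral_mul_dd hΩ h.smooth_p (hv i) (hs i) (hc i) _
  have e4 : ∫ x, p x * dd (e2 0) (v 0) x + p x * dd (e2 1) (v 1) x = 0 := by
    rw [← integral_zero Vec2 ℝ]
    congr 1; ext x
    rw [← mul_add, hdiv, mul_zero]
  rw [integral_add (iP 0) (iP 1), e3, e3] at e4
  have e5 : ∀ i, -(∑ j, ∫ x, dd (e2 j) (dd (e2 j) (U i)) x * v i x) + ∫ x, dd (e2 i) p x * v i x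
      = ∑ j, ∫ x, dd (e2 j) (G i j) x * v i x := fun i => by
    rw [← integral_finsetSum _ (fun j _ => iUU i j), ← integral_finsetSum _ (fun j _ => iGG i j),
      ← integral_neg, ← integral_add (f := fun x => -∑ j, dd (e2 j) (dd (e2 j) (U i)) x * v i x)
        (integrable_finsetSum _ (fun j _ => iUU i j)).neg (iPP i)]
    congr 1; ext x
    by_cases hx : x ∈ Ω
    · rw [← Finset.sum_mul, ← Finset.sum_mul, ← h.eqn i x hx]; ring
    · have : v i x = 0 := image_eq_zero_of_notMem_tsupport fun h' => hx (hs i h')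
      simp [this]
  rw [integral_finsetSum _ (fun i _ => integrable_finsetSum _ (fun j _ => iU i j)),
    integral_finsetSum _ (fun i _ => integrable_finsetSum _ (fun j _ => iG i j))]
  simp only [integral_finsetSum _ (fun j _ => iU _ j), integral_finsetSum _ (fun j _ => iG _ j),
    e1, e2', Finset.sum_neg_distrib]
  have h0 := e5 0
  have h1 := e5 1
  simp only [Fin.sum_univ_two] at h0 h1 ⊢
  linarith

/-- The stream function formulation. -/
structure StreamSol (Ω : Set Vec2) (G : Fin 2 → Fin 2 → Vec2 → ℝ) (ψ : Vec2 → ℝ) : Prop where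
  contDiff : ContDiff ℝ 1 ψ
  fderiv_eq_zero : ∀ x ∉ Ω, fderiv ℝ ψ x = 0
  smooth : ContDiffOn ℝ 3 ψ Ω
  smooth_G : ∀ i j, ContDiffOn ℝ 1 (G i j) Ω
  weak_field : ∀ v : Fin 2 → Vec2 → ℝ, (∀ i, ContDiff ℝ 1 (v i)) → (∀ i, tsupport (v i) ⊆ Ω) →
    (∀ i, HasCompactSupport (v i)) → (∀ x, dd (e2 0) (v 0) x + dd (e2 1) (v 1) x = 0) →
    ∫ x, ∑ i, ∑ j, dd (e2 j) (perp ψ i) x * dd (e2 j) (v i) x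
      = -∫ x, ∑ i, ∑ j, G i j x * dd (e2 j) (v i) x

theorem StreamSol.weak {G : Fin 2 → Fin 2 → Vec2 → ℝ} {ψ : Vec2 → ℝ} (h : StreamSol Ω G ψ)
    (φ : Vec2 → ℝ) (hφ : ContDiff ℝ 3 φ) (hc : HasCompactSupport φ) (hs : tsupport φ ⊆ Ω) :
    ∫ x, ∑ i, ∑ j, dd (e2 j) (perp ψ i) x * dd (e2 j) (perp φ i) x = -∫ x, load G φ x :=
  h.weak_field (perp φ) (fun i => (perp_contDiff (n := 2) hφ i).of_le (by norm_num))
    (fun i => (tsupport_perp φ i).trans hs) (fun i => hc.perp i) (fun x => by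
      simp only [perp, Matrix.cons_val_zero, Matrix.cons_val_one]
      rw [dd_neg, dd_comm_of_two ((hφ.of_le (by norm_num)).contDiffAt)]
      simp)

theorem ScalarStokes.streamSol {G : Fin 2 → Fin 2 → Vec2 → ℝ} {U : Fin 2 → Vec2 → ℝ} {p : Vec2 → ℝ}
    (h : ScalarStokes Ω G U p) (hΩ : IsOpen Ω) {ψ : Vec2 → ℝ}
    (hψ : ∀ x, HasFDerivAt ψ (fderiv ℝ ψ x) x)
    (hp : ∀ i, perp ψ i = U i) : StreamSol Ω G ψ := by
  have h1 : ∀ x, dd (e2 1) ψ x = - U 0 x := fun x => by rw [← hp 0]; simp [perp]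
  have h0 : ∀ x, dd (e2 0) ψ x = U 1 x := fun x => by rw [← hp 1]; simp [perp]
  have hf : fderiv ℝ ψ = fun x => U 1 x • (EuclideanSpace.proj 0 : Vec2 →L[ℝ] ℝ)
      - U 0 x • (EuclideanSpace.proj 1 : Vec2 →L[ℝ] ℝ) := by
    ext x v
    rw [fderiv_apply_eq, h0, h1]
    simp; ring
  refine ⟨?_, fun x hx => ?_, ?_, h.smooth_G, fun v hv hs hc hdiv => ?_⟩
  · rw [contDiff_one_iff_fderiv]
    refine ⟨fun x => (hψ x).differentiableAt, ?_⟩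
    rw [hf]
    exact ((h.cont 1).smul continuous_const).sub ((h.cont 0).smul continuous_const)
  · rw [hf]; simp [h.zero _ x hx]
  · have : ContDiffOn ℝ (2 + 1) ψ Ω := by
      rw [contDiffOn_succ_iff_fderiv_of_isOpen hΩ]
      refine ⟨fun x _ => (hψ x).differentiableAt.differentiableWithinAt, by simp, ?_⟩
      rw [hf]
      exact ((h.smooth 1).smul contDiffOn_const).sub ((h.smooth 0).smul contDiffOn_const)
    exact this.of_le (by norm_num)
  · have := h.weak hΩ hv hs hc hdiv
    simpa only [hp] using this

/-- The Laplacian of a scalar function. -/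
noncomputable def lap (f : Vec2 → ℝ) (x : Vec2) : ℝ :=
  dd (e2 0) (dd (e2 0) f) x + dd (e2 1) (dd (e2 1) f) x

theorem integral_mul_four (hΩ : IsOpen Ω) {ψ φ : Vec2 → ℝ} (hψ : ContDiffOn ℝ 3 ψ Ω)
    (hφ : ContDiff ℝ ∞ φ) (hc : HasCompactSupport φ) (hs : tsupport φ ⊆ Ω) (v w : Vec2) :
    ∫ x, ψ x * dd v (dd v (dd w (dd w φ))) x = ∫ x, dd v (dd w ψ) x * dd v (dd w φ) x := by
  have s1 := (tsupport_dd_subset φ w).trans hs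
  have s2 := (tsupport_dd_subset (dd w φ) w).trans s1
  have s3 := (tsupport_dd_subset (dd w φ) v).trans s1
  have s4 := (tsupport_dd_subset _ v).trans s2
  have h1 : dd v (dd w (dd w φ)) = dd w (dd v (dd w φ)) := by
    ext x; exact dd_comm isOpen_univ (hφ.dd w).contDiffOn v w (mem_univ x)
  rw [integral_mul_dd hΩ (hψ.of_le (by norm_num)) ((((hφ.dd _).dd _).dd _).of_le (by simp)) s4
    (((hc.dd _).dd _).dd _), h1, integral_mul_dd hΩ
      (((hψ.of_le (by norm_num)).dd_succ hΩ (n := 1) v)) (((hφ.dd _).dd _).of_le (by simp)) s3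
    ((hc.dd _).dd _), neg_neg]
  congr 1; ext x
  by_cases hx : x ∈ Ω
  · rw [dd_comm_of_two ((hψ.contDiffAt (hΩ.mem_nhds hx)).of_le (by norm_num))]
  · have : dd v (dd w φ) x = 0 := image_eq_zero_of_notMem_tsupport fun h => hx (s3 h)
    simp [this]

theorem StreamSol.integral_lap_lap {G : Fin 2 → Fin 2 → Vec2 → ℝ} {ψ : Vec2 → ℝ}
    (h : StreamSol Ω G ψ) (hΩ : IsOpen Ω) {φ : Vec2 → ℝ} (hφ : ContDiff ℝ ∞ φ)
    (hc : HasCompactSupport φ) (hs : tsupport φ ⊆ Ω) :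
    ∫ x, ψ x * lap (lap φ) x = -∫ x, load G φ x := by
  rw [← h.weak φ (contDiff_infty.1 hφ 3) hc hs]
  have hi : ∀ v w, Integrable (fun x => ψ x * dd v (dd v (dd w (dd w φ))) x) := fun v w =>
    (h.contDiff.continuous.mul (((((hφ.dd _).dd _).dd _).dd _).continuous)).integrable_of_hasCompactSupport
      (((((hc.dd _).dd _).dd _).dd _).mul_left)
  have hj : ∀ v w, Integrable (fun x => dd v (dd w ψ) x * dd v (dd w φ) x) := fun v w =>
    (((h.smooth.dd_succ hΩ (n := 2) w).dd_succ hΩ (n := 1) v).continuousOn).integrable_mul hΩ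
      ((hφ.dd _).dd _).continuous (((tsupport_dd_subset _ _).trans (tsupport_dd_subset _ _)).trans hs)
      ((hc.dd _).dd _)
  have hl : ∀ x, ψ x * lap (lap φ) x = ψ x * dd (e2 0) (dd (e2 0) (dd (e2 0) (dd (e2 0) φ))) x
      + ψ x * dd (e2 0) (dd (e2 0) (dd (e2 1) (dd (e2 1) φ))) x
      + (ψ x * dd (e2 1) (dd (e2 1) (dd (e2 0) (dd (e2 0) φ))) x
      + ψ x * dd (e2 1) (dd (e2 1) (dd (e2 1) (dd (e2 1) φ))) x) := fun x => by
    have hh : ∀ v, dd v (dd v (lap φ)) x = dd v (dd v (dd (e2 0) (dd (e2 0) φ))) x +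
        dd v (dd v (dd (e2 1) (dd (e2 1) φ))) x := fun v => by
      have e : dd v (lap φ) = fun x => dd v (dd (e2 0) (dd (e2 0) φ)) x +
          dd v (dd (e2 1) (dd (e2 1) φ)) x := by
        ext y
        exact dd_add (((hφ.dd _).dd _).differentiable (by simp) y)
          (((hφ.dd _).dd _).differentiable (by simp) y) v
      rw [e]
      exact dd_add ((((hφ.dd _).dd _).dd _).differentiable (by simp) x)
          ((((hφ.dd _).dd _).dd _).differentiable (by simp) x) v
    rw [show lap (lap φ) x = dd (e2 0) (dd (e2 0) (lap φ)) x + dd (e2 1) (dd (e2 1) (lap φ)) x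
      from rfl, hh, hh]
    ring
  simp only [hl]
  have i1 : Integrable (fun x => ψ x * dd (e2 0) (dd (e2 0) (dd (e2 0) (dd (e2 0) φ))) x
      + ψ x * dd (e2 0) (dd (e2 0) (dd (e2 1) (dd (e2 1) φ))) x) := (hi _ _).add (hi _ _)
  have i2 : Integrable (fun x => ψ x * dd (e2 1) (dd (e2 1) (dd (e2 0) (dd (e2 0) φ))) x
      + ψ x * dd (e2 1) (dd (e2 1) (dd (e2 1) (dd (e2 1) φ))) x) := (hi _ _).add (hi _ _)
  rw [integral_add i1 i2, integral_add (hi _ _) (hi _ _), integral_add (hi _ _) (hi _ _)]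
  simp only [integral_mul_four hΩ h.smooth hφ hc hs]
  have j1 : Integrable (fun x => dd (e2 0) (dd (e2 0) ψ) x * dd (e2 0) (dd (e2 0) φ) x
      + dd (e2 0) (dd (e2 1) ψ) x * dd (e2 0) (dd (e2 1) φ) x) := (hj _ _).add (hj _ _)
  have j2 : Integrable (fun x => dd (e2 1) (dd (e2 0) ψ) x * dd (e2 1) (dd (e2 0) φ) x
      + dd (e2 1) (dd (e2 1) ψ) x * dd (e2 1) (dd (e2 1) φ) x) := (hj _ _).add (hj _ _)
  rw [← integral_add (hj _ _) (hj _ _), ← integral_add (hj _ _) (hj _ _), ← integral_add j1 j2]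
  congr 1; ext x
  simp only [Fin.sum_univ_two, perp, Matrix.cons_val_zero, Matrix.cons_val_one, dd_neg]
  ring

/-- Localised form of the right-hand side: the derivative is put on the source where `χ ≠ 0`. -/
theorem integral_load_eq (hΩ : IsOpen Ω) {G : Fin 2 → Fin 2 → Vec2 → ℝ}
    (hG : ∀ i j, ContDiffOn ℝ 1 (G i j) Ω) {φ χ : Vec2 → ℝ} (hφ : ContDiff ℝ 2 φ)
    (hc : HasCompactSupport φ) (hs : tsupport φ ⊆ Ω) (hχ : ContDiff ℝ 1 χ) :
    ∫ x, load G φ x = ∑ i, ∑ j, (∫ x, G i j x * ((1 - χ x) * dd (e2 j) (perp φ i) x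
      - dd (e2 j) χ x * perp φ i x)) - ∑ i, ∑ j, ∫ x, dd (e2 j) (G i j) x * (χ x * perp φ i x) := by
  have hp : ∀ i, ContDiff ℝ 1 (perp φ i) := fun i => perp_contDiff (n := 1) hφ i
  have hps : ∀ i, tsupport (perp φ i) ⊆ Ω := fun i => (tsupport_perp φ i).trans hs
  have hpd : ∀ i j, tsupport (dd (e2 j) (perp φ i)) ⊆ Ω := fun i j =>
    (tsupport_dd_subset _ _).trans (hps i)
  have hm : ∀ i, tsupport (fun x => χ x * perp φ i x) ⊆ Ω := fun i =>
    (tsupport_mul_subset_right (f := χ) (g := perp φ i)).trans (hps i)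
  have i0 : ∀ i j, Integrable (fun x => G i j x * dd (e2 j) (perp φ i) x) := fun i j =>
    (hG i j).continuousOn.integrable_mul hΩ ((hp i).continuous_dd _) (hpd i j) ((hc.perp i).dd _)
  have i1 : ∀ i j, Integrable (fun x => G i j x * dd (e2 j) (fun x => χ x * perp φ i x) x) :=
    fun i j => (hG i j).continuousOn.integrable_mul hΩ ((hχ.mul (hp i)).continuous_dd _)
      ((tsupport_dd_subset _ _).trans (hm i)) (((hc.perp i).mul_left).dd _)
  simp only [load]
  rw [integral_finsetSum _ (fun i _ => integrable_finsetSum _ (fun j _ => i0 i j)),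
    ← Finset.sum_sub_distrib]
  refine Finset.sum_congr rfl fun i _ => ?_
  rw [integral_finsetSum _ (fun j _ => i0 i j), ← Finset.sum_sub_distrib]
  refine Finset.sum_congr rfl fun j _ => ?_
  have e1 := integral_mul_dd hΩ (hG i j) (hχ.mul (hp i)) (hm i) ((hc.perp i).mul_left) (e2 j)
  have e2' : ∫ x, G i j x * ((1 - χ x) * dd (e2 j) (perp φ i) x - dd (e2 j) χ x * perp φ i x) =
      ∫ x, (G i j x * dd (e2 j) (perp φ i) x - G i j x * dd (e2 j) (fun x => χ x * perp φ i x) x) := by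
    congr 1; ext x
    rw [dd_mul (hχ.differentiable (by simp) x) ((hp i).differentiable (by simp) x)]
    ring
  rw [e2', integral_sub (i0 i j) (i1 i j), e1]
  ring

end Weak

/-! ### The stream function of a solenoidal field -/

section Stream

open Filter Topology

variable {Ω : Set Vec2} {d : Vec2 → ℝ}

namespace IsDefFun

/-- Integrals over the boundary strip. -/
theorem exists_integral_strip_le (h : IsDefFun Ω d) : ∃ C, 0 < C ∧ ∀ ε > 0, ∀ (g : Vec2 → ℝ) (m : ℝ), 0 ≤ m →
    (∀ x, ¬ (x ∈ Ω ∧ d x ≤ ε) → g x = 0) → (∀ x ∈ Ω, d x ≤ ε → |g x| ≤ m) →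
    |∫ x, g x| ≤ C * ε * m := by
  obtain ⟨C, hC, hs⟩ := h.exists_strip
  refine ⟨C, hC, fun ε hε g m hm0 h0 hm => ?_⟩
  have hfin : volume {x | x ∈ Ω ∧ d x ≤ ε} < ⊤ :=
    (measure_mono (fun x hx => hx.1)).trans_lt h.volume_lt_top
  have h1 : ∫ x in {x | x ∈ Ω ∧ d x ≤ ε}, g x = ∫ x, g x :=
    setIntegral_eq_integral_of_forall_compl_eq_zero fun x hx => h0 x hx
  have h2 := norm_setIntegral_le_of_norm_le_const (f := g) (C := m) hfin
    (fun x hx => hm x hx.1 hx.2)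
  rw [h1, Real.norm_eq_abs] at h2
  calc _ ≤ _ := h2
    _ ≤ m * (C * ε) := mul_le_mul_of_nonneg_left (hs ε hε) hm0
    _ = _ := by ring

/-- A continuous function vanishing on the boundary is uniformly small near the boundary. -/
theorem small_near_frontier {F : Type*} [NormedAddCommGroup F] (h : IsDefFun Ω d) {f : Vec2 → F}
    (hf : ContinuousOn f (closure Ω)) (h0 : ∀ x ∈ frontier Ω, f x = 0) {η : ℝ} (hη : 0 < η) :
    ∃ ε > 0, ∀ x ∈ Ω, d x ≤ ε → ‖f x‖ ≤ η := by
  have hu := h.isCompact_closure.uniformContinuousOn_of_continuous hf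
  obtain ⟨δ, hδ, hu⟩ := Metric.uniformContinuousOn_iff.1 hu η hη
  obtain ⟨C, hC, hinf⟩ := h.exists_infDist_le
  refine ⟨δ / (2 * C), by positivity, fun x hx hdx => ?_⟩
  obtain ⟨z, hz⟩ := h.exists_isNearest hx
  have h1 : dist x z < δ := by
    rw [dist_eq_norm, ← hz.eq]
    calc _ ≤ C * d x := hinf x hx
      _ ≤ C * (δ / (2 * C)) := by gcongr
      _ = δ / 2 := by field_simp
      _ < δ := by linarith
  have h2 := hu x (subset_closure hx) z (frontier_subset_closure hz.mem) h1
  rw [h0 z hz.mem, dist_zero_right] at h2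
  exact h2.le

theorem exists_cut_grad_le (h : IsDefFun Ω d) (v : Vec2) :
    ∃ C, 0 < C ∧ ∀ ε > 0, ∀ x, |dd v (cut d ε) x| ≤ C * ε⁻¹ := by
  obtain ⟨C, hC, hb⟩ := ((h.symb_cut).dd (h.isWeight ℝ) v).bound (h.isWeight ℝ)
  refine ⟨2 * C + 1, by positivity, fun ε hε x => ?_⟩
  by_cases hx : x ∈ Ω
  · by_cases hx2 : ε / 2 ≤ d x
    · have h1 := hb ε x hx
      have h2 : (d x)⁻¹ ≤ 2 * ε⁻¹ := by
        rw [show 2 * ε⁻¹ = (ε / 2)⁻¹ by rw [inv_div]; ring]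
        exact inv_anti₀ (by positivity) hx2
      simp only [zero_sub, zpow_neg_one] at h1
      have : 0 < ε⁻¹ := by positivity
      nlinarith
    · have hn : {y | d y < ε / 2} ∈ 𝓝 x :=
        (isOpen_lt h.smooth.continuous continuous_const).mem_nhds (not_le.1 hx2)
      have : cut d ε =ᶠ[𝓝 x] fun _ => 0 := by
        filter_upwards [hn] with y hy using cut_eq_zero hε (le_of_lt hy)
      simp only [dd, this.fderiv_eq]
      simp; positivity
  · rw [dd_eq_zero_of_notMem_tsupport fun hc => hx (h.tsupport_cut_subset hε hc)]
    simp; positivity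

theorem dd_cut_eq_zero (h : IsDefFun Ω d) (v : Vec2) {ε : ℝ} (hε : 0 < ε) {x : Vec2}
    (hx : ¬ (x ∈ Ω ∧ d x ≤ ε)) : dd v (cut d ε) x = 0 := by
  by_cases hxΩ : x ∈ Ω
  · have hn : {y | ε < d y} ∈ 𝓝 x :=
      (isOpen_lt continuous_const h.smooth.continuous).mem_nhds (not_le.1 fun hc => hx ⟨hxΩ, hc⟩)
    have : cut d ε =ᶠ[𝓝 x] fun _ => 1 := by
      filter_upwards [hn] with y hy using cut_eq_one hε (le_of_lt hy)
    simp only [dd, this.fderiv_eq]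
    simp
  · exact dd_eq_zero_of_notMem_tsupport (fun hc => hxΩ (h.tsupport_cut_subset hε hc)) v

theorem tendsto_cut_mul (h : IsDefFun Ω d) {f : Vec2 → ℝ} {x : Vec2} (h0 : x ∉ Ω → f x = 0) :
    Tendsto (fun ε => cut d ε x * f x) (𝓝[>] 0) (𝓝 (f x)) := by
  by_cases hx : x ∈ Ω
  · refine tendsto_const_nhds.congr' ?_
    have := h.pos hx
    filter_upwards [Ioo_mem_nhdsGT this] with ε hε
    rw [cut_eq_one hε.1 hε.2.le, one_mul]
  · simp [h0 hx]

theorem cut_nonneg (d : Vec2 → ℝ) (ε : ℝ) (x : Vec2) : 0 ≤ cut d ε x := stepFun_nonneg _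
theorem cut_le_one (d : Vec2 → ℝ) (ε : ℝ) (x : Vec2) : cut d ε x ≤ 1 := stepFun_le_one _

end IsDefFun

/-- The point with the given coordinates. -/
noncomputable def toVec2 : ℝ × ℝ →L[ℝ] Vec2 :=
  (ContinuousLinearMap.fst ℝ ℝ ℝ).smulRight (e2 0) + (ContinuousLinearMap.snd ℝ ℝ ℝ).smulRight (e2 1)

theorem toVec2_apply (z : ℝ × ℝ) : toVec2 z = z.1 • e2 0 + z.2 • e2 1 := by simp [toVec2]

theorem toVec2_coord (x : Vec2) : toVec2 (x 0, x 1) = x := by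
  rw [toVec2_apply]; exact (vec2_eq x).symm

theorem toVec2_zero (z : ℝ × ℝ) : toVec2 z 0 = z.1 := by simp [toVec2_apply, e2]
theorem toVec2_one (z : ℝ × ℝ) : toVec2 z 1 = z.2 := by simp [toVec2_apply, e2]

theorem measurePreserving_toVec2 : MeasurePreserving toVec2 := by
  have h1 := (volume_preserving_finTwoArrow ℝ).symm
  have h2 := PiLp.volume_preserving_toLp (Fin 2)
  have h3 := h2.comp h1
  have : (toVec2 : ℝ × ℝ → Vec2) = (WithLp.toLp 2) ∘ (MeasurableEquiv.finTwoArrow (α := ℝ)).symm := by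
    ext z i
    fin_cases i
    · exact toVec2_zero z
    · exact toVec2_one z
  rw [this]; exact h3

theorem isClosedEmbedding_toVec2 : MeasurableEmbedding toVec2 := by
  have : Function.Injective toVec2 := fun z w hzw => by
    have h0 := congrArg (fun v : Vec2 => v 0) hzw
    have h1 := congrArg (fun v : Vec2 => v 1) hzw
    simp only [toVec2_zero, toVec2_one] at h0 h1
    exact Prod.ext h0 h1
  exact toVec2.continuous.measurableEmbedding this

theorem IsDefFun.flux_eq_zero (h : IsDefFun Ω d) {U : Fin 2 → Vec2 → ℝ} (hc : ∀ i, Continuous (U i))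
    (h0 : ∀ i, ∀ x ∉ Ω, U i x = 0) (hs : ∀ i, ContDiffOn ℝ 1 (U i) Ω)
    (hdiv : ∀ x ∈ Ω, dd (e2 0) (U 0) x + dd (e2 1) (U 1) x = 0) {a b : ℝ} (hab : a ≤ b) {r s : ℝ}
    (hrs : r ≤ s) :
    (∫ σ in a..b, U 1 (toVec2 (σ, s))) - (∫ σ in a..b, U 1 (toVec2 (σ, r)))
      + (∫ τ in r..s, U 0 (toVec2 (b, τ))) - (∫ τ in r..s, U 0 (toVec2 (a, τ))) = 0 := by
  have hfr : ∀ i, ∀ x ∈ frontier Ω, U i x = 0 := fun i x hx =>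
    h0 i x (h.frontier_eq ▸ hx : x ∈ closure Ω \ Ω).2
  -- the cut-off fields
  have hV : ∀ ε > 0, ∀ i, ContDiff ℝ 1 (fun x => U i x * cut d ε x) := fun ε hε i =>
    (hs i).mul_of_tsupport h.isOpen (n := 1) ((h.cut_contDiff ε).of_le (by simp))
      (h.tsupport_cut_subset hε)
  have hdivV : ∀ ε > 0, ∀ x, dd (e2 0) (fun x => U 0 x * cut d ε x) x +
      dd (e2 1) (fun x => U 1 x * cut d ε x) x =
      U 0 x * dd (e2 0) (cut d ε) x + U 1 x * dd (e2 1) (cut d ε) x := fun ε hε x => by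
    by_cases hx : x ∈ Ω
    · have hd : ∀ i, DifferentiableAt ℝ (U i) x := fun i =>
        ((hs i).contDiffAt (h.isOpen.mem_nhds hx)).differentiableAt (by simp)
      have hcd := (h.cut_contDiff ε).differentiable (by simp) x
      rw [dd_mul (hd 0) hcd, dd_mul (hd 1) hcd]
      linear_combination (cut d ε x) * hdiv x hx
    · have h1 : x ∉ tsupport (cut d ε) := fun hh => hx (h.tsupport_cut_subset hε hh)
      have h2 : ∀ i, x ∉ tsupport (fun x => U i x * cut d ε x) := fun i hh =>
        h1 (tsupport_mul_subset_right (f := U i) (g := cut d ε) hh)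
      rw [dd_eq_zero_of_notMem_tsupport (h2 0), dd_eq_zero_of_notMem_tsupport (h2 1), h0 0 x hx,
        h0 1 x hx]
      simp
  have hflux : ∀ ε > 0, (∫ σ in a..b, U 1 (toVec2 (σ, s)) * cut d ε (toVec2 (σ, s)))
      - (∫ σ in a..b, U 1 (toVec2 (σ, r)) * cut d ε (toVec2 (σ, r)))
      + (∫ τ in r..s, U 0 (toVec2 (b, τ)) * cut d ε (toVec2 (b, τ)))
      - (∫ τ in r..s, U 0 (toVec2 (a, τ)) * cut d ε (toVec2 (a, τ))) =
      ∫ x, (toVec2 '' (Icc a b ×ˢ Icc r s)).indicator (fun x => U 0 x * dd (e2 0) (cut d ε) x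
        + U 1 x * dd (e2 1) (cut d ε) x) x := fun ε hε => by
    set V : Fin 2 → Vec2 → ℝ := fun i x => U i x * cut d ε x with hVdef
    set g : Vec2 → ℝ := fun x => U 0 x * dd (e2 0) (cut d ε) x + U 1 x * dd (e2 1) (cut d ε) x with hg
    have hgc : Continuous g := ((hc 0).mul ((h.cut_contDiff ε).dd _).continuous).add
      ((hc 1).mul ((h.cut_contDiff ε).dd _).continuous)
    have hder : ∀ i z, HasFDerivAt (fun z => V i (toVec2 z))
        ((fderiv ℝ (V i) (toVec2 z)).comp toVec2) z := fun i z =>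
      (((hV ε hε i).differentiable (by simp)) (toVec2 z)).hasFDerivAt.comp z toVec2.hasFDerivAt
    have hpt : ∀ z, ((fderiv ℝ (V 0) (toVec2 z)).comp toVec2) (1, 0) +
        ((fderiv ℝ (V 1) (toVec2 z)).comp toVec2) (0, 1) = g (toVec2 z) := fun z => by
      have := hdivV ε hε (toVec2 z)
      simpa [toVec2_apply, dd, hg, hVdef] using this
    have hcont : ∀ i, Continuous (fun z => V i (toVec2 z)) := fun i =>
      (hV ε hε i).continuous.comp toVec2.continuous
    have hgi : IntegrableOn (fun z => g (toVec2 z)) (Icc a b ×ˢ Icc r s) :=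
      (hgc.comp toVec2.continuous).continuousOn.integrableOn_compact (isCompact_Icc.prod isCompact_Icc)
    have key := integral2_divergence_prod_of_hasFDerivAt (fun z => V 0 (toVec2 z))
      (fun z => V 1 (toVec2 z)) _ _ a r b s (hcont 0).continuousOn (hcont 1).continuousOn
      (fun z _ => hder 0 z) (fun z _ => hder 1 z) (by
        simp only [hpt, uIcc_of_le hab, uIcc_of_le hrs]; exact hgi)
    simp only [hpt] at key
    rw [← key, integral_indicator (isClosedEmbedding_toVec2.measurableSet_image.2
      (measurableSet_Icc.prod measurableSet_Icc)),
      measurePreserving_toVec2.setIntegral_image_emb isClosedEmbedding_toVec2]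
    rw [intervalIntegral.integral_of_le hab]
    simp only [intervalIntegral.integral_of_le hrs]
    simp only [← integral_Icc_eq_integral_Ioc]
    exact (setIntegral_prod _ hgi).symm
  have hlim : ∀ i (c : ℝ → Vec2), Continuous c → ∀ m n : ℝ,
      Tendsto (fun ε => ∫ σ in m..n, U i (c σ) * cut d ε (c σ)) (𝓝[>] 0)
        (𝓝 (∫ σ in m..n, U i (c σ))) := fun i c hcc m n => by
    refine intervalIntegral.tendsto_integral_filter_of_dominated_convergence
      (fun σ => ‖U i (c σ)‖) ?_ ?_ ?_ ?_
    · exact Eventually.of_forall fun ε => (((hc i).comp hcc).mul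
        ((h.cut_contDiff ε).continuous.comp hcc)).aestronglyMeasurable
    · refine Eventually.of_forall fun ε => Eventually.of_forall fun σ _ => ?_
      rw [norm_mul, Real.norm_of_nonneg (IsDefFun.cut_nonneg d ε _)]
      exact mul_le_of_le_one_right (norm_nonneg _) (IsDefFun.cut_le_one d ε _)
    · exact ((hc i).comp hcc).norm.intervalIntegrable _ _
    · refine Eventually.of_forall fun σ _ => ?_
      simp only [mul_comm (U i (c σ))]
      exact h.tendsto_cut_mul (h0 i _)
  have hT := (((hlim 1 (fun σ => toVec2 (σ, s)) (by fun_prop) a b).sub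
    (hlim 1 (fun σ => toVec2 (σ, r)) (by fun_prop) a b)).add
    (hlim 0 (fun τ => toVec2 (b, τ)) (by fun_prop) r s)).sub
    (hlim 0 (fun τ => toVec2 (a, τ)) (by fun_prop) r s)
  refine tendsto_nhds_unique hT ?_
  obtain ⟨C, hC, hstrip⟩ := h.exists_integral_strip_le
  obtain ⟨C0, hC0, hb0⟩ := h.exists_cut_grad_le (e2 0)
  obtain ⟨C1, hC1, hb1⟩ := h.exists_cut_grad_le (e2 1)
  rw [Metric.tendsto_nhds]
  intro η hη
  obtain ⟨ε0, hε0, hs0⟩ := h.small_near_frontier (hc 0).continuousOn (hfr 0)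
    (η := η / (2 * (C * (C0 + C1)))) (by positivity)
  obtain ⟨ε1, hε1, hs1⟩ := h.small_near_frontier (hc 1).continuousOn (hfr 1)
    (η := η / (2 * (C * (C0 + C1)))) (by positivity)
  filter_upwards [Ioo_mem_nhdsGT hε0, Ioo_mem_nhdsGT hε1] with ε hε hε'
  rw [hflux ε hε.1, dist_zero_right, Real.norm_eq_abs]
  have hεp := hε.1
  refine (hstrip ε hε.1 _ (η / (2 * (C * (C0 + C1))) * ((C0 + C1) * ε⁻¹)) (by positivity) ?_ ?_).trans_lt ?_
  · intro x hx
    simp only [indicator, h.dd_cut_eq_zero _ hε.1 hx]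
    simp
  · intro x hx hdx
    rw [← Real.norm_eq_abs]
    refine (norm_indicator_le_norm_self _ _).trans ?_
    refine (norm_add_le _ _).trans ?_
    rw [norm_mul, norm_mul]
    have a0 := mul_le_mul (hs0 x hx (hdx.trans hε.2.le)) (hb0 ε hε.1 x) (abs_nonneg _) (by positivity)
    have a1 := mul_le_mul (hs1 x hx (hdx.trans hε'.2.le)) (hb1 ε hε.1 x) (abs_nonneg _) (by positivity)
    simp only [Real.norm_eq_abs] at a0 a1 ⊢
    linarith
  · have : C * ε * (η / (2 * (C * (C0 + C1))) * ((C0 + C1) * ε⁻¹)) = η / 2 := by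
      field_simp
    rw [this]; linarith

theorem IsDefFun.exists_stream (h : IsDefFun Ω d) {U : Fin 2 → Vec2 → ℝ} (hc : ∀ i, Continuous (U i))
    (h0 : ∀ i, ∀ x ∉ Ω, U i x = 0) (hs : ∀ i, ContDiffOn ℝ 1 (U i) Ω)
    (hdiv : ∀ x ∈ Ω, dd (e2 0) (U 0) x + dd (e2 1) (U 1) x = 0) :
    ∃ ψ : Vec2 → ℝ, (∀ x, HasFDerivAt ψ (fderiv ℝ ψ x) x) ∧ ∀ i, perp ψ i = U i := by
  obtain ⟨M, hM⟩ := h.bdd.exists_norm_le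
  set m : ℝ := -(|M| + 1) with hm
  have hbot : ∀ σ, U 1 (toVec2 (σ, m)) = 0 := fun σ => h0 1 _ fun hx => by
    have h1 := (abs_coord_le _ 1).trans (hM _ hx)
    rw [toVec2_one] at h1
    have h2 := le_abs_self M
    have h3 := neg_abs_le m
    have : |m| = |M| + 1 := by rw [hm, abs_neg, abs_of_pos (by positivity)]
    simp only at h1
    linarith
  set f : ℝ → ℝ → ℝ := fun s t => -∫ τ in m..t, U 0 (toVec2 (s, τ)) with hf
  have hfle : ∀ a b t, a ≤ b → f b t - f a t = ∫ σ in a..b, U 1 (toVec2 (σ, t)) := by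
    intro a b t hab
    rcases le_total m t with hmt | hmt
    · have := h.flux_eq_zero hc h0 hs hdiv hab hmt
      simp only [hbot, intervalIntegral.integral_zero] at this
      simp only [hf]; linarith
    · have := h.flux_eq_zero hc h0 hs hdiv hab hmt
      simp only [hbot, intervalIntegral.integral_zero] at this
      simp only [hf]
      rw [intervalIntegral.integral_symm t m, intervalIntegral.integral_symm t m]
      linarith
  have hf0 : ∀ s t, f s t = f 0 t + ∫ σ in (0)..s, U 1 (toVec2 (σ, t)) := fun s t => by
    rcases le_total 0 s with hs0 | hs0
    · have := hfle 0 s t hs0; linarith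
    · have := hfle s 0 t hs0; rw [intervalIntegral.integral_symm]; linarith
  have hd1 : ∀ s t, HasDerivAt (fun s => f s t) (U 1 (toVec2 (s, t))) s := fun s t => by
    have hcont : Continuous fun σ : ℝ => U 1 (toVec2 (σ, t)) := (hc 1).comp (by fun_prop)
    have := (hcont.integral_hasStrictDerivAt 0 s).hasDerivAt.const_add (f 0 t)
    simp only [← hf0] at this
    exact this
  have hd2 : ∀ s t, HasDerivAt (fun t => f s t) (-U 0 (toVec2 (s, t))) t := fun s t => by
    have hcont : Continuous fun τ : ℝ => U 0 (toVec2 (s, τ)) := (hc 0).comp (by fun_prop)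
    exact (hcont.integral_hasStrictDerivAt m t).hasDerivAt.neg
  have hF : ∀ z : ℝ × ℝ, HasFDerivAt (Function.uncurry f)
      ((ContinuousLinearMap.toSpanSingleton ℝ (U 1 (toVec2 z))).coprod
        (ContinuousLinearMap.toSpanSingleton ℝ (-U 0 (toVec2 z)))) z := fun z => by
    have := hasStrictFDerivAt_uncurry_coprod (𝕜 := ℝ) (u := z) (f := f)
      (f₁ := fun s t => ContinuousLinearMap.toSpanSingleton ℝ (U 1 (toVec2 (s, t))))
      (f₂ := fun s t => ContinuousLinearMap.toSpanSingleton ℝ (-U 0 (toVec2 (s, t))))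
      (Eventually.of_forall fun v => (hd1 v.1 v.2).hasFDerivAt)
      (Eventually.of_forall fun v => (hd2 v.1 v.2).hasFDerivAt)
      (by
        have : Continuous fun z : ℝ × ℝ => ContinuousLinearMap.toSpanSingleton ℝ (U 1 (toVec2 z)) :=
          (ContinuousLinearMap.toSpanSingletonCLE (𝕜 := ℝ) (E := ℝ)).continuous.comp
            ((hc 1).comp toVec2.continuous)
        exact this.continuousAt)
      (by
        have : Continuous fun z : ℝ × ℝ => ContinuousLinearMap.toSpanSingleton ℝ (-U 0 (toVec2 z)) :=
          (ContinuousLinearMap.toSpanSingletonCLE (𝕜 := ℝ) (E := ℝ)).continuous.comp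
            ((hc 0).comp toVec2.continuous).neg
        exact this.continuousAt)
    exact this.hasFDerivAt
  let P : Vec2 →L[ℝ] ℝ × ℝ :=
    (EuclideanSpace.proj 0 : Vec2 →L[ℝ] ℝ).prod (EuclideanSpace.proj 1 : Vec2 →L[ℝ] ℝ)
  have hψ : ∀ x : Vec2, HasFDerivAt (fun x : Vec2 => f (x 0) (x 1))
      (((ContinuousLinearMap.toSpanSingleton ℝ (U 1 x)).coprod
        (ContinuousLinearMap.toSpanSingleton ℝ (-U 0 x))).comp P) x := fun x => by
    have := (hF (P x)).comp x P.hasFDerivAt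
    have hx : toVec2 (P x) = x := toVec2_coord x
    rw [hx] at this
    exact this
  refine ⟨fun x => f (x 0) (x 1), fun x => (hψ x).differentiableAt.hasFDerivAt, fun i => ?_⟩
  fin_cases i
  · ext x
    show -(fderiv ℝ (fun x : Vec2 => f (x 0) (x 1)) x (e2 1)) = U 0 x
    rw [(hψ x).fderiv]
    simp [P, e2]
  · ext x
    show fderiv ℝ (fun x : Vec2 => f (x 0) (x 1)) x (e2 0) = U 1 x
    rw [(hψ x).fderiv]
    simp [P, e2]

end Stream

/-! ### Test functions vanishing to second order at the boundary -/

section Limit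

open Filter Topology

variable {Ω : Set Vec2} {d : Vec2 → ℝ}

theorem Filter.EventuallyEq.dd {E : Type*} [NormedAddCommGroup E] [NormedSpace ℝ E] {f g : E → ℝ}
    {x : E} (h : f =ᶠ[𝓝 x] g) (v : E) : dd v f =ᶠ[𝓝 x] dd v g :=
  (h.fderiv (𝕜 := ℝ)).mono fun y hy => by simp only [_root_.dd, hy]

theorem Filter.EventuallyEq.lap {f g : Vec2 → ℝ} {x : Vec2} (h : f =ᶠ[𝓝 x] g) :
    lap f =ᶠ[𝓝 x] lap g := by
  filter_upwards [(h.dd (e2 0)).dd (e2 0), (h.dd (e2 1)).dd (e2 1)] with y h0 h1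
  simp only [_root_.lap, h0, h1]

theorem lap_zero : lap (fun _ => (0 : ℝ)) = fun _ => 0 := by
  ext x
  have h : ∀ v : Vec2, dd v (fun _ => (0 : ℝ)) = fun _ => 0 := fun v => funext fun x => dd_const 0 x v
  simp only [lap, h, add_zero]

theorem Filter.EventuallyEq.perp {f g : Vec2 → ℝ} {x : Vec2} (h : f =ᶠ[𝓝 x] g) (i : Fin 2) :
    perp f i =ᶠ[𝓝 x] perp g i := by
  fin_cases i
  · exact (h.dd (e2 1)).neg
  · exact h.dd (e2 0)

theorem ContDiffOn.lap {V : Set Vec2} (hV : IsOpen V) {f : Vec2 → ℝ} (hf : ContDiffOn ℝ ∞ f V) :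
    ContDiffOn ℝ ∞ (lap f) V :=
  ((hf.dd hV _).dd hV _).add ((hf.dd hV _).dd hV _)

theorem ContDiffOn.perp {V : Set Vec2} (hV : IsOpen V) {f : Vec2 → ℝ} (hf : ContDiffOn ℝ ∞ f V)
    (i : Fin 2) : ContDiffOn ℝ ∞ (perp f i) V := by
  fin_cases i
  · exact (hf.dd hV (e2 1)).neg
  · exact hf.dd hV (e2 0)

theorem Symb.lap {V : Set Vec2} {ι : Type*} {w f : ι → Vec2 → ℝ} {k : ℤ} (hw : IsWeight V w)
    (hf : Symb V w k f) : Symb V w (k - 2) (fun i => lap (f i)) := by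
  have h := (((hf.dd hw (e2 0)).dd hw (e2 0)).add hw ((hf.dd hw (e2 1)).dd hw (e2 1)))
  rwa [show k - 1 - 1 = k - 2 by ring] at h

theorem Symb.perp {V : Set Vec2} {ι : Type*} {w f : ι → Vec2 → ℝ} {k : ℤ} (hw : IsWeight V w)
    (hf : Symb V w k f) (i : Fin 2) : Symb V w (k - 1) (fun ε => perp (f ε) i) := by
  fin_cases i
  · exact (hf.dd hw (e2 1)).neg hw
  · exact hf.dd hw (e2 0)

theorem tendsto_setIntegral_of_eventually_eq {hΩ : MeasurableSet Ω} {f g0 : Vec2 → ℝ}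
    {g : ℝ → Vec2 → ℝ} (hf : IntegrableOn f Ω) (hg : ∀ ε > 0, ContinuousOn (g ε) Ω) {C : ℝ}
    (hC : ∀ ε > 0, ∀ x ∈ Ω, |g ε x| ≤ C) (he : ∀ x ∈ Ω, ∀ᶠ ε in 𝓝[>] 0, g ε x = g0 x) :
    Tendsto (fun ε => ∫ x in Ω, f x * g ε x) (𝓝[>] 0) (𝓝 (∫ x in Ω, f x * g0 x)) := by
  refine tendsto_integral_filter_of_dominated_convergence (fun x => |f x| * C) ?_ ?_ ?_ ?_
  · filter_upwards [self_mem_nhdsWithin] with ε hε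
    exact hf.aestronglyMeasurable.mul ((hg ε hε).aestronglyMeasurable hΩ)
  · filter_upwards [self_mem_nhdsWithin] with ε hε
    filter_upwards [ae_restrict_mem hΩ] with x hx
    rw [norm_mul, Real.norm_eq_abs, Real.norm_eq_abs]
    exact mul_le_mul_of_nonneg_left (hC ε hε x hx) (abs_nonneg _)
  · exact hf.norm.mul_const C
  · filter_upwards [ae_restrict_mem hΩ] with x hx
    refine tendsto_const_nhds.congr' ?_
    filter_upwards [he x hx] with ε h
    rw [h]

namespace IsDefFun

theorem cut_eventually_eq_one (h : IsDefFun Ω d) {x : Vec2} (hx : x ∈ Ω) :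
    ∀ᶠ ε in 𝓝[>] (0 : ℝ), cut d ε =ᶠ[𝓝 x] fun _ => 1 := by
  filter_upwards [Ioo_mem_nhdsGT (h.pos hx)] with ε hε
  filter_upwards [(isOpen_lt continuous_const h.smooth.continuous).mem_nhds hε.2] with y hy
  exact cut_eq_one hε.1 (le_of_lt hy)

theorem integrableOn_of_nhds (h : IsDefFun Ω d) {U : Set Vec2} (hcl : closure Ω ⊆ U)
    {f : Vec2 → ℝ} (hf : ContinuousOn f U) : IntegrableOn f Ω :=
  ((hf.mono hcl).integrableOn_compact h.isCompact_closure).mono_set subset_closure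

end IsDefFun

theorem integral_eq_setIntegral_of_tsupport {f : Vec2 → ℝ} (hf : tsupport f ⊆ Ω) :
    ∫ x, f x = ∫ x in Ω, f x :=
  (setIntegral_eq_integral_of_forall_compl_eq_zero fun _ hx =>
    image_eq_zero_of_notMem_tsupport fun h' => hx (hf h')).symm

theorem integral_lap_lap_eq_zero {φ : Vec2 → ℝ} (hφ : ContDiff ℝ ∞ φ) (hc : HasCompactSupport φ) :
    ∫ x, lap (lap φ) x = 0 := by
  have hl : ContDiff ℝ ∞ (lap φ) := ((hφ.dd _).dd _).add ((hφ.dd _).dd _)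
  have hlc : HasCompactSupport (lap φ) := ((hc.dd _).dd _).add ((hc.dd _).dd _)
  have hi : ∀ v, Integrable (dd v (dd v (lap φ))) := fun v =>
    ((hl.dd v).dd v).continuous.integrable_of_hasCompactSupport ((hlc.dd v).dd v)
  rw [show lap (lap φ) = fun x => dd (e2 0) (dd (e2 0) (lap φ)) x + dd (e2 1) (dd (e2 1) (lap φ)) x
    from rfl, integral_add (hi _) (hi _), integral_dd_eq_zero ((hl.dd _).of_le (by simp)) (hlc.dd _),
    integral_dd_eq_zero ((hl.dd _).of_le (by simp)) (hlc.dd _), add_zero]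

/-- The localised pairing of the source with a test function. -/
noncomputable def locLoad (Ω : Set Vec2) (G : Fin 2 → Fin 2 → Vec2 → ℝ) (χ φ : Vec2 → ℝ) : ℝ :=
  ∑ i, ∑ j, (∫ x in Ω, G i j x * ((1 - χ x) * dd (e2 j) (perp φ i) x
      - dd (e2 j) χ x * perp φ i x)) - ∑ i, ∑ j, ∫ x in Ω, dd (e2 j) (G i j) x * (χ x * perp φ i x)

theorem StreamSol.integral_lap_lap_eq_locLoad {G : Fin 2 → Fin 2 → Vec2 → ℝ} {ψ : Vec2 → ℝ}
    (hS : StreamSol Ω G ψ) (h : IsDefFun Ω d)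
    (hG : ∀ i j, IntegrableOn (G i j) Ω) (hG' : ∀ i j, IntegrableOn (dd (e2 j) (G i j)) Ω)
    {U : Set Vec2} (hU : IsOpen U) (hcl : closure Ω ⊆ U) {φ χ : Vec2 → ℝ}
    (hφ : ContDiffOn ℝ ∞ φ U) (h0 : ∀ x ∈ frontier Ω, φ x = 0)
    (h1 : ∀ x ∈ frontier Ω, ∀ v, dd v φ x = 0) (hχ : ContDiff ℝ ∞ χ) {c : ℝ}
    (hψ : ∀ η > 0, ∃ ε > 0, ∀ y ∈ Ω, d y ≤ ε → |ψ y - c| ≤ η * d y ∨ φ =ᶠ[𝓝 y] fun _ => 0) :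
    ∫ x in Ω, (ψ x - c) * lap (lap φ) x = - locLoad Ω G χ φ := by
  have hm : MeasurableSet Ω := h.isOpen.measurableSet
  have hw := h.isWeight ℝ
  have hsub : Ω ⊆ U := subset_closure.trans hcl
  set Φ : ℝ → Vec2 → ℝ := fun ε x => IsDefFun.cut d ε x * φ x with hΦ
  have hsymb : Symb Ω (fun _ : ℝ => d) 2 Φ :=
    h.symb_cut.mul' hw (h.symb_two_of_nhds ℝ hU hcl hφ h0 h1) (m := 2) (by ring)
  have hts : ∀ ε > 0, tsupport (Φ ε) ⊆ Ω := fun ε hε =>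
    (tsupport_mul_subset_left (f := IsDefFun.cut d ε) (g := φ)).trans (IsDefFun.tsupport_cut_subset h hε)
  have hcs : ∀ ε > 0, HasCompactSupport (Φ ε) := fun ε hε =>
    (IsDefFun.hasCompactSupport_cut h hε).mul_right
  have hΦs : ∀ ε > 0, ContDiff ℝ ∞ (Φ ε) := fun ε hε =>
    contDiff_of_tsupport_subset h.isOpen (hsymb.smooth ε) (hts ε hε)
  have hev : ∀ x ∈ Ω, ∀ᶠ ε in 𝓝[>] (0 : ℝ), Φ ε =ᶠ[𝓝 x] φ := fun x hx => by
    filter_upwards [h.cut_eventually_eq_one hx] with ε hε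
    filter_upwards [hε] with y hy
    simp [hΦ, hy]
  obtain ⟨M, hM, hdM⟩ := h.exists_bound
  -- convergence of the source terms
  have hR : Tendsto (fun ε => locLoad Ω G χ (Φ ε)) (𝓝[>] 0) (𝓝 (locLoad Ω G χ φ)) := by
    have hp : ∀ i, ∃ C, ∀ ε > 0, ∀ x ∈ Ω, |perp (Φ ε) i x| ≤ C := fun i => by
      obtain ⟨C, hC, hb⟩ := (hsymb.perp hw i).bound hw
      refine ⟨C * M, fun ε _ x hx => (hb ε x hx).trans ?_⟩
      rw [show (2 : ℤ) - 1 = 1 by norm_num, zpow_one]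
      exact mul_le_mul_of_nonneg_left ((le_abs_self _).trans (hdM x)) hC
    have hdp : ∀ i j, ∃ C, ∀ ε > 0, ∀ x ∈ Ω, |dd (e2 j) (perp (Φ ε) i) x| ≤ C := fun i j => by
      obtain ⟨C, hC, hb⟩ := ((hsymb.perp hw i).dd hw (e2 j)).bound hw
      exact ⟨C, fun ε _ x hx => by simpa using hb ε x hx⟩
    have hχb : ∀ f : Vec2 → ℝ, Continuous f → ∃ C, 0 ≤ C ∧ ∀ x ∈ Ω, |f x| ≤ C := fun f hf => by
      obtain ⟨C, hC⟩ := h.isCompact_closure.exists_bound_of_continuousOn hf.continuousOn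
      exact ⟨|C|, abs_nonneg _, fun x hx => (hC x (subset_closure hx)).trans (le_abs_self C)⟩
    obtain ⟨Cχ, hCχ, hbχ⟩ := hχb χ hχ.continuous
    obtain ⟨Cm, hCm, hbm⟩ := hχb (fun x => 1 - χ x) (continuous_const.sub hχ.continuous)
    refine Tendsto.sub (tendsto_finsetSum _ fun i _ => tendsto_finsetSum _ fun j _ => ?_)
      (tendsto_finsetSum _ fun i _ => tendsto_finsetSum _ fun j _ => ?_)
    · obtain ⟨C1, hb1⟩ := hp i
      obtain ⟨C2, hb2⟩ := hdp i j
      obtain ⟨Cd, hCd, hbd⟩ := hχb (dd (e2 j) χ) (hχ.dd _).continuous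
      refine tendsto_setIntegral_of_eventually_eq (hΩ := hm) (hG i j) (C := Cm * C2 + Cd * C1)
        (fun ε hε => ?_) (fun ε hε x hx => ?_) (fun x hx => ?_)
      · have := (((hΦs ε hε).contDiffOn (s := univ)).perp isOpen_univ i)
        have h2 := (this.dd isOpen_univ (e2 j)).continuousOn.mono (subset_univ Ω)
        have h3 := this.continuousOn.mono (subset_univ Ω)
        exact ((continuous_const.sub hχ.continuous).continuousOn.mul h2).sub
          ((hχ.dd _).continuous.continuousOn.mul h3)
      · refine (abs_sub _ _).trans ?_
        rw [abs_mul, abs_mul]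
        exact add_le_add (mul_le_mul (hbm x hx) (hb2 ε hε x hx) (abs_nonneg _) hCm)
          (mul_le_mul (hbd x hx) (hb1 ε hε x hx) (abs_nonneg _) hCd)
      · filter_upwards [hev x hx] with ε hε
        rw [((hε.perp i).dd (e2 j)).eq_of_nhds, (hε.perp i).eq_of_nhds]
    · obtain ⟨C1, hb1⟩ := hp i
      refine tendsto_setIntegral_of_eventually_eq (hΩ := hm) (hG' i j) (C := Cχ * C1)
        (fun ε hε => ?_) (fun ε hε x hx => ?_) (fun x hx => ?_)
      · have := (((hΦs ε hε).contDiffOn (s := univ)).perp isOpen_univ i)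
        exact hχ.continuous.continuousOn.mul (this.continuousOn.mono (subset_univ Ω))
      · rw [abs_mul]
        exact mul_le_mul (hbχ x hx) (hb1 ε hε x hx) (abs_nonneg _) hCχ
      · filter_upwards [hev x hx] with ε hε
        rw [(hε.perp i).eq_of_nhds]
  -- the identity for the truncated test functions
  have hlam : ∀ ε > 0, tsupport (lap (lap (Φ ε))) ⊆ Ω := fun ε hε => by
    have ht : ∀ f : Vec2 → ℝ, tsupport (lap f) ⊆ tsupport f := fun f =>
      (tsupport_add _ _).trans (union_subset
        ((tsupport_dd_subset _ _).trans (tsupport_dd_subset _ _))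
        ((tsupport_dd_subset _ _).trans (tsupport_dd_subset _ _)))
    exact ((ht _).trans (ht _)).trans (hts ε hε)
  have hΦl : ∀ ε > 0, ContDiff ℝ ∞ (lap (lap (Φ ε))) := fun ε hε =>
    contDiffOn_univ.1 ((((hΦs ε hε).contDiffOn (s := univ)).lap isOpen_univ).lap isOpen_univ)
  have hΦc : ∀ ε > 0, HasCompactSupport (lap (lap (Φ ε))) := fun ε hε =>
    h.isCompact_closure.of_isClosed_subset isClosed_closure ((hlam ε hε).trans subset_closure)
  have hid : ∀ ε > 0, ∫ x in Ω, (ψ x - c) * lap (lap (Φ ε)) x = -locLoad Ω G χ (Φ ε) := fun ε hε => by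
    have hi1 : Integrable (fun x => ψ x * lap (lap (Φ ε)) x) :=
      (hS.contDiff.continuous.mul (hΦl ε hε).continuous).integrable_of_hasCompactSupport
        (hΦc ε hε).mul_left
    have hi2 : Integrable (fun x => c * lap (lap (Φ ε)) x) :=
      ((hΦl ε hε).continuous.integrable_of_hasCompactSupport (hΦc ε hε)).const_mul c
    rw [← integral_eq_setIntegral_of_tsupport ((tsupport_mul_subset_right
      (f := fun x => ψ x - c) (g := lap (lap (Φ ε)))).trans (hlam ε hε))]
    simp only [sub_mul]
    rw [integral_sub hi1 hi2, integral_const_mul, integral_lap_lap_eq_zero (hΦs ε hε) (hcs ε hε),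
      mul_zero, sub_zero, hS.integral_lap_lap h.isOpen (hΦs ε hε) (hcs ε hε) (hts ε hε),
      integral_load_eq h.isOpen hS.smooth_G (contDiff_infty.1 (hΦs ε hε) 2) (hcs ε hε) (hts ε hε)
        (contDiff_infty.1 hχ 1)]
    have hpt : ∀ i, tsupport (perp (Φ ε) i) ⊆ Ω := fun i => (tsupport_perp _ i).trans (hts ε hε)
    have hz : ∀ i, ∀ x ∉ Ω, perp (Φ ε) i x = 0 := fun i x hx =>
      image_eq_zero_of_notMem_tsupport fun h' => hx (hpt i h')
    have hz' : ∀ i j, ∀ x ∉ Ω, dd (e2 j) (perp (Φ ε) i) x = 0 := fun i j x hx =>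
      image_eq_zero_of_notMem_tsupport fun h' => hx (hpt i (tsupport_dd_subset _ _ h'))
    congr 1
    simp only [locLoad]
    congr 1
    · refine Finset.sum_congr rfl fun i _ => Finset.sum_congr rfl fun j _ =>
        (setIntegral_eq_integral_of_forall_compl_eq_zero fun x hx => ?_).symm
      rw [hz i x hx, hz' i j x hx]; ring
    · refine Finset.sum_congr rfl fun i _ => Finset.sum_congr rfl fun j _ =>
        (setIntegral_eq_integral_of_forall_compl_eq_zero fun x hx => ?_).symm
      rw [hz i x hx]; ring
  -- convergence of the left-hand side
  have hφl : ContDiffOn ℝ ∞ (lap (lap φ)) U := (hφ.lap hU).lap hU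
  have hψc : ∀ c, Continuous fun x => ψ x - c := fun c => hS.contDiff.continuous.sub continuous_const
  have hL : Tendsto (fun ε => ∫ x in Ω, (ψ x - c) * lap (lap (Φ ε)) x) (𝓝[>] 0)
      (𝓝 (∫ x in Ω, (ψ x - c) * lap (lap φ) x)) := by
    obtain ⟨C, hC, hstrip⟩ := h.exists_integral_strip_le
    obtain ⟨A, hA, hbA⟩ := ((hsymb.lap hw).lap hw).bound hw
    obtain ⟨B, hB⟩ := h.isCompact_closure.exists_bound_of_continuousOn
      (hφl.continuousOn.mono hcl)
    have hB' : ∀ x ∈ Ω, |lap (lap φ) x| ≤ |B| := fun x hx =>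
      (hB x (subset_closure hx)).trans (le_abs_self _)
    rw [Metric.tendsto_nhds]
    intro η hη
    set κ : ℝ := η / (2 * C * (2 * A + |B| + 1)) with hκ
    have hκ0 : 0 < κ := by positivity
    obtain ⟨ε0, hε0, hs⟩ := hψ κ hκ0
    filter_upwards [Ioo_mem_nhdsGT hε0, Ioo_mem_nhdsGT one_pos] with ε hε hε1
    have hεp : 0 < ε := hε.1
    have hI1 : IntegrableOn (fun x => (ψ x - c) * lap (lap (Φ ε)) x) Ω :=
      (((hψc c).mul (hΦl ε hε.1).continuous).integrable_of_hasCompactSupport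
        (hΦc ε hε.1).mul_left).integrableOn
    have hI2 : IntegrableOn (fun x => (ψ x - c) * lap (lap φ) x) Ω :=
      h.integrableOn_of_nhds hcl ((hψc c).continuousOn.mul hφl.continuousOn)
    rw [dist_eq_norm, ← integral_sub hI1 hI2, Real.norm_eq_abs, ← integral_indicator hm]
    refine (hstrip ε hε.1 _ (κ * ((2 * A + |B|) * ε⁻¹)) (by positivity) ?_ ?_).trans_lt ?_
    · intro x hx
      by_cases hxΩ : x ∈ Ω
      · have hdx : ε < d x := not_le.1 fun h' => hx ⟨hxΩ, h'⟩
        have : Φ ε =ᶠ[𝓝 x] φ := by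
          filter_upwards [(isOpen_lt continuous_const h.smooth.continuous).mem_nhds hdx] with y hy
          simp [hΦ, IsDefFun.cut_eq_one hε.1 (le_of_lt hy)]
        rw [indicator_of_mem hxΩ, this.lap.lap.eq_of_nhds, sub_self]
      · exact indicator_of_notMem hxΩ _
    · intro x hx hdx
      rw [indicator_of_mem hx, ← mul_sub]
      have hdp := h.pos hx
      rcases hs x hx (hdx.trans hε.2.le) with hc' | hc'
      · have hAx : |lap (lap (Φ ε)) x| * d x ≤ 2 * A * ε⁻¹ := by
          rcases lt_or_ge (d x) (ε / 2) with hlt | hge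
          · have : Φ ε =ᶠ[𝓝 x] fun _ => 0 := by
              filter_upwards [(isOpen_lt h.smooth.continuous continuous_const).mem_nhds hlt] with y hy
              simp [hΦ, IsDefFun.cut_eq_zero hε.1 (le_of_lt hy)]
            rw [this.lap.lap.eq_of_nhds]
            rw [lap_zero, lap_zero, abs_zero, zero_mul]
            positivity
          · have h2 := hbA ε x hx
            rw [show (2 : ℤ) - 2 - 2 = -2 by norm_num] at h2
            calc _ ≤ A * d x ^ (-2 : ℤ) * d x := by gcongr
              _ = A * (d x)⁻¹ := by
                rw [zpow_neg]; field_simp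
              _ ≤ A * (ε / 2)⁻¹ := by gcongr
              _ = _ := by field_simp
        have hBx : |lap (lap φ) x| * d x ≤ |B| * ε⁻¹ := by
          refine mul_le_mul (hB' x hx) ?_ hdp.le (abs_nonneg _)
          refine hdx.trans (hε1.2.le.trans ?_)
          exact (one_le_inv₀ hε.1).2 hε1.2.le
        rw [abs_mul]
        calc _ ≤ κ * d x * (|lap (lap (Φ ε)) x| + |lap (lap φ) x|) :=
              mul_le_mul hc' (abs_sub _ _) (abs_nonneg _) (by positivity)
          _ = κ * (|lap (lap (Φ ε)) x| * d x + |lap (lap φ) x| * d x) := by ring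
          _ ≤ κ * (2 * A * ε⁻¹ + |B| * ε⁻¹) := by gcongr
          _ = _ := by ring
      · have e1 : Φ ε =ᶠ[𝓝 x] φ := by
          filter_upwards [hc'] with y hy
          simp [hΦ, hy]
        rw [e1.lap.lap.eq_of_nhds, sub_self, mul_zero, abs_zero]
        positivity
    · have : C * ε * (κ * ((2 * A + |B|) * ε⁻¹)) = η * ((2 * A + |B|) / (2 * (2 * A + |B| + 1))) := by
        rw [hκ]; field_simp
      rw [this]
      refine mul_lt_of_lt_one_right hη ?_
      rw [div_lt_one (by positivity)]
      linarith [abs_nonneg B]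
  refine tendsto_nhds_unique hL ?_
  refine hR.neg.congr' ?_
  filter_upwards [self_mem_nhdsWithin] with ε hε
  exact (hid ε hε).symm

end Limit

/-! ### Calculus on the product space -/

section Product

variable {E ι : Type*} [NormedAddCommGroup E] [NormedSpace ℝ E]

theorem Symb.of_contDiff [FiniteDimensional ℝ E] {V : Set E} {w : ι → E → ℝ} (hw : IsWeight V w)
    (hV : Bornology.IsBounded V) {g : E → ℝ} (hg : ContDiff ℝ ∞ g) : Symb V w 0 (fun _ => g) := by
  obtain ⟨r, hr0, hr⟩ : ∃ r : ℝ, 0 < r ∧ V ⊆ Metric.closedBall 0 r := by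
    obtain ⟨r, hr⟩ := hV.subset_closedBall 0
    exact ⟨max r 1, by positivity, hr.trans (Metric.closedBall_subset_closedBall (le_max_left _ _))⟩
  let χ : ContDiffBump (0 : E) := ⟨r, r + 1, hr0, by linarith⟩
  have h1 : ContDiff ℝ ∞ (fun x => χ x * g x) := χ.contDiff.mul hg
  have h2 : HasCompactSupport (fun x => χ x * g x) := χ.hasCompactSupport.mul_right
  refine (Symb.of_compactSupport hw h1 h2).congr hw fun _ x hx => ?_
  rw [χ.one_of_mem_closedBall (hr hx), one_mul]

theorem SymbN.change {V V' : Set E} {w w' : ι → E → ℝ} (hw : IsWeight V w) (hw' : IsWeight V' w')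
    (hV : V' ⊆ V) (hww : ∀ i, ∀ x ∈ V', w' i x ≤ w i x) {J : ℕ} {k : ℤ} (hk : k ≤ 0) {f : ι → E → ℝ}
    (hf : SymbN V w J k f) : SymbN V' w' J k f := by
  have key : ∀ (J : ℕ) (k : ℤ) (f : ι → E → ℝ), k ≤ 0 → SymbN V w J k f →
      ∃ C, ∀ i, ∀ x ∈ V', |f i x| ≤ C * w' i x ^ k := fun J k f hk hf => by
    obtain ⟨C, hC, hb⟩ := hf.bound
    refine ⟨C, fun i x hx => (hb i x (hV hx)).trans ?_⟩
    have h1 := hw.pos i x (hV hx)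
    have h2 := hw'.pos i x hx
    rw [abs_of_pos (zpow_pos h1 _)]
    refine mul_le_mul_of_nonneg_left ?_ hC
    obtain ⟨n, rfl⟩ : ∃ n : ℕ, k = -n := ⟨k.natAbs, by omega⟩
    rw [zpow_neg, zpow_neg, zpow_natCast, zpow_natCast]
    exact inv_anti₀ (pow_pos h2 _) (pow_le_pow_left₀ h2.le (hww i x hx) _)
  induction J generalizing k f with
  | zero => exact key 0 k f hk hf
  | succ J ih => exact ⟨key _ k f hk hf, fun v => ih (by omega) (hf.2 v)⟩

/-- Symbols of nonpositive order remain symbols for a smaller weight. -/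
theorem Symb.change {V V' : Set E} {w w' : ι → E → ℝ} {k : ℤ} {f : ι → E → ℝ} (hf : Symb V w k f)
    (hw : IsWeight V w) (hw' : IsWeight V' w') (hV : V' ⊆ V)
    (hww : ∀ i, ∀ x ∈ V', w' i x ≤ w i x) (hk : k ≤ 0) : Symb V' w' k f :=
  ⟨fun i => (hf.smooth i).mono hV, fun J => (hf.symbN J).change hw hw' hV hww hk⟩

/-- `f` is differentiable on `V` and its derivative in direction `v` is `f'`. -/
def HasDD (V : Set E) (v : E) (f f' : E → ℝ) : Prop :=
  ∀ x ∈ V, DifferentiableAt ℝ f x ∧ dd v f x = f' x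

namespace HasDD

variable {V : Set E} {v : E} {f f' g g' : E → ℝ}

theorem add (hf : HasDD V v f f') (hg : HasDD V v g g') :
    HasDD V v (fun x => f x + g x) (fun x => f' x + g' x) := fun x hx =>
  ⟨(hf x hx).1.add (hg x hx).1, by rw [dd_add (hf x hx).1 (hg x hx).1, (hf x hx).2, (hg x hx).2]⟩

theorem sub (hf : HasDD V v f f') (hg : HasDD V v g g') :
    HasDD V v (fun x => f x - g x) (fun x => f' x - g' x) := fun x hx =>
  ⟨(hf x hx).1.sub (hg x hx).1, by rw [dd_sub (hf x hx).1 (hg x hx).1, (hf x hx).2, (hg x hx).2]⟩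

theorem mul (hf : HasDD V v f f') (hg : HasDD V v g g') :
    HasDD V v (fun x => f x * g x) (fun x => f' x * g x + f x * g' x) := fun x hx =>
  ⟨(hf x hx).1.mul (hg x hx).1, by rw [dd_mul (hf x hx).1 (hg x hx).1, (hf x hx).2, (hg x hx).2]⟩

theorem const (c : ℝ) : HasDD V v (fun _ => c) (fun _ => 0) := fun x _ =>
  ⟨differentiableAt_const _, dd_const c x v⟩

theorem const_mul (c : ℝ) (hf : HasDD V v f f') :
    HasDD V v (fun x => c * f x) (fun x => c * f' x) := fun x hx =>
  ⟨(hf x hx).1.const_mul c, by rw [dd_const_mul, (hf x hx).2]⟩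

theorem inv (hf : HasDD V v f f') (h0 : ∀ x ∈ V, f x ≠ 0) :
    HasDD V v (fun x => (f x)⁻¹) (fun x => - f' x * ((f x)⁻¹ * (f x)⁻¹)) := fun x hx =>
  ⟨(hf x hx).1.inv (h0 x hx), by rw [dd_inv (hf x hx).1 (h0 x hx), (hf x hx).2]⟩

theorem log (hf : HasDD V v f f') (h0 : ∀ x ∈ V, f x ≠ 0) :
    HasDD V v (fun x => Real.log (f x)) (fun x => f' x * (f x)⁻¹) := fun x hx =>
  ⟨(hf x hx).1.log (h0 x hx), by rw [dd_log (hf x hx).1 (h0 x hx), (hf x hx).2]⟩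

theorem congr_right (hf : HasDD V v f f') (h : EqOn f' g' V) : HasDD V v f g' := fun x hx =>
  ⟨(hf x hx).1, (hf x hx).2.trans (h hx)⟩

theorem eqOn (hf : HasDD V v f f') : EqOn (dd v f) f' V := fun x hx => (hf x hx).2

theorem eqOn_dd (hV : IsOpen V) {u : E} (hf : HasDD V v f f') (hg : HasDD V u f' g') :
    EqOn (dd u (dd v f)) g' V := fun x hx =>
  (dd_congr_of_isOpen hV hf.eqOn u hx).trans (hg x hx).2

theorem of_contDiffOn (hV : IsOpen V) (hf : ContDiffOn ℝ ∞ f V) : HasDD V v f (dd v f) :=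
  fun _ hx => ⟨hf.diffAt hV hx, rfl⟩

end HasDD

theorem dd_comp_fst {f : Vec2 → ℝ} {z : Vec2 × Vec2} (hf : DifferentiableAt ℝ f z.1)
    (u : Vec2 × Vec2) : dd u (fun z => f z.1) z = dd u.1 f z.1 := by
  have := hf.hasFDerivAt.comp z (hasFDerivAt_fst (p := z) (𝕜 := ℝ) (E := Vec2) (F := Vec2))
  simp only [dd]
  rw [show (fun z : Vec2 × Vec2 => f z.1) = f ∘ Prod.fst from rfl, this.fderiv]
  rfl

theorem dd_comp_snd {f : Vec2 → ℝ} {z : Vec2 × Vec2} (hf : DifferentiableAt ℝ f z.2)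
    (u : Vec2 × Vec2) : dd u (fun z => f z.2) z = dd u.2 f z.2 := by
  have := hf.hasFDerivAt.comp z (hasFDerivAt_snd (p := z) (𝕜 := ℝ) (E := Vec2) (F := Vec2))
  simp only [dd]
  rw [show (fun z : Vec2 × Vec2 => f z.2) = f ∘ Prod.snd from rfl, this.fderiv]
  rfl

theorem dd_comp_diff {f : Vec2 → ℝ} {z : Vec2 × Vec2} (hf : DifferentiableAt ℝ f (z.2 - z.1))
    (u : Vec2 × Vec2) : dd u (fun z => f (z.2 - z.1)) z = dd (u.2 - u.1) f (z.2 - z.1) := by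
  have := hf.hasFDerivAt.comp z ((hasFDerivAt_snd (p := z) (𝕜 := ℝ) (E := Vec2) (F := Vec2)).sub
    (hasFDerivAt_fst (p := z) (𝕜 := ℝ) (E := Vec2) (F := Vec2)))
  simp only [dd]
  rw [show (fun z : Vec2 × Vec2 => f (z.2 - z.1)) = f ∘ (Prod.snd - Prod.fst) from rfl, this.fderiv]
  rfl

/-- Derivatives of a slice. -/
theorem dd_slice {f : Vec2 × Vec2 → ℝ} {x y : Vec2} (hf : DifferentiableAt ℝ f (x, y)) (v : Vec2) :
    dd v (fun y => f (x, y)) y = dd (0, v) f (x, y) := by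
  have := hf.hasFDerivAt.comp y (hasFDerivAt_prodMk_right (𝕜 := ℝ) x y)
  simp only [dd]
  rw [show (fun y => f (x, y)) = f ∘ (fun y => (x, y)) from rfl, this.fderiv]
  rfl

theorem dd_slice_left {f : Vec2 × Vec2 → ℝ} {x y : Vec2} (hf : DifferentiableAt ℝ f (x, y))
    (v : Vec2) : dd v (fun x => f (x, y)) x = dd (v, 0) f (x, y) := by
  have := hf.hasFDerivAt.comp x (hasFDerivAt_prodMk_left (𝕜 := ℝ) x y)
  simp only [dd]
  rw [show (fun x => f (x, y)) = f ∘ (fun x => (x, y)) from rfl, this.fderiv]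
  rfl

/-- The Laplacian in the second variable. -/
noncomputable def lapY (f : Vec2 × Vec2 → ℝ) (z : Vec2 × Vec2) : ℝ :=
  dd (0, e2 0) (dd (0, e2 0) f) z + dd (0, e2 1) (dd (0, e2 1) f) z

variable {V : Set (Vec2 × Vec2)} {f g : Vec2 × Vec2 → ℝ}

theorem ContDiffOn.lapY (hV : IsOpen V) (hf : ContDiffOn ℝ ∞ f V) : ContDiffOn ℝ ∞ (lapY f) V :=
  ((hf.dd hV _).dd hV _).add ((hf.dd hV _).dd hV _)

theorem lapY_congr (hV : IsOpen V) (h : EqOn f g V) : EqOn (lapY f) (lapY g) V := fun z hz => by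
  simp only [lapY]
  rw [dd_congr_of_isOpen hV (dd_congr_of_isOpen hV h _) _ hz,
    dd_congr_of_isOpen hV (dd_congr_of_isOpen hV h _) _ hz]

theorem lapY_add (hV : IsOpen V) (hf : ContDiffOn ℝ ∞ f V) (hg : ContDiffOn ℝ ∞ g V) :
    EqOn (lapY fun z => f z + g z) (fun z => lapY f z + lapY g z) V := fun z hz => by
  have h : ∀ v, EqOn (dd v fun z => f z + g z) (fun z => dd v f z + dd v g z) V := fun v z hz =>
    dd_add (hf.diffAt hV hz) (hg.diffAt hV hz) v
  simp only [lapY]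
  rw [dd_congr_of_isOpen hV (h _) _ hz, dd_congr_of_isOpen hV (h _) _ hz,
    dd_add ((hf.dd hV _).diffAt hV hz) ((hg.dd hV _).diffAt hV hz),
    dd_add ((hf.dd hV _).diffAt hV hz) ((hg.dd hV _).diffAt hV hz)]
  ring

theorem lapY_dd_comm (hV : IsOpen V) (hf : ContDiffOn ℝ ∞ f V) (u : Vec2 × Vec2) :
    EqOn (lapY (dd u f)) (dd u (lapY f)) V := fun z hz => by
  have h : ∀ v, dd v (dd v (dd u f)) z = dd u (dd v (dd v f)) z := fun v => by
    rw [dd_congr_of_isOpen hV (dd_comm hV hf v u) v hz, dd_comm hV (hf.dd hV v) v u hz]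
  have h2 : dd u (lapY f) z = dd u (dd (0, e2 0) (dd (0, e2 0) f)) z
      + dd u (dd (0, e2 1) (dd (0, e2 1) f)) z :=
    dd_add (((hf.dd hV _).dd hV _).diffAt hV hz) (((hf.dd hV _).dd hV _).diffAt hV hz) u
  rw [h2, ← h, ← h]
  rfl

theorem Symb.lapY {w f : ι → Vec2 × Vec2 → ℝ} {k : ℤ} (hw : IsWeight V w)
    (hf : Symb V w k f) : Symb V w (k - 2) (fun i => lapY (f i)) := by
  have h := (((hf.dd hw (0, e2 0)).dd hw (0, e2 0)).add hw ((hf.dd hw (0, e2 1)).dd hw (0, e2 1)))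
  rwa [show k - 1 - 1 = k - 2 by ring] at h

theorem isOpen_slice (hV : IsOpen V) (x : Vec2) : IsOpen {y | (x, y) ∈ V} :=
  hV.preimage (by fun_prop)

theorem ContDiffOn.slice (hf : ContDiffOn ℝ ∞ f V) (x : Vec2) :
    ContDiffOn ℝ ∞ (fun y => f (x, y)) {y | (x, y) ∈ V} :=
  hf.comp (by fun_prop) fun _ hy => hy

theorem dd_slice_eqOn (hV : IsOpen V) (hf : ContDiffOn ℝ ∞ f V) (x v : Vec2) :
    EqOn (dd v fun y => f (x, y)) (fun y => dd (0, v) f (x, y)) {y | (x, y) ∈ V} := fun _ hy =>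
  dd_slice (hf.diffAt hV hy) v

theorem dd_dd_slice_eqOn (hV : IsOpen V) (hf : ContDiffOn ℝ ∞ f V) (x u v : Vec2) :
    EqOn (dd u (dd v fun y => f (x, y))) (fun y => dd (0, u) (dd (0, v) f) (x, y))
      {y | (x, y) ∈ V} := fun _ hy =>
  (dd_congr_of_isOpen (isOpen_slice hV x) (dd_slice_eqOn hV hf x v) u hy).trans
    (dd_slice_eqOn hV (hf.dd hV _) x u hy)

theorem lap_slice_eqOn (hV : IsOpen V) (hf : ContDiffOn ℝ ∞ f V) (x : Vec2) :
    EqOn (lap fun y => f (x, y)) (fun y => lapY f (x, y)) {y | (x, y) ∈ V} := fun y hy => by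
  simp only [lap, lapY]
  rw [dd_dd_slice_eqOn hV hf x _ _ hy, dd_dd_slice_eqOn hV hf x _ _ hy]

theorem lap_congr_of_isOpen {V : Set Vec2} (hV : IsOpen V) {f g : Vec2 → ℝ} (h : EqOn f g V) :
    EqOn (lap f) (lap g) V := fun z hz => by
  simp only [lap]
  rw [dd_congr_of_isOpen hV (dd_congr_of_isOpen hV h _) _ hz,
    dd_congr_of_isOpen hV (dd_congr_of_isOpen hV h _) _ hz]

theorem lap_lap_slice_eqOn (hV : IsOpen V) (hf : ContDiffOn ℝ ∞ f V) (x : Vec2) :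
    EqOn (lap (lap fun y => f (x, y))) (fun y => lapY (lapY f) (x, y)) {y | (x, y) ∈ V} :=
  fun _ hy => (lap_congr_of_isOpen (isOpen_slice hV x) (lap_slice_eqOn hV hf x) hy).trans
    (lap_slice_eqOn hV (hf.lapY hV) x hy)

end Product

/-! ### The kernel -/

section Kernel

/-- The coordinates of `y - x`. -/
noncomputable def kX (i : Fin 2) (z : Vec2 × Vec2) : ℝ := z.2 i - z.1 i

/-- The squared distance. -/
noncomputable def kS (z : Vec2 × Vec2) : ℝ := kX 0 z * kX 0 z + kX 1 z * kX 1 z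

/-- The boundary part of the squared reflected distance. -/
noncomputable def kB (d : Vec2 → ℝ) (z : Vec2 × Vec2) : ℝ := 4 * (d z.1 * d z.2)

/-- The squared distance to the reflected point, up to a factor. -/
noncomputable def kR (d : Vec2 → ℝ) (z : Vec2 × Vec2) : ℝ := kS z + kB d z

/-- The reflected part of the kernel. -/
noncomputable def kT (d : Vec2 → ℝ) (z : Vec2 × Vec2) : ℝ := kS z * Real.log (kR d z)

/-- The Taylor remainder of the defining function. -/
noncomputable def kTau (d : Vec2 → ℝ) (z : Vec2 × Vec2) : ℝ :=
  d z.1 - d z.2 + (dd (e2 0) d z.2 * kX 0 z + dd (e2 1) d z.2 * kX 1 z)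

/-- The deviation of the squared gradient from one. -/
noncomputable def kE (d : Vec2 → ℝ) (z : Vec2 × Vec2) : ℝ :=
  dd (e2 0) d z.2 * dd (e2 0) d z.2 + dd (e2 1) d z.2 * dd (e2 1) d z.2 - 1

noncomputable def kE1 (d : Vec2 → ℝ) (z : Vec2 × Vec2) : ℝ :=
  16 * (d z.1 * kTau d z) + 16 * (d z.1 * d z.1 * kE d z)

noncomputable def kE2 (d : Vec2 → ℝ) (z : Vec2 × Vec2) : ℝ := 4 * (d z.1 * lap d z.2)

noncomputable def kE3 (d : Vec2 → ℝ) (z : Vec2 × Vec2) : ℝ :=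
  8 * (d z.1 * kTau d z) + 16 * (d z.1 * d z.1 * kE d z)

noncomputable def kQ (d : Vec2 → ℝ) (z : Vec2 × Vec2) : ℝ :=
  16 * (d z.1 * d z.2) + 16 * (d z.1 * d z.1)

noncomputable def kG (d : Vec2 → ℝ) (z : Vec2 × Vec2) : ℝ :=
  16 * (d z.1 * kTau d z * (kR d z)⁻¹) + kS z * kE2 d z * (kR d z)⁻¹
    - kS z * kE1 d z * ((kR d z)⁻¹ * (kR d z)⁻¹)

variable {d : Vec2 → ℝ} {V : Set (Vec2 × Vec2)}

theorem contDiff_kX (i : Fin 2) : ContDiff ℝ ∞ (kX i) := by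
  unfold kX
  have h : ContDiff ℝ ∞ (fun y : Vec2 => y i) := (EuclideanSpace.proj i : Vec2 →L[ℝ] ℝ).contDiff
  exact (h.comp contDiff_snd).sub (h.comp contDiff_fst)

theorem dd_coord (i : Fin 2) (v x : Vec2) : dd v (fun y : Vec2 => y i) x = v i := by
  have : HasFDerivAt (fun y : Vec2 => y i) (EuclideanSpace.proj i : Vec2 →L[ℝ] ℝ) x :=
    (EuclideanSpace.proj i : Vec2 →L[ℝ] ℝ).hasFDerivAt
  simp only [dd, this.fderiv]
  rfl

theorem dd_kX (i : Fin 2) (u z : Vec2 × Vec2) : dd u (kX i) z = u.2 i - u.1 i := by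
  have h : DifferentiableAt ℝ (fun y : Vec2 => y i) (z.2 - z.1) :=
    (EuclideanSpace.proj i : Vec2 →L[ℝ] ℝ).differentiableAt
  exact (dd_comp_diff h u).trans (dd_coord i _ _)

theorem hasDD_kX (i : Fin 2) (u : Vec2 × Vec2) : HasDD V u (kX i) (fun _ => u.2 i - u.1 i) :=
  fun z _ => ⟨(contDiff_kX i).differentiable (by simp) z, dd_kX i u z⟩

theorem hasDD_fst {f : Vec2 → ℝ} (hf : ContDiff ℝ ∞ f) (v : Vec2) :
    HasDD V (0, v) (fun z => f z.1) (fun _ => 0) := fun z _ =>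
  ⟨(hf.comp contDiff_fst).differentiable (by simp) z, by
    rw [dd_comp_fst (hf.differentiable (by simp) _)]; simp [dd]⟩

theorem hasDD_snd {f : Vec2 → ℝ} (hf : ContDiff ℝ ∞ f) (v : Vec2) :
    HasDD V (0, v) (fun z => f z.2) (fun z => dd v f z.2) := fun z _ =>
  ⟨(hf.comp contDiff_snd).differentiable (by simp) z, dd_comp_snd (hf.differentiable (by simp) _) _⟩

theorem kS_eq (z : Vec2 × Vec2) : kS z = ‖z.2 - z.1‖ ^ 2 := by
  rw [EuclideanSpace.norm_eq, Real.sq_sqrt (by positivity)]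
  simp [kS, kX, Fin.sum_univ_two, pow_two]

theorem contDiff_kS : ContDiff ℝ ∞ kS :=
  ((contDiff_kX 0).mul (contDiff_kX 0)).add ((contDiff_kX 1).mul (contDiff_kX 1))

theorem contDiff_kB (hd : ContDiff ℝ ∞ d) : ContDiff ℝ ∞ (kB d) :=
  contDiff_const.mul ((hd.comp contDiff_fst).mul (hd.comp contDiff_snd))

theorem contDiff_kR (hd : ContDiff ℝ ∞ d) : ContDiff ℝ ∞ (kR d) := contDiff_kS.add (contDiff_kB hd)

theorem contDiffOn_log_kR (hd : ContDiff ℝ ∞ d) (hV : ∀ z ∈ V, 0 < kR d z) :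
    ContDiffOn ℝ ∞ (fun z => Real.log (kR d z)) V :=
  (contDiff_kR hd).contDiffOn.log fun z hz => (hV z hz).ne'

theorem contDiffOn_kT (hd : ContDiff ℝ ∞ d) (hV : ∀ z ∈ V, 0 < kR d z) : ContDiffOn ℝ ∞ (kT d) V :=
  contDiff_kS.contDiffOn.mul (contDiffOn_log_kR hd hV)

theorem hasDD_kS (j : Fin 2) : HasDD V (0, e2 j) kS (fun z => 2 * kX j z) :=
  (((hasDD_kX 0 _).mul (hasDD_kX 0 _)).add ((hasDD_kX 1 _).mul (hasDD_kX 1 _))).congr_right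
    fun z _ => by fin_cases j <;> simp [e2] <;> ring

theorem hasDD_kR (hd : ContDiff ℝ ∞ d) (j : Fin 2) : HasDD V (0, e2 j) (kR d)
    (fun z => 2 * kX j z + 4 * (d z.1 * dd (e2 j) d z.2)) :=
  ((hasDD_kS j).add (((hasDD_fst hd _).mul (hasDD_snd hd _)).const_mul 4)).congr_right
    fun z _ => by simp

theorem hasDD_kR' (hd : ContDiff ℝ ∞ d) (j : Fin 2) : HasDD V (0, e2 j)
    (fun z => 2 * kX j z + 4 * (d z.1 * dd (e2 j) d z.2))
    (fun z => 2 + 4 * (d z.1 * dd (e2 j) (dd (e2 j) d) z.2)) :=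
  (((hasDD_kX j _).const_mul 2).add
    (((hasDD_fst hd _).mul (hasDD_snd (hd.dd _) _)).const_mul 4)).congr_right
    fun z _ => by simp [e2]

theorem lapY_kT (hd : ContDiff ℝ ∞ d) (hVo : IsOpen V) (hV : ∀ z ∈ V, 0 < kR d z) :
    EqOn (lapY (kT d)) (fun z => 4 * Real.log (kR d z) + 8 - kQ d z * (kR d z)⁻¹ + kG d z) V := by
  have h0 : ∀ z ∈ V, kR d z ≠ 0 := fun z hz => (hV z hz).ne'
  have key : ∀ j : Fin 2, EqOn (dd (0, e2 j) (dd (0, e2 j) (kT d))) (fun z =>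
      2 * Real.log (kR d z) + 4 * kX j z * ((2 * kX j z + 4 * (d z.1 * dd (e2 j) d z.2)) * (kR d z)⁻¹)
      + kS z * ((2 + 4 * (d z.1 * dd (e2 j) (dd (e2 j) d) z.2)) * (kR d z)⁻¹
      - (2 * kX j z + 4 * (d z.1 * dd (e2 j) d z.2)) ^ 2 * ((kR d z)⁻¹ * (kR d z)⁻¹))) V := by
    intro j z hz
    have hL := (hasDD_kR hd j).log h0
    have h1 := (hasDD_kS (V := V) j).mul hL
    have h2 := (((hasDD_kX (V := V) j (0, e2 j)).const_mul 2).mul hL).add ((hasDD_kS (V := V) j).mul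
      ((hasDD_kR' (V := V) hd j).mul ((hasDD_kR hd j).inv h0)))
    refine (h1.eqOn_dd hVo h2 hz).trans ?_
    simp only [e2, PiLp.single_apply, EuclideanSpace.single, if_true, PiLp.zero_apply]
    ring
  intro z hz
  have hPR : (kR d z)⁻¹ * kR d z = 1 := inv_mul_cancel₀ (h0 z hz)
  simp only [lapY]
  rw [key 0 hz, key 1 hz]
  simp only [kG, kQ, kE2, kE1, kTau, kE, lap]
  generalize (kR d z)⁻¹ = P at *
  simp only [kR, kB, kS] at hPR ⊢
  generalize Real.log _ = L
  linear_combination (8 - 4 * (kX 0 z * kX 0 z + kX 1 z * kX 1 z) * P) * hPR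

theorem lapY_main (hd : ContDiff ℝ ∞ d) (hVo : IsOpen V) (hV : ∀ z ∈ V, 0 < kR d z) :
    EqOn (lapY fun z => 4 * Real.log (kR d z) + 8 - kQ d z * (kR d z)⁻¹)
      (fun z => -4 * (kE1 d z * ((kR d z)⁻¹ * (kR d z)⁻¹)) + 8 * (kE3 d z * ((kR d z)⁻¹ * (kR d z)⁻¹))
        + kQ d z * kE2 d z * ((kR d z)⁻¹ * (kR d z)⁻¹)
        - 2 * (kQ d z * kE1 d z * ((kR d z)⁻¹ * (kR d z)⁻¹ * (kR d z)⁻¹))) V := by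
  have h0 : ∀ z ∈ V, kR d z ≠ 0 := fun z hz => (hV z hz).ne'
  have hQ : ∀ j, HasDD V (0, e2 j) (kQ d) (fun z => 16 * (d z.1 * dd (e2 j) d z.2)) := fun j =>
    ((((hasDD_fst hd _).mul (hasDD_snd hd _)).const_mul 16).add
      (((hasDD_fst hd _).mul (hasDD_fst hd _)).const_mul 16)).congr_right fun z _ => by simp
  have hQ' : ∀ j, HasDD V (0, e2 j) (fun z => 16 * (d z.1 * dd (e2 j) d z.2))
      (fun z => 16 * (d z.1 * dd (e2 j) (dd (e2 j) d) z.2)) := fun j =>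
    (((hasDD_fst hd _).mul (hasDD_snd (hd.dd _) _)).const_mul 16).congr_right fun z _ => by simp
  have key : ∀ j : Fin 2, EqOn (dd (0, e2 j) (dd (0, e2 j)
      fun z => 4 * Real.log (kR d z) + 8 - kQ d z * (kR d z)⁻¹)) (fun z =>
      4 * ((2 + 4 * (d z.1 * dd (e2 j) (dd (e2 j) d) z.2)) * (kR d z)⁻¹
      - (2 * kX j z + 4 * (d z.1 * dd (e2 j) d z.2)) ^ 2 * ((kR d z)⁻¹ * (kR d z)⁻¹))
      - (16 * (d z.1 * dd (e2 j) (dd (e2 j) d) z.2) * (kR d z)⁻¹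
        - 2 * (16 * (d z.1 * dd (e2 j) d z.2)) * (2 * kX j z + 4 * (d z.1 * dd (e2 j) d z.2))
          * ((kR d z)⁻¹ * (kR d z)⁻¹)
        - kQ d z * (2 + 4 * (d z.1 * dd (e2 j) (dd (e2 j) d) z.2)) * ((kR d z)⁻¹ * (kR d z)⁻¹)
        + 2 * kQ d z * (2 * kX j z + 4 * (d z.1 * dd (e2 j) d z.2)) ^ 2
          * ((kR d z)⁻¹ * (kR d z)⁻¹ * (kR d z)⁻¹))) V := by
    intro j z hz
    have hR := hasDD_kR (V := V) hd j
    have hR' := hasDD_kR' (V := V) hd j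
    have hI := hR.inv h0
    have h1 := (((hR.log h0).const_mul 4).add (HasDD.const 8)).sub ((hQ j).mul hI)
    have h2 := (((hR'.mul hI).const_mul 4).add (HasDD.const 0)).sub (((hQ' j).mul hI).add
      ((hQ j).mul (((HasDD.const (V := V) (v := (0, e2 j)) 0).sub hR').mul (hI.mul hI))))
    have h1' := h1.congr_right (g' := fun z => 4 * ((2 * kX j z + 4 * (d z.1 * dd (e2 j) d z.2)) *
      (kR d z)⁻¹) + 0 - (16 * (d z.1 * dd (e2 j) d z.2) * (kR d z)⁻¹ + kQ d z * ((0 -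
      (2 * kX j z + 4 * (d z.1 * dd (e2 j) d z.2))) * ((kR d z)⁻¹ * (kR d z)⁻¹))))
      fun z _ => by simp only; ring
    refine (h1'.eqOn_dd hVo h2 hz).trans ?_
    ring
  intro z hz
  have hPR : (kR d z)⁻¹ * kR d z = 1 := inv_mul_cancel₀ (h0 z hz)
  simp only [lapY]
  rw [key 0 hz, key 1 hz]
  simp only [kQ, kE3, kE2, kE1, kTau, kE, lap]
  generalize (kR d z)⁻¹ = P at *
  simp only [kR, kB, kS] at hPR ⊢
  linear_combination (-16 * P - 8 * (16 * (d z.1 * d z.2) + 16 * (d z.1 * d z.1)) * P ^ 2) * hPR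

end Kernel

/-! ### Symbol estimates for the kernel -/

section KernelSymb

theorem Symb.quad {E ι : Type*} [NormedAddCommGroup E] [NormedSpace ℝ E] {V : Set E}
    {w l : ι → E → ℝ} (hw : IsWeight V w) {q : E → ℝ} (hq : Symb V w 2 (fun _ => q))
    (hq2 : ∀ u v, ∃ c, ∀ x, _root_.dd u (_root_.dd v q) x = c) (hl : Symb V w (-1) l)
    (hl' : ∀ v, Symb V w (-1) (fun i => _root_.dd v (l i))) :
    (∀ u v, Symb V w (-1) (fun i => _root_.dd u (_root_.dd v fun x => q x * l i x))) ∧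
    ∀ t u v, Symb V w (-1)
      (fun i => _root_.dd t (_root_.dd u (_root_.dd v fun x => q x * l i x))) := by
  have hd := fun (f : ι → E → ℝ) (k : ℤ) (hf : Symb V w k f) (i : ι) (x : E) (hx : x ∈ V) =>
    (hf.smooth i).diffAt hw.isOpen hx
  have main : ∀ u v, ∃ c : ℝ, ∃ r : ι → E → ℝ, Symb V w 0 r ∧ ∀ i,
      EqOn (_root_.dd u (_root_.dd v fun x => q x * l i x)) (fun x => c * l i x + r i x) V := by
    intro u v
    obtain ⟨c, hc⟩ := hq2 u v
    have hqv := hq.dd hw v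
    have hqu := hq.dd hw u
    refine ⟨c, fun i x => _root_.dd v q x * _root_.dd u (l i) x + _root_.dd u q x * _root_.dd v (l i) x
      + q x * _root_.dd u (_root_.dd v (l i)) x, ?_, fun i x hx => ?_⟩
    · exact ((hqv.mul' hw (hl' u) (by norm_num)).add hw (hqu.mul' hw (hl' v) (by norm_num))).add hw
        (hq.mul' hw ((hl' v).dd hw u) (by norm_num))
    · have h1 : EqOn (_root_.dd v fun x => q x * l i x)
          (fun x => _root_.dd v q x * l i x + q x * _root_.dd v (l i) x) V := fun x hx =>
        dd_mul (hd _ _ hq i x hx) (hd _ _ hl i x hx) v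
      rw [dd_congr_of_isOpen hw.isOpen h1 u hx,
        dd_add (f := fun x => _root_.dd v q x * l i x) (g := fun x => q x * _root_.dd v (l i) x)
          ((hd _ _ hqv i x hx).mul (hd _ _ hl i x hx))
          ((hd _ _ hq i x hx).mul (hd _ _ (hl' v) i x hx)),
        dd_mul (hd _ _ hqv i x hx) (hd _ _ hl i x hx),
        dd_mul (hd _ _ hq i x hx) (hd _ _ (hl' v) i x hx), hc]
      ring
  refine ⟨fun u v => ?_, fun t u v => ?_⟩
  · obtain ⟨c, r, hr, he⟩ := main u v
    exact ((hl.const_mul hw c).add hw (hr.mono hw (by norm_num))).congr hw he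
  · obtain ⟨c, r, hr, he⟩ := main u v
    refine (((hl' t).const_mul hw c).add hw (hr.dd hw t)).congr hw fun i x hx => ?_
    rw [dd_congr_of_isOpen hw.isOpen (he i) t hx,
      dd_add (f := fun x => c * l i x) ((hd _ _ hl i x hx).const_mul c) (hd _ _ hr i x hx),
      dd_const_mul]

theorem kS_nonneg (z : Vec2 × Vec2) : 0 ≤ kS z := by rw [kS_eq]; positivity

theorem abs_kX_le (i : Fin 2) (z : Vec2 × Vec2) : |kX i z| ≤ ‖z.2 - z.1‖ := by
  have := abs_coord_le (z.2 - z.1) i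
  simpa [kX] using this

theorem dd_dd_kS (u v : Vec2 × Vec2) : ∃ c, ∀ z, dd u (dd v kS) z = c := by
  have h := fun i (u : Vec2 × Vec2) => hasDD_kX (V := univ) i u
  have h1 := ((h 0 v).mul (h 0 v)).add ((h 1 v).mul (h 1 v))
  have h2 := (((HasDD.const (V := univ) (v := u) (v.2 0 - v.1 0)).mul (h 0 u)).add ((h 0 u).mul
    (HasDD.const (v.2 0 - v.1 0)))).add (((HasDD.const (v.2 1 - v.1 1)).mul (h 1 u)).add
    ((h 1 u).mul (HasDD.const (v.2 1 - v.1 1))))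
  exact ⟨2 * ((v.2 0 - v.1 0) * (u.2 0 - u.1 0) + (v.2 1 - v.1 1) * (u.2 1 - u.1 1)),
    fun z => (h1.eqOn_dd isOpen_univ h2 (mem_univ z)).trans (by ring)⟩

namespace IsDefFun

variable {Ω : Set Vec2} {d : Vec2 → ℝ}

theorem kR_pos (h : IsDefFun Ω d) {x y : Vec2} (hx : x ∈ Ω) (hy : y ∈ closure Ω) : 0 < kR d (x, y) := by
  have h1 := h.pos hx
  have h2 := h.nonneg_of_closure hy
  rcases eq_or_ne y x with rfl | hne
  · have : 0 < kB d (y, y) := by simp only [kB]; positivity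
    exact add_pos_of_nonneg_of_pos (kS_nonneg _) this
  · have : 0 < kS (x, y) := by
      rw [kS_eq]; have := norm_pos_iff.2 (sub_ne_zero.2 hne); positivity
    have h3 : 0 ≤ kB d (x, y) := by simp only [kB]; positivity
    exact add_pos_of_pos_of_nonneg this h3

theorem kS_le_kR (h : IsDefFun Ω d) {z : Vec2 × Vec2} (hz : z ∈ Ω ×ˢ Ω) : kS z ≤ kR d z := by
  have h1 := h.pos hz.1
  have h2 := h.pos hz.2
  have h3 : 0 ≤ kB d z := by simp only [kB]; positivity
  simp only [kR]; linarith

/-- The weight of the reflected kernel. -/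
theorem isWeight_kR (h : IsDefFun Ω d) (ι : Type*) : IsWeight (Ω ×ˢ Ω) (fun (_ : ι) z => √(kR d z)) := by
  refine ⟨h.isOpen.prod h.isOpen, fun _ z hz => Real.sqrt_pos.2 (h.kR_pos hz.1 (subset_closure hz.2)), ?_⟩
  obtain ⟨M, hM⟩ := (h.isCompact_closure.prod h.isCompact_closure).exists_bound_of_continuousOn
    (f := fun z => √(kR d z)) (contDiff_kR h.smooth).continuous.sqrt.continuousOn
  exact ⟨M, fun _ z hz => (le_abs_self _).trans (hM z ⟨subset_closure hz.1, subset_closure hz.2⟩)⟩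

theorem norm_le_sqrt_kR (h : IsDefFun Ω d) {z : Vec2 × Vec2} (hz : z ∈ Ω ×ˢ Ω) : ‖z.2 - z.1‖ ≤ √(kR d z) := by
  apply Real.le_sqrt_of_sq_le
  rw [← kS_eq]
  exact h.kS_le_kR hz

theorem exists_sq_le_kR (h : IsDefFun Ω d) : ∃ C, 0 < C ∧ ∀ z ∈ Ω ×ˢ Ω, d z.1 ≤ C * √(kR d z) ∧ d z.2 ≤ C * √(kR d z) := by
  obtain ⟨Λ, hΛ, hlip⟩ := h.exists_lipschitz
  refine ⟨1 + Λ, by positivity, fun z hz => ?_⟩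
  have h1 := h.pos hz.1
  have h2 := h.pos hz.2
  have h3 := abs_le.1 (hlip z.2 z.1)
  have hr := h.norm_le_sqrt_kR hz
  have h4 : 2 * min (d z.1) (d z.2) ≤ √(kR d z) := by
    apply Real.le_sqrt_of_sq_le
    have : (2 * min (d z.1) (d z.2)) ^ 2 ≤ 4 * (d z.1 * d z.2) := by
      rw [mul_pow, pow_two (min _ _)]
      have := mul_le_mul (min_le_left (d z.1) (d z.2)) (min_le_right (d z.1) (d z.2))
        (le_min h1.le h2.le) h1.le
      linarith
    refine this.trans ?_
    simp only [kR, kB]; linarith [kS_nonneg z]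
  have h5 : Λ * ‖z.2 - z.1‖ ≤ Λ * √(kR d z) := by gcongr
  have h6 := le_min h1.le h2.le
  rcases le_total (d z.1) (d z.2) with hle | hle
  · rw [min_eq_left hle] at h4 h6; constructor <;> linarith
  · rw [min_eq_right hle] at h4 h6; constructor <;> linarith

theorem symb_smooth (h : IsDefFun Ω d) (ι : Type*) {g : Vec2 × Vec2 → ℝ} (hg : ContDiff ℝ ∞ g) :
    Symb (Ω ×ˢ Ω) (fun (_ : ι) z => √(kR d z)) 0 (fun _ => g) :=
  Symb.of_contDiff (h.isWeight_kR ι) (h.bdd.prod h.bdd) hg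

theorem symb_one_kR (h : IsDefFun Ω d) (ι : Type*) {g : Vec2 × Vec2 → ℝ} (hg : ContDiff ℝ ∞ g)
    (hb : ∃ C, ∀ z ∈ Ω ×ˢ Ω, |g z| ≤ C * √(kR d z)) :
    Symb (Ω ×ˢ Ω) (fun (_ : ι) z => √(kR d z)) 1 (fun _ => g) := by
  obtain ⟨C, hC⟩ := hb
  exact Symb.of_dd (fun _ => hg.contDiffOn) ⟨C, fun _ z hz => by simpa using hC z hz⟩
    fun v => h.symb_smooth ι (hg.dd v)

theorem symb_kX (h : IsDefFun Ω d) (ι : Type*) (i : Fin 2) :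
    Symb (Ω ×ˢ Ω) (fun (_ : ι) z => √(kR d z)) 1 (fun _ => kX i) :=
  h.symb_one_kR ι (contDiff_kX i) ⟨1, fun z hz => by
    rw [one_mul]; exact (abs_kX_le i z).trans (h.norm_le_sqrt_kR hz)⟩

theorem symb_fst (h : IsDefFun Ω d) (ι : Type*) :
    Symb (Ω ×ˢ Ω) (fun (_ : ι) z => √(kR d z)) 1 (fun _ z => d z.1) := by
  obtain ⟨C, -, hC⟩ := h.exists_sq_le_kR
  exact h.symb_one_kR ι (h.smooth.comp contDiff_fst) ⟨C, fun z hz => by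
    rw [abs_of_pos (h.pos hz.1)]; exact (hC z hz).1⟩

theorem symb_snd (h : IsDefFun Ω d) (ι : Type*) :
    Symb (Ω ×ˢ Ω) (fun (_ : ι) z => √(kR d z)) 1 (fun _ z => d z.2) := by
  obtain ⟨C, -, hC⟩ := h.exists_sq_le_kR
  exact h.symb_one_kR ι (h.smooth.comp contDiff_snd) ⟨C, fun z hz => by
    rw [abs_of_pos (h.pos hz.2)]; exact (hC z hz).2⟩

theorem symb_kS (h : IsDefFun Ω d) (ι : Type*) : Symb (Ω ×ˢ Ω) (fun (_ : ι) z => √(kR d z)) 2 (fun _ => kS) := by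
  have hw := h.isWeight_kR ι
  exact ((h.symb_kX ι 0).mul' hw (h.symb_kX ι 0) (by norm_num)).add hw
    ((h.symb_kX ι 1).mul' hw (h.symb_kX ι 1) (by norm_num))

theorem symb_kR (h : IsDefFun Ω d) (ι : Type*) : Symb (Ω ×ˢ Ω) (fun (_ : ι) z => √(kR d z)) 2 (fun _ => kR d) := by
  have hw := h.isWeight_kR ι
  exact (h.symb_kS ι).add hw
    (((h.symb_fst ι).mul' hw (h.symb_snd ι) (by norm_num)).const_mul hw 4)

theorem kR_lower (h : IsDefFun Ω d) (ι : Type*) : ∀ (_ : ι), ∀ z ∈ Ω ×ˢ Ω, 1 * √(kR d z) ^ (2 : ℤ) ≤ kR d z :=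
  fun _ z hz => by
    have := (h.kR_pos hz.1 (subset_closure hz.2)).le
    rw [one_mul]; exact_mod_cast (Real.sq_sqrt this).le

theorem symb_inv_kR (h : IsDefFun Ω d) (ι : Type*) :
    Symb (Ω ×ˢ Ω) (fun (_ : ι) z => √(kR d z)) (-2) (fun _ z => (kR d z)⁻¹) :=
  (h.symb_kR ι).inv (h.isWeight_kR ι) one_pos (h.kR_lower ι)

theorem symb_log_kR (h : IsDefFun Ω d) (ι : Type*) :
    Symb (Ω ×ˢ Ω) (fun (_ : ι) z => √(kR d z)) (-1) (fun _ z => Real.log (kR d z)) ∧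
    ∀ v, Symb (Ω ×ˢ Ω) (fun (_ : ι) z => √(kR d z)) (-1)
      (fun _ => dd v fun z => Real.log (kR d z)) := by
  have hw := h.isWeight_kR ι
  refine (h.symb_kR ι).log hw one_pos (h.kR_lower ι) ?_
  obtain ⟨M, hM⟩ := (h.isWeight_kR Unit).bdd
  refine ⟨2 * (1 + M ^ 2), fun _ z hz => ?_⟩
  have hp : 0 < √(kR d z) := (h.isWeight_kR Unit).pos () z hz
  have hMz : √(kR d z) ≤ M := hM () z hz
  have hR := (h.kR_pos hz.1 (subset_closure hz.2))
  change |Real.log (kR d z)| ≤ _ * √(kR d z) ^ (-1 : ℤ)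
  set w := √(kR d z) with hwd
  have hsq : kR d z = w ^ 2 := (Real.sq_sqrt hR.le).symm
  rw [hsq, Real.log_pow, zpow_neg_one]
  have h1 : |Real.log w| ≤ (1 + M ^ 2) * w⁻¹ := by
    have e1 := Real.log_le_sub_one_of_pos hp
    have e2 := Real.log_le_sub_one_of_pos (inv_pos.2 hp)
    rw [Real.log_inv] at e2
    have hi := inv_pos.2 hp
    have hwM : w ≤ M ^ 2 * w⁻¹ := by
      rw [← div_eq_mul_inv, le_div_iff₀ hp]; nlinarith
    rw [abs_le]; constructor <;> nlinarith [sq_nonneg M]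
  push_cast
  rw [abs_mul, abs_two]
  linarith

theorem symb_kTau (h : IsDefFun Ω d) (ι : Type*) : Symb (Ω ×ˢ Ω) (fun (_ : ι) z => √(kR d z)) 2 (fun _ => kTau d) := by
  have hw := h.isWeight_kR ι
  obtain ⟨Λ, hΛ, hlip⟩ := h.exists_grad_lipschitz
  have hs1 : ContDiff ℝ ∞ (fun z : Vec2 × Vec2 => d z.1) := h.smooth.comp contDiff_fst
  have hs2 : ContDiff ℝ ∞ (fun z : Vec2 × Vec2 => d z.2) := h.smooth.comp contDiff_snd
  have hb : ∀ i, ContDiff ℝ ∞ (fun z : Vec2 × Vec2 => dd (e2 i) d z.2) := fun i =>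
    (h.smooth.dd _).comp contDiff_snd
  have hsm : ContDiff ℝ ∞ (kTau d) :=
    (hs1.sub hs2).add (((hb 0).mul (contDiff_kX 0)).add ((hb 1).mul (contDiff_kX 1)))
  refine Symb.of_dd (fun _ => hsm.contDiffOn) ⟨Λ, fun _ z hz => ?_⟩ fun u => ?_
  · have hT : ‖d z.1 - d z.2 - fderiv ℝ d z.2 (z.1 - z.2)‖ ≤ Λ * ‖z.1 - z.2‖ * ‖z.1 - z.2‖ := by
      refine (convex_segment z.2 z.1).norm_image_sub_le_of_norm_fderiv_le' (𝕜 := ℝ)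
        (fun p _ => h.smooth.differentiable (by simp) p) (fun p hp => ?_)
        (left_mem_segment ℝ _ _) (right_mem_segment ℝ _ _)
      refine ContinuousLinearMap.opNorm_le_bound _ (by positivity) fun v => ?_
      have := norm_sub_le_of_mem_segment hp
      refine (hlip p z.2 v).trans ?_
      gcongr
    have he : kTau d z = d z.1 - d z.2 - fderiv ℝ d z.2 (z.1 - z.2) := by
      rw [fderiv_apply_eq]
      simp only [kTau, kX, PiLp.sub_apply]
      ring
    rw [he, ← Real.norm_eq_abs]
    refine hT.trans ?_
    rw [mul_assoc, norm_sub_rev, zpow_ofNat, pow_two]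
    have := h.norm_le_sqrt_kR hz
    gcongr
  · have hdiff : Symb (Ω ×ˢ Ω) (fun (_ : ι) z => √(kR d z)) 1
        (fun _ z => dd u.1 d z.1 - dd u.1 d z.2) := by
      refine h.symb_one_kR ι (((h.smooth.dd _).comp contDiff_fst).sub
        ((h.smooth.dd _).comp contDiff_snd)) ⟨Λ * ‖u.1‖, fun z hz => ?_⟩
      refine (hlip z.1 z.2 u.1).trans ?_
      rw [norm_sub_rev, mul_right_comm]
      have := h.norm_le_sqrt_kR hz
      gcongr
    have hm : ∀ i, Symb (Ω ×ˢ Ω) (fun (_ : ι) z => √(kR d z)) 1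
        (fun _ z => dd u.2 (dd (e2 i) d) z.2 * kX i z) := fun i =>
      (h.symb_smooth ι (((h.smooth.dd _).dd _).comp contDiff_snd)).mul' hw (h.symb_kX ι i) (by norm_num)
    refine (hdiff.add hw ((hm 0).add hw (hm 1))).congr hw fun _ z _ => ?_
    have hD := fun {f : Vec2 × Vec2 → ℝ} (hf : ContDiff ℝ ∞ f) =>
      (hf.differentiable (by simp) : Differentiable ℝ f) z
    have hE : dd u (kTau d) z = (dd u.1 d z.1 - dd u.2 d z.2)
        + ((dd u.2 (dd (e2 0) d) z.2 * kX 0 z + dd (e2 0) d z.2 * (u.2 0 - u.1 0))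
        + (dd u.2 (dd (e2 1) d) z.2 * kX 1 z + dd (e2 1) d z.2 * (u.2 1 - u.1 1))) := by
      have hF : ∀ {f : Vec2 → ℝ}, ContDiff ℝ ∞ f → DifferentiableAt ℝ f z.2 := fun hf =>
        hf.differentiable (by simp) _
      rw [show kTau d = fun z => (d z.1 - d z.2) + (dd (e2 0) d z.2 * kX 0 z
          + dd (e2 1) d z.2 * kX 1 z) from funext fun z => by simp [kTau],
        dd_add (f := fun z => d z.1 - d z.2)
          (g := fun z => dd (e2 0) d z.2 * kX 0 z + dd (e2 1) d z.2 * kX 1 z)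
          ((hD hs1).sub (hD hs2)) (((hD (hb 0)).mul (hD (contDiff_kX 0))).add
          ((hD (hb 1)).mul (hD (contDiff_kX 1)))), dd_sub (hD hs1) (hD hs2),
        dd_add (f := fun z => dd (e2 0) d z.2 * kX 0 z) (g := fun z => dd (e2 1) d z.2 * kX 1 z)
          ((hD (hb 0)).mul (hD (contDiff_kX 0))) ((hD (hb 1)).mul (hD (contDiff_kX 1))),
        dd_mul (hD (hb 0)) (hD (contDiff_kX 0)), dd_mul (hD (hb 1)) (hD (contDiff_kX 1)), dd_kX,
        dd_kX, dd_comp_fst (h.smooth.differentiable (by simp) _),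
        dd_comp_snd (h.smooth.differentiable (by simp) _),
        dd_comp_snd (hF (h.smooth.dd _)), dd_comp_snd (hF (h.smooth.dd _))]
    rw [hE]
    have e1 := fderiv_apply_eq d z.2 u.1
    have e3 := fderiv_apply_eq d z.2 u.2
    simp only [dd] at e1 e3 ⊢
    linarith

theorem symb_kE (h : IsDefFun Ω d) (ι : Type*) : Symb (Ω ×ˢ Ω) (fun (_ : ι) z => √(kR d z)) 1 (fun _ => kE d) := by
  have hb : ∀ i, ContDiff ℝ ∞ (fun z : Vec2 × Vec2 => dd (e2 i) d z.2) := fun i =>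
    (h.smooth.dd _).comp contDiff_snd
  refine h.symb_one_kR ι ((((hb 0).mul (hb 0)).add ((hb 1).mul (hb 1))).sub contDiff_const) ?_
  obtain ⟨C, hC, hb⟩ := h.exists_abs_gradSq_sub_one_le
  obtain ⟨C', hC', hb'⟩ := h.exists_sq_le_kR
  refine ⟨C * C', fun z hz => ?_⟩
  have h1 := hb z.2 hz.2
  have h2 := (hb' z hz).2
  rw [show kE d z = gradSq d z.2 - 1 by simp [kE, gradSq, pow_two], mul_assoc]
  exact h1.trans (by gcongr)

theorem symb_kE1 (h : IsDefFun Ω d) (ι : Type*) : Symb (Ω ×ˢ Ω) (fun (_ : ι) z => √(kR d z)) 3 (fun _ => kE1 d) := by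
  have hw := h.isWeight_kR ι
  have h1 := h.symb_fst ι
  exact ((h1.mul' hw (h.symb_kTau ι) (by norm_num)).const_mul hw 16).add hw
    (((h1.mul hw h1).mul' hw (h.symb_kE ι) (by norm_num)).const_mul hw 16)

theorem symb_kE3 (h : IsDefFun Ω d) (ι : Type*) : Symb (Ω ×ˢ Ω) (fun (_ : ι) z => √(kR d z)) 3 (fun _ => kE3 d) := by
  have hw := h.isWeight_kR ι
  have h1 := h.symb_fst ι
  exact ((h1.mul' hw (h.symb_kTau ι) (by norm_num)).const_mul hw 8).add hw
    (((h1.mul hw h1).mul' hw (h.symb_kE ι) (by norm_num)).const_mul hw 16)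

theorem symb_kE2 (h : IsDefFun Ω d) (ι : Type*) : Symb (Ω ×ˢ Ω) (fun (_ : ι) z => √(kR d z)) 1 (fun _ => kE2 d) := by
  have hw := h.isWeight_kR ι
  have hl : ContDiff ℝ ∞ (lap d) := ((h.smooth.dd _).dd _).add ((h.smooth.dd _).dd _)
  exact ((h.symb_fst ι).mul' hw (h.symb_smooth ι (hl.comp contDiff_snd)) (by norm_num)).const_mul hw 4

theorem symb_kQ (h : IsDefFun Ω d) (ι : Type*) : Symb (Ω ×ˢ Ω) (fun (_ : ι) z => √(kR d z)) 2 (fun _ => kQ d) := by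
  have hw := h.isWeight_kR ι
  have h1 := h.symb_fst ι
  exact ((h1.mul' hw (h.symb_snd ι) (by norm_num)).const_mul hw 16).add hw
    ((h1.mul' hw h1 (by norm_num)).const_mul hw 16)

theorem symb_kG (h : IsDefFun Ω d) (ι : Type*) : Symb (Ω ×ˢ Ω) (fun (_ : ι) z => √(kR d z)) 1 (fun _ => kG d) := by
  have hw := h.isWeight_kR ι
  have h1 := h.symb_fst ι
  have hP := h.symb_inv_kR ι
  have hS := h.symb_kS ι
  exact (((((h1.mul hw (h.symb_kTau ι)).mul' hw hP (by norm_num)).const_mul hw 16).add hw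
    ((hS.mul hw (h.symb_kE2 ι)).mul' hw hP (by norm_num))).sub hw
    ((hS.mul hw (h.symb_kE1 ι)).mul' hw (hP.mul hw hP) (by norm_num)))

/-- The kernel is biharmonic to leading order. -/
theorem symb_lapY_lapY_kT (h : IsDefFun Ω d) (ι : Type*) :
    Symb (Ω ×ˢ Ω) (fun (_ : ι) z => √(kR d z)) (-1) (fun _ => lapY (lapY (kT d))) := by
  have hw := h.isWeight_kR ι
  have hV : ∀ z ∈ Ω ×ˢ Ω, 0 < kR d z := fun z hz => h.kR_pos hz.1 (subset_closure hz.2)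
  have hP := h.symb_inv_kR ι
  have hPP := hP.mul hw hP
  have hQ := h.symb_kQ ι
  have hs : ∀ {k : ℤ} {f : Vec2 × Vec2 → ℝ}, Symb (Ω ×ˢ Ω) (fun (_ : ι) z => √(kR d z)) k (fun _ => f) →
    ι → ContDiffOn ℝ ∞ f (Ω ×ˢ Ω) := fun hf i => hf.smooth i
  have hmain := ((((((h.symb_kE1 ι).mul' hw hPP (m := -1) (by norm_num)).const_mul hw (-4)).add hw
    (((h.symb_kE3 ι).mul' hw hPP (m := -1) (by norm_num)).const_mul hw 8)).add hw
    ((hQ.mul hw (h.symb_kE2 ι)).mul' hw hPP (m := -1) (by norm_num))).sub hw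
    (((hQ.mul hw (h.symb_kE1 ι)).mul' hw (hPP.mul hw hP) (m := -1) (by norm_num)).const_mul hw 2))
  refine (hmain.add hw (((h.symb_kG ι).lapY hw).mono hw (by norm_num))).congr hw fun i z hz => ?_
  have hl := contDiffOn_log_kR h.smooth hV
  have hc1 : ContDiffOn ℝ ∞ (fun z => 4 * Real.log (kR d z) + 8 - kQ d z * (kR d z)⁻¹) (Ω ×ˢ Ω) :=
    ((contDiffOn_const.mul hl).add contDiffOn_const).sub ((hs hQ i).mul (hs hP i))
  refine (lapY_congr hw.isOpen (lapY_kT h.smooth hw.isOpen hV) hz).trans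
    ((lapY_add hw.isOpen hc1 (hs (h.symb_kG ι) i) hz).trans ?_)
  exact congrArg (· + _) (lapY_main h.smooth hw.isOpen hV hz)

theorem symb_dd_kT (h : IsDefFun Ω d) (ι : Type*) :
    (∀ u v, Symb (Ω ×ˢ Ω) (fun (_ : ι) z => √(kR d z)) (-1) (fun _ => dd u (dd v (kT d)))) ∧
    ∀ t u v, Symb (Ω ×ˢ Ω) (fun (_ : ι) z => √(kR d z)) (-1)
      (fun _ => dd t (dd u (dd v (kT d)))) :=
  Symb.quad (h.isWeight_kR ι) (h.symb_kS ι) dd_dd_kS (h.symb_log_kR ι).1 (h.symb_log_kR ι).2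

end IsDefFun

end KernelSymb

/-! ### The regularised fundamental solution -/

section Radial

open Filter Topology

/-- The logarithm, cut off near the origin. -/
noncomputable def cutLog (t : ℝ) : ℝ := stepFun t * Real.log t

theorem cutLog_of_one_le {t : ℝ} (h : 1 ≤ t) : cutLog t = Real.log t := by
  rw [cutLog, stepFun_eq_one h, one_mul]

theorem contDiff_cutLog : ContDiff ℝ ∞ cutLog := by
  refine contDiff_iff_contDiffAt.2 fun t => ?_
  rcases lt_or_ge t (1 / 2) with h | h
  · refine (contDiffAt_const (c := (0 : ℝ))).congr_of_eventuallyEq ?_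
    filter_upwards [Iio_mem_nhds h] with u hu
    rw [cutLog, stepFun_eq_zero (le_of_lt hu), zero_mul]
  · exact stepFun_contDiff.contDiffAt.mul (Real.contDiffAt_log.2 (by linarith))

theorem deriv_cutLog {t : ℝ} (h : 1 < t) : deriv cutLog t = t⁻¹ := by
  have : cutLog =ᶠ[𝓝 t] Real.log := by
    filter_upwards [Ioi_mem_nhds h] with u hu using cutLog_of_one_le (le_of_lt hu)
  rw [this.deriv_eq, Real.deriv_log]

theorem ContDiff.deriv_infty {f : ℝ → ℝ} (hf : ContDiff ℝ ∞ f) : ContDiff ℝ ∞ (deriv f) :=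
  (contDiff_infty_iff_deriv.1 hf).2

/-- The squared norm. -/
noncomputable def sqN (y : Vec2) : ℝ := y 0 * y 0 + y 1 * y 1

theorem sqN_eq (y : Vec2) : sqN y = ‖y‖ ^ 2 := by
  rw [EuclideanSpace.norm_sq_eq, Fin.sum_univ_two]
  simp [sqN, pow_two]

theorem contDiff_coord (i : Fin 2) : ContDiff ℝ ∞ (fun y : Vec2 => y i) :=
  (EuclideanSpace.proj i : Vec2 →L[ℝ] ℝ).contDiff

theorem contDiff_sqN : ContDiff ℝ ∞ sqN :=
  ((contDiff_coord 0).mul (contDiff_coord 0)).add ((contDiff_coord 1).mul (contDiff_coord 1))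

/-- The radial part of the Laplacian, in the variable `‖y‖ ^ 2`. -/
noncomputable def radLap (f : ℝ → ℝ) (t : ℝ) : ℝ := 4 * (t * deriv (deriv f) t + deriv f t)

theorem ContDiff.radLap {f : ℝ → ℝ} (hf : ContDiff ℝ ∞ f) : ContDiff ℝ ∞ (radLap f) :=
  contDiff_const.mul ((contDiff_id.mul hf.deriv_infty.deriv_infty).add hf.deriv_infty)

theorem hasDD_coord (i : Fin 2) (v : Vec2) : HasDD univ v (fun y : Vec2 => y i) (fun _ => v i) :=
  fun x _ => ⟨(contDiff_coord i).differentiable (by simp) x, dd_coord i v x⟩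

theorem hasDD_sqN (v : Vec2) : HasDD univ v sqN (fun y => 2 * (v 0 * y 0 + v 1 * y 1)) :=
  (((hasDD_coord 0 v).mul (hasDD_coord 0 v)).add
    ((hasDD_coord 1 v).mul (hasDD_coord 1 v))).congr_right fun y _ => by ring

theorem hasDD_comp_sqN {f : ℝ → ℝ} (hf : ContDiff ℝ ∞ f) (v : Vec2) :
    HasDD univ v (fun y => f (sqN y)) (fun y => deriv f (sqN y) * (2 * (v 0 * y 0 + v 1 * y 1))) :=
  fun x _ => by
    have h1 := hf.differentiable (by simp) (sqN x)
    have h2 := contDiff_sqN.differentiable (by simp) x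
    exact ⟨h1.comp x h2, (dd_comp h1 h2 v).trans (by rw [(hasDD_sqN v).eqOn (mem_univ x)])⟩

theorem lap_comp_sqN {f : ℝ → ℝ} (hf : ContDiff ℝ ∞ f) :
    lap (fun y => f (sqN y)) = fun y => radLap f (sqN y) := by
  ext y
  have h2 : ∀ v : Vec2, dd v (dd v fun y => f (sqN y)) y
      = deriv (deriv f) (sqN y) * (2 * (v 0 * y 0 + v 1 * y 1)) * (2 * (v 0 * y 0 + v 1 * y 1))
        + deriv f (sqN y) * (2 * (v 0 * v 0 + v 1 * v 1)) := fun v => by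
    have hl := (((HasDD.const (V := univ) (v := v) (v 0)).mul (hasDD_coord 0 v)).add
      ((HasDD.const (V := univ) (v := v) (v 1)).mul (hasDD_coord 1 v))).const_mul 2
    rw [(hasDD_comp_sqN hf v).eqOn_dd isOpen_univ ((hasDD_comp_sqN hf.deriv_infty v).mul hl)
      (mem_univ y)]
    ring
  rw [lap, h2, h2, radLap, sqN]
  simp [e2]
  ring

/-- The radial profile of the regularised fundamental solution of the bilaplacian. -/
noncomputable def radTheta (t : ℝ) : ℝ := t * cutLog t

theorem contDiff_radTheta : ContDiff ℝ ∞ radTheta := contDiff_id.mul contDiff_cutLog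

theorem deriv_radTheta {t : ℝ} (h : 1 < t) : deriv radTheta t = Real.log t + 1 := by
  have h1 : HasDerivAt cutLog t⁻¹ t := by
    rw [← deriv_cutLog h]
    exact (contDiff_cutLog.differentiable (by simp) t).hasDerivAt
  have h2 : HasDerivAt radTheta _ t := (hasDerivAt_id t).mul h1
  rw [h2.deriv, cutLog_of_one_le h.le]
  have : t ≠ 0 := by positivity
  simp [this]

theorem radLap_radTheta {t : ℝ} (h : 1 < t) : radLap radTheta t = 4 * Real.log t + 8 := by
  have h1 : deriv radTheta =ᶠ[𝓝 t] fun t => Real.log t + 1 := by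
    filter_upwards [Ioi_mem_nhds h] with u hu using deriv_radTheta hu
  have : t ≠ 0 := by positivity
  rw [radLap, h1.deriv_eq, deriv_radTheta h, deriv_add_const, Real.deriv_log]
  field_simp; ring

theorem deriv_radLap_radTheta {t : ℝ} (h : 1 < t) : deriv (radLap radTheta) t = 4 * t⁻¹ := by
  have h1 : radLap radTheta =ᶠ[𝓝 t] fun t => 4 * Real.log t + 8 := by
    filter_upwards [Ioi_mem_nhds h] with u hu using radLap_radTheta hu
  rw [h1.deriv_eq, deriv_add_const, deriv_const_mul_field, Real.deriv_log]

/-- The bilaplacian of the regularised fundamental solution. -/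
noncomputable def radM : ℝ → ℝ := radLap (radLap radTheta)

theorem contDiff_radM : ContDiff ℝ ∞ radM := contDiff_radTheta.radLap.radLap

theorem hasDerivAt_primitive_radM (t : ℝ) :
    HasDerivAt (fun t => 4 * (t * deriv (radLap radTheta) t)) (radM t) t := by
  have h := (contDiff_radTheta.radLap.deriv_infty.differentiable (by simp) t).hasDerivAt
  refine (((hasDerivAt_id t).mul h).const_mul 4).congr_deriv ?_
  simp only [radM, radLap, id]; ring

theorem primitive_radM_eq {t : ℝ} (h : 1 < t) : 4 * (t * deriv (radLap radTheta) t) = 16 := by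
  have : t ≠ 0 := by positivity
  rw [deriv_radLap_radTheta h]; field_simp; norm_num

theorem radM_eq_zero {t : ℝ} (h : 1 < t) : radM t = 0 := by
  have h1 : (fun t => 4 * (t * deriv (radLap radTheta) t)) =ᶠ[𝓝 t] fun _ => 16 := by
    filter_upwards [Ioi_mem_nhds h] with u hu using primitive_radM_eq hu
  rw [← (hasDerivAt_primitive_radM t).deriv, h1.deriv_eq, deriv_const]

/-- An approximate identity (up to a factor) at scale `s ^ (-1/2)`. -/
noncomputable def mollM (s : ℝ) (y : Vec2) : ℝ := s * radM (s * sqN y)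

theorem contDiff_mollM (s : ℝ) : ContDiff ℝ ∞ (mollM s) :=
  contDiff_const.mul (contDiff_radM.comp (contDiff_const.mul contDiff_sqN))

theorem mollM_eq_zero {s : ℝ} {y : Vec2} (h : 1 < s * ‖y‖ ^ 2) : mollM s y = 0 := by
  rw [mollM, sqN_eq, radM_eq_zero h, mul_zero]

theorem tsupport_mollM_subset {δ : ℝ} (hδ : 0 < δ) :
    tsupport (mollM (δ ^ 2)⁻¹) ⊆ Metric.closedBall 0 δ := by
  refine closure_minimal (fun y hy => ?_) Metric.isClosed_closedBall
  rw [mem_closedBall_zero_iff]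
  by_contra hc
  refine hy (mollM_eq_zero ?_)
  rw [lt_inv_mul_iff₀ (by positivity), mul_one]
  exact pow_lt_pow_left₀ (not_le.1 hc) hδ.le two_ne_zero

/-- The total mass of `mollM`. -/
noncomputable def massM : ℝ := 16 * volume.real (Metric.ball (0 : Vec2) 1)

theorem massM_pos : 0 < massM := by
  have : 0 < volume.real (Metric.ball (0 : Vec2) 1) :=
    ENNReal.toReal_pos (Metric.measure_ball_pos _ _ one_pos).ne' measure_ball_lt_top.ne
  rw [massM]; positivity

theorem integral_mollM {δ : ℝ} (hδ : 0 < δ) : ∫ y, mollM (δ ^ 2)⁻¹ y = massM := by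
  set s := (δ ^ 2)⁻¹ with hs
  have hs0 : 0 < s := by positivity
  have h1 : ∀ y, mollM s y = (fun r => s * radM (s * r ^ 2)) ‖y‖ := fun y => by
    simp only [mollM, sqN_eq]
  have hd : ∀ r ∈ Ioi (0 : ℝ), HasDerivAt
      (fun r => 2⁻¹ * (4 * (s * r ^ 2 * deriv (radLap radTheta) (s * r ^ 2))))
      (r * (s * radM (s * r ^ 2))) r := fun r _ => by
    have := (hasDerivAt_primitive_radM (s * r ^ 2)).comp r (((hasDerivAt_pow 2 r).const_mul s))
    refine (this.const_mul 2⁻¹).congr_deriv ?_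
    simp; ring
  have hlarge : ∀ r : ℝ, δ < r → 1 < s * r ^ 2 := fun r hr => by
    rw [hs, lt_inv_mul_iff₀ (by positivity), mul_one]
    exact pow_lt_pow_left₀ hr hδ.le two_ne_zero
  have hcont : Continuous fun r : ℝ => r * (s * radM (s * r ^ 2)) := by
    have := contDiff_radM.continuous
    fun_prop
  have hInt : IntegrableOn (fun r : ℝ => r * (s * radM (s * r ^ 2))) (Ioi 0) := by
    have hc : HasCompactSupport fun r : ℝ => r * (s * radM (s * r ^ 2)) := by
      refine HasCompactSupport.of_support_subset_isCompact (isCompact_Icc (a := -δ) (b := δ))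
        fun r hr => ?_
      by_contra hc
      refine hr ?_
      have : δ < |r| := by
        by_contra hh; exact hc (abs_le.1 (not_lt.1 hh))
      have := hlarge _ this
      rw [sq_abs] at this
      simp only [radM_eq_zero this, mul_zero]
    exact (hcont.integrable_of_hasCompactSupport hc).integrableOn
  have hF := contDiff_radTheta.radLap.deriv_infty.continuous
  have h2 := integral_Ioi_of_hasDerivAt_of_tendsto (a := 0) (m := 8) (f := fun r =>
    2⁻¹ * (4 * (s * r ^ 2 * deriv (radLap radTheta) (s * r ^ 2))))
    (Continuous.continuousWithinAt (by fun_prop)) hd hInt (by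
      refine (tendsto_const_nhds (x := (8 : ℝ))).congr' ?_
      filter_upwards [Ioi_mem_atTop δ] with r hr
      rw [primitive_radM_eq (hlarge r hr)]; norm_num)
  refine (integral_congr_ae (.of_forall h1)).trans
    ((integral_fun_norm_addHaar volume fun r => s * radM (s * r ^ 2)).trans ?_)
  simp only [finrank_euclideanSpace, Fintype.card_fin, smul_eq_mul, nsmul_eq_mul]
  simp only [pow_one, show 2 - 1 = 1 from rfl]
  rw [h2, massM]
  simp; ring

theorem exists_integral_abs_mollM_le : ∃ C, ∀ δ > 0, ∫ y, |mollM (δ ^ 2)⁻¹ y| ≤ C := by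
  obtain ⟨K, hK⟩ := (isCompact_Icc (a := (0 : ℝ)) (b := 1)).exists_bound_of_continuousOn
    contDiff_radM.continuous.continuousOn
  have hK0 : 0 ≤ K := (norm_nonneg _).trans (hK 0 ⟨le_rfl, zero_le_one⟩)
  refine ⟨K * volume.real (Metric.closedBall (0 : Vec2) 1), fun δ hδ => ?_⟩
  have h0 : ∀ y ∉ Metric.closedBall (0 : Vec2) δ, |mollM (δ ^ 2)⁻¹ y| = 0 := fun y hy => by
    rw [image_eq_zero_of_notMem_tsupport fun h => hy (tsupport_mollM_subset hδ h), abs_zero]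
  rw [← setIntegral_eq_integral_of_forall_compl_eq_zero h0]
  have hb : ∀ y ∈ Metric.closedBall (0 : Vec2) δ, ‖|mollM (δ ^ 2)⁻¹ y|‖ ≤ (δ ^ 2)⁻¹ * K := fun y hy => by
    rw [Real.norm_eq_abs, abs_abs, mollM, abs_mul, abs_of_pos (by positivity)]
    refine mul_le_mul_of_nonneg_left (hK _ ⟨?_, ?_⟩) (by positivity)
    · rw [sqN_eq]; positivity
    · rw [sqN_eq, inv_mul_le_iff₀ (by positivity), mul_one]
      exact pow_le_pow_left₀ (norm_nonneg _) (mem_closedBall_zero_iff.1 hy) 2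
  have := norm_setIntegral_le_of_norm_le_const (μ := volume) measure_closedBall_lt_top hb
  refine (le_abs_self _).trans (this.trans (le_of_eq ?_))
  rw [Measure.addHaar_real_closedBall' volume 0 hδ.le]
  simp only [finrank_euclideanSpace, Fintype.card_fin]
  have : δ ≠ 0 := hδ.ne'
  field_simp

end Radial

/-! ### The regularised kernel -/

section RegKernel

open Filter Topology

/-- `t * cutLog' t`. -/
noncomputable def cutLogD (t : ℝ) : ℝ := t * deriv cutLog t

theorem contDiff_cutLogD : ContDiff ℝ ∞ cutLogD := contDiff_id.mul contDiff_cutLog.deriv_infty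

theorem cutLogD_eq_one {t : ℝ} (h : 1 < t) : cutLogD t = 1 := by
  have : t ≠ 0 := by positivity
  rw [cutLogD, deriv_cutLog h, mul_inv_cancel₀ this]

theorem cutLogD_eq_zero {t : ℝ} (h : t < 1 / 2) : cutLogD t = 0 := by
  have : cutLog =ᶠ[𝓝 t] fun _ => 0 := by
    filter_upwards [Iio_mem_nhds h] with u hu
    rw [cutLog, stepFun_eq_zero (le_of_lt hu), zero_mul]
  rw [cutLogD, this.deriv_eq, deriv_const, mul_zero]

theorem exists_abs_cutLogD_le : ∃ M, ∀ t, |cutLogD t| ≤ M := by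
  obtain ⟨M, hM⟩ := (isCompact_Icc (a := (1 / 2 : ℝ)) (b := 1)).exists_bound_of_continuousOn
    contDiff_cutLogD.continuous.continuousOn
  have hM0 : 0 ≤ M := (norm_nonneg _).trans (hM 1 ⟨by norm_num, le_rfl⟩)
  refine ⟨M + 1, fun t => ?_⟩
  rcases lt_or_ge t (1 / 2) with h | h
  · rw [cutLogD_eq_zero h, abs_zero]; linarith
  · rcases le_or_gt t 1 with h1 | h1
    · exact (hM t ⟨h, h1⟩).trans (by linarith)
    · rw [cutLogD_eq_one h1, abs_one]; linarith

theorem hasCompactSupport_deriv_cutLogD : HasCompactSupport (deriv cutLogD) := by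
  refine HasCompactSupport.of_support_subset_isCompact (isCompact_Icc (a := (1/2 : ℝ)) (b := 1)) ?_
  intro t ht
  by_contra hc
  apply ht
  rcases not_and_or.1 (show ¬ (1 / 2 ≤ t ∧ t ≤ 1) from hc) with h | h
  · have : cutLogD =ᶠ[𝓝 t] fun _ => 0 := by
      filter_upwards [Iio_mem_nhds (not_le.1 h)] with s hs using cutLogD_eq_zero hs
    rw [this.deriv_eq, deriv_const]
  · have : cutLogD =ᶠ[𝓝 t] fun _ => 1 := by
      filter_upwards [Ioi_mem_nhds (not_le.1 h)] with s hs using cutLogD_eq_one hs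
    rw [this.deriv_eq, deriv_const]

/-- The regularised logarithm of the squared distance. -/
noncomputable def kLam (s : ℝ) (z : Vec2 × Vec2) : ℝ := cutLog (s * kS z) - Real.log s

/-- The regularised fundamental solution. -/
noncomputable def kZ (s : ℝ) (z : Vec2 × Vec2) : ℝ := kS z * kLam s z

/-- The parametrix. -/
noncomputable def kK (d : Vec2 → ℝ) (s : ℝ) (z : Vec2 × Vec2) : ℝ := kZ s z - kT d z + kB d z

theorem contDiff_kLam (s : ℝ) : ContDiff ℝ ∞ (kLam s) :=
  (contDiff_cutLog.comp (contDiff_const.mul contDiff_kS)).sub contDiff_const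

theorem contDiff_kZ (s : ℝ) : ContDiff ℝ ∞ (kZ s) := contDiff_kS.mul (contDiff_kLam s)

theorem contDiffOn_kK {d : Vec2 → ℝ} (hd : ContDiff ℝ ∞ d) (s : ℝ) {V : Set (Vec2 × Vec2)}
    (hV : ∀ z ∈ V, 0 < kR d z) : ContDiffOn ℝ ∞ (kK d s) V :=
  ((contDiff_kZ s).contDiffOn.sub (contDiffOn_kT hd hV)).add (contDiff_kB hd).contDiffOn

theorem kLam_eq {s : ℝ} (hs : 0 < s) {z : Vec2 × Vec2} (h : 1 ≤ s * kS z) :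
    kLam s z = Real.log (kS z) := by
  have : kS z ≠ 0 := by rintro h0; rw [h0] at h; linarith
  rw [kLam, cutLog_of_one_le h, Real.log_mul hs.ne' this]; ring

theorem lapY_comp_diff {f : Vec2 → ℝ} (hf : ContDiff ℝ ∞ f) :
    lapY (fun z => f (z.2 - z.1)) = fun z => lap f (z.2 - z.1) := by
  have h : ∀ (g : Vec2 → ℝ), ContDiff ℝ ∞ g → ∀ v : Vec2,
      dd (0, v) (fun z : Vec2 × Vec2 => g (z.2 - z.1)) = fun z => dd v g (z.2 - z.1) :=
    fun g hg v => funext fun z => by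
      rw [dd_comp_diff (hg.differentiable (by simp) _), sub_zero]
  ext z
  rw [lapY, lap, h f hf, h f hf, h _ (hf.dd _), h _ (hf.dd _)]

theorem radLap_rescale {f : ℝ → ℝ} (hf : ContDiff ℝ ∞ f) (a b c s : ℝ) :
    radLap (fun t => a * f (s * t) + (b * t + c)) = fun t => a * s * radLap f (s * t) + 4 * b := by
  have h1 : ∀ (g : ℝ → ℝ), ContDiff ℝ ∞ g → ∀ t, HasDerivAt (fun t => g (s * t))
      (s * deriv g (s * t)) t := fun g hg t => by
    have := (hg.differentiable (by simp) (s * t)).hasDerivAt.comp t ((hasDerivAt_id t).const_mul s)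
    exact this.congr_deriv (by ring)
  have h2 : deriv (fun t => a * f (s * t) + (b * t + c)) = fun t => a * (s * deriv f (s * t)) + b :=
    funext fun t => (((h1 f hf t).const_mul a).add
      ((((hasDerivAt_id t).const_mul b).add_const c).congr_deriv (mul_one b))).deriv
  have h3 : deriv (fun t => a * (s * deriv f (s * t)) + b) = fun t =>
      a * (s * (s * deriv (deriv f) (s * t))) :=
    funext fun t => ((((h1 _ hf.deriv_infty t).const_mul s).const_mul a).add_const b).deriv
  ext t
  rw [radLap, h2, h3, radLap]; ring

theorem lapY_lapY_kZ {s : ℝ} (hs : 0 < s) :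
    lapY (lapY (kZ s)) = fun z => mollM s (z.2 - z.1) := by
  set f : ℝ → ℝ := fun t => s⁻¹ * radTheta (s * t) + (-Real.log s * t + 0) with hf
  have hfs : ContDiff ℝ ∞ f :=
    (contDiff_const.mul (contDiff_radTheta.comp (contDiff_const.mul contDiff_id))).add
      ((contDiff_const.mul contDiff_id).add contDiff_const)
  have h0 : kZ s = fun z => (fun y => f (sqN y)) (z.2 - z.1) := funext fun z => by
    have : kS z = sqN (z.2 - z.1) := by simp [kS, kX, sqN]
    simp only [hf, kZ, kLam, this, radTheta]
    field_simp; ring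
  have h1 : radLap f = fun t => 1 * radLap radTheta (s * t) + (0 * t + 4 * -Real.log s) := by
    rw [hf, radLap_rescale contDiff_radTheta]
    ext t; field_simp; ring
  have h2 : radLap (radLap f) = fun t => s * radM (s * t) := by
    rw [h1, radLap_rescale contDiff_radTheta.radLap]
    ext t; rw [radM]; ring
  rw [h0, lapY_comp_diff (f := fun y => f (sqN y)) (hfs.comp contDiff_sqN), lap_comp_sqN hfs,
    lapY_comp_diff (f := fun y => radLap f (sqN y)) (hfs.radLap.comp contDiff_sqN), lap_comp_sqN hfs.radLap, h2]
  rfl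

/-- If `f` vanishes on a horizontal slice, so do its derivatives in the first variable. -/
theorem dd_left_eq_zero {V : Set (Vec2 × Vec2)} (hV : IsOpen V) {f : Vec2 × Vec2 → ℝ}
    (hf : ContDiffOn ℝ ∞ f V) {O : Set Vec2} (hO : IsOpen O) {y : Vec2}
    (hOV : ∀ x ∈ O, (x, y) ∈ V) (h0 : ∀ x ∈ O, f (x, y) = 0) (u : Vec2) :
    ∀ x ∈ O, dd (u, 0) f (x, y) = 0 := fun x hx => by
  rw [← dd_slice_left (hf.diffAt hV (hOV x hx)), dd_congr_of_isOpen (g := fun _ => 0) hO h0 u hx,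
    dd_const]

theorem abs_log_sq_le {w M : ℝ} (hw : 0 < w) (hM : w ≤ M) :
    |Real.log (w ^ 2)| ≤ 2 * (1 + M ^ 2) * w ^ (-1 : ℤ) := by
  rw [Real.log_pow, zpow_neg_one]
  have h1 : |Real.log w| ≤ (1 + M ^ 2) * w⁻¹ := by
    have e1 := Real.log_le_sub_one_of_pos hw
    have e2 := Real.log_le_sub_one_of_pos (inv_pos.2 hw)
    rw [Real.log_inv] at e2
    have hi := inv_pos.2 hw
    have hwM : w ≤ M ^ 2 * w⁻¹ := by
      rw [← div_eq_mul_inv, le_div_iff₀ hw]; nlinarith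
    rw [abs_le]; constructor <;> nlinarith [sq_nonneg M]
  push_cast
  rw [abs_mul, abs_two]
  linarith

namespace IsDefFun

variable {Ω : Set Vec2} {d : Vec2 → ℝ}

theorem kK_eq_zero (h : IsDefFun Ω d) {s : ℝ} (hs : 0 < s) {x y : Vec2} (hy : y ∈ frontier Ω)
    (hxy : 1 ≤ s * kS (x, y)) : kK d s (x, y) = 0 := by
  have hd : kB d (x, y) = 0 := by simp [kB, h.frontier_zero hy]
  rw [kK, kZ, kLam_eq hs hxy, kT, kR, hd]; ring_nf

theorem dd_kK_eq_zero (h : IsDefFun Ω d) {s : ℝ} (hs : 0 < s) {x y : Vec2} (hx : x ∈ Ω) (hy : y ∈ frontier Ω)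
    (hxy : 1 < s * kS (x, y)) (w : Vec2) : dd (0, w) (kK d s) (x, y) = 0 := by
  set V : Set (Vec2 × Vec2) := {z | 1 < s * kS z} ∩ {z | 0 < kR d z} with hVd
  have hV : IsOpen V := (isOpen_lt continuous_const (continuous_const.mul contDiff_kS.continuous)).inter
    (isOpen_lt continuous_const (contDiff_kR h.smooth).continuous)
  have hz : (x, y) ∈ V := ⟨hxy, h.kR_pos hx (frontier_subset_closure hy)⟩
  have hS0 : ∀ z ∈ V, kS z ≠ 0 := fun z hz h0 => by
    have := hz.1; simp only [mem_ofPred_eq, h0] at this; linarith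
  have hR0 : ∀ z ∈ V, kR d z ≠ 0 := fun z hz => (show 0 < kR d z from hz.2).ne'
  have hS := HasDD.of_contDiffOn (v := ((0, w) : Vec2 × Vec2)) hV contDiff_kS.contDiffOn
  have hR := HasDD.of_contDiffOn (v := ((0, w) : Vec2 × Vec2)) hV (contDiff_kR h.smooth).contDiffOn
  have hB := HasDD.of_contDiffOn (v := ((0, w) : Vec2 × Vec2)) hV (contDiff_kB h.smooth).contDiffOn
  have hd : kB d (x, y) = 0 := by simp [kB, h.frontier_zero hy]
  have he : EqOn (kK d s) (fun z => kS z * Real.log (kS z) - kS z * Real.log (kR d z) + kB d z) V :=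
    fun z hz => by simp only [kK, kZ, kLam_eq hs (le_of_lt hz.1), kT]
  have hRSB : dd (0, w) (kR d) (x, y) = dd (0, w) kS (x, y) + dd (0, w) (kB d) (x, y) :=
    dd_add (hS _ hz).1 (hB _ hz).1 _
  rw [dd_congr_of_isOpen hV he _ hz,
    (((hS.mul (hS.log hS0)).sub (hS.mul (hR.log hR0))).add hB).eqOn hz]
  beta_reduce
  rw [hRSB]
  have h1 := hS0 _ hz
  simp only [kR, hd, add_zero]
  field_simp
  ring

/-- All the mixed derivatives of the parametrix which are needed vanish at the boundary. -/
theorem dd_dd_kK_frontier (h : IsDefFun Ω d) {s : ℝ} (hs : 0 < s) {x y : Vec2} (hx : x ∈ Ω) (hy : y ∈ frontier Ω)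
    (hxy : 1 < s * kS (x, y)) (u v : Vec2) :
    dd (u, 0) (dd (v, 0) (kK d s)) (x, y) = 0 ∧
    ∀ w, dd (0, w) (dd (u, 0) (dd (v, 0) (kK d s))) (x, y) = 0 := by
  set V : Set (Vec2 × Vec2) := {z | 0 < kR d z} with hVd
  have hV : IsOpen V := isOpen_lt continuous_const (contDiff_kR h.smooth).continuous
  have hK : ContDiffOn ℝ ∞ (kK d s) V := contDiffOn_kK h.smooth s fun z hz => hz
  set O : Set Vec2 := Ω ∩ {x | 1 < s * kS (x, y)} with hOd
  have hO : IsOpen O := h.isOpen.inter (isOpen_lt continuous_const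
    (continuous_const.mul (contDiff_kS.continuous.comp (by fun_prop))))
  have hOV : ∀ x ∈ O, (x, y) ∈ V := fun x hx => h.kR_pos hx.1 (frontier_subset_closure hy)
  have hxO : x ∈ O := ⟨hx, hxy⟩
  have key : ∀ f : Vec2 × Vec2 → ℝ, ContDiffOn ℝ ∞ f V → (∀ x ∈ O, f (x, y) = 0) →
      dd (u, 0) (dd (v, 0) f) (x, y) = 0 := fun f hf h0 =>
    dd_left_eq_zero hV (hf.dd hV _) hO hOV (dd_left_eq_zero hV hf hO hOV h0 v) u x hxO
  refine ⟨key _ hK fun x hx => h.kK_eq_zero hs hy (le_of_lt hx.2), fun w => ?_⟩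
  rw [dd_comm hV (hK.dd hV _) (0, w) (u, 0) (hOV x hxO),
    dd_congr_of_isOpen hV (dd_comm hV hK (0, w) (v, 0)) (u, 0) (hOV x hxO)]
  exact key _ (hK.dd hV _) fun x hx => h.dd_kK_eq_zero hs hx.1 hy hx.2 w

end IsDefFun

end RegKernel

section RegKernelSymb

open Filter Topology

/-- The off-diagonal part of `Ω × Ω`. -/
def offDiag2 (Ω : Set Vec2) : Set (Vec2 × Vec2) := Ω ×ˢ Ω ∩ {z | z.1 ≠ z.2}

/-- A smooth cutoff around the origin at scale `r`. -/
noncomputable def bumpAt (r : ℝ) (y : Vec2) : ℝ := 1 - stepFun (2 * (r ^ 2)⁻¹ * sqN y)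

theorem contDiff_bumpAt (r : ℝ) : ContDiff ℝ ∞ (bumpAt r) :=
  contDiff_const.sub (stepFun_contDiff.comp (contDiff_const.mul contDiff_sqN))

theorem bumpAt_eq_one {r : ℝ} (hr : 0 < r) {y : Vec2} (hy : ‖y‖ ≤ r / 2) : bumpAt r y = 1 := by
  rw [bumpAt, stepFun_eq_zero, sub_zero]
  have : ‖y‖ ^ 2 ≤ (r / 2) ^ 2 := pow_le_pow_left₀ (norm_nonneg _) hy 2
  rw [sqN_eq, mul_assoc, inv_mul_eq_div, ← le_div_iff₀' (by norm_num), div_le_iff₀ (by positivity)]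
  linarith

theorem bumpAt_eq_zero {r : ℝ} (hr : 0 < r) {y : Vec2} (hy : r ^ 2 ≤ 2 * ‖y‖ ^ 2) : bumpAt r y = 0 := by
  rw [bumpAt, stepFun_eq_one, sub_self]
  rw [sqN_eq, mul_right_comm, ← div_eq_mul_inv, le_div_iff₀ (by positivity)]
  linarith

theorem kS_lower_dist {Ω : Set Vec2} (ι : Type*) : ∀ _ : ι, ∀ z ∈ offDiag2 Ω, 1 * ‖z.2 - z.1‖ ^ (2 : ℤ) ≤ kS z :=
  fun _ z _ => by rw [one_mul, kS_eq]; norm_cast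

namespace IsDefFun

variable {Ω : Set Vec2} {d : Vec2 → ℝ}

theorem isWeight_dist (h : IsDefFun Ω d) (ι : Type*) :
    IsWeight (offDiag2 Ω) (fun (_ : ι) (z : Vec2 × Vec2) => ‖z.2 - z.1‖) := by
  refine ⟨(h.isOpen.prod h.isOpen).inter (isOpen_ne_fun continuous_fst continuous_snd),
    fun _ z hz => norm_pos_iff.2 (sub_ne_zero.2 fun e => hz.2 e.symm), ?_⟩
  obtain ⟨M, hM⟩ := (h.isWeight_kR Unit).bdd
  exact ⟨M, fun _ z hz => (h.norm_le_sqrt_kR hz.1).trans (hM () z hz.1)⟩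

theorem symb_kX_dist (h : IsDefFun Ω d) (ι : Type*) (i : Fin 2) :
    Symb (offDiag2 Ω) (fun (_ : ι) (z : Vec2 × Vec2) => ‖z.2 - z.1‖) 1 (fun _ => kX i) := by
  refine Symb.of_dd (fun _ => (contDiff_kX i).contDiffOn) ⟨1, fun _ z _ => ?_⟩ fun u => ?_
  · simpa using abs_kX_le i z
  · exact (Symb.const (h.isWeight_dist ι) (u.2 i - u.1 i)).congr (h.isWeight_dist ι)
      fun _ z _ => dd_kX i u z

theorem symb_kS_dist (h : IsDefFun Ω d) (ι : Type*) :
    Symb (offDiag2 Ω) (fun (_ : ι) (z : Vec2 × Vec2) => ‖z.2 - z.1‖) 2 (fun _ => kS) := by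
  have hw := h.isWeight_dist ι
  have hx := h.symb_kX_dist ι
  exact ((hx 0).mul' hw (hx 0) (by norm_num)).add hw ((hx 1).mul' hw (hx 1) (by norm_num))

theorem symb_dd_kLam (h : IsDefFun Ω d) (v : Vec2 × Vec2) :
    Symb (offDiag2 Ω) (fun (_ : Ici (1 : ℝ)) (z : Vec2 × Vec2) => ‖z.2 - z.1‖) (-1)
      (fun s => dd v (kLam s)) := by
  have hw := h.isWeight_dist (Ici (1 : ℝ))
  have hS := h.symb_kS_dist (Ici (1 : ℝ))
  have hlow := kS_lower_dist (Ω := Ω) (Ici (1 : ℝ))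
  have h1 := hS.scaled hw one_pos hlow (fun s => s) contDiff_cutLogD exists_abs_cutLogD_le
    hasCompactSupport_deriv_cutLogD
  refine ((h1.mul hw (hS.dd hw v)).mul' hw (hS.inv hw one_pos hlow) (by norm_num)).congr hw
    fun s z hz => ?_
  have hz0 : kS z ≠ 0 := by
    rw [kS_eq]; exact (pow_pos (hw.pos s z hz) 2).ne'
  have e1 : dd v (kLam s) z = deriv cutLog (s * kS z) * dd v (fun z => s * kS z) z := by
    unfold kLam
    rw [dd_sub (f := fun z => cutLog (s * kS z)) (g := fun _ => Real.log s)
      (((contDiff_cutLog.comp (contDiff_const.mul contDiff_kS)).differentiable (by simp)) z)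
      (differentiableAt_const _), dd_const, sub_zero]
    exact dd_comp (contDiff_cutLog.differentiable (by simp) _)
      ((contDiff_const.mul contDiff_kS).differentiable (by simp) z) v
  rw [e1, dd_const_mul]
  simp only [cutLogD]
  field_simp

theorem symb_kLam (h : IsDefFun Ω d) :
    Symb (offDiag2 Ω) (fun (_ : Ici (1 : ℝ)) (z : Vec2 × Vec2) => ‖z.2 - z.1‖) (-1)
      (fun s => kLam s) := by
  have hw := h.isWeight_dist (Ici (1 : ℝ))
  refine Symb.of_dd (fun s => (contDiff_kLam s).contDiffOn) ?_ fun v =>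
    (h.symb_dd_kLam v).mono hw (by norm_num)
  obtain ⟨C, hC⟩ := (isCompact_Icc (a := (0 : ℝ)) (b := 1)).exists_bound_of_continuousOn
    contDiff_cutLog.continuous.continuousOn
  have hC0 : 0 ≤ C := (norm_nonneg _).trans (hC 0 ⟨le_rfl, zero_le_one⟩)
  obtain ⟨M, hM⟩ := hw.bdd
  refine ⟨2 * (1 + M ^ 2) + C * M, fun s z hz => ?_⟩
  have hpos : 0 < ‖z.2 - z.1‖ := hw.pos s z hz
  have hwM : ‖z.2 - z.1‖ ≤ M := hM s z hz
  change |kLam s z| ≤ _ * ‖z.2 - z.1‖ ^ (-1 : ℤ)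
  have hS := kS_eq z
  set w := ‖z.2 - z.1‖ with hwd
  have hlog := abs_log_sq_le hpos hwM
  have h1 : 1 ≤ M * w ^ (-1 : ℤ) := by
    rw [zpow_neg_one, ← div_eq_mul_inv, one_le_div₀ hpos]; exact hwM
  have hs0 : (0 : ℝ) < s := zero_lt_one.trans_le s.2
  have hCM : C ≤ C * M * w ^ (-1 : ℤ) := by
    rw [mul_assoc]; exact le_mul_of_one_le_right hC0 h1
  rw [add_mul]
  rcases le_or_gt 1 (s * kS z) with hh | hh
  · rw [kLam_eq hs0 hh, hS]; linarith
  · have hSpos : 0 < kS z := by rw [hS]; positivity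
    have e1 : |cutLog (s * kS z)| ≤ C := hC _ ⟨by positivity, hh.le⟩
    have e2 : 0 ≤ Real.log s := Real.log_nonneg s.2
    have e3 : Real.log s + Real.log (kS z) ≤ 0 := by
      rw [← Real.log_mul hs0.ne' hSpos.ne']; exact Real.log_nonpos (by positivity) hh.le
    rw [← hS] at hlog
    have e4 := abs_le.1 hlog
    have e5 := abs_le.1 e1
    rw [kLam, abs_le]; constructor <;> linarith

theorem symb_dd_kZ (h : IsDefFun Ω d) :
    (∀ u v, Symb (offDiag2 Ω) (fun (_ : Ici (1 : ℝ)) (z : Vec2 × Vec2) => ‖z.2 - z.1‖) (-1)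
      (fun s => dd u (dd v (kZ s)))) ∧
    ∀ t u v, Symb (offDiag2 Ω) (fun (_ : Ici (1 : ℝ)) (z : Vec2 × Vec2) => ‖z.2 - z.1‖) (-1)
      (fun s => dd t (dd u (dd v (kZ s)))) :=
  Symb.quad (h.isWeight_dist _) (h.symb_kS_dist _) dd_dd_kS h.symb_kLam h.symb_dd_kLam

theorem kR_pos_of_offDiag (h : IsDefFun Ω d) {z : Vec2 × Vec2} (hz : z ∈ offDiag2 Ω) : 0 < kR d z :=
  h.kR_pos hz.1.1 (subset_closure hz.1.2)

theorem symb_dd_kK (h : IsDefFun Ω d) (u v : Vec2 × Vec2) :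
    Symb (offDiag2 Ω) (fun (_ : Ici (1 : ℝ)) (z : Vec2 × Vec2) => ‖z.2 - z.1‖) (-1)
      (fun s => dd u (dd v (kK d s))) ∧ ∀ t,
    Symb (offDiag2 Ω) (fun (_ : Ici (1 : ℝ)) (z : Vec2 × Vec2) => ‖z.2 - z.1‖) (-1)
      (fun s => dd t (dd u (dd v (kK d s)))) := by
  have hw := h.isWeight_dist (Ici (1 : ℝ))
  have hV := hw.isOpen
  have hZ := h.symb_dd_kZ
  have hch := fun {f : Vec2 × Vec2 → ℝ} (hf : Symb (Ω ×ˢ Ω)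
      (fun (_ : Ici (1 : ℝ)) z => √(kR d z)) (-1) (fun _ => f)) =>
    hf.change (h.isWeight_kR _) hw (fun z hz => hz.1) (fun _ z hz => h.norm_le_sqrt_kR hz.1)
      (by norm_num)
  have hT := h.symb_dd_kT (Ici (1 : ℝ))
  have hB := contDiff_kB h.smooth
  have hb : ∀ {f : Vec2 × Vec2 → ℝ}, ContDiff ℝ ∞ f → Symb (offDiag2 Ω)
      (fun (_ : Ici (1 : ℝ)) (z : Vec2 × Vec2) => ‖z.2 - z.1‖) (-1) (fun _ => f) := fun hf =>
    (Symb.of_contDiff hw ((h.bdd.prod h.bdd).subset inter_subset_left) hf).mono hw (by norm_num)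
  have hZd := fun (s : ℝ) => contDiff_kZ s
  have hTd : ContDiffOn ℝ ∞ (kT d) (offDiag2 Ω) :=
    contDiffOn_kT h.smooth fun z hz => h.kR_pos_of_offDiag hz
  have lin : ∀ (w : Vec2 × Vec2) {f g k : Vec2 × Vec2 → ℝ}, ContDiff ℝ ∞ f →
      ContDiffOn ℝ ∞ g (offDiag2 Ω) → ContDiff ℝ ∞ k →
      EqOn (dd w fun z => f z - g z + k z) (fun z => dd w f z - dd w g z + dd w k z) (offDiag2 Ω) :=
    fun w f g k hf hg hk => (((HasDD.of_contDiffOn hV hf.contDiffOn).sub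
      (HasDD.of_contDiffOn hV hg)).add (HasDD.of_contDiffOn hV hk.contDiffOn)).eqOn
  have e2 : ∀ s : ℝ, EqOn (dd u (dd v (kK d s))) (fun z => dd u (dd v (kZ s)) z
      - dd u (dd v (kT d)) z + dd u (dd v (kB d)) z) (offDiag2 Ω) := fun s z hz =>
    (dd_congr_of_isOpen hV (lin v (hZd s) hTd hB) u hz).trans
      (lin u ((hZd s).dd v) (hTd.dd hV v) (hB.dd v) hz)
  refine ⟨(((hZ.1 u v).sub hw (hch (hT.1 u v))).add hw (hb ((hB.dd v).dd u))).congr hw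
    fun s => e2 s, fun t => ?_⟩
  refine (((hZ.2 t u v).sub hw (hch (hT.2 t u v))).add hw (hb (((hB.dd v).dd u).dd t))).congr hw
    fun s z hz => ?_
  exact (dd_congr_of_isOpen hV (e2 s) t hz).trans
    (lin t (((hZd s).dd v).dd u) ((hTd.dd hV v).dd hV u) ((hB.dd v).dd u) hz)

/-- The parametrix is biharmonic to leading order. -/
theorem exists_lapY_lapY_dd_dd_kK (h : IsDefFun Ω d) (u v : Vec2) : ∃ C, ∀ s > 0, ∀ z ∈ Ω ×ˢ Ω,
    |lapY (lapY (dd (u, 0) (dd (v, 0) (kK d s)))) z - dd u (dd v (mollM s)) (z.2 - z.1)|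
      ≤ C * √(kR d z) ^ (-3 : ℤ) := by
  have hw := h.isWeight_kR Unit
  have hV := hw.isOpen
  have hpos : ∀ z ∈ Ω ×ˢ Ω, 0 < kR d z := fun z hz => h.kR_pos hz.1 (subset_closure hz.2)
  have hTd := contDiffOn_kT h.smooth hpos
  have hBd := (contDiff_kB h.smooth).contDiffOn (s := Ω ×ˢ Ω)
  have hT := ((h.symb_lapY_lapY_kT Unit).dd hw (v, 0)).dd hw (u, 0)
  have hb : Symb (Ω ×ˢ Ω) (fun (_ : Unit) z => √(kR d z)) 0
      (fun _ => dd (u, 0) (dd (v, 0) (lapY (lapY (kB d))))) :=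
    h.symb_smooth Unit (by
      have : ∀ {f : Vec2 × Vec2 → ℝ}, ContDiff ℝ ∞ f → ContDiff ℝ ∞ (lapY f) := fun hf =>
        ((hf.dd _).dd _).add ((hf.dd _).dd _)
      exact ((this (this (contDiff_kB h.smooth))).dd _).dd _)
  obtain ⟨C, hC0, hC⟩ := ((hT.neg hw).add hw (hb.mono hw (l := -1 - 1 - 1) (by norm_num))).bound hw
  refine ⟨C, fun s hs z hz => ?_⟩
  have hK := contDiffOn_kK h.smooth s hpos
  have hZd := (contDiff_kZ s).contDiffOn (s := Ω ×ˢ Ω)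
  have hsplit : EqOn (lapY (lapY (kK d s))) (fun z => mollM s (z.2 - z.1)
      + (-lapY (lapY (kT d)) z + lapY (lapY (kB d)) z)) (Ω ×ˢ Ω) := by
    have hadd : ∀ {f g : Vec2 × Vec2 → ℝ}, ContDiffOn ℝ ∞ f (Ω ×ˢ Ω) → ContDiffOn ℝ ∞ g (Ω ×ˢ Ω) →
        EqOn (lapY (lapY fun z => f z + g z)) (fun z => lapY (lapY f) z + lapY (lapY g) z)
          (Ω ×ˢ Ω) := fun hf hg z hz =>
      (lapY_congr hV (lapY_add hV hf hg) hz).trans (lapY_add hV (hf.lapY hV) (hg.lapY hV) hz)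
    have hneg : ∀ f : Vec2 × Vec2 → ℝ, lapY (fun z => -f z) = fun z => -lapY f z := fun f => by
      have : ∀ (f : Vec2 × Vec2 → ℝ) w, dd w (fun z => -f z) = fun z => -dd w f z := fun f w =>
        funext fun z => dd_neg f z w
      ext z; simp only [lapY, this]; ring
    intro z hz
    rw [show kK d s = fun z => kZ s z + (-kT d z + kB d z) from
      funext fun z => by rw [kK]; ring]
    refine (hadd hZd (hTd.neg.add hBd) hz).trans ?_
    rw [lapY_lapY_kZ hs]
    refine congrArg (_ + ·) ((hadd hTd.neg hBd hz).trans ?_)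
    rw [hneg, hneg]
  have hcomm : lapY (lapY (dd (u, 0) (dd (v, 0) (kK d s)))) z
      = dd (u, 0) (dd (v, 0) (lapY (lapY (kK d s)))) z := by
    have c1 : ∀ {f : Vec2 × Vec2 → ℝ}, ContDiffOn ℝ ∞ f (Ω ×ˢ Ω) → ∀ w,
      EqOn (lapY (lapY (dd w f))) (dd w (lapY (lapY f))) (Ω ×ˢ Ω) := fun hf w z hz =>
        (lapY_congr hV (lapY_dd_comm hV hf w) hz).trans (lapY_dd_comm hV (hf.lapY hV) w hz)
    exact (c1 (hK.dd hV _) _ hz).trans (dd_congr_of_isOpen hV (c1 hK _) _ hz)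
  have hm : ContDiff ℝ ∞ (mollM s) := contDiff_mollM s
  have hmd : ∀ {f : Vec2 → ℝ}, ContDiff ℝ ∞ f → ∀ w : Vec2, HasDD (Ω ×ˢ Ω) (w, 0)
      (fun z => f (z.2 - z.1)) (fun z => -dd w f (z.2 - z.1)) := fun {f} hf w z _ =>
    have hd := hf.differentiable (by simp) (z.2 - z.1)
    ⟨hd.comp z (by fun_prop), (dd_comp_diff hd _).trans (by simp [dd])⟩
  have hTT := (hTd.lapY hV).lapY hV
  have hBB := (hBd.lapY hV).lapY hV
  have hneg : ∀ {f : Vec2 × Vec2 → ℝ} {w}, ContDiffOn ℝ ∞ f (Ω ×ˢ Ω) →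
      HasDD (Ω ×ˢ Ω) w (fun z => -f z) (fun z => -dd w f z) := fun {f w} hf z hz =>
    ⟨(hf.diffAt hV hz).neg, dd_neg f z w⟩
  have h1 := (hmd hm v).add ((hneg (w := (v, 0)) hTT).add (HasDD.of_contDiffOn (v := (v, 0)) hV hBB))
  have h2 := (hneg (w := (u, 0)) (((hm.dd v).comp (contDiff_snd.sub contDiff_fst)).contDiffOn)).add
    ((hneg (w := (u, 0)) (hTT.dd hV (v, 0))).add (HasDD.of_contDiffOn (v := (u, 0)) hV (hBB.dd hV (v, 0))))
  have h3 := (dd_congr_of_isOpen hV (dd_congr_of_isOpen hV hsplit _) (u, 0) hz).trans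
    (h1.eqOn_dd hV h2 hz)
  have h4 := (hmd (hm.dd v) u z hz).2
  rw [hcomm, h3]
  refine le_trans (le_of_eq (congrArg _ ?_)) (hC () z hz)
  have h5 : dd (u, 0) (dd v (mollM s) ∘ fun p : Vec2 × Vec2 => p.2 - p.1) z
    = -dd u (dd v (mollM s)) (z.2 - z.1) := h4
  simp only [h5]
  ring

end IsDefFun

end RegKernelSymb

section TestFunction

open Filter Topology

/-- A test function which is adapted to second derivatives at `x`. -/
structure IsParametrix (Ω : Set Vec2) (d : Vec2 → ℝ) (x u v : Vec2) (r C δ : ℝ) (U : Set Vec2)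
    (φ : Vec2 → ℝ) : Prop where
  isOpen : IsOpen U
  closure_subset : closure Ω ⊆ U
  contDiffOn : ContDiffOn ℝ ∞ φ U
  eq_zero : ∀ y ∈ frontier Ω, φ y = 0
  dd_eq_zero : ∀ y ∈ frontier Ω, ∀ w, dd w φ y = 0
  local_eq : ∀ y, r ≤ ‖y - x‖ → φ =ᶠ[𝓝 y] fun _ => 0
  dd_le : ∀ y ∈ Ω, y ≠ x → ∀ k, |dd (e2 k) φ y| ≤ C * ‖y - x‖⁻¹
  dd_dd_le : ∀ y ∈ Ω, y ≠ x → ∀ k l, |dd (e2 k) (dd (e2 l) φ) y| ≤ C * (‖y - x‖ ^ 2)⁻¹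
  lap_lap_le : ∀ y ∈ Ω, y ≠ x → |lap (lap φ) y - dd u (dd v (mollM (δ ^ 2)⁻¹)) (y - x)|
    ≤ C * √(kR d (x, y)) ^ (-3 : ℤ)

namespace IsDefFun

variable {Ω : Set Vec2} {d : Vec2 → ℝ}

theorem exists_sqrt_kR_le (h : IsDefFun Ω d) : ∃ M, 0 ≤ M ∧ ∀ z ∈ Ω ×ˢ Ω, √(kR d z) ≤ M := by
  obtain ⟨C, hC0, hC⟩ := ((h.symb_smooth Unit (contDiff_kR h.smooth)).bound (h.isWeight_kR Unit))
  refine ⟨√C, by positivity, fun z hz => Real.sqrt_le_sqrt ?_⟩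
  simpa using (le_abs_self _).trans (hC () z hz)

theorem exists_parametrix (h : IsDefFun Ω d) (u v : Vec2) {r : ℝ} (hr : 0 < r) : ∃ C, 0 < C ∧ ∀ x ∈ Ω, ∀ δ > 0,
    δ ≤ 1 → δ ≤ r / 4 → (∀ y ∈ frontier Ω, δ < ‖y - x‖) →
    ∃ U φ, IsParametrix Ω d x u v r C δ U φ := by
  have hw := h.isWeight_dist (Ici (1 : ℝ))
  have hV := hw.isOpen
  obtain ⟨C1, hC1⟩ := h.exists_lapY_lapY_dd_dd_kK u v
  have hbs : ContDiff ℝ ∞ (fun z : Vec2 × Vec2 => bumpAt r (z.2 - z.1)) :=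
    (contDiff_bumpAt r).comp (contDiff_snd.sub contDiff_fst)
  have hb0 : Symb (offDiag2 Ω) (fun (_ : Ici (1 : ℝ)) (z : Vec2 × Vec2) => ‖z.2 - z.1‖) 0
      (fun _ z => bumpAt r (z.2 - z.1)) :=
    Symb.of_contDiff hw ((h.bdd.prod h.bdd).subset inter_subset_left) hbs
  have hK := h.symb_dd_kK (u, 0) (v, 0)
  set H : ℝ → Vec2 × Vec2 → ℝ := fun s => dd (u, 0) (dd (v, 0) (kK d s)) with hH
  set Φ : ℝ → Vec2 × Vec2 → ℝ := fun s z => bumpAt r (z.2 - z.1) * H s z with hΦ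
  have hΦ1 : Symb (offDiag2 Ω) (fun (_ : Ici (1 : ℝ)) (z : Vec2 × Vec2) => ‖z.2 - z.1‖) (-1)
      (fun s => Φ s) := hb0.mul' hw hK.1 (by norm_num)
  set W : Set (Vec2 × Vec2) := {z | 0 < kR d z} with hWd
  have hWo : IsOpen W := isOpen_lt continuous_const (contDiff_kR h.smooth).continuous
  have hWcl : ∀ x ∈ Ω, ∀ y ∈ closure Ω, (x, y) ∈ W := fun x hx y hy => h.kR_pos hx hy
  have hVW : offDiag2 Ω ⊆ W := fun z hz => hWcl _ hz.1.1 _ (subset_closure hz.1.2)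
  have hHW : ∀ s, ContDiffOn ℝ ∞ (H s) W := fun s =>
    ((contDiffOn_kK h.smooth s fun z hz => hz).dd hWo _).dd hWo _
  have hΦW : ∀ s, ContDiffOn ℝ ∞ (Φ s) W := fun s => hbs.contDiffOn.mul (hHW s)
  have hprod : ∀ s t, EqOn (dd t (Φ s)) (fun z => dd t (fun z => bumpAt r (z.2 - z.1)) z * H s z
      + bumpAt r (z.2 - z.1) * dd t (H s) z) W := fun s t z hz =>
    (((HasDD.of_contDiffOn hWo hbs.contDiffOn).mul
      (HasDD.of_contDiffOn hWo (hHW s))).eqOn hz).trans (by ring)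
  have hΦd : ∀ t, Symb (offDiag2 Ω) (fun (_ : Ici (1 : ℝ)) (z : Vec2 × Vec2) => ‖z.2 - z.1‖) (-1)
      (fun s => dd t (Φ s)) := fun t =>
    (((Symb.of_contDiff hw ((h.bdd.prod h.bdd).subset inter_subset_left) (hbs.dd t)).mul' hw hK.1
      (m := -1) (by norm_num)).add hw (hb0.mul' hw (hK.2 t) (m := -1) (by norm_num))).congr hw
      fun s z hz => hprod s t (hVW hz)
  have hΦdd : ∀ t t', Symb (offDiag2 Ω) (fun (_ : Ici (1 : ℝ)) (z : Vec2 × Vec2) => ‖z.2 - z.1‖)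
      (-1 - 1) (fun s => dd t' (dd t (Φ s))) := fun t t' => (hΦd t).dd hw t'
  choose A hA0 hA using fun k : Fin 2 => (hΦd (0, e2 k)).bound hw
  choose B hB0 hB using fun k l : Fin 2 => (hΦdd (0, e2 l) (0, e2 k)).bound hw
  obtain ⟨D, hD0, hD⟩ := ((hΦ1.lapY hw).lapY hw).bound hw
  obtain ⟨M, hM0, hM⟩ := h.exists_sqrt_kR_le
  set C := ∑ k, A k + ∑ k, ∑ l, B k l + |C1| + D * (r / 2) ^ (-1 - 2 - 2 : ℤ) * M ^ (3 : ℕ) + 1 with hC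
  have hDM : 0 ≤ D * (r / 2) ^ (-1 - 2 - 2 : ℤ) * M ^ (3 : ℕ) := by positivity
  have hAs : ∀ k, A k ≤ ∑ k, A k := fun k => Finset.single_le_sum (fun i _ => hA0 i) (Finset.mem_univ k)
  have hBs : ∀ k l, B k l ≤ ∑ k, ∑ l, B k l := fun k l =>
    (Finset.single_le_sum (fun i _ => hB0 k i) (Finset.mem_univ l)).trans
      (Finset.single_le_sum (f := fun k => ∑ l, B k l) (fun i _ => Finset.sum_nonneg fun j _ => hB0 i j)
        (Finset.mem_univ k))
  have hAS : 0 ≤ ∑ k, A k := Finset.sum_nonneg fun k _ => hA0 k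
  have hBS : 0 ≤ ∑ k, ∑ l, B k l := Finset.sum_nonneg fun k _ => Finset.sum_nonneg fun l _ => hB0 k l
  have hC1' := abs_nonneg C1
  refine ⟨C, by positivity, fun x hx δ hδ hδ1 hδr hδf => ?_⟩
  have hs1 : (1 : ℝ) ≤ (δ ^ 2)⁻¹ := (one_le_inv₀ (by positivity)).2 (pow_le_one₀ hδ.le hδ1)
  set s : ℝ := (δ ^ 2)⁻¹ with hs
  have hs0 : 0 < s := by positivity
  have hmem : ∀ y ∈ Ω, y ≠ x → (x, y) ∈ offDiag2 Ω := fun y hy hyx => ⟨⟨hx, hy⟩, hyx.symm⟩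
  have hbf : ∀ y ∈ frontier Ω, 1 < s * kS (x, y) := fun y hy => by
    rw [kS_eq, hs, inv_mul_eq_div, one_lt_div (by positivity)]
    exact pow_lt_pow_left₀ (hδf y hy) hδ.le (by norm_num)
  refine ⟨{y | (x, y) ∈ W}, fun y => Φ s (x, y), ?_⟩
  refine ⟨isOpen_slice hWo x, fun y hy => hWcl x hx y hy, (hΦW s).slice x, fun y hy => ?_,
    fun y hy w => ?_, fun y hy => ?_, fun y hy hyx k => ?_, fun y hy hyx k l => ?_, fun y hy hyx => ?_⟩
  · simp [hΦ, hH, (h.dd_dd_kK_frontier hs0 hx hy (hbf y hy) u v).1]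
  · have hyW := hWcl x hx y (frontier_subset_closure hy)
    have h1 := h.dd_dd_kK_frontier hs0 hx hy (hbf y hy) u v
    rw [dd_slice_eqOn hWo (hΦW s) x w hyW]
    beta_reduce
    rw [hprod s _ hyW]
    simp [hH, h1.1, h1.2 w]
  · have ho : IsOpen {y : Vec2 | r ^ 2 < 2 * ‖y - x‖ ^ 2} :=
      isOpen_lt continuous_const (by fun_prop)
    filter_upwards [ho.mem_nhds (show r ^ 2 < 2 * ‖y - x‖ ^ 2 by
      have := pow_le_pow_left₀ hr.le hy 2; nlinarith)] with y' hy'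
    simp [hΦ, bumpAt_eq_zero hr (le_of_lt hy')]
  · rw [dd_slice_eqOn hWo (hΦW s) x _ (hVW (hmem y hy hyx))]
    refine (hA k ⟨s, hs1⟩ _ (hmem y hy hyx)).trans ?_
    rw [zpow_neg_one]
    exact mul_le_mul_of_nonneg_right (by linarith [hAs k]) (by positivity)
  · rw [dd_dd_slice_eqOn hWo (hΦW s) x _ _ (hVW (hmem y hy hyx))]
    refine (hB k l ⟨s, hs1⟩ _ (hmem y hy hyx)).trans ?_
    rw [show (-1 - 1 : ℤ) = -((2 : ℕ) : ℤ) by norm_num, zpow_neg, zpow_natCast]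
    exact mul_le_mul_of_nonneg_right (by linarith [hBs k l]) (by positivity)
  · have hRp : 0 < √(kR d (x, y)) := Real.sqrt_pos.2 (hWcl x hx y (subset_closure hy))
    rcases lt_or_ge ‖y - x‖ (r / 2) with hlt | hge
    · have hev : (fun y => Φ s (x, y)) =ᶠ[𝓝 y] fun y => H s (x, y) := by
        filter_upwards [(isOpen_lt (f := fun y : Vec2 => ‖y - x‖) (by fun_prop)
          continuous_const).mem_nhds hlt] with y' hy'
        simp [hΦ, bumpAt_eq_one hr (le_of_lt hy')]
      rw [hev.lap.lap.eq_of_nhds, lap_lap_slice_eqOn hWo (hHW s) x (hVW (hmem y hy hyx))]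
      refine (hC1 s hs0 (x, y) ⟨hx, hy⟩).trans ?_
      refine mul_le_mul_of_nonneg_right ?_ (by positivity)
      have := le_abs_self C1
      linarith
    · rw [lap_lap_slice_eqOn hWo (hΦW s) x (hVW (hmem y hy hyx))]
      have hnt : ∀ f : Vec2 → ℝ, tsupport f ⊆ Metric.closedBall 0 δ → f (y - x) = 0 := fun f hf => by
        by_contra h0
        have := hf (subset_tsupport f h0)
        rw [mem_closedBall_zero_iff] at this
        linarith
      rw [hnt _ ((tsupport_dd_subset _ _).trans ((tsupport_dd_subset _ _).trans
        (tsupport_mollM_subset hδ))), sub_zero]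
      refine (hD ⟨s, hs1⟩ _ (hmem y hy hyx)).trans ?_
      have h1 : ‖y - x‖ ^ (-1 - 2 - 2 : ℤ) ≤ (r / 2) ^ (-1 - 2 - 2 : ℤ) := by
        rw [show (-1 - 2 - 2 : ℤ) = -((5 : ℕ) : ℤ) by norm_num, zpow_neg, zpow_neg, zpow_natCast,
          zpow_natCast]
        gcongr
      have h2 : 1 ≤ M ^ (3 : ℕ) * √(kR d (x, y)) ^ (-3 : ℤ) := by
        rw [show (-3 : ℤ) = -((3 : ℕ) : ℤ) by norm_num, zpow_neg, zpow_natCast, ← div_eq_mul_inv,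
          one_le_div (by positivity)]
        gcongr
        exact hM _ ⟨hx, hy⟩
      calc D * ‖y - x‖ ^ (-1 - 2 - 2 : ℤ) ≤ D * (r / 2) ^ (-1 - 2 - 2 : ℤ) := by gcongr
        _ ≤ D * (r / 2) ^ (-1 - 2 - 2 : ℤ) * (M ^ (3 : ℕ) * √(kR d (x, y)) ^ (-3 : ℤ)) :=
          le_mul_of_one_le_right (by positivity) h2
        _ = (D * (r / 2) ^ (-1 - 2 - 2 : ℤ) * M ^ (3 : ℕ)) * √(kR d (x, y)) ^ (-3 : ℤ) := by ring
        _ ≤ C * √(kR d (x, y)) ^ (-3 : ℤ) := mul_le_mul_of_nonneg_right (by linarith) (by positivity)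

end IsDefFun

end TestFunction

section Radial

/-- Integration of a radial function which is supported in an annulus. -/
theorem integral_radial {g k : ℝ → ℝ} {a b : ℝ} (ha : 0 ≤ a) (hab : a ≤ b)
    (hk : IntervalIntegrable k volume a b) (h : ∀ t > 0, t * g t = (Ioc a b).indicator k t)
    (x : Vec2) : Integrable (fun y : Vec2 => g ‖y - x‖) ∧ ∫ y : Vec2, g ‖y - x‖ =
      2 * volume.real (Metric.ball (0 : Vec2) 1) * ∫ t in a..b, k t := by
  have hsub : Ioc a b ⊆ Ioi 0 := fun t ht => ha.trans_lt ht.1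
  have hi : IntegrableOn (fun t => t * g t) (Ioi 0) :=
    (integrableOn_congr_fun (fun t ht => h t ht) measurableSet_Ioi).2
      (((integrable_indicator_iff measurableSet_Ioc).2 hk.1).integrableOn)
  refine ⟨?_, ?_⟩
  · refine Integrable.comp_sub_right (f := fun y : Vec2 => g ‖y‖) ?_ x
    rw [integrable_fun_norm_addHaar volume (f := g)]
    simpa using hi
  · rw [integral_sub_right_eq_self (fun y : Vec2 => g ‖y‖) x, integral_fun_norm_addHaar volume g,
      intervalIntegral.integral_of_le hab]
    have : ∫ t in Ioi (0 : ℝ), t * g t = ∫ t in Ioc a b, k t := by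
      rw [setIntegral_congr_fun measurableSet_Ioi (fun t ht => h t ht),
        setIntegral_indicator measurableSet_Ioc, inter_eq_self_of_subset_right hsub]
    simp [mul_assoc, ← this]

/-- A weakly singular power of the distance is integrable, uniformly in the pole. -/
theorem exists_setIntegral_rpow_le {Ω : Set Vec2} (hb : Bornology.IsBounded Ω)
    (hm : MeasurableSet Ω) {α : ℝ} (hα : α < 2) : ∃ C, 0 ≤ C ∧ ∀ x ∈ Ω,
    IntegrableOn (fun y => ‖y - x‖ ^ (-α)) Ω ∧ ∫ y in Ω, ‖y - x‖ ^ (-α) ≤ C := by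
  obtain ⟨M, hM⟩ := Metric.isBounded_iff.1 hb
  set g : ℝ → ℝ := (Iic |M|).indicator fun t => t ^ (-α) with hg
  have h0 : ∀ y x : Vec2, 0 ≤ g ‖y - x‖ := fun y x =>
    indicator_apply_nonneg fun _ => Real.rpow_nonneg (norm_nonneg _) _
  have heq : ∀ x ∈ Ω, EqOn (fun y => ‖y - x‖ ^ (-α)) (fun y => g ‖y - x‖) Ω := fun x hx y hy => by
    have : ‖y - x‖ ∈ Iic |M| := by
      rw [← dist_eq_norm]; exact (hM hy hx).trans (le_abs_self _)
    simp [hg, indicator_of_mem this]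
  have key := integral_radial (g := g) (k := fun t => t ^ (1 - α)) le_rfl (abs_nonneg M)
    (intervalIntegral.intervalIntegrable_rpow' (by linarith)) fun t ht => by
      by_cases h : t ≤ |M|
      · rw [hg, indicator_of_mem (show t ∈ Iic |M| from h), indicator_of_mem (show t ∈ Ioc 0 |M| from ⟨ht, h⟩),
          sub_eq_add_neg, Real.rpow_add ht, Real.rpow_one]
      · rw [hg, indicator_of_notMem (show t ∉ Iic |M| from h), indicator_of_notMem fun h' => h h'.2,
          mul_zero]
  refine ⟨∫ y, g ‖y - (0 : Vec2)‖, integral_nonneg (h0 · 0), fun x hx => ⟨?_, ?_⟩⟩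
  · exact (integrableOn_congr_fun (heq x hx) hm).2 (key x).1.integrableOn
  · rw [setIntegral_congr_fun hm (heq x hx)]
    exact (setIntegral_le_integral (key x).1 (Filter.Eventually.of_forall (h0 · x))).trans
      ((key x).2.trans (key 0).2.symm).le

/-- The logarithmic divergence of the inverse square of the distance. -/
theorem exists_setIntegral_inv_sq_le {Ω : Set Vec2} (hb : Bornology.IsBounded Ω)
    (hm : MeasurableSet Ω) : ∃ C, 0 ≤ C ∧ ∀ x ∈ Ω, ∀ κ : ℝ, 0 < κ → κ ≤ 1 →
    IntegrableOn (fun y => {y | κ < ‖y - x‖}.indicator (fun y => (‖y - x‖ ^ 2)⁻¹) y) Ω ∧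
    ∫ y in Ω, {y | κ < ‖y - x‖}.indicator (fun y => (‖y - x‖ ^ 2)⁻¹) y
      ≤ C * (1 + Real.log κ⁻¹) := by
  obtain ⟨M, hM⟩ := Metric.isBounded_iff.1 hb
  have hM1 : 1 ≤ |M| + 1 := by linarith [abs_nonneg M]
  have hlog := Real.log_nonneg hM1
  set v := volume.real (Metric.ball (0 : Vec2) 1) with hv
  have hv0 : 0 ≤ v := measureReal_nonneg
  refine ⟨2 * v * (1 + Real.log (|M| + 1)), by positivity, fun x hx κ hκ hκ1 => ?_⟩
  set g : ℝ → ℝ := (Ioc κ (|M| + 1)).indicator fun t => (t ^ 2)⁻¹ with hg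
  have h0 : ∀ y x : Vec2, 0 ≤ g ‖y - x‖ := fun y x =>
    indicator_apply_nonneg fun _ => by positivity
  have heq : EqOn (fun y => {y | κ < ‖y - x‖}.indicator (fun y => (‖y - x‖ ^ 2)⁻¹) y)
      (fun y => g ‖y - x‖) Ω := fun y hy => by
    have : ‖y - x‖ ≤ |M| + 1 := by
      rw [← dist_eq_norm]; exact (hM hy hx).trans (by linarith [le_abs_self M])
    by_cases h : κ < ‖y - x‖
    · simp [hg, indicator, h, this]
    · simp [hg, indicator, h]
  have key := integral_radial (g := g) (k := fun t => t⁻¹) hκ.le (hκ1.trans hM1)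
    (intervalIntegral.intervalIntegrable_inv (fun t ht => by
      rw [uIcc_of_le (hκ1.trans hM1)] at ht; linarith [ht.1]) continuousOn_id) (fun t ht => by
      by_cases h : t ∈ Ioc κ (|M| + 1)
      · rw [hg, indicator_of_mem h, indicator_of_mem h]; field_simp
      · rw [hg, indicator_of_notMem h, indicator_of_notMem h, mul_zero]) x
  refine ⟨(integrableOn_congr_fun heq hm).2 key.1.integrableOn, ?_⟩
  rw [setIntegral_congr_fun hm heq]
  refine (setIntegral_le_integral key.1 (Filter.Eventually.of_forall (h0 · x))).trans
    (key.2.le.trans ?_)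
  rw [integral_inv_of_pos hκ (by linarith), div_eq_mul_inv, Real.log_mul (by linarith)
    (by positivity), ← hv]
  have : 0 ≤ Real.log κ⁻¹ := Real.log_nonneg ((one_le_inv₀ hκ).2 hκ1)
  rw [mul_assoc (2 * v)]
  refine mul_le_mul_of_nonneg_left ?_ (by positivity)
  nlinarith

end Radial

section LocLoad

open Filter Topology

theorem exists_dd_bumpAt_le : ∃ C, 0 ≤ C ∧ ∀ ε > 0, ∀ y : Vec2, ∀ j,
    |dd (e2 j) (bumpAt ε) y| ≤ {y | ε / 3 < ‖y‖}.indicator (fun y : Vec2 => C * ‖y‖⁻¹) y := by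
  obtain ⟨S, hS⟩ := hasCompactSupport_deriv_stepFun.exists_bound_of_continuous
    (stepFun_contDiff.continuous_deriv (by simp))
  have hS0 : 0 ≤ S := (norm_nonneg _).trans (hS 0)
  refine ⟨4 * S, by positivity, fun ε hε y j => ?_⟩
  rcases lt_or_ge ‖y‖ (ε / 2) with h1 | h1
  · have : bumpAt ε =ᶠ[𝓝 y] fun _ => 1 := by
      filter_upwards [(isOpen_lt continuous_norm continuous_const).mem_nhds h1] with z hz
      exact bumpAt_eq_one hε (le_of_lt hz)
    rw [(this.dd _).eq_of_nhds, dd_const, abs_zero]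
    exact indicator_apply_nonneg fun _ => by positivity
  have hm : y ∈ {y : Vec2 | ε / 3 < ‖y‖} := by
    change ε / 3 < ‖y‖
    linarith
  have hy : 0 < ‖y‖ := by linarith
  rw [indicator_of_mem hm]
  rcases lt_or_ge ε ‖y‖ with h2 | h2
  · have : bumpAt ε =ᶠ[𝓝 y] fun _ => 0 := by
      filter_upwards [(isOpen_lt continuous_const continuous_norm).mem_nhds h2] with z hz
      exact bumpAt_eq_zero hε (by have := pow_le_pow_left₀ hε.le (le_of_lt hz) 2; nlinarith)
    rw [(this.dd _).eq_of_nhds, dd_const, abs_zero]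
    positivity
  have e1 : dd (e2 j) (bumpAt ε) y
      = - (deriv stepFun (2 * (ε ^ 2)⁻¹ * sqN y) * (2 * (ε ^ 2)⁻¹) * (2 * y j)) := by
    have hd : ∀ t, HasDerivAt (fun t => 1 - stepFun (2 * (ε ^ 2)⁻¹ * t))
        (-(deriv stepFun (2 * (ε ^ 2)⁻¹ * t) * (2 * (ε ^ 2)⁻¹))) t := fun t => by
      have h1 : HasDerivAt stepFun _ (2 * (ε ^ 2)⁻¹ * t) :=
        (stepFun_contDiff.differentiable (by simp) _).hasDerivAt
      have h2 : HasDerivAt (fun t => 2 * (ε ^ 2)⁻¹ * t) (2 * (ε ^ 2)⁻¹) t := by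
        simpa using (hasDerivAt_id t).const_mul (2 * (ε ^ 2)⁻¹)
      simpa using (h1.comp t h2).const_sub 1
    have h1 : dd (e2 j) (bumpAt ε) y = _ :=
      (hasDD_comp_sqN (f := fun t => 1 - stepFun (2 * (ε ^ 2)⁻¹ * t)) (contDiff_const.sub
        (stepFun_contDiff.comp (contDiff_const.mul contDiff_id))) (e2 j)).eqOn (mem_univ y)
    rw [h1, (hd _).deriv]
    fin_cases j <;> simp [e2]
  rw [e1, abs_neg, abs_mul, abs_mul, abs_of_pos (show (0 : ℝ) < 2 * (ε ^ 2)⁻¹ by positivity),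
    abs_mul 2, abs_two]
  have h3 := abs_coord_le y j
  have h4 : |deriv stepFun (2 * (ε ^ 2)⁻¹ * sqN y)| ≤ S := hS _
  calc _ ≤ S * (2 * (ε ^ 2)⁻¹) * (2 * ‖y‖) := by gcongr
    _ ≤ S * (2 * (‖y‖ ^ 2)⁻¹) * (2 * ‖y‖) := by gcongr
    _ = 4 * S * ‖y‖⁻¹ := by field_simp; ring

theorem bumpAt_mem_Icc (r : ℝ) (y : Vec2) : bumpAt r y ∈ Icc (0 : ℝ) 1 :=
  ⟨sub_nonneg.2 (stepFun_le_one _), sub_le_self _ (stepFun_nonneg _)⟩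

theorem abs_perp_le {φ : Vec2 → ℝ} {y : Vec2} {b : ℝ} (h : ∀ k, |dd (e2 k) φ y| ≤ b) (i : Fin 2) :
    |perp φ i y| ≤ b := by
  fin_cases i
  · simpa [perp] using h 1
  · simpa [perp] using h 0

theorem abs_dd_perp_le {φ : Vec2 → ℝ} {y : Vec2} {b : ℝ} (h : ∀ k l, |dd (e2 k) (dd (e2 l) φ) y| ≤ b)
    (i j : Fin 2) : |dd (e2 j) (perp φ i) y| ≤ b := by
  fin_cases i
  · have : dd (e2 j) (perp φ 0) y = - dd (e2 j) (dd (e2 1) φ) y := dd_neg _ _ _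
    simpa [this] using h j 1
  · simpa [perp] using h j 0

/-- Hölder's inequality against a weakly singular power of the distance. -/
theorem exists_setIntegral_mul_rpow_le {Ω : Set Vec2} (hb : Bornology.IsBounded Ω)
    (hm : MeasurableSet Ω) {q : ℝ≥0∞} (hq : 2 < q) (hq' : q < ⊤) : ∃ a : ℝ, 0 < a ∧ ∃ C, 0 ≤ C ∧
    ∀ x ∈ Ω, ∀ (g : Vec2 → ℝ) (B : ℝ), 0 ≤ B → MemLp g q (volume.restrict Ω) →
      eLpNorm g q (volume.restrict Ω) ≤ ENNReal.ofReal B →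
      IntegrableOn (fun y => |g y| * ‖y - x‖ ^ (-(1 + a))) Ω ∧
      ∫ y in Ω, |g y| * ‖y - x‖ ^ (-(1 + a)) ≤ B * C := by
  set Q := q.toReal with hQ
  have hqQ : q = ENNReal.ofReal Q := (ENNReal.ofReal_toReal hq'.ne).symm
  have hQ2 : 2 < Q := by
    rw [hQ, show (2 : ℝ) = (2 : ℝ≥0∞).toReal by simp]
    exact (ENNReal.toReal_lt_toReal (by simp) hq'.ne).2 hq
  have hconj := Real.HolderConjugate.conjExponent (show 1 < Q by linarith)
  set Q' := Real.conjExponent Q with hQ'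
  have hQ'e : Q' = Q / (Q - 1) := rfl
  have hQ'0 : 0 < Q' := hconj.symm.pos
  refine ⟨1 / 2 - 1 / Q, by
    rw [sub_pos]; exact one_div_lt_one_div_of_lt (by norm_num) hQ2, ?_⟩
  set α := 1 + (1 / 2 - 1 / Q) with hα
  have hα2 : α * Q' < 2 := by
    rw [hQ'e, hα, ← mul_div_assoc, div_lt_iff₀ (by linarith)]
    have : (1 + (1 / 2 - 1 / Q)) * Q = 3 / 2 * Q - 1 := by field_simp; ring
    linarith
  obtain ⟨C, hC0, hC⟩ := exists_setIntegral_rpow_le hb hm hα2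
  refine ⟨C ^ (1 / Q'), by positivity, fun x hx g B hB hg hgB => ?_⟩
  obtain ⟨h1, h2⟩ := hC x hx
  have hpow : ∀ y : Vec2, (‖y - x‖ ^ (-α)) ^ Q' = ‖y - x‖ ^ (-(α * Q')) := fun y => by
    rw [← Real.rpow_mul (norm_nonneg _), neg_mul]
  have hmeas : AEStronglyMeasurable (fun y : Vec2 => ‖y - x‖ ^ (-α)) (volume.restrict Ω) :=
    (((measurable_id.sub_const x).norm).pow_const _).aestronglyMeasurable
  have hML : MemLp (fun y : Vec2 => ‖y - x‖ ^ (-α)) (ENNReal.ofReal Q') (volume.restrict Ω) := by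
    rw [← integrable_norm_rpow_iff hmeas (by simpa using hQ'0) (by simp)]
    refine Integrable.congr h1 (Filter.Eventually.of_forall fun y => ?_)
    beta_reduce
    rw [ENNReal.toReal_ofReal hQ'0.le, Real.norm_of_nonneg (by positivity), hpow]
  have hga : MemLp (fun y => |g y|) (ENNReal.ofReal Q) (volume.restrict Ω) := hqQ ▸ hg.norm
  have hhol : ENNReal.HolderConjugate (ENNReal.ofReal Q) (ENNReal.ofReal Q') := hconj.ennrealOfReal
  refine ⟨hga.integrable_mul hML, ?_⟩
  refine (integral_mul_le_Lp_mul_Lq_of_nonneg hconj (Filter.Eventually.of_forall fun y => abs_nonneg _)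
    (Filter.Eventually.of_forall fun y => by positivity) hga hML).trans ?_
  have hI : (∫ y in Ω, |g y| ^ Q) ^ (1 / Q) ≤ B := by
    have := hg.eLpNorm_eq_integral_rpow_norm (by rintro rfl; simp at hq) hq'.ne
    rw [this, ENNReal.ofReal_le_ofReal_iff hB] at hgB
    simpa using hgB
  have hJ : (∫ y in Ω, (‖y - x‖ ^ (-α)) ^ Q') ^ (1 / Q') ≤ C ^ (1 / Q') := by
    simp only [hpow]
    exact Real.rpow_le_rpow (setIntegral_nonneg hm fun y _ => by positivity) h2 (by positivity)
  exact mul_le_mul hI hJ (Real.rpow_nonneg (setIntegral_nonneg hm fun y _ => by positivity) _) hB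

/-- The logarithmic bound for the localised load. -/
theorem IsDefFun.exists_locLoad_le {Ω : Set Vec2} {d : Vec2 → ℝ} (h : IsDefFun Ω d) {q : ℝ≥0∞}
    (hq : 2 < q) (hq' : q < ⊤) : ∃ C, 0 ≤ C ∧ ∀ x ∈ Ω, ∀ (φ : Vec2 → ℝ) (C1 : ℝ), 0 ≤ C1 →
    (∀ y ∈ Ω, y ≠ x → ∀ k, |dd (e2 k) φ y| ≤ C1 * ‖y - x‖⁻¹) →
    (∀ y ∈ Ω, y ≠ x → ∀ k l, |dd (e2 k) (dd (e2 l) φ) y| ≤ C1 * (‖y - x‖ ^ 2)⁻¹) →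
    ∀ (G : Fin 2 → Fin 2 → Vec2 → ℝ) (A B : ℝ), 0 ≤ A → 0 ≤ B →
    (∀ i j, ∀ y ∈ Ω, |G i j y| ≤ A) →
    (∀ i j, MemLp (dd (e2 j) (G i j)) q (volume.restrict Ω)) →
    (∀ i j, eLpNorm (dd (e2 j) (G i j)) q (volume.restrict Ω) ≤ ENNReal.ofReal B) →
    ∃ χ, ContDiff ℝ ∞ χ ∧
      |locLoad Ω G χ φ| ≤ C * C1 * ((1 + A) * Real.log (Real.exp 1 + B)) := by
  have hm := h.isOpen.measurableSet
  obtain ⟨Cb, hCb0, hCb⟩ := exists_dd_bumpAt_le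
  obtain ⟨a, ha, Ch, hCh0, hCh⟩ := exists_setIntegral_mul_rpow_le h.bdd hm hq hq'
  obtain ⟨Cl, hCl0, hCl⟩ := exists_setIntegral_inv_sq_le h.bdd hm
  have hl3 : 0 ≤ Real.log 3 := Real.log_nonneg (by norm_num)
  refine ⟨4 * ((1 + Cb) * (Cl * (1 + Real.log 3 + 1 / a)) + Ch), by positivity,
    fun x hx φ C1 hC1 hφ1 hφ2 G A B hA hB hGA hGq hGB => ?_⟩
  set Y := Real.exp 1 + B with hY
  have hY1 : Real.exp 1 ≤ Y := by linarith
  have hYe : 1 < Y := lt_of_lt_of_le (by simp) hY1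
  have hY0 : 0 < Y := by linarith
  have hlog : 1 ≤ Real.log Y := (Real.le_log_iff_exp_le hY0).2 hY1
  set ε := Y ^ (-(1 / a)) with hε
  have hε0 : 0 < ε := by positivity
  have hε1 : ε ≤ 1 := Real.rpow_le_one_of_one_le_of_nonpos hYe.le (by
    have : 0 < 1 / a := by positivity
    linarith)
  have hεa : ε ^ a = Y⁻¹ := by
    rw [hε, ← Real.rpow_mul hY0.le, neg_mul, one_div_mul_cancel ha.ne', Real.rpow_neg_one]
  have hlogε : Real.log (ε / 3)⁻¹ = Real.log 3 + 1 / a * Real.log Y := by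
    rw [Real.log_inv, Real.log_div hε0.ne' (by norm_num), hε, Real.log_rpow hY0]; ring
  have hχs : ContDiff ℝ ∞ (fun y => bumpAt ε (y - x)) :=
    (contDiff_bumpAt ε).comp (contDiff_id.sub contDiff_const)
  refine ⟨fun y => bumpAt ε (y - x), hχs, ?_⟩
  have hχd : ∀ j y, dd (e2 j) (fun y => bumpAt ε (y - x)) y = dd (e2 j) (bumpAt ε) (y - x) :=
    fun j y => by
      rw [dd, dd, fderiv_comp_sub]
  obtain ⟨hl1, hl2⟩ := hCl x hx (ε / 3) (by positivity) (by linarith)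
  set K : Vec2 → ℝ := fun y => {y | ε / 3 < ‖y - x‖}.indicator (fun y => (‖y - x‖ ^ 2)⁻¹) y with hK
  have hae : ∀ᵐ y ∂(volume.restrict Ω), y ∈ Ω ∧ y ≠ x :=
    (ae_restrict_mem hm).and (ae_restrict_of_ae (Measure.ae_ne volume x))
  have hT1 : ∀ i j, |∫ y in Ω, G i j y * ((1 - bumpAt ε (y - x)) * dd (e2 j) (perp φ i) y
      - dd (e2 j) (fun y => bumpAt ε (y - x)) y * perp φ i y)|
      ≤ A * (C1 * (1 + Cb)) * (Cl * ((1 + Real.log 3 + 1 / a) * Real.log Y)) := fun i j => by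
    rw [← Real.norm_eq_abs]
    refine (norm_integral_le_of_norm_le (g := fun y => A * (C1 * (1 + Cb)) * K y)
      (hl1.const_mul _) ?_).trans ?_
    · filter_upwards [hae] with y ⟨hy, hyx⟩
      have hyx' : 0 < ‖y - x‖ := norm_pos_iff.2 (sub_ne_zero.2 hyx)
      have hp1 := abs_perp_le (hφ1 y hy hyx) i
      have hp2 := abs_dd_perp_le (hφ2 y hy hyx) i j
      rw [Real.norm_eq_abs, abs_mul, hχd, mul_assoc A]
      refine mul_le_mul (hGA i j y hy) ?_ (abs_nonneg _) hA
      refine (abs_sub _ _).trans ?_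
      rw [abs_mul, abs_mul]
      have hb := hCb ε hε0 (y - x) j
      by_cases hin : ε / 3 < ‖y - x‖
      · rw [indicator_of_mem (show y - x ∈ {y : Vec2 | ε / 3 < ‖y‖} from hin)] at hb
        rw [hK]
        beta_reduce
        rw [indicator_of_mem (show y ∈ {y : Vec2 | ε / 3 < ‖y - x‖} from hin)]
        have hb1 : |1 - bumpAt ε (y - x)| ≤ 1 := by
          have := bumpAt_mem_Icc ε (y - x)
          exact abs_le.2 ⟨by linarith [this.2], by linarith [this.1]⟩
        calc _ ≤ 1 * (C1 * (‖y - x‖ ^ 2)⁻¹) + Cb * ‖y - x‖⁻¹ * (C1 * ‖y - x‖⁻¹) := by gcongr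
          _ = _ := by field_simp
      · rw [indicator_of_notMem (show y - x ∉ {y : Vec2 | ε / 3 < ‖y‖} from hin)] at hb
        rw [bumpAt_eq_one hε0 (by linarith), le_antisymm hb (abs_nonneg _), hK]
        beta_reduce
        rw [indicator_of_notMem (show y ∉ {y : Vec2 | ε / 3 < ‖y - x‖} from hin)]
        simp
    · rw [integral_const_mul]
      refine mul_le_mul_of_nonneg_left (hl2.trans (mul_le_mul_of_nonneg_left ?_ hCl0)) (by positivity)
      rw [hlogε]
      nlinarith
  have hT2 : ∀ i j, |∫ y in Ω, dd (e2 j) (G i j) y * (bumpAt ε (y - x) * perp φ i y)| ≤ C1 * Ch := fun i j => by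
    obtain ⟨hh1, hh2⟩ := hCh x hx _ B hB (hGq i j) (hGB i j)
    rw [← Real.norm_eq_abs]
    refine (norm_integral_le_of_norm_le
      (g := fun y => C1 * Y⁻¹ * (|dd (e2 j) (G i j) y| * ‖y - x‖ ^ (-(1 + a))))
      (hh1.const_mul _) ?_).trans ?_
    · filter_upwards [hae] with y ⟨hy, hyx⟩
      have hyx' : 0 < ‖y - x‖ := norm_pos_iff.2 (sub_ne_zero.2 hyx)
      have hp1 := abs_perp_le (hφ1 y hy hyx) i
      rw [Real.norm_eq_abs, abs_mul, abs_mul, mul_left_comm (C1 * Y⁻¹)]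
      refine mul_le_mul_of_nonneg_left ?_ (abs_nonneg _)
      have hbm := bumpAt_mem_Icc ε (y - x)
      rcases lt_or_ge ε ‖y - x‖ with hlt | hge
      · rw [bumpAt_eq_zero hε0 (by have := pow_le_pow_left₀ hε0.le hlt.le 2; nlinarith)]
        simp only [abs_zero, zero_mul]
        positivity
      · have : ‖y - x‖⁻¹ ≤ Y⁻¹ * ‖y - x‖ ^ (-(1 + a)) := by
          rw [← hεa, neg_add, Real.rpow_add hyx', Real.rpow_neg_one, Real.rpow_neg hyx'.le]
          have : 1 ≤ ε ^ a * (‖y - x‖ ^ a)⁻¹ := by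
            rw [← div_eq_mul_inv, one_le_div (by positivity)]
            gcongr
          calc ‖y - x‖⁻¹ = ‖y - x‖⁻¹ * 1 := (mul_one _).symm
            _ ≤ ‖y - x‖⁻¹ * (ε ^ a * (‖y - x‖ ^ a)⁻¹) := by gcongr
            _ = _ := by ring
        rw [abs_of_nonneg hbm.1]
        calc _ ≤ 1 * (C1 * ‖y - x‖⁻¹) := by gcongr; exact hbm.2
          _ ≤ C1 * (Y⁻¹ * ‖y - x‖ ^ (-(1 + a))) := by rw [one_mul]; gcongr
          _ = _ := by ring
    · rw [integral_const_mul]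
      calc _ ≤ C1 * Y⁻¹ * (B * Ch) := by gcongr
        _ = C1 * Ch * (Y⁻¹ * B) := by ring
        _ ≤ C1 * Ch * 1 := by
          refine mul_le_mul_of_nonneg_left ?_ (by positivity)
          rw [inv_mul_le_iff₀ hY0, hY]
          linarith [Real.exp_pos 1]
        _ = _ := mul_one _
  have hsum : ∀ (I : Fin 2 → Fin 2 → ℝ) T, (∀ i j, |I i j| ≤ T) → |∑ i, ∑ j, I i j| ≤ 4 * T :=
    fun I T hI => by
      simp only [Fin.sum_univ_two]
      have := hI 0 0; have := hI 0 1; have := hI 1 0; have := hI 1 1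
      simp only [abs_le] at *
      constructor <;> linarith
  have hA1 : A * Real.log Y ≤ (1 + A) * Real.log Y := by nlinarith
  have hA2 : 1 ≤ (1 + A) * Real.log Y := by nlinarith
  refine (abs_sub (G := ℝ) _ _).trans ((add_le_add (hsum _ _ hT1) (hsum _ _ hT2)).trans ?_)
  calc _ = 4 * C1 * ((1 + Cb) * (Cl * (1 + Real.log 3 + 1 / a)) * (A * Real.log Y) + Ch * 1) := by ring
    _ ≤ 4 * C1 * ((1 + Cb) * (Cl * (1 + Real.log 3 + 1 / a)) * ((1 + A) * Real.log Y)
        + Ch * ((1 + A) * Real.log Y)) := by gcongr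
    _ = _ := by ring

end LocLoad

section Estimate

/-- Near a point `x`, the stream function differs little from its value at a boundary point close
to `x`. -/
theorem IsDefFun.exists_local_bound {Ω : Set Vec2} {d : Vec2 → ℝ} (h : IsDefFun Ω d) (s : ℝ)
    (hs : 0 ≤ s) : ∃ r > 0, ∃ C, 0 ≤ C ∧ ∀ (ψ : Vec2 → ℝ) (K : ℝ), 0 ≤ K → ContDiff ℝ 1 ψ →
    (∀ x ∉ Ω, fderiv ℝ ψ x = 0) → (∀ x y, |ψ x - ψ y| ≤ K * ‖x - y‖) →
    (∀ y z, y ∈ Ω → IsNearest Ω y z → |ψ y - ψ z| ≤ K * d y ^ s) → ∀ x ∈ Ω, ∃ c,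
    (∀ y ∈ Ω, ‖y - x‖ < r → |ψ y - c| ≤ C * K * d y ^ s) ∧
    ∀ η > 0, ∃ ε > 0, ∀ y ∈ Ω, d y ≤ ε → |ψ y - c| ≤ η * d y ∨ r ≤ ‖y - x‖ := by
  obtain ⟨r0, hr0, hrad⟩ := h.exists_radius
  obtain ⟨Ci, hCi, hinf⟩ := h.exists_infDist_le
  obtain ⟨Λ, hΛ, hlipd⟩ := h.exists_lipschitz
  obtain ⟨M, hM⟩ := Metric.isBounded_iff.1 h.isCompact_closure.isBounded
  set r := r0 / 8 with hr
  have hrp : 0 < r := by positivity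
  refine ⟨r, hrp, max 1 (|M| * (r / Ci) ^ (-s)), by positivity,
    fun ψ K hK hψ h0 hlip hnear x hx => ?_⟩
  obtain ⟨xs, hxs⟩ := h.exists_isNearest hx
  have hdist : ∀ a b : Vec2, Metric.infDist a Ωᶜ ≤ Metric.infDist b Ωᶜ + ‖a - b‖ := fun a b => by
    rw [← dist_eq_norm]; exact Metric.infDist_le_infDist_add_dist
  refine ⟨ψ xs, ?_⟩
  rcases lt_or_ge (Metric.infDist x Ωᶜ) (2 * r) with hlt | hge
  · have hconst : ∀ y ∈ Ω, ‖y - x‖ < r → ∀ z, IsNearest Ω y z → ψ z = ψ xs := fun y hy hyx z hz => by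
      refine hrad ψ (hψ.differentiable (by simp)) h0 z hz.mem xs hxs.mem ?_
      have h1 := hdist y x
      rw [hz.eq] at h1
      rw [hxs.eq] at h1 hlt
      have : ‖z - xs‖ ≤ ‖y - z‖ + ‖y - x‖ + ‖x - xs‖ := by
        rw [show z - xs = -(y - z) + (y - x) + (x - xs) by abel]
        exact (norm_add_le _ _).trans (by gcongr; exact (norm_add_le _ _).trans (by rw [norm_neg]))
      linarith
    refine ⟨fun y hy hyx => ?_, fun η hη => ?_⟩
    · obtain ⟨z, hz⟩ := h.exists_isNearest hy
      rw [← hconst y hy hyx z hz]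
      refine (hnear y z hy hz).trans ?_
      have := h.pos hy
      rw [mul_assoc]
      exact le_mul_of_one_le_left (by positivity) (le_max_left _ _)
    · obtain ⟨ε, hε, hsm⟩ := small_near_frontier h (f := fderiv ℝ ψ)
        (hψ.continuous_fderiv (by simp)).continuousOn
        (fun y hy => h0 y fun hy' => by
          rw [h.isOpen.frontier_eq] at hy; exact hy.2 hy') (η := η / Ci) (by positivity)
      refine ⟨ε / (Λ * Ci), by positivity, fun y hy hdy => or_iff_not_imp_right.2 fun hyx => ?_⟩
      rw [not_le] at hyx
      obtain ⟨z, hz⟩ := h.exists_isNearest hy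
      rw [← hconst y hy hyx z hz]
      rw [le_div_iff₀ (by positivity)] at hdy
      have hyz : ‖y - z‖ ≤ Ci * d y := hz.eq ▸ hinf y hy
      have hb : ∀ w ∈ segment ℝ z y, ‖fderiv ℝ ψ w‖ ≤ η / Ci := by
        rw [segment_eq_image']
        rintro _ ⟨t, ht, rfl⟩
        rcases eq_or_lt_of_le ht.1 with rfl | ht0
        · have : z ∉ Ω := fun hz' => by
            have := hz.mem
            rw [h.isOpen.frontier_eq] at this; exact this.2 hz'
          simp only [zero_smul, add_zero, h0 z this, norm_zero]
          positivity
        · obtain ⟨hw, -⟩ := hz.seg t ⟨ht0, ht.2⟩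
          refine hsm _ hw ?_
          have h1 := hlipd (z + t • (y - z)) z
          rw [h.frontier_zero hz.mem, sub_zero, add_sub_cancel_left, norm_smul,
            Real.norm_of_nonneg ht.1] at h1
          calc _ ≤ _ := (le_abs_self _).trans h1
            _ ≤ Λ * (1 * (Ci * d y)) := by
              gcongr
              exact ht.2
            _ ≤ ε := by linarith
      have := (convex_segment z y).norm_image_sub_le_of_norm_fderiv_le (𝕜 := ℝ)
        (fun w _ => hψ.differentiable (by simp) w) hb (left_mem_segment ℝ z y)
        (right_mem_segment ℝ z y)
      rw [Real.norm_eq_abs] at this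
      calc _ ≤ _ := this
        _ ≤ η / Ci * (Ci * d y) := by gcongr
        _ = η * d y := by field_simp
  · refine ⟨fun y hy hyx => ?_, fun η hη => ⟨r / (2 * Ci), by positivity,
      fun y hy hdy => Or.inr ?_⟩⟩
    · have h1 := hdist x y
      rw [norm_sub_rev] at h1
      have h2 : r / Ci ≤ d y := by
        rw [div_le_iff₀' hCi]
        linarith [hinf y hy]
      have h3 : ‖y - xs‖ ≤ |M| := by
        rw [← dist_eq_norm]
        exact (hM (subset_closure hy) (frontier_subset_closure hxs.mem)).trans (le_abs_self M)
      have h4 : 0 < d y := h.pos hy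
      have h5 : 1 ≤ (r / Ci) ^ (-s) * d y ^ s := by
        rw [Real.rpow_neg (by positivity), ← div_eq_inv_mul, one_le_div (by positivity)]
        gcongr
      calc _ ≤ K * ‖y - xs‖ := hlip _ _
        _ ≤ K * |M| := by gcongr
        _ ≤ K * |M| * ((r / Ci) ^ (-s) * d y ^ s) := le_mul_of_one_le_right (by positivity) h5
        _ = (|M| * (r / Ci) ^ (-s)) * K * d y ^ s := by ring
        _ ≤ _ := by gcongr; exact le_max_right _ _
    · rw [le_div_iff₀ (by positivity)] at hdy
      have h1 := hdist x y
      rw [norm_sub_rev] at h1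
      linarith [hinf y hy]

theorem exists_integral_mul_mollM_sub_le {Ω : Set Vec2} (hΩ : IsOpen Ω) {f : Vec2 → ℝ}
    (hf : ContinuousOn f Ω) {x : Vec2} (hx : x ∈ Ω) {η : ℝ} (hη : 0 < η) :
    ∃ δ0 > 0, ∀ δ > 0, δ ≤ δ0 → Metric.closedBall x δ ⊆ Ω ∧
      |(∫ y, f y * mollM (δ ^ 2)⁻¹ (y - x)) - massM * f x| ≤ η := by
  obtain ⟨C, hC⟩ := exists_integral_abs_mollM_le
  obtain ⟨δ1, hδ1, hb⟩ := Metric.isOpen_iff.1 hΩ x hx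
  obtain ⟨δ2, hδ2, hc⟩ := Metric.continuousAt_iff.1 (hf.continuousAt (hΩ.mem_nhds hx))
    (η / (|C| + 1)) (by positivity)
  refine ⟨min δ1 δ2 / 2, by positivity, fun δ hδ hδ' => ?_⟩
  have hδ1' : δ < δ1 := by have := min_le_left δ1 δ2; linarith
  have hδ2' : δ < δ2 := by have := min_le_right δ1 δ2; linarith
  have hball : Metric.closedBall x δ ⊆ Ω := (Metric.closedBall_subset_ball hδ1').trans hb
  refine ⟨hball, ?_⟩
  set m : Vec2 → ℝ := fun y => mollM (δ ^ 2)⁻¹ (y - x) with hm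
  have hm0 : ∀ y, y ∉ Metric.closedBall x δ → m y = 0 := fun y hy => by
    by_contra hne
    refine hy ?_
    have := tsupport_mollM_subset hδ (subset_tsupport _ hne)
    rwa [mem_closedBall_zero_iff, ← dist_eq_norm] at this
  have hmc : Continuous m :=
    (contDiff_mollM _).continuous.comp (continuous_id.sub continuous_const)
  have hts : tsupport m ⊆ Metric.closedBall x δ :=
    closure_minimal (fun y hy => by_contra fun hy' => hy (hm0 y hy')) Metric.isClosed_closedBall
  have hmcs : HasCompactSupport m :=
    (isCompact_closedBall x δ).of_isClosed_subset (isClosed_tsupport _) hts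
  have hmi : Integrable m := hmc.integrable_of_hasCompactSupport hmcs
  have hInt : ∫ y, m y = massM := by
    rw [← integral_mollM hδ]
    exact integral_sub_right_eq_self (fun y => mollM (δ ^ 2)⁻¹ y) x
  have hInt' : ∫ y, |m y| ≤ C := by
    refine le_trans (le_of_eq ?_) (hC δ hδ)
    exact integral_sub_right_eq_self (fun y => |mollM (δ ^ 2)⁻¹ y|) x
  change |(∫ y, f y * m y) - massM * f x| ≤ η
  rw [← hInt, mul_comm, ← integral_const_mul, ← integral_sub
    (ContinuousOn.integrable_mul hΩ hf hmc (hts.trans hball) hmcs) (hmi.const_mul _),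
    ← Real.norm_eq_abs]
  refine (norm_integral_le_of_norm_le (g := fun y => η / (|C| + 1) * |m y|)
    (hmi.abs.const_mul _) (Filter.Eventually.of_forall fun y => ?_)).trans ?_
  · rw [← sub_mul, norm_mul, Real.norm_eq_abs (m y)]
    by_cases hy : y ∈ Metric.closedBall x δ
    · have := hc (lt_of_le_of_lt (Metric.mem_closedBall.1 hy) hδ2')
      rw [dist_eq_norm] at this
      gcongr
    · rw [hm0 y hy, abs_zero, mul_zero, mul_zero]
  · rw [integral_const_mul, div_mul_eq_mul_div, div_le_iff₀ (by positivity)]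
    gcongr
    exact hInt'.trans ((le_abs_self C).trans (by linarith))

end Estimate

section MainEstimate

/-- The tensor `G` is bounded by `A` and its divergence terms are bounded by `B` in `L^q`. -/
structure LoadBound (Ω : Set Vec2) (q : ℝ≥0∞) (G : Fin 2 → Fin 2 → Vec2 → ℝ) (A B : ℝ) : Prop where
  nonneg_left : 0 ≤ A
  nonneg_right : 0 ≤ B
  abs_le : ∀ i j, ∀ y ∈ Ω, |G i j y| ≤ A
  memLp : ∀ i j, MemLp (dd (e2 j) (G i j)) q (volume.restrict Ω)
  eLpNorm_le : ∀ i j, eLpNorm (dd (e2 j) (G i j)) q (volume.restrict Ω) ≤ ENNReal.ofReal B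

theorem LoadBound.integrableOn {Ω : Set Vec2} {d : Vec2 → ℝ} {q : ℝ≥0∞}
    {G : Fin 2 → Fin 2 → Vec2 → ℝ} {A B : ℝ} (h : IsDefFun Ω d) (hB : LoadBound Ω q G A B)
    (hG : ∀ i j, ContDiffOn ℝ 1 (G i j) Ω) (i j : Fin 2) : IntegrableOn (G i j) Ω :=
  IntegrableOn.of_bound h.volume_lt_top
    ((hG i j).continuousOn.aestronglyMeasurable h.isOpen.measurableSet) A
    ((ae_restrict_mem h.isOpen.measurableSet).mono fun y hy => hB.abs_le i j y hy)

theorem LoadBound.integrableOn_dd {Ω : Set Vec2} {d : Vec2 → ℝ} {q : ℝ≥0∞}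
    {G : Fin 2 → Fin 2 → Vec2 → ℝ} {A B : ℝ} (h : IsDefFun Ω d) (hB : LoadBound Ω q G A B)
    (hq : 1 ≤ q) (i j : Fin 2) : IntegrableOn (dd (e2 j) (G i j)) Ω :=
  haveI : IsFiniteMeasure (volume.restrict Ω) := ⟨by simpa using h.volume_lt_top⟩
  (hB.memLp i j).integrable hq

theorem log_factor_nonneg {A B : ℝ} (hA : 0 ≤ A) (hB : 0 ≤ B) :
    1 ≤ (1 + A) * Real.log (Real.exp 1 + B) := by
  have : 1 ≤ Real.log (Real.exp 1 + B) :=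
    (Real.le_log_iff_exp_le (by positivity)).2 (by linarith)
  nlinarith

theorem setIntegral_mul_dd_dd_mollM {Ω : Set Vec2} (hΩ : IsOpen Ω) {ψ : Vec2 → ℝ}
    (hψ : ContDiffOn ℝ 3 ψ Ω) {x : Vec2} {δ : ℝ} (hδ : 0 < δ) (hb : Metric.closedBall x δ ⊆ Ω)
    (u v : Vec2) (c : ℝ) :
    IntegrableOn (fun y => (ψ y - c) * dd u (dd v (mollM (δ ^ 2)⁻¹)) (y - x)) Ω ∧
    ∫ y in Ω, (ψ y - c) * dd u (dd v (mollM (δ ^ 2)⁻¹)) (y - x)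
      = ∫ y, dd v (dd u ψ) y * mollM (δ ^ 2)⁻¹ (y - x) := by
  set m : Vec2 → ℝ := fun y => mollM (δ ^ 2)⁻¹ (y - x) with hm
  have hms : ContDiff ℝ ∞ m := (contDiff_mollM _).comp (contDiff_id.sub contDiff_const)
  have hshift : ∀ (f : Vec2 → ℝ) w y, dd w (fun y => f (y - x)) y = dd w f (y - x) := fun f w y => by
    rw [dd, dd, fderiv_comp_sub]
  have hdd : ∀ y, dd u (dd v (mollM (δ ^ 2)⁻¹)) (y - x) = dd u (dd v m) y := fun y => by
    rw [← hshift]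
    congr 1
    funext z
    exact (hshift _ _ _).symm
  have hm0 : ∀ y, y ∉ Metric.closedBall x δ → m y = 0 := fun y hy => by
    by_contra hne
    refine hy ?_
    have := tsupport_mollM_subset hδ (subset_tsupport _ hne)
    rwa [mem_closedBall_zero_iff, ← dist_eq_norm] at this
  have hts : tsupport m ⊆ Metric.closedBall x δ :=
    closure_minimal (fun y hy => by_contra fun hy' => hy (hm0 y hy')) Metric.isClosed_closedBall
  have hcs : HasCompactSupport m :=
    (isCompact_closedBall x δ).of_isClosed_subset (isClosed_tsupport _) hts
  have hs1 : tsupport m ⊆ Ω := hts.trans hb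
  have hs2 := (tsupport_dd_subset m v).trans hs1
  have hs3 := (tsupport_dd_subset (dd v m) u).trans hs2
  have hψc : ContDiffOn ℝ 3 (fun y => ψ y - c) Ω := hψ.sub contDiffOn_const
  have hd1 : ContDiff ℝ ∞ (dd v m) := hms.dd v
  have hd2 : ContDiff ℝ ∞ (dd u (dd v m)) := hd1.dd u
  simp only [hdd]
  have hInt : Integrable (fun y => (ψ y - c) * dd u (dd v m) y) :=
    ContinuousOn.integrable_mul hΩ hψc.continuousOn hd2.continuous hs3 ((hcs.dd v).dd u)
  refine ⟨hInt.integrableOn, ?_⟩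
  have hts' : tsupport (fun y => (ψ y - c) * dd u (dd v m) y) ⊆ Ω :=
    (tsupport_mul_subset_right).trans hs3
  rw [← integral_eq_setIntegral_of_tsupport hts',
    integral_mul_dd hΩ (hψc.of_le (by norm_num)) (hd1.of_le (by simp)) hs2 (hcs.dd v)]
  have e1 : ∀ y, dd u (fun y => ψ y - c) y = dd u ψ y := fun y => by
    rw [dd, dd, fderiv_sub_const]
  simp only [e1]
  have hψu : ContDiffOn ℝ 2 (dd u ψ) Ω := ContDiffOn.dd_succ hΩ (n := 2) (by simpa using hψ) u
  rw [integral_mul_dd hΩ (hψu.of_le (by norm_num)) (hms.of_le (by simp)) hs1 hcs, neg_neg]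

theorem rpow_mul_zpow_le {s D X R ρ C : ℝ} (hs : 0 ≤ s) (hs' : s ≤ 3 / 2) (hC : 0 < C) (hD : 0 ≤ D)
    (hX : 0 < X) (hρ : 0 < ρ) (hDR : D ≤ C * R) (hXR : X ≤ C * R) (hρR : ρ ≤ R) :
    D ^ s * R ^ (-3 : ℤ) ≤ C ^ s * C ^ (3 / 2 - s) * X ^ (s - 3 / 2) * ρ ^ (-(3 / 2) : ℝ) := by
  have hR : 0 < R := hρ.trans_le hρR
  have h1 : D ^ s ≤ C ^ s * R ^ s := by
    rw [← Real.mul_rpow hC.le hR.le]; exact Real.rpow_le_rpow hD hDR hs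
  have h2 : R ^ (s - 3 / 2) ≤ C ^ (3 / 2 - s) * X ^ (s - 3 / 2) := by
    have : (C * R) ^ (s - 3 / 2) ≤ X ^ (s - 3 / 2) :=
      Real.rpow_le_rpow_of_nonpos hX hXR (by linarith)
    rw [Real.mul_rpow hC.le hR.le] at this
    calc R ^ (s - 3 / 2) = C ^ (3 / 2 - s) * (C ^ (s - 3 / 2) * R ^ (s - 3 / 2)) := by
          rw [← mul_assoc, ← Real.rpow_add hC]; simp
      _ ≤ _ := by gcongr
  have h3 : R ^ (-(3 / 2) : ℝ) ≤ ρ ^ (-(3 / 2) : ℝ) :=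
    Real.rpow_le_rpow_of_nonpos hρ hρR (by norm_num)
  have h4 : R ^ (-3 : ℤ) = R ^ (-s) * R ^ (s - 3 / 2) * R ^ (-(3 / 2) : ℝ) := by
    rw [← Real.rpow_add hR, ← Real.rpow_add hR, ← Real.rpow_intCast]
    congr 1; push_cast; ring
  calc D ^ s * R ^ (-3 : ℤ) ≤ (C ^ s * R ^ s) * (R ^ (-s) * R ^ (s - 3 / 2) * R ^ (-(3 / 2) : ℝ)) := by
        rw [h4]; gcongr
    _ = C ^ s * R ^ (s - 3 / 2) * R ^ (-(3 / 2) : ℝ) * (R ^ s * R ^ (-s)) := by ring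
    _ = C ^ s * R ^ (s - 3 / 2) * R ^ (-(3 / 2) : ℝ) := by
        rw [← Real.rpow_add hR]; simp
    _ ≤ C ^ s * (C ^ (3 / 2 - s) * X ^ (s - 3 / 2)) * ρ ^ (-(3 / 2) : ℝ) := by gcongr
    _ = _ := by ring

theorem IsDefFun.exists_dd_dd_le {Ω : Set Vec2} {d : Vec2 → ℝ} (h : IsDefFun Ω d) {q : ℝ≥0∞}
    (hq : 2 < q) (hq' : q < ⊤) {s : ℝ} (hs : 0 ≤ s) (hs' : s ≤ 3 / 2) (u v : Vec2) :
    ∃ C, 0 ≤ C ∧ ∀ (G : Fin 2 → Fin 2 → Vec2 → ℝ) (ψ : Vec2 → ℝ) (A B K : ℝ), StreamSol Ω G ψ →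
    LoadBound Ω q G A B → 0 ≤ K → (∀ x y, |ψ x - ψ y| ≤ K * ‖x - y‖) →
    (∀ y z, y ∈ Ω → IsNearest Ω y z → |ψ y - ψ z| ≤ K * d y ^ s) → ∀ x ∈ Ω,
    |dd v (dd u ψ) x| ≤ C * ((1 + A) * Real.log (Real.exp 1 + B) + K * d x ^ (s - 3 / 2)) := by
  have hm := h.isOpen.measurableSet
  obtain ⟨r, hr, Cl, hCl0, hCl⟩ := h.exists_local_bound s hs
  obtain ⟨Cp, hCp0, hCp⟩ := h.exists_parametrix u v hr
  obtain ⟨CL, hCL0, hCL⟩ := h.exists_locLoad_le hq hq'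
  obtain ⟨CR, hCR0, hCR⟩ := h.exists_sq_le_kR
  obtain ⟨CI, hCI0, hCI⟩ := exists_setIntegral_rpow_le h.bdd hm (α := 3 / 2) (by norm_num)
  set C' := Cl * Cp * (CR ^ s * CR ^ (3 / 2 - s)) with hC'
  have hC'0 : 0 ≤ C' := by positivity
  refine ⟨(CL * Cp + C' * CI) / massM, div_nonneg (by positivity) massM_pos.le,
    fun G ψ A B K hS hB hK hlip hnear x hx => ?_⟩
  set L := (1 + A) * Real.log (Real.exp 1 + B) with hL
  have hL0 : 1 ≤ L := log_factor_nonneg hB.nonneg_left hB.nonneg_right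
  have hdx := h.pos hx
  obtain ⟨c, hc1, hc2⟩ := hCl ψ K hK hS.contDiff hS.fderiv_eq_zero hlip hnear x hx
  rw [div_mul_eq_mul_div, le_div_iff₀ massM_pos]
  refine le_of_forall_pos_le_add fun η hη => ?_
  have hf : ContinuousOn (dd v (dd u ψ)) Ω :=
    (ContDiffOn.dd_succ h.isOpen (n := 1) ((ContDiffOn.dd_succ h.isOpen (n := 2)
      (by simpa using hS.smooth) u).of_le (by norm_num)) v).continuousOn
  obtain ⟨δ0, hδ0, hδ⟩ := exists_integral_mul_mollM_sub_le h.isOpen hf hx hη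
  set δ := min (min δ0 1) (r / 4) with hδd
  have hδp : 0 < δ := by positivity
  obtain ⟨hball, happ⟩ := hδ δ hδp ((min_le_left _ _).trans (min_le_left _ _))
  obtain ⟨U, φ, hφ⟩ := hCp x hx δ hδp ((min_le_left _ _).trans (min_le_right _ _)) (min_le_right _ _)
    (fun y hy => by
      by_contra hle
      rw [h.isOpen.frontier_eq] at hy
      exact hy.2 (hball (by rw [Metric.mem_closedBall, dist_eq_norm]; linarith)))
  obtain ⟨χ, hχ, hload⟩ := hCL x hx φ Cp hCp0.le hφ.dd_le hφ.dd_dd_le G A B hB.nonneg_left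
    hB.nonneg_right hB.abs_le hB.memLp hB.eLpNorm_le
  have hid := hS.integral_lap_lap_eq_locLoad h (hB.integrableOn h hS.smooth_G)
    (hB.integrableOn_dd h (le_trans (by norm_num) hq.le)) hφ.isOpen hφ.closure_subset hφ.contDiffOn
    hφ.eq_zero hφ.dd_eq_zero hχ (c := c) (fun η hη => by
      obtain ⟨ε, hε, he⟩ := hc2 η hη
      exact ⟨ε, hε, fun y hy hdy => (he y hy hdy).imp_right (hφ.local_eq y)⟩)
  obtain ⟨hmi, hme⟩ := setIntegral_mul_dd_dd_mollM h.isOpen hS.smooth hδp hball u v c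
  set E : Vec2 → ℝ := fun y => (ψ y - c) * (lap (lap φ) y
    - dd u (dd v (mollM (δ ^ 2)⁻¹)) (y - x)) with hE
  have hlapc : ContinuousOn (lap (lap φ)) Ω :=
    (((hφ.contDiffOn.lap hφ.isOpen).lap hφ.isOpen).continuousOn).mono
      (subset_closure.trans hφ.closure_subset)
  have hmc : Continuous fun y => dd u (dd v (mollM (δ ^ 2)⁻¹)) (y - x) :=
    (((contDiff_mollM _).dd v).dd u).continuous.comp (continuous_id.sub continuous_const)
  have hEc : ContinuousOn E Ω :=
    ((hS.contDiff.continuous.continuousOn).sub continuousOn_const).mul (hlapc.sub hmc.continuousOn)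
  obtain ⟨hI1, hI2⟩ := hCI x hx
  have hEb : ∀ᵐ y ∂(volume.restrict Ω), ‖E y‖ ≤ C' * K * d x ^ (s - 3 / 2) * ‖y - x‖ ^ (-(3 / 2) : ℝ) := by
    filter_upwards [(ae_restrict_mem hm).and (ae_restrict_of_ae (Measure.ae_ne volume x))]
      with y ⟨hy, hyx⟩
    have hyx' : 0 < ‖y - x‖ := norm_pos_iff.2 (sub_ne_zero.2 hyx)
    rw [hE, Real.norm_eq_abs, abs_mul]
    rcases lt_or_ge ‖y - x‖ r with hlt | hge
    · have h1 := hc1 y hy hlt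
      have h2 := hφ.lap_lap_le y hy hyx
      obtain ⟨h3, h4⟩ := hCR (x, y) ⟨hx, hy⟩
      have h5 := h.norm_le_sqrt_kR (z := (x, y)) ⟨hx, hy⟩
      have h6 := rpow_mul_zpow_le hs hs' hCR0 (h.pos hy).le hdx hyx' h4 h3 h5
      have hdy := h.pos hy
      calc _ ≤ (Cl * K * d y ^ s) * (Cp * √(kR d (x, y)) ^ (-3 : ℤ)) := by gcongr
        _ = Cl * Cp * K * (d y ^ s * √(kR d (x, y)) ^ (-3 : ℤ)) := by ring
        _ ≤ Cl * Cp * K * _ := mul_le_mul_of_nonneg_left h6 (by positivity)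
        _ = _ := by rw [hC']; ring
    · have h1 : lap (lap φ) y = 0 := by
        have := (hφ.local_eq y hge).lap.lap.eq_of_nhds
        rw [this]
        simp [lap_zero]
      have h2 : dd u (dd v (mollM (δ ^ 2)⁻¹)) (y - x) = 0 := by
        refine image_eq_zero_of_notMem_tsupport fun hy' => ?_
        have := tsupport_mollM_subset hδp (tsupport_dd_subset _ v (tsupport_dd_subset _ u hy'))
        rw [mem_closedBall_zero_iff] at this
        have : δ ≤ r / 4 := min_le_right _ _
        linarith
      rw [h1, h2, sub_zero, abs_zero, mul_zero]
      positivity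
  have hEi : IntegrableOn E Ω := Integrable.mono' (hI1.const_mul _)
    (hEc.aestronglyMeasurable hm) hEb
  have hEI : |∫ y in Ω, E y| ≤ C' * K * d x ^ (s - 3 / 2) * CI := by
    rw [← Real.norm_eq_abs]
    refine (norm_integral_le_of_norm_le (hI1.const_mul _) hEb).trans ?_
    rw [integral_const_mul]
    gcongr
  have hsplit : ∫ y in Ω, (ψ y - c) * lap (lap φ) y
      = (∫ y in Ω, E y) + ∫ y, dd v (dd u ψ) y * mollM (δ ^ 2)⁻¹ (y - x) := by
    rw [← hme, ← integral_add hEi hmi]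
    congr 1
    funext y
    rw [hE]; ring
  have hfin : |massM * dd v (dd u ψ) x| ≤ CL * Cp * L + C' * K * d x ^ (s - 3 / 2) * CI + η := by
    rw [hsplit] at hid
    rw [abs_le] at happ hEI hload ⊢
    constructor <;> linarith
  rw [abs_mul, abs_of_pos massM_pos, mul_comm] at hfin
  have hKx : 0 ≤ K * d x ^ (s - 3 / 2) := by positivity
  refine hfin.trans ?_
  have e1 : 0 ≤ CL * Cp * (K * d x ^ (s - 3 / 2)) := by positivity
  have e2 : 0 ≤ C' * CI * L := by positivity
  nlinarith

end MainEstimate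

section Bootstrap

variable {Ω : Set Vec2} {d : Vec2 → ℝ}

theorem IsDefFun.exists_dd_dd_le_uniform (h : IsDefFun Ω d) {q : ℝ≥0∞}
    (hq : 2 < q) (hq' : q < ⊤) {s : ℝ} (hs : 0 ≤ s) (hs' : s ≤ 3 / 2) :
    ∃ C, 0 ≤ C ∧ ∀ (G : Fin 2 → Fin 2 → Vec2 → ℝ) (ψ : Vec2 → ℝ) (A B K : ℝ), StreamSol Ω G ψ →
    LoadBound Ω q G A B → 0 ≤ K → (∀ x y, |ψ x - ψ y| ≤ K * ‖x - y‖) →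
    (∀ y z, y ∈ Ω → IsNearest Ω y z → |ψ y - ψ z| ≤ K * d y ^ s) → ∀ x ∈ Ω, ∀ i j,
    |dd (e2 j) (dd (e2 i) ψ) x|
      ≤ C * ((1 + A) * Real.log (Real.exp 1 + B) + K * d x ^ (s - 3 / 2)) := by
  choose C hC0 hC using fun i j => h.exists_dd_dd_le hq hq' hs hs' (e2 i) (e2 j)
  refine ⟨∑ i, ∑ j, C i j, Finset.sum_nonneg fun i _ => Finset.sum_nonneg fun j _ => hC0 i j,
    fun G ψ A B K hS hB hK hlip hnear x hx i j => ?_⟩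
  have hdx := h.pos hx
  have hL := log_factor_nonneg hB.nonneg_left hB.nonneg_right
  refine (hC i j G ψ A B K hS hB hK hlip hnear x hx).trans (mul_le_mul_of_nonneg_right ?_ (by positivity))
  exact (Finset.single_le_sum (f := fun j => C i j) (fun j _ => hC0 i j) (Finset.mem_univ j)).trans
    (Finset.single_le_sum (f := fun i => ∑ j, C i j)
      (fun i _ => Finset.sum_nonneg fun j _ => hC0 i j) (Finset.mem_univ i))

theorem IsDefFun.notMem_of_mem_frontier (h : IsDefFun Ω d) {z : Vec2} (hz : z ∈ frontier Ω) :
    z ∉ Ω := fun hz' => by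
  rw [h.isOpen.frontier_eq] at hz
  exact hz.2 hz'

theorem StreamSol.contDiffOn_dd {G : Fin 2 → Fin 2 → Vec2 → ℝ} {ψ : Vec2 → ℝ}
    (hS : StreamSol Ω G ψ) (hΩ : IsOpen Ω) (v : Vec2) : ContDiffOn ℝ 2 (dd v ψ) Ω :=
  ContDiffOn.dd_succ hΩ (n := 2) (by simpa using hS.smooth) v

theorem StreamSol.dd_eq_zero {G : Fin 2 → Fin 2 → Vec2 → ℝ} {ψ : Vec2 → ℝ}
    (hS : StreamSol Ω G ψ) (v : Vec2) {x : Vec2} (hx : x ∉ Ω) : dd v ψ x = 0 := by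
  rw [dd, hS.fderiv_eq_zero x hx]; rfl

theorem StreamSol.continuous_dd {G : Fin 2 → Fin 2 → Vec2 → ℝ} {ψ : Vec2 → ℝ}
    (hS : StreamSol Ω G ψ) (v : Vec2) : Continuous (dd v ψ) :=
  (hS.contDiff.continuous_fderiv (by simp)).clm_apply continuous_const

/-- The velocity gradient is bounded by the load and the maximum of the velocity. -/
theorem IsDefFun.exists_dd_dd_le_add_sup (h : IsDefFun Ω d) {q : ℝ≥0∞} (hq : 2 < q) (hq' : q < ⊤) :
    ∃ C, 0 ≤ C ∧ ∀ (G : Fin 2 → Fin 2 → Vec2 → ℝ) (ψ : Vec2 → ℝ) (A B K : ℝ), StreamSol Ω G ψ →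
    LoadBound Ω q G A B → (∀ x, ‖fderiv ℝ ψ x‖ ≤ K) → ∀ x ∈ Ω, ∀ i j,
    |dd (e2 j) (dd (e2 i) ψ) x| ≤ C * ((1 + A) * Real.log (Real.exp 1 + B) + K) := by
  obtain ⟨C1, hC10, hC1⟩ := h.exists_dd_dd_le_uniform hq hq' (s := 1) (by norm_num) (by norm_num)
  obtain ⟨C2, hC20, hC2⟩ := h.exists_dd_dd_le_uniform hq hq' (s := 3 / 2) (by norm_num) le_rfl
  obtain ⟨Ci, hCi, hinf⟩ := h.exists_infDist_le
  obtain ⟨M, hM0, hM⟩ := h.exists_bound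
  set a := 2 * C1 * (M ^ (1 / 2 : ℝ) + (1 + Ci)) * Ci ^ (1 / 2 : ℝ) with ha
  have ha0 : 0 ≤ a := by positivity
  set b := 4 * a / (3 / 2) * Ci ^ (3 / 2 : ℝ) with hb
  have hb0 : 0 ≤ b := by positivity
  refine ⟨C2 * (2 + b), by positivity, fun G ψ A B K hS hB hK x hx i j => ?_⟩
  have hK0 : 0 ≤ K := (norm_nonneg _).trans (hK x)
  set L := (1 + A) * Real.log (Real.exp 1 + B) with hL
  have hL0 : 1 ≤ L := log_factor_nonneg hB.nonneg_left hB.nonneg_right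
  have hdiff : Differentiable ℝ ψ := hS.contDiff.differentiable (by simp)
  have hlip : ∀ x y, |ψ x - ψ y| ≤ K * ‖x - y‖ := fun x y => by
    simpa using convex_univ.norm_image_sub_le_of_norm_fderiv_le (𝕜 := ℝ)
      (fun w _ => hdiff w) (fun w _ => hK w) (mem_univ y) (mem_univ x)
  have hdist : ∀ {y z}, y ∈ Ω → IsNearest Ω y z → ‖y - z‖ ≤ Ci * d y := fun hy hz => hz.eq ▸ hinf _ hy
  have h1 : ∀ y ∈ Ω, ∀ i j, |dd (e2 j) (dd (e2 i) ψ) y| ≤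
      C1 * (M ^ (1 / 2 : ℝ) + (1 + Ci)) * (L + K) * d y ^ (-(1 / 2) : ℝ) := fun y hy i j => by
    have hdy := h.pos hy
    refine (hC1 G ψ A B ((1 + Ci) * K) hS hB (by positivity)
      (fun x y => (hlip x y).trans (by gcongr; nlinarith)) (fun y z hy hz => ?_) y hy i j).trans ?_
    · have := h.pos hy
      calc _ ≤ K * ‖y - z‖ := hlip _ _
        _ ≤ K * (Ci * d y) := by gcongr; exact hdist hy hz
        _ ≤ _ := by rw [Real.rpow_one]; nlinarith [mul_nonneg hK0 this.le]
    · have e1 : 1 ≤ M ^ (1 / 2 : ℝ) * d y ^ (-(1 / 2) : ℝ) := by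
        rw [Real.rpow_neg hdy.le, ← div_eq_mul_inv, one_le_div (by positivity)]
        have := (le_abs_self _).trans (hM y)
        gcongr
      rw [show (1 : ℝ) - 3 / 2 = -(1 / 2) by norm_num, mul_assoc C1, mul_assoc C1]
      refine mul_le_mul_of_nonneg_left ?_ hC10
      have e2 : 0 ≤ d y ^ (-(1 / 2) : ℝ) := by positivity
      have e3 : L ≤ L * (M ^ (1 / 2 : ℝ) * d y ^ (-(1 / 2) : ℝ)) := le_mul_of_one_le_right (by linarith) e1
      have e4 : 0 ≤ K * M ^ (1 / 2 : ℝ) * d y ^ (-(1 / 2) : ℝ) := by positivity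
      have e5 : 0 ≤ L * (1 + Ci) * d y ^ (-(1 / 2) : ℝ) := by positivity
      linarith
  have hneg : ∀ y ∈ Ω, d y ^ (-(1 / 2) : ℝ)
      ≤ Ci ^ (1 / 2 : ℝ) * Metric.infDist y Ωᶜ ^ (-(1 / 2) : ℝ) := fun y hy => by
    have hdy := h.pos hy
    obtain ⟨z, hz⟩ := h.exists_isNearest hy
    have h0 : 0 < Metric.infDist y Ωᶜ := hz.eq ▸ hz.pos
    have := Real.rpow_le_rpow_of_nonpos h0 (hinf y hy) (z := -(1 / 2)) (by norm_num)
    rw [Real.mul_rpow hCi.le hdy.le] at this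
    calc d y ^ (-(1 / 2) : ℝ) = Ci ^ (1 / 2 : ℝ) * (Ci ^ (-(1 / 2) : ℝ) * d y ^ (-(1 / 2) : ℝ)) := by
          rw [← mul_assoc, ← Real.rpow_add hCi]; simp
      _ ≤ _ := by gcongr
  have h2 : ∀ y ∈ Ω, ∀ i, |dd (e2 i) ψ y| ≤ 2 * (a * (L + K)) * Metric.infDist y Ωᶜ ^ (1 / 2 : ℝ) :=
    fun y hy i => by
      obtain ⟨z, hz⟩ := h.exists_isNearest hy
      have := abs_sub_nearest_le (f := dd (e2 i) ψ) (A := a * (L + K)) (s := 1 / 2)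
        (fun y hy => ((hS.contDiffOn_dd h.isOpen _).contDiffAt
          (h.isOpen.mem_nhds hy)).differentiableAt (by simp))
        (hS.continuous_dd _).continuousOn (by norm_num) (fun y hy => by
          refine (norm_fderiv_le _ _).trans ((add_le_add (h1 y hy i 0) (h1 y hy i 1)).trans ?_)
          have := hneg y hy
          rw [show (1 / 2 : ℝ) - 1 = -(1 / 2) by norm_num]
          calc _ = 2 * C1 * (M ^ (1 / 2 : ℝ) + (1 + Ci)) * (L + K) * d y ^ (-(1 / 2) : ℝ) := by ring
            _ ≤ 2 * C1 * (M ^ (1 / 2 : ℝ) + (1 + Ci)) * (L + K) * _ :=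
              mul_le_mul_of_nonneg_left this (by positivity)
            _ = _ := by rw [ha]; ring) hz
      rw [hS.dd_eq_zero _ (h.notMem_of_mem_frontier hz.mem), sub_zero] at this
      rw [hz.eq]
      calc _ ≤ _ := this
        _ = _ := by ring
  refine (hC2 G ψ A B (K + b * (L + K)) hS hB (by positivity)
      (fun x y => (hlip x y).trans (by gcongr; nlinarith)) (fun y z hy hz => ?_) x hx i j).trans ?_
  · have hdy := h.pos hy
    have := abs_sub_nearest_le (f := ψ) (A := 4 * a * (L + K)) (s := 3 / 2)
        (fun y _ => hdiff y) hS.contDiff.continuous.continuousOn (by norm_num) (fun y hy => by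
          refine (norm_fderiv_le _ _).trans ((add_le_add (h2 y hy 0) (h2 y hy 1)).trans ?_)
          rw [show (3 / 2 : ℝ) - 1 = 1 / 2 by norm_num]
          exact le_of_eq (by ring)) hz
    calc _ ≤ _ := this
      _ ≤ 4 * a * (L + K) / (3 / 2) * (Ci * d y) ^ (3 / 2 : ℝ) := by gcongr; exact hdist hy hz
      _ = b * (L + K) * d y ^ (3 / 2 : ℝ) := by rw [Real.mul_rpow hCi.le hdy.le, hb]; ring
      _ ≤ _ := by gcongr; linarith
  · rw [sub_self, Real.rpow_zero, mul_one, mul_assoc C2]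
    refine mul_le_mul_of_nonneg_left ?_ hC20
    nlinarith

end Bootstrap

section Energy

variable {Ω : Set Vec2} {d : Vec2 → ℝ}

theorem StreamSol.abs_dd_le {G : Fin 2 → Fin 2 → Vec2 → ℝ} {ψ : Vec2 → ℝ} (hS : StreamSol Ω G ψ)
    (h : IsDefFun Ω d) {N : ℝ} (hN : ∀ x ∈ Ω, ∀ i j, |dd (e2 j) (dd (e2 i) ψ) x| ≤ N) {y : Vec2}
    (hy : y ∈ Ω) (i : Fin 2) : |dd (e2 i) ψ y| ≤ 2 * N * Metric.infDist y Ωᶜ := by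
  obtain ⟨z, hz⟩ := h.exists_isNearest hy
  have := IsDefFun.abs_sub_nearest_le (f := dd (e2 i) ψ) (A := 2 * N) (s := 1)
    (fun y hy => ((hS.contDiffOn_dd h.isOpen _).contDiffAt
      (h.isOpen.mem_nhds hy)).differentiableAt (by simp))
    (hS.continuous_dd _).continuousOn (by norm_num) (fun y hy => by
      refine (norm_fderiv_le _ _).trans ((add_le_add (hN y hy i 0) (hN y hy i 1)).trans ?_)
      simp [two_mul]) hz
  rwa [hS.dd_eq_zero _ (h.notMem_of_mem_frontier hz.mem), sub_zero, Real.rpow_one, div_one,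
    ← hz.eq] at this

theorem StreamSol.abs_sub_nearest_le_sq {G : Fin 2 → Fin 2 → Vec2 → ℝ} {ψ : Vec2 → ℝ}
    (hS : StreamSol Ω G ψ) (h : IsDefFun Ω d) {N : ℝ}
    (hN : ∀ x ∈ Ω, ∀ i j, |dd (e2 j) (dd (e2 i) ψ) x| ≤ N) {y z : Vec2}
    (hz : IsNearest Ω y z) : |ψ y - ψ z| ≤ 2 * N * Metric.infDist y Ωᶜ ^ 2 := by
  have := IsDefFun.abs_sub_nearest_le (f := ψ) (A := 4 * N) (s := 2)
    (fun y _ => hS.contDiff.differentiable (by simp) y) hS.contDiff.continuous.continuousOn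
    (by norm_num) (fun y hy => by
      refine (norm_fderiv_le _ _).trans
        ((add_le_add (hS.abs_dd_le h hN hy 0) (hS.abs_dd_le h hN hy 1)).trans ?_)
      rw [show (2 : ℝ) - 1 = 1 by norm_num, Real.rpow_one]
      exact le_of_eq (by ring)) hz
  rw [← hz.eq, Real.rpow_two] at this
  linarith

/-- The divergence theorem for fields vanishing linearly at the boundary. -/
theorem IsDefFun.setIntegral_dd_eq_zero (h : IsDefFun Ω d) {g : Vec2 → ℝ} (hg : ContDiffOn ℝ 1 g Ω)
    {C : ℝ} (hb : ∀ x ∈ Ω, |g x| ≤ C * d x) (v : Vec2) (hb' : ∀ x ∈ Ω, |dd v g x| ≤ C) :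
    ∫ x in Ω, dd v g x = 0 := by
  have hw := h.isWeight ℝ
  obtain ⟨D, hD0, hD⟩ := (h.symb_cut.dd hw v).bound hw
  have hC : 0 ≤ C := by
    obtain ⟨x, hx⟩ := h.nonempty
    exact (abs_nonneg _).trans (hb' x hx)
  have hcd : ∀ ε > 0, ContDiff ℝ 1 (fun x => g x * IsDefFun.cut d ε x) := fun ε hε =>
    hg.mul_of_tsupport h.isOpen ((h.cut_contDiff ε).of_le (by simp)) (h.tsupport_cut_subset hε)
  have hcut : ∀ ε x, DifferentiableAt ℝ (IsDefFun.cut d ε) x :=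
    fun ε x => (h.cut_contDiff ε).differentiable (by simp) x
  have hlim := tendsto_setIntegral_of_eventually_eq (hΩ := h.isOpen.measurableSet)
    (f := fun _ => (1 : ℝ)) (g0 := dd v g) (g := fun ε => dd v (fun x => g x * IsDefFun.cut d ε x))
    (integrableOn_const h.volume_lt_top.ne) (fun ε hε => ((hcd ε hε).continuous_dd v).continuousOn)
    (C := C + C * D) (fun ε hε x hx => by
      have hdx := h.pos hx
      rw [dd_mul ((hg.contDiffAt (h.isOpen.mem_nhds hx)).differentiableAt (by simp)) (hcut ε x)]
      refine (abs_add_le _ _).trans ?_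
      rw [abs_mul, abs_mul, abs_of_nonneg (IsDefFun.cut_nonneg d ε x)]
      have h1 := hD ε x hx
      rw [zero_sub, zpow_neg_one] at h1
      calc _ ≤ C * 1 + (C * d x) * (D * (d x)⁻¹) := by
            gcongr
            · exact IsDefFun.cut_nonneg d ε x
            · exact hb' x hx
            · exact IsDefFun.cut_le_one d ε x
            · exact hb x hx
        _ = _ := by field_simp)
    (fun x hx => by
      filter_upwards [h.cut_eventually_eq_one hx] with ε hε
      have : (fun x => g x * IsDefFun.cut d ε x) =ᶠ[𝓝 x] g := by
        filter_upwards [hε] with y hy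
        rw [hy, mul_one]
      exact (this.dd v).eq_of_nhds)
  have hz : ∀ ε > 0, ∫ x in Ω, (1 : ℝ) * dd v (fun x => g x * IsDefFun.cut d ε x) x = 0 :=
    fun ε hε => by
      have hts : tsupport (fun x => g x * IsDefFun.cut d ε x) ⊆ Ω :=
        (tsupport_mul_subset_right).trans (h.tsupport_cut_subset hε)
      simp only [one_mul]
      rw [← integral_eq_setIntegral_of_tsupport ((tsupport_dd_subset _ v).trans hts)]
      exact integral_dd_eq_zero (hcd ε hε) (h.hasCompactSupport_cut hε).mul_left v
  have := hlim.congr' (f₂ := fun _ => 0) (by filter_upwards [self_mem_nhdsWithin] with ε hε using hz ε hε)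
  simpa using (tendsto_nhds_unique this tendsto_const_nhds)

/-- Poincare's inequality. -/
theorem IsDefFun.exists_poincare (h : IsDefFun Ω d) : ∃ P, 0 ≤ P ∧ ∀ f : Vec2 → ℝ,
    ContDiffOn ℝ 1 f Ω → ∀ C, (∀ x ∈ Ω, |f x| ≤ C * d x) →
    (∀ x ∈ Ω, |dd (e2 0) f x| ≤ C) →
    IntegrableOn (fun x => f x ^ 2) Ω ∧ IntegrableOn (fun x => dd (e2 0) f x ^ 2) Ω ∧
    ∫ x in Ω, f x ^ 2 ≤ P * ∫ x in Ω, dd (e2 0) f x ^ 2 := by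
  have hm := h.isOpen.measurableSet
  obtain ⟨M, hM⟩ := h.bdd.exists_norm_le
  obtain ⟨D, hD0, hD⟩ := h.exists_bound
  refine ⟨4 * M ^ 2, by positivity, fun f hf C hb hb' => ?_⟩
  have hC : 0 ≤ C := by
    obtain ⟨x, hx⟩ := h.nonempty
    exact (abs_nonneg _).trans (hb' x hx)
  have hfd : ∀ x ∈ Ω, DifferentiableAt ℝ f x := fun x hx =>
    (hf.contDiffAt (h.isOpen.mem_nhds hx)).differentiableAt (by simp)
  have hfc : ContinuousOn (dd (e2 0) f) Ω := by
    have : ContDiffOn ℝ 0 (dd (e2 0) f) Ω := ContDiffOn.dd_succ h.isOpen (n := 0) (by simpa using hf) _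
    exact this.continuousOn
  have hfb : ∀ x ∈ Ω, |f x| ≤ C * D := fun x hx =>
    (hb x hx).trans (by gcongr; exact (le_abs_self _).trans (hD x))
  have hM0 : 0 ≤ M := by
    obtain ⟨x, hx⟩ := h.nonempty
    exact (norm_nonneg _).trans (hM x hx)
  have hx0 : ∀ x ∈ Ω, |x 0| ≤ M := fun x hx => (abs_coord_le x 0).trans (hM x hx)
  have hcoord : ContDiff ℝ ∞ (fun x : Vec2 => x 0) := contDiff_piLp_apply (p := 2)
  have hcdd : ∀ x : Vec2, dd (e2 0) (fun x : Vec2 => x 0) x = 1 := fun x => by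
    have : HasFDerivAt (fun x : Vec2 => x 0) (EuclideanSpace.proj (𝕜 := ℝ) (0 : Fin 2)) x :=
      (EuclideanSpace.proj (𝕜 := ℝ) (0 : Fin 2)).hasFDerivAt
    rw [dd, this.fderiv]
    simp [e2]
  set g : Vec2 → ℝ := fun x => x 0 * (f x * f x) with hg
  have hgdd : ∀ x ∈ Ω, dd (e2 0) g x = f x ^ 2 + 2 * x 0 * f x * dd (e2 0) f x := fun x hx => by
    rw [hg, dd_mul (f := fun x : Vec2 => x 0) (g := fun x => f x * f x)
      (hcoord.differentiable (by simp) x) ((hfd x hx).fun_mul (hfd x hx)), hcdd,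
      dd_mul (hfd x hx) (hfd x hx)]
    ring
  have hInt : ∀ {k : Vec2 → ℝ}, ContinuousOn k Ω → ∀ E, (∀ x ∈ Ω, |k x| ≤ E) → IntegrableOn k Ω :=
    fun hk E hE => IntegrableOn.of_bound h.volume_lt_top (hk.aestronglyMeasurable hm) E
      ((ae_restrict_mem hm).mono hE)
  have hi1 : IntegrableOn (fun x => f x ^ 2) Ω := hInt (hf.continuousOn.pow 2) ((C * D) ^ 2)
    fun x hx => by rw [abs_pow]; gcongr; exact hfb x hx
  have hi2 : IntegrableOn (fun x => dd (e2 0) f x ^ 2) Ω := hInt (hfc.pow 2) (C ^ 2)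
    fun x hx => by rw [abs_pow]; gcongr; exact hb' x hx
  have hb2 : ∀ x ∈ Ω, |2 * x 0 * f x * dd (e2 0) f x| ≤ 2 * M * (C * D) * C := fun x hx => by
    rw [abs_mul, abs_mul, abs_mul, abs_two]
    gcongr
    · exact hx0 x hx
    · exact hfb x hx
    · exact hb' x hx
  have hi3 : IntegrableOn (fun x => 2 * x 0 * f x * dd (e2 0) f x) Ω :=
    hInt (((continuousOn_const.mul hcoord.continuous.continuousOn).mul hf.continuousOn).mul hfc) _ hb2
  refine ⟨hi1, hi2, ?_⟩
  have hz := h.setIntegral_dd_eq_zero (g := g) (hcoord.contDiffOn.of_le (by simp) |>.mul (hf.mul hf))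
    (C := M * (C * D) * C + (C * D) ^ 2 + 2 * M * (C * D) * C) (fun x hx => by
      have hdx := h.pos hx
      rw [hg, abs_mul, abs_mul]
      calc _ ≤ M * ((C * D) * (C * d x)) := by
            gcongr
            · exact hx0 x hx
            · exact hfb x hx
            · exact hb x hx
        _ = M * (C * D) * C * d x := by ring
        _ ≤ _ := by
          gcongr
          have : 0 ≤ (C * D) ^ 2 + 2 * M * (C * D) * C := by positivity
          linarith) (e2 0)
    (fun x hx => by
      rw [hgdd x hx]
      refine (abs_add_le _ _).trans ?_
      have h1 : |f x ^ 2| ≤ (C * D) ^ 2 := by rw [abs_pow]; gcongr; exact hfb x hx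
      have : 0 ≤ M * (C * D) * C := by positivity
      linarith [hb2 x hx])
  rw [setIntegral_congr_fun hm hgdd, integral_add (f := fun x => f x ^ 2)
    (g := fun x : Vec2 => 2 * x 0 * f x * dd (e2 0) f x) hi1 hi3] at hz
  have hmono : -∫ x in Ω, 2 * x 0 * f x * dd (e2 0) f x
      ≤ (1 / 2) * (∫ x in Ω, f x ^ 2) + 2 * M ^ 2 * ∫ x in Ω, dd (e2 0) f x ^ 2 := by
    rw [← integral_neg, ← integral_const_mul, ← integral_const_mul,
      ← integral_add (hi1.const_mul _) (hi2.const_mul _)]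
    refine setIntegral_mono_on hi3.neg ((hi1.const_mul _).add (hi2.const_mul _)) hm fun x hx => ?_
    have h1 : (x 0) ^ 2 ≤ M ^ 2 := by
      rw [← sq_abs]; gcongr; exact hx0 x hx
    have h2 := mul_le_mul_of_nonneg_right h1 (sq_nonneg (dd (e2 0) f x))
    nlinarith [sq_nonneg (f x + 2 * x 0 * dd (e2 0) f x)]
  linarith

end Energy

section EnergyBound

variable {Ω : Set Vec2} {d : Vec2 → ℝ}

theorem dd_add_const (f : Vec2 → ℝ) (c : ℝ) (v : Vec2) : dd v (fun y => f y + c) = dd v f := by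
  funext x
  simp only [dd, fderiv_add_const]

theorem dd_sub_const (f : Vec2 → ℝ) (c : ℝ) (v : Vec2) : dd v (fun y => f y - c) = dd v f := by
  simpa only [sub_eq_add_neg] using dd_add_const f (-c) v

theorem IsDefFun.exists_dd_dd_cut_mul_le (h : IsDefFun Ω d) (v w : Vec2) : ∃ C, 0 ≤ C ∧
    ∀ (ε K : ℝ) (f : Vec2 → ℝ), 0 ≤ K → ContDiffOn ℝ 2 f Ω → ∀ x ∈ Ω, |f x| ≤ K * d x ^ 2 →
    |dd v f x| ≤ K * d x → |dd w f x| ≤ K * d x → |dd v (dd w f) x| ≤ K →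
    |dd v (dd w (fun y => IsDefFun.cut d ε y * f y)) x| ≤ C * K := by
  have hw := h.isWeight ℝ
  obtain ⟨Cv, hCv0, hCv⟩ := (h.symb_cut.dd hw v).bound hw
  obtain ⟨Cw, hCw0, hCw⟩ := (h.symb_cut.dd hw w).bound hw
  obtain ⟨Cvw, hCvw0, hCvw⟩ := ((h.symb_cut.dd hw w).dd hw v).bound hw
  refine ⟨Cvw + Cw + Cv + 1, by positivity, fun ε K f hK hf x hx h0 h1 h2 h3 => ?_⟩
  have hdx := h.pos hx
  have hcd : ∀ y, DifferentiableAt ℝ (IsDefFun.cut d ε) y :=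
    fun y => (h.cut_contDiff ε).differentiable (by simp) y
  have hcd2 : ∀ y, DifferentiableAt ℝ (dd w (IsDefFun.cut d ε)) y :=
    fun y => ((h.cut_contDiff ε).dd w).differentiable (by simp) y
  have hfd : ∀ y ∈ Ω, DifferentiableAt ℝ f y := fun y hy =>
    (hf.contDiffAt (h.isOpen.mem_nhds hy)).differentiableAt (by simp)
  have hfd2 : ∀ y ∈ Ω, DifferentiableAt ℝ (dd w f) y := fun y hy =>
    ((ContDiffOn.dd_succ h.isOpen (n := 1) (by simpa using hf) w).contDiffAt
      (h.isOpen.mem_nhds hy)).differentiableAt (by simp)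
  rw [dd_congr_of_isOpen h.isOpen (g := fun y => dd w (IsDefFun.cut d ε) y * f y
      + IsDefFun.cut d ε y * dd w f y) (fun y hy => dd_mul (hcd y) (hfd y hy) w) v hx,
    dd_add (f := fun y => dd w (IsDefFun.cut d ε) y * f y)
      (g := fun y => IsDefFun.cut d ε y * dd w f y) ((hcd2 x).fun_mul (hfd x hx))
      ((hcd x).fun_mul (hfd2 x hx)), dd_mul (hcd2 x) (hfd x hx), dd_mul (hcd x) (hfd2 x hx)]
  have e1 : |dd v (dd w (IsDefFun.cut d ε)) x * f x| ≤ Cvw * K := by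
    rw [abs_mul]
    have := hCvw ε x hx
    norm_num at this
    calc _ ≤ (Cvw * (d x ^ 2)⁻¹) * (K * d x ^ 2) := by gcongr
      _ = _ := by field_simp
  have e2 : |dd w (IsDefFun.cut d ε) x * dd v f x| ≤ Cw * K := by
    rw [abs_mul]
    have := hCw ε x hx
    rw [zero_sub, zpow_neg_one] at this
    calc _ ≤ (Cw * (d x)⁻¹) * (K * d x) := by gcongr
      _ = _ := by field_simp
  have e3 : |dd v (IsDefFun.cut d ε) x * dd w f x| ≤ Cv * K := by
    rw [abs_mul]
    have := hCv ε x hx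
    rw [zero_sub, zpow_neg_one] at this
    calc _ ≤ (Cv * (d x)⁻¹) * (K * d x) := by gcongr
      _ = _ := by field_simp
  have e4 : |IsDefFun.cut d ε x * dd v (dd w f) x| ≤ 1 * K := by
    rw [abs_mul, abs_of_nonneg (IsDefFun.cut_nonneg d ε x)]
    gcongr
    exact IsDefFun.cut_le_one d ε x
  refine (abs_add_le _ _).trans ((add_le_add (abs_add_le _ _) (abs_add_le _ _)).trans ?_)
  linarith

theorem IsDefFun.exists_near_const (h : IsDefFun Ω d) : ∃ ρ > 0, ∀ ψ : Vec2 → ℝ,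
    Differentiable ℝ ψ → (∀ x ∉ Ω, fderiv ℝ ψ x = 0) → ∀ y z y' z', IsNearest Ω y z →
    IsNearest Ω y' z' → Metric.infDist y Ωᶜ < ρ → Metric.infDist y' Ωᶜ < ρ → ‖y - y'‖ < ρ →
    ψ z = ψ z' := by
  obtain ⟨r, hr, hψ⟩ := h.exists_radius
  refine ⟨r / 3, by positivity, fun ψ hd h0 y z y' z' hz hz' h1 h2 h3 => ?_⟩
  refine hψ ψ hd h0 z hz.mem z' hz'.mem ?_
  rw [hz.eq] at h1
  rw [hz'.eq] at h2
  have : z - z' = -(y - z) + (y - y') + (y' - z') := by abel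
  rw [this]
  refine (norm_add₃_le).trans_lt ?_
  rw [norm_neg]
  linarith

/-- Admissible test fields converging to the velocity field of a stream function. -/
theorem IsDefFun.exists_test_field (h : IsDefFun Ω d) {G : Fin 2 → Fin 2 → Vec2 → ℝ}
    {ψ : Vec2 → ℝ} (hS : StreamSol Ω G ψ) {N : ℝ}
    (hN : ∀ x ∈ Ω, ∀ i j, |dd (e2 j) (dd (e2 i) ψ) x| ≤ N) :
    ∃ (C : ℝ) (v : ℝ → Fin 2 → Vec2 → ℝ), (∀ ε > 0, (∀ i, ContDiff ℝ 1 (v ε i)) ∧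
      (∀ i, tsupport (v ε i) ⊆ Ω) ∧ (∀ i, HasCompactSupport (v ε i)) ∧
      (∀ x, dd (e2 0) (v ε 0) x + dd (e2 1) (v ε 1) x = 0) ∧
      ∀ x ∈ Ω, ∀ i j, |dd (e2 j) (v ε i) x| ≤ C) ∧
    ∀ x ∈ Ω, ∀ i, ∀ᶠ ε in 𝓝[>] (0 : ℝ), v ε i =ᶠ[𝓝 x] perp ψ i := by
  classical
  have hN0 : 0 ≤ N := by
    obtain ⟨x, hx⟩ := h.nonempty
    exact (abs_nonneg _).trans (hN x hx 0 0)
  obtain ⟨ρ, hρ, hnear⟩ := h.exists_near_const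
  obtain ⟨Ci, hCi, hinf⟩ := h.exists_infDist_le
  choose C hC0 hC using fun i j => h.exists_dd_dd_cut_mul_le (e2 i) (e2 j)
  choose! near hne using fun y (hy : y ∈ Ω) => h.exists_isNearest hy
  set κ : Vec2 → ℝ := fun y => ψ (near y) with hκ
  set η : ℝ := ρ / Ci with hη
  have hη0 : 0 < η := by positivity
  set H : ℝ → ℝ → Vec2 → ℝ := fun c ε y => IsDefFun.cut d ε y * (ψ y - c) + c with hH
  set v : ℝ → Fin 2 → Vec2 → ℝ := fun ε i => Ω.indicator
    (perp (fun y => H (κ y) (min ε (η / 2)) y) i) with hv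
  have hε0 : ∀ ε : ℝ, 0 < ε → 0 < min ε (η / 2) := fun ε hε => lt_min hε (half_pos hη0)
  have hsub : ∀ c, ContDiffOn ℝ 3 (fun y => ψ y - c) Ω := fun c => hS.smooth.sub contDiffOn_const
  have hHs : ∀ c ε, ContDiffOn ℝ 3 (H c ε) Ω := fun c ε =>
    ((contDiff_infty.1 (h.cut_contDiff ε) 3).contDiffOn.mul (hsub c)).add
      contDiffOn_const
  -- local identification of the test fields
  have hloc : ∀ ε > 0, ∀ y ∈ Ω, (fun w => H (κ w) (min ε (η / 2)) w) =ᶠ[𝓝 y]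
      H (κ y) (min ε (η / 2)) := fun ε hε y hy => by
    by_cases hyρ : Metric.infDist y Ωᶜ < ρ
    · have h1 : ∀ᶠ w in 𝓝 y, Metric.infDist w Ωᶜ < ρ :=
        (isOpen_lt (Metric.continuous_infDist_pt _) continuous_const).mem_nhds hyρ
      filter_upwards [h1, h.isOpen.mem_nhds hy, Metric.ball_mem_nhds y hρ] with w hw hwΩ hwy
      have : κ w = κ y := hnear ψ (hS.contDiff.differentiable (by simp)) hS.fderiv_eq_zero
        w _ y _ (hne w hwΩ) (hne y hy) hw hyρ (by rwa [← mem_ball_iff_norm])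
      simp only [this]
    · have h1 : min ε (η / 2) < d y := by
        refine (min_le_right _ _).trans_lt ?_
        have := hinf y hy
        have h2 : η ≤ d y := by rw [hη, div_le_iff₀ hCi]; linarith
        linarith
      filter_upwards [(isOpen_lt continuous_const h.smooth.continuous).mem_nhds h1] with w hw
      simp only [hH, IsDefFun.cut_eq_one (hε0 ε hε) (le_of_lt hw)]
      ring
  have hvloc : ∀ ε > 0, ∀ y ∈ Ω, ∀ i, v ε i =ᶠ[𝓝 y] perp (H (κ y) (min ε (η / 2))) i :=
    fun ε hε y hy i => by
      filter_upwards [(hloc ε hε y hy).perp i, h.isOpen.mem_nhds hy] with w hw hwΩ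
      rw [hv]
      simp only [indicator_of_mem hwΩ, hw]
  have hpc : ∀ c ε i, ContDiffOn ℝ 1 (perp (H c ε) i) Ω := fun c ε i => by
    have h3 : ∀ w, ContDiffOn ℝ 1 (dd w (H c ε)) Ω := fun w =>
      (ContDiffOn.dd_succ h.isOpen (n := 2) (by simpa using hHs c ε) w).of_le (by norm_num)
    fin_cases i
    · exact (h3 _).neg
    · exact h3 _
  have hts : ∀ ε > 0, ∀ i, tsupport (v ε i) ⊆ Ω := fun ε hε i => by
    have : tsupport (v ε i) ⊆ {x | min ε (η / 2) / 2 ≤ d x} := by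
      refine closure_minimal (fun x hx => ?_) (isClosed_le continuous_const h.smooth.continuous)
      by_contra hc
      have hxΩ : x ∈ Ω := by
        by_contra hx'
        exact hx (by rw [hv]; exact indicator_of_notMem hx' _)
      refine hx ?_
      rw [(hvloc ε hε x hxΩ i).eq_of_nhds]
      have h1 : H (κ x) (min ε (η / 2)) =ᶠ[𝓝 x] fun _ => κ x := by
        filter_upwards [(isOpen_lt h.smooth.continuous continuous_const).mem_nhds
          (not_le.1 hc : d x < min ε (η / 2) / 2)] with w hw
        simp only [hH, IsDefFun.cut_eq_zero (hε0 ε hε) (le_of_lt hw)]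
        ring
      rw [(h1.perp i).eq_of_nhds]
      fin_cases i <;> simp [perp, dd_const]
    exact this.trans fun x hx => (h.mem_iff x).2 (lt_of_lt_of_le (half_pos (hε0 ε hε)) hx)
  refine ⟨(∑ i, ∑ j, C i j) * (2 * N * (Ci + 1) ^ 2 + N), v, fun ε hε => ⟨fun i => ?_, hts ε hε, fun i => ?_,
    fun x => ?_, fun x hx i j => ?_⟩, fun x hx i => ?_⟩
  · refine contDiff_of_tsupport_subset h.isOpen (n := 1) (fun y hy => ?_) (hts ε hε i)
    exact (((hpc _ _ i).contDiffAt (h.isOpen.mem_nhds hy)).congr_of_eventuallyEq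
      (hvloc ε hε y hy i)).contDiffWithinAt
  · exact h.isCompact_closure.of_isClosed_subset isClosed_closure
      ((hts ε hε i).trans subset_closure)
  · by_cases hx : x ∈ Ω
    · rw [((hvloc ε hε x hx 0).dd _).eq_of_nhds, ((hvloc ε hε x hx 1).dd _).eq_of_nhds]
      simp only [perp, Matrix.cons_val_zero, Matrix.cons_val_one]
      rw [dd_neg,
        dd_comm_of_two (((hHs _ _).contDiffAt (h.isOpen.mem_nhds hx)).of_le (by norm_num))]
      simp
    · rw [dd_eq_zero_of_notMem_tsupport fun h' => hx (hts ε hε 0 h'),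
        dd_eq_zero_of_notMem_tsupport fun h' => hx (hts ε hε 1 h'), add_zero]
  · have hdx := h.pos hx
    set K := 2 * N * (Ci + 1) ^ 2 + N with hK
    have hK0 : 0 ≤ K := by positivity
    have key : ∀ i j, |dd (e2 j) (dd (e2 i) (H (κ x) (min ε (η / 2)))) x|
        ≤ (∑ i, ∑ j, C i j) * K := fun i j => by
      rw [hH]
      simp only [dd_add_const]
      have hb : ∀ k, |dd (e2 k) (fun y => ψ y - κ x) x| ≤ K * d x := fun k => by
        rw [dd_sub_const]
        refine (hS.abs_dd_le h hN hx k).trans ?_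
        calc _ ≤ 2 * N * (Ci * d x) := by gcongr; exact hinf x hx
          _ = (2 * N * Ci) * d x := by ring
          _ ≤ _ := by
            gcongr
            rw [hK]
            nlinarith [mul_nonneg hN0 hCi.le, mul_nonneg hN0 (sq_nonneg Ci)]
      refine (hC j i _ K (fun y => ψ y - κ x) hK0 ((hsub _).of_le (by norm_num)) x hx ?_ (hb j) (hb i) ?_).trans ?_
      · refine (hS.abs_sub_nearest_le_sq h hN (hne x hx)).trans ?_
        have h0 : 0 ≤ Metric.infDist x Ωᶜ := Metric.infDist_nonneg
        calc _ ≤ 2 * N * (Ci * d x) ^ 2 := by gcongr; exact hinf x hx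
          _ = (2 * N * Ci ^ 2) * d x ^ 2 := by ring
          _ ≤ _ := by
            gcongr
            rw [hK]
            nlinarith [mul_nonneg hN0 hCi.le, mul_nonneg hN0 (sq_nonneg Ci)]
      · rw [dd_sub_const]
        refine (hN x hx i j).trans ?_
        rw [hK]
        have : 0 ≤ 2 * N * (Ci + 1) ^ 2 := by positivity
        linarith
      · refine mul_le_mul_of_nonneg_right ?_ hK0
        exact (Finset.single_le_sum (f := fun i => C j i) (fun i _ => hC0 j i)
          (Finset.mem_univ i)).trans (Finset.single_le_sum (f := fun j => ∑ i, C j i)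
          (fun j _ => Finset.sum_nonneg fun i _ => hC0 j i) (Finset.mem_univ j))
    rw [((hvloc ε hε x hx i).dd _).eq_of_nhds]
    fin_cases i
    · change |dd (e2 j) (fun y => -dd (e2 1) (H (κ x) (min ε (η / 2))) y) x| ≤ _
      rw [dd_neg, abs_neg]
      exact key 1 j
    · exact key 0 j
  · have hm : ∀ᶠ ε in 𝓝[>] (0 : ℝ), ε < d x := Filter.eventually_of_mem
      (Ioo_mem_nhdsGT (h.pos hx)) fun ε hε => hε.2
    filter_upwards [hm, self_mem_nhdsWithin] with ε h1 h2
    refine (hvloc ε h2 x hx i).trans (Filter.EventuallyEq.perp ?_ i)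
    filter_upwards [(isOpen_lt continuous_const h.smooth.continuous).mem_nhds
      ((min_le_left ε (η / 2)).trans_lt h1)] with w hw
    simp only [hH, IsDefFun.cut_eq_one (hε0 ε h2) (le_of_lt hw)]
    ring

end EnergyBound

section MaxPoint

variable {Ω : Set Vec2} {d : Vec2 → ℝ}

theorem StreamSol.contDiffOn_perp {G : Fin 2 → Fin 2 → Vec2 → ℝ} {ψ : Vec2 → ℝ}
    (hS : StreamSol Ω G ψ) (hΩ : IsOpen Ω) (i : Fin 2) : ContDiffOn ℝ 2 (perp ψ i) Ω := by
  fin_cases i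
  · exact (hS.contDiffOn_dd hΩ _).neg
  · exact hS.contDiffOn_dd hΩ _

/-- The energy estimate. -/
theorem IsDefFun.energy_le (h : IsDefFun Ω d) {G : Fin 2 → Fin 2 → Vec2 → ℝ}
    {ψ : Vec2 → ℝ} (hS : StreamSol Ω G ψ) {N A : ℝ}
    (hN : ∀ x ∈ Ω, ∀ i j, |dd (e2 j) (dd (e2 i) ψ) x| ≤ N) (hA : ∀ i j, ∀ x ∈ Ω, |G i j x| ≤ A) :
    ∑ i, ∑ j, ∫ x in Ω, dd (e2 j) (perp ψ i) x ^ 2 ≤ 4 * A ^ 2 * volume.real Ω := by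
  have hm := h.isOpen.measurableSet
  obtain ⟨C, v, hv, hlim⟩ := h.exists_test_field hS hN
  have hInt : ∀ {k : Vec2 → ℝ}, ContinuousOn k Ω → ∀ E, (∀ x ∈ Ω, |k x| ≤ E) → IntegrableOn k Ω :=
    fun hk E hE => IntegrableOn.of_bound h.volume_lt_top (hk.aestronglyMeasurable hm) E
      ((ae_restrict_mem hm).mono hE)
  have hpc : ∀ i j, ContinuousOn (dd (e2 j) (perp ψ i)) Ω := fun i j =>
    (ContDiffOn.dd_succ h.isOpen (n := 1) (by simpa using hS.contDiffOn_perp h.isOpen i) _).continuousOn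
  have hGc : ∀ i j, ContinuousOn (G i j) Ω := fun i j => (hS.smooth_G i j).continuousOn
  have hpN : ∀ i j, ∀ x ∈ Ω, |dd (e2 j) (perp ψ i) x| ≤ N := fun i j x hx =>
    abs_dd_perp_le (fun k l => hN x hx l k) i j
  have hvc : ∀ ε > 0, ∀ i j, ContinuousOn (dd (e2 j) (v ε i)) Ω := fun ε hε i j =>
    (((hv ε hε).1 i).continuous_dd _).continuousOn
  have hvN : ∀ ε > 0, ∀ i j, ∀ x ∈ Ω, |dd (e2 j) (v ε i) x| ≤ C := fun ε hε i j x hx =>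
    (hv ε hε).2.2.2.2 x hx i j
  have hmul : ∀ {f g : Vec2 → ℝ} {a b : ℝ}, ContinuousOn f Ω → ContinuousOn g Ω →
      (∀ x ∈ Ω, |f x| ≤ a) → (∀ x ∈ Ω, |g x| ≤ b) → IntegrableOn (fun x => f x * g x) Ω :=
    fun {f g a b} hf hg ha hb => hInt (hf.mul hg) (a * b) fun x hx => by
      rw [abs_mul]
      exact mul_le_mul (ha x hx) (hb x hx) (abs_nonneg _) ((abs_nonneg _).trans (ha x hx))
  have hswap : ∀ ε > 0, ∀ {f : Fin 2 → Fin 2 → Vec2 → ℝ} {a : ℝ}, (∀ i j, ContinuousOn (f i j) Ω) →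
      (∀ i j, ∀ x ∈ Ω, |f i j x| ≤ a) → ∫ x, ∑ i, ∑ j, f i j x * dd (e2 j) (v ε i) x
        = ∑ i, ∑ j, ∫ x in Ω, f i j x * dd (e2 j) (v ε i) x := fun ε hε {f a} hf ha => by
    have hi : ∀ i j, IntegrableOn (fun x => f i j x * dd (e2 j) (v ε i) x) Ω := fun i j =>
      hmul (hf i j) (hvc ε hε i j) (ha i j) (hvN ε hε i j)
    rw [← setIntegral_eq_integral_of_forall_compl_eq_zero (s := Ω) fun x hx =>
      Finset.sum_eq_zero fun i _ => Finset.sum_eq_zero fun j _ => by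
        rw [dd_eq_zero_of_notMem_tsupport (fun h' => hx ((hv ε hε).2.1 i h')), mul_zero],
      integral_finsetSum _ fun i _ => integrable_finsetSum _ fun j _ => hi i j]
    exact Finset.sum_congr rfl fun i _ => integral_finsetSum _ fun j _ => hi i j
  have hid : ∀ ε > 0, ∑ i, ∑ j, ∫ x in Ω, dd (e2 j) (perp ψ i) x * dd (e2 j) (v ε i) x
      = -∑ i, ∑ j, ∫ x in Ω, G i j x * dd (e2 j) (v ε i) x := fun ε hε => by
    obtain ⟨h1, h2, h3, h4, -⟩ := hv ε hε
    rw [← hswap ε hε hpc hpN, ← hswap ε hε hGc hA]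
    exact hS.weak_field (v ε) h1 h2 h3 h4
  have htend : ∀ {f : Fin 2 → Fin 2 → Vec2 → ℝ} {a : ℝ}, (∀ i j, ContinuousOn (f i j) Ω) →
      (∀ i j, ∀ x ∈ Ω, |f i j x| ≤ a) → Filter.Tendsto
        (fun ε => ∑ i, ∑ j, ∫ x in Ω, f i j x * dd (e2 j) (v ε i) x) (𝓝[>] 0)
        (𝓝 (∑ i, ∑ j, ∫ x in Ω, f i j x * dd (e2 j) (perp ψ i) x)) := fun {f a} hf ha =>
    tendsto_finsetSum _ fun i _ => tendsto_finsetSum _ fun j _ =>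
      tendsto_setIntegral_of_eventually_eq (hΩ := hm) (hInt (hf i j) a (ha i j))
        (g := fun ε => dd (e2 j) (v ε i))
        (fun ε hε => hvc ε hε i j) (C := C) (fun ε hε => hvN ε hε i j)
        fun x hx => by
          filter_upwards [hlim x hx i] with ε hε using (hε.dd _).eq_of_nhds
  have heq := tendsto_nhds_unique ((htend hpc hpN).congr' (by
    filter_upwards [self_mem_nhdsWithin] with ε hε using hid ε hε)) (htend hGc hA).neg
  have hY : ∀ i j, -∫ x in Ω, G i j x * dd (e2 j) (perp ψ i) x
      ≤ A ^ 2 / 2 * volume.real Ω + (1 / 2) * ∫ x in Ω, dd (e2 j) (perp ψ i) x ^ 2 := fun i j => by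
    have hsq : IntegrableOn (fun x => dd (e2 j) (perp ψ i) x ^ 2) Ω := by
      simpa only [sq] using hmul (hpc i j) (hpc i j) (hpN i j) (hpN i j)
    have hc : IntegrableOn (fun _ : Vec2 => A ^ 2 / 2) Ω := integrableOn_const h.volume_lt_top.ne
    have hcst : A ^ 2 / 2 * volume.real Ω = ∫ x in Ω, A ^ 2 / 2 := by
      rw [setIntegral_const, smul_eq_mul, mul_comm]
    rw [hcst, ← integral_neg, ← integral_const_mul, ← integral_add hc (hsq.const_mul _)]
    refine setIntegral_mono_on (hmul (hGc i j) (hpc i j) (hA i j) (hpN i j)).neg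
      (hc.add (hsq.const_mul _)) hm fun x hx => ?_
    have h1 : G i j x ^ 2 ≤ A ^ 2 := by
      rw [← sq_abs]; gcongr; exact hA i j x hx
    nlinarith [sq_nonneg (G i j x + dd (e2 j) (perp ψ i) x)]
  have hsum := Finset.sum_le_sum fun i (_ : i ∈ Finset.univ) =>
    Finset.sum_le_sum fun j (_ : j ∈ Finset.univ) => hY i j
  simp only [Finset.sum_neg_distrib, Finset.sum_add_distrib, ← Finset.mul_sum, ← heq] at hsum
  simp only [← sq] at hsum
  simp only [Fin.sum_univ_two] at hsum ⊢
  linarith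

theorem dd_sq_eq_perp (ψ : Vec2 → ℝ) (k : Fin 2) :
    ∃ i, ∀ v x, dd v (dd (e2 k) ψ) x ^ 2 = dd v (perp ψ i) x ^ 2 := by
  fin_cases k
  · exact ⟨1, fun v x => rfl⟩
  · refine ⟨0, fun v x => ?_⟩
    change _ = dd v (fun y => -dd (e2 1) ψ y) x ^ 2
    rw [dd_neg, neg_sq]
    rfl

theorem IsDefFun.setIntegral_dd_dd_sq_le (h : IsDefFun Ω d) {G : Fin 2 → Fin 2 → Vec2 → ℝ}
    {ψ : Vec2 → ℝ} (hS : StreamSol Ω G ψ) {N A : ℝ}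
    (hN : ∀ x ∈ Ω, ∀ i j, |dd (e2 j) (dd (e2 i) ψ) x| ≤ N) (hA : ∀ i j, ∀ x ∈ Ω, |G i j x| ≤ A)
    (j k : Fin 2) : ∫ x in Ω, dd (e2 j) (dd (e2 k) ψ) x ^ 2 ≤ 4 * A ^ 2 * volume.real Ω := by
  obtain ⟨i, hi⟩ := dd_sq_eq_perp ψ k
  simp only [hi]
  refine le_trans ?_ (h.energy_le hS hN hA)
  have h0 : ∀ i j, 0 ≤ ∫ x in Ω, dd (e2 j) (perp ψ i) x ^ 2 := fun i j =>
    integral_nonneg fun x => sq_nonneg _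
  exact (Finset.single_le_sum (f := fun j => ∫ x in Ω, dd (e2 j) (perp ψ i) x ^ 2)
    (fun j _ => h0 i j) (Finset.mem_univ j)).trans
    (Finset.single_le_sum (f := fun i => ∑ j, ∫ x in Ω, dd (e2 j) (perp ψ i) x ^ 2)
      (fun i _ => Finset.sum_nonneg fun j _ => h0 i j) (Finset.mem_univ i))

theorem StreamSol.exists_isMax (h : IsDefFun Ω d) {G : Fin 2 → Fin 2 → Vec2 → ℝ}
    {ψ : Vec2 → ℝ} (hS : StreamSol Ω G ψ) : ∃ x₀, ∀ x, ‖fderiv ℝ ψ x‖ ≤ ‖fderiv ℝ ψ x₀‖ := by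
  obtain ⟨x₀, -, hx₀⟩ := h.isCompact_closure.exists_isMaxOn h.nonempty.closure
    (hS.contDiff.continuous_fderiv (by simp)).norm.continuousOn
  refine ⟨x₀, fun x => ?_⟩
  by_cases hx : x ∈ Ω
  · exact hx₀ (subset_closure hx)
  · rw [hS.fderiv_eq_zero x hx, norm_zero]
    exact norm_nonneg _

/-- The velocity gradient is bounded by the load. -/
theorem IsDefFun.exists_dd_dd_le_load (h : IsDefFun Ω d) {q : ℝ≥0∞} (hq : 2 < q) (hq' : q < ⊤) :
    ∃ C, 0 ≤ C ∧ ∀ (G : Fin 2 → Fin 2 → Vec2 → ℝ) (ψ : Vec2 → ℝ) (A B : ℝ), StreamSol Ω G ψ →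
    LoadBound Ω q G A B → ∀ x ∈ Ω, ∀ i j,
    |dd (e2 j) (dd (e2 i) ψ) x| ≤ C * ((1 + A) * Real.log (Real.exp 1 + B)) := by
  obtain ⟨C, hC0, hC⟩ := h.exists_dd_dd_le_add_sup hq hq'
  obtain ⟨P, hP0, hP⟩ := h.exists_poincare
  obtain ⟨Ci, hCi, hinf⟩ := h.exists_infDist_le
  set r : ℝ := 1 / (16 * (C + 1)) with hr
  have hr0 : 0 < r := by positivity
  set m : ℝ := volume.real (Metric.ball (0 : Vec2) r) with hm
  have hm0 : 0 < m := ENNReal.toReal_pos (Metric.measure_ball_pos _ _ hr0).ne' measure_ball_lt_top.ne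
  set D : ℝ := 64 * P * volume.real Ω / m with hD
  have hD0 : 0 ≤ D := by positivity
  refine ⟨C * (2 + √D), by positivity, fun G ψ A B hS hB x hx i j => ?_⟩
  have hL1 := log_factor_nonneg hB.nonneg_left hB.nonneg_right
  have hlog : 1 ≤ Real.log (Real.exp 1 + B) := by
    rw [Real.le_log_iff_exp_le (by have := Real.exp_pos 1; linarith [hB.nonneg_right])]
    linarith [hB.nonneg_right]
  have hAL : A ≤ (1 + A) * Real.log (Real.exp 1 + B) := by nlinarith [hB.nonneg_left]
  set L := (1 + A) * Real.log (Real.exp 1 + B) with hL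
  obtain ⟨x₀, hx₀⟩ := hS.exists_isMax h
  set K := ‖fderiv ℝ ψ x₀‖ with hK
  suffices hKL : K ≤ (1 + √D) * L by
    refine (hC G ψ A B K hS hB hx₀ x hx i j).trans ?_
    rw [mul_assoc C]
    exact mul_le_mul_of_nonneg_left (by linarith) hC0
  by_cases hcase : K ≤ L
  · have : 0 ≤ √D * L := by positivity
    linarith
  rw [not_le] at hcase
  have hKp : 0 < K := by linarith
  set N := 2 * (C + 1) * K with hN
  have hNp : 0 < N := by positivity
  have hdd : ∀ y ∈ Ω, ∀ i j, |dd (e2 j) (dd (e2 i) ψ) y| ≤ N := fun y hy i j => by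
    refine (hC G ψ A B K hS hB hx₀ y hy i j).trans ?_
    rw [hN]
    nlinarith
  obtain ⟨k, hk⟩ : ∃ k, K / 2 ≤ |dd (e2 k) ψ x₀| := by
    by_contra! hcon
    have := norm_fderiv_le ψ x₀
    linarith [hcon 0, hcon 1]
  have hx₀Ω : x₀ ∈ Ω := by
    by_contra hx'
    rw [hS.dd_eq_zero _ hx', abs_zero] at hk
    linarith
  have hδ : 2 * r ≤ Metric.infDist x₀ Ωᶜ := by
    have h1 := hk.trans (hS.abs_dd_le h hdd hx₀Ω k)
    have h2 : 2 * N * (2 * r) = K / 2 := by rw [hN, hr]; field_simp; norm_num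
    rw [← h2] at h1
    exact le_of_mul_le_mul_left h1 (by positivity)
  have hball : Metric.ball x₀ r ⊆ Ω := fun y hy => by
    by_contra hy'
    have := Metric.infDist_le_dist_of_mem (x := x₀) (show y ∈ Ωᶜ from hy')
    rw [dist_comm] at this
    linarith [Metric.mem_ball.1 hy]
  have hlow : ∀ y ∈ Metric.ball x₀ r, (K / 4) ^ 2 ≤ dd (e2 k) ψ y ^ 2 := fun y hy => by
    have h1 := (convex_ball x₀ r).norm_image_sub_le_of_norm_fderiv_le (𝕜 := ℝ) (f := dd (e2 k) ψ)
      (C := 2 * N) (fun z hz => ((hS.contDiffOn_dd h.isOpen _).contDiffAt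
        (h.isOpen.mem_nhds (hball hz))).differentiableAt (by simp))
      (fun z hz => (norm_fderiv_le _ _).trans
        (by linarith [hdd z (hball hz) k 0, hdd z (hball hz) k 1]))
      (Metric.mem_ball_self hr0) hy
    have h2 : 2 * N * ‖y - x₀‖ ≤ K / 4 := by
      have h3 : 2 * N * r = K / 4 := by rw [hN, hr]; field_simp; norm_num
      rw [← h3]
      gcongr
      exact (mem_ball_iff_norm.1 hy).le
    rw [Real.norm_eq_abs] at h1
    rw [← sq_abs (dd (e2 k) ψ y)]
    have h4 := abs_sub_abs_le_abs_sub (dd (e2 k) ψ x₀) (dd (e2 k) ψ y)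
    rw [abs_sub_comm] at h4
    gcongr
    linarith
  obtain ⟨hi, -, hpo⟩ := hP (dd (e2 k) ψ) ((hS.contDiffOn_dd h.isOpen _).of_le (by norm_num))
    (2 * N * Ci + N) (fun y hy => by
      have := h.pos hy
      refine (hS.abs_dd_le h hdd hy k).trans ?_
      have h1 := mul_le_mul_of_nonneg_left (hinf y hy) (by positivity : 0 ≤ 2 * N)
      nlinarith) (fun y hy => (hdd y hy k 0).trans (by
        have : 0 ≤ 2 * N * Ci := by positivity
        linarith))
  have hmass : (K / 4) ^ 2 * m ≤ ∫ y in Ω, dd (e2 k) ψ y ^ 2 := by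
    calc _ = ∫ y in Metric.ball x₀ r, (K / 4) ^ 2 := by
          rw [setIntegral_const, smul_eq_mul, mul_comm, hm, Measure.real, Measure.real,
            Measure.addHaar_ball_center volume x₀]
      _ ≤ ∫ y in Metric.ball x₀ r, dd (e2 k) ψ y ^ 2 :=
        setIntegral_mono_on (integrableOn_const measure_ball_lt_top.ne) (hi.mono_set hball)
          measurableSet_ball hlow
      _ ≤ _ := setIntegral_mono_set hi (ae_of_all _ fun y => sq_nonneg _) hball.eventuallyLE
  have hen := h.setIntegral_dd_dd_sq_le hS hdd (fun i j y hy => hB.abs_le i j y hy) 0 k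
  have hKsq : K ^ 2 ≤ D * L ^ 2 := by
    have h1 := hmass.trans (hpo.trans (mul_le_mul_of_nonneg_left hen hP0))
    have h2 : A ^ 2 ≤ L ^ 2 := by have := hB.nonneg_left; gcongr
    have h3 : K ^ 2 ≤ D * A ^ 2 := by
      rw [hD, div_mul_eq_mul_div, le_div_iff₀ hm0]
      linarith
    exact h3.trans (by gcongr)
  have : K ≤ √D * L := by
    refine (Real.le_sqrt_of_sq_le hKsq).trans (le_of_eq ?_)
    rw [Real.sqrt_mul hD0, Real.sqrt_sq (by positivity)]
  linarith

end MaxPoint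

section Final

variable {Ω : Set Vec2} {d : Vec2 → ℝ}

theorem norm_vec2_le (v : Vec2) : ‖v‖ ≤ |v 0| + |v 1| := by
  rw [vec2_eq v]
  refine (norm_add_le _ _).trans (le_of_eq ?_)
  rw [← vec2_eq v]
  simp [norm_smul, norm_e2]

theorem norm_le_of_apply_le {T : Vec2 →L[ℝ] Vec2} {N : ℝ} (hT : ∀ i j, |T (e2 j) i| ≤ N) :
    ‖T‖ ≤ 4 * N := by
  have hN : 0 ≤ N := (abs_nonneg _).trans (hT 0 0)
  refine T.opNorm_le_bound (by positivity) fun v => ?_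
  have h1 : ∀ j, ‖T (e2 j)‖ ≤ 2 * N := fun j =>
    (norm_vec2_le _).trans (by linarith [hT 0 j, hT 1 j])
  have h2 : T v = v 0 • T (e2 0) + v 1 • T (e2 1) := by
    conv_lhs => rw [vec2_eq v]
    simp
  rw [h2]
  refine (norm_add_le _ _).trans ?_
  rw [norm_smul, norm_smul, Real.norm_eq_abs, Real.norm_eq_abs]
  have h3 : ∀ j, |v j| * ‖T (e2 j)‖ ≤ ‖v‖ * (2 * N) := fun j =>
    mul_le_mul (abs_coord_le v j) (h1 j) (norm_nonneg _) (norm_nonneg _)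
  linarith [h3 0, h3 1]

theorem dd_apply_coord {u : Vec2 → Vec2} {x : Vec2} (hu : DifferentiableAt ℝ u x) (i : Fin 2) (v : Vec2) :
    dd v (fun y => u y i) x = fderiv ℝ u x v i := by
  have : HasFDerivAt (fun y => u y i)
      ((EuclideanSpace.proj (𝕜 := ℝ) i).comp (fderiv ℝ u x)) x :=
    ((EuclideanSpace.proj (𝕜 := ℝ) i : Vec2 →L[ℝ] ℝ).hasFDerivAt (x := u x)).comp x hu.hasFDerivAt
  rw [dd, this.fderiv]
  rfl

theorem dd_dd_apply_coord (hΩ : IsOpen Ω) {u : Vec2 → Vec2} (hu : ContDiffOn ℝ 2 u Ω) {x : Vec2}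
    (hx : x ∈ Ω) (i : Fin 2) (v w : Vec2) :
    dd v (dd w (fun y => u y i)) x = iteratedFDeriv ℝ 2 u x ![v, w] i := by
  have h2 : DifferentiableAt ℝ (fderiv ℝ u) x :=
    ((hu.contDiffAt (hΩ.mem_nhds hx)).fderiv_right (m := 1) (by norm_num)).differentiableAt (by simp)
  rw [dd_congr_of_isOpen hΩ (g := fun y => fderiv ℝ u y w i) (fun y hy => dd_apply_coord
    ((hu.contDiffAt (hΩ.mem_nhds hy)).differentiableAt (by simp)) i w) v hx,
    dd_apply_coord (u := fun y => fderiv ℝ u y w) (h2.clm_apply (differentiableAt_const _)),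
    fderiv_clm_apply h2 (differentiableAt_const _), iteratedFDeriv_two_apply]
  simp

/-- The components of a classical solution, extended by zero. -/
theorem IsStokesSol.scalarStokes (h : IsDefFun Ω d) {F : Vec2 → Fin 2 → Fin 2 → ℝ} {u : Vec2 → Vec2}
    {p : Vec2 → ℝ} (hF : ContDiffOn ℝ 1 F Ω) (hs : IsStokesSol Ω (fun x => matDiv F x) u p)
    (hu : ContDiffOn ℝ 2 u Ω) (hp : ContDiffOn ℝ 1 p Ω) (hc : ContinuousOn u (closure Ω)) :
    ScalarStokes Ω (fun i j x => F x i j) (fun i => Ω.indicator fun x => u x i) p := by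
  obtain ⟨h1, h2, h3⟩ := hs
  have hi : ∀ i, ContDiffOn ℝ 2 (fun x => u x i) Ω := fun i =>
    (contDiff_piLp_apply (p := 2) (i := i)).comp_contDiffOn hu
  have he : ∀ i, EqOn (Ω.indicator fun x => u x i) (fun x => u x i) Ω := fun i x hx =>
    indicator_of_mem hx _
  have hdd : ∀ i v, EqOn (dd v (Ω.indicator fun x => u x i)) (dd v (fun x => u x i)) Ω :=
    fun i v => dd_congr_of_isOpen h.isOpen (he i) v
  refine ⟨fun i => (hi i).congr (he i), hp, fun i j => contDiffOn_pi.1 (contDiffOn_pi.1 hF i) j,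
    fun i x hx => ?_, fun x hx => ?_, fun i => ?_, fun i x hx => indicator_of_notMem hx _⟩
  · have := congrArg (fun w : Vec2 => w i) (h1 x hx)
    have h4 : ∀ j, dd (e2 j) (dd (e2 j) (Ω.indicator fun x => u x i)) x
        = iteratedFDeriv ℝ 2 u x ![e2 j, e2 j] i := fun j => by
      rw [dd_congr_of_isOpen h.isOpen (hdd i (e2 j)) _ hx, dd_dd_apply_coord h.isOpen hu hx]
    simp only [h4]
    fin_cases i <;> simpa [lapl, grad2, matDiv, pd, dd] using this
  · rw [hdd 0 _ hx, hdd 1 _ hx]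
    have hux := (hu.contDiffAt (h.isOpen.mem_nhds hx)).differentiableAt (by simp)
    rw [dd_apply_coord hux, dd_apply_coord hux]
    simpa [div2, pd] using h2 x hx
  · refine continuous_indicator (fun x hx => by rw [h3 x hx]; rfl) ?_
    exact (contDiff_piLp_apply (𝕜 := ℝ) (n := 0) (p := 2) (i := i)).continuous.comp_continuousOn hc

theorem IsDefFun.loadBound (h : IsDefFun Ω d) {q : ℝ≥0∞} {F : Vec2 → Fin 2 → Fin 2 → ℝ}
    (hF : ContDiffOn ℝ 1 F (closure Ω)) (hq : sobNorm Ω 1 q F < ⊤) :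
    LoadBound Ω q (fun i j x => F x i j) (lpnorm Ω ⊤ F).toReal
      (lpnorm Ω q (fun x => fderiv ℝ F x)).toReal := by
  have hm := h.isOpen.measurableSet
  have hFΩ := hF.mono subset_closure
  have hfd : ∀ x ∈ Ω, DifferentiableAt ℝ F x := fun x hx =>
    (hFΩ.contDiffAt (h.isOpen.mem_nhds hx)).differentiableAt (by simp)
  have htop : lpnorm Ω q (fun x => fderiv ℝ F x) ≠ ⊤ := by
    have h1 : lpnorm Ω q (fun x => iteratedFDeriv ℝ 1 F x) < ⊤ :=
      (Finset.single_le_sum (f := fun j => lpnorm Ω q (fun x => iteratedFDeriv ℝ j F x))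
        (fun _ _ => zero_le) (by simp : 1 ∈ Finset.range (1 + 1))).trans_lt hq
    rw [lpnorm, ← eLpNorm_norm] at h1 ⊢
    simp only [norm_iteratedFDeriv_one] at h1
    exact h1.ne
  have hle : ∀ i j, eLpNorm (dd (e2 j) fun x => F x i j) q (volume.restrict Ω)
      ≤ lpnorm Ω q (fun x => fderiv ℝ F x) := fun i j => by
    refine eLpNorm_mono_ae ((ae_restrict_mem hm).mono fun x hx => ?_)
    have h1 := hasFDerivAt_pi'.1 (hasFDerivAt_pi'.1 (hfd x hx).hasFDerivAt i) j
    rw [dd, h1.fderiv]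
    refine (norm_le_pi_norm (fderiv ℝ F x (e2 j) i) j).trans
      ((norm_le_pi_norm (fderiv ℝ F x (e2 j)) i).trans ?_)
    simpa [norm_e2] using (fderiv ℝ F x).le_opNorm (e2 j)
  have hess : lpnorm Ω ⊤ F ≠ ⊤ := by
    obtain ⟨M, hM⟩ := h.isCompact_closure.exists_bound_of_continuousOn hF.continuousOn
    refine ((eLpNorm_exponent_top.trans_le (eLpNormEssSup_le_of_ae_bound (C := M)
      ((ae_restrict_mem hm).mono fun x hx => hM x (subset_closure hx)))).trans_lt
      ENNReal.ofReal_lt_top).ne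
  refine ⟨ENNReal.toReal_nonneg, ENNReal.toReal_nonneg, fun i j y hy => ?_, fun i j => ⟨?_, ?_⟩,
    fun i j => ?_⟩
  · by_contra! hcon
    have hV : IsOpen (Ω ∩ {x | (lpnorm Ω ⊤ F).toReal < ‖F x‖}) :=
      hFΩ.continuousOn.norm.isOpen_inter_preimage h.isOpen isOpen_Ioi
    have h0 : volume (Ω ∩ {x | (lpnorm Ω ⊤ F).toReal < ‖F x‖}) = 0 := by
      have h1 : ∀ᵐ x ∂(volume.restrict Ω), ¬ (lpnorm Ω ⊤ F).toReal < ‖F x‖ := by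
        filter_upwards [ae_le_eLpNormEssSup (f := F) (μ := volume.restrict Ω)] with x hx
        rw [not_lt, ← ENNReal.ofReal_le_iff_le_toReal hess, ofReal_norm, lpnorm, eLpNorm_exponent_top]
        exact hx
      rw [ae_iff, Measure.restrict_apply' hm] at h1
      simp only [not_not] at h1
      rwa [inter_comm] at h1
    have h2 := (hV.measure_eq_zero_iff volume).1 h0
    refine (h2 ▸ ⟨hy, hcon.trans_le ?_⟩ : y ∈ (∅ : Set Vec2))
    exact (norm_le_pi_norm (F y i) j).trans (norm_le_pi_norm (F y) i)
  · have : ContDiffOn ℝ 0 (dd (e2 j) fun x => F x i j) Ω := ContDiffOn.dd_succ h.isOpen (n := 0)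
      (by simpa using contDiffOn_pi.1 (contDiffOn_pi.1 hFΩ i) j) _
    exact this.continuousOn.aestronglyMeasurable hm
  · exact (hle i j).trans_lt htop.lt_top
  · rw [ENNReal.ofReal_toReal htop]
    exact hle i j

end Final

/-- **Logarithmic `∇u`-`L^∞` estimate for the Stokes system with divergence-form source.**
Let `Ω ⊂ ℝ²` be a bounded domain with smooth boundary and `q ∈ (2,∞)`.  If the source of
the Stokes system `−Δu + ∇p = ∇·F`, `∇·u = 0` in `Ω`, `u = 0` on `∂Ω`, is in divergence
form with `F ∈ W^{1,q}(Ω)`, then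
`‖∇u‖_{L^∞(Ω)} ≤ C (1 + ‖F‖_{L^∞(Ω)}) ln(e + ‖∇F‖_{L^q(Ω)})` with `C = C(Ω)`. -/
theorem stokes_divergence_form_log_estimate (Ω : Set Vec2) (hΩ : IsBoundedSmoothDomain Ω)
    (q : ℝ≥0∞) (hq1 : 2 < q) (hq2 : q < ⊤) :
    ∃ C > (0 : ℝ), ∀ F : Vec2 → Fin 2 → Fin 2 → ℝ, ∀ u : Vec2 → Vec2, ∀ p : Vec2 → ℝ,
      ContDiffOn ℝ 1 F (closure Ω) → sobNorm Ω 1 q F < ⊤ →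
      IsStokesSol Ω (fun x => matDiv F x) u p →
      ContDiffOn ℝ 2 u Ω → ContDiffOn ℝ 1 p Ω → ContinuousOn u (closure Ω) →
      lpnorm Ω ⊤ (fun x => fderiv ℝ u x) ≤
        ENNReal.ofReal (C * (1 + (lpnorm Ω ⊤ F).toReal)
          * Real.log (Real.exp 1 + (lpnorm Ω q (fun x => fderiv ℝ F x)).toReal)) := by
  obtain ⟨d, h⟩ := exists_isDefFun hΩ
  obtain ⟨C, hC0, hC⟩ := h.exists_dd_dd_le_load hq1 hq2
  refine ⟨4 * C + 1, by positivity, fun F u p hF hFq hs hu hp hc => ?_⟩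
  have hB := h.loadBound hF hFq
  have hsc := hs.scalarStokes h (hF.mono subset_closure) hu hp hc
  obtain ⟨ψ, hψ, hψp⟩ := h.exists_stream hsc.cont hsc.zero
    (fun i => (hsc.smooth i).of_le (by norm_num)) hsc.div
  have hS := hsc.streamSol h.isOpen hψ hψp
  have hL := log_factor_nonneg hB.nonneg_left hB.nonneg_right
  rw [lpnorm, eLpNorm_exponent_top]
  refine eLpNormEssSup_le_of_ae_bound ((ae_restrict_mem h.isOpen.measurableSet).mono fun x hx => ?_)
  have hux := (hu.contDiffAt (h.isOpen.mem_nhds hx)).differentiableAt (by simp)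
  refine (norm_le_of_apply_le (N := C * ((1 + (lpnorm Ω ⊤ F).toReal)
    * Real.log (Real.exp 1 + (lpnorm Ω q (fun x => fderiv ℝ F x)).toReal))) fun i j => ?_).trans ?_
  · rw [← dd_apply_coord hux, ← dd_congr_of_isOpen h.isOpen
      (fun y hy => indicator_of_mem hy fun x => u x i) _ hx, ← hψp i]
    exact abs_dd_perp_le (fun k l => hC _ ψ _ _ hS hB x hx l k) i j
  · rw [mul_assoc (4 * C + 1)]
    linarith
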